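/- Let χ be a primitive Dirichlet character of conductor m whose order does not divide 6 (extended to ℤ by χ(n) = 0 when gcd(n, m) > 1). Then for every ε > 0 there is a constant C(ε), independent of χ and m, such that for both signs ± and all X ≥ 1: |Σ_{K cubic, 0 < ±Disc(K) < X} χ(Disc(K))| ≤ C(ε)·X^{7/9+ε}·m^{8/9+ε}, the sum running over isomorphism classes of cubic fields. -/

import Mathlib

open scoped Classical

noncomputable section

/-- Discriminant of a subfield of `ℂ` (as a number field); junk value `0` if the
subfield is not finite-dimensional over `ℚ`. -/
noncomputable def subDisc (K : Subfield ℂ) : ℤ :=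
  if h : FiniteDimensional ℚ K then
    letI := h
    haveI : NumberField K := ⟨⟩
    NumberField.discr K
  else 0

/-- The number of isomorphism classes of number fields (as subfields of `ℂ`)
satisfying a predicate `P`. -/
noncomputable def countFields (P : Subfield ℂ → Prop) : ℕ :=
  Nat.card (Quot (fun K L : {K : Subfield ℂ // P K} => Nonempty (K.1 ≃+* L.1)))

/-- The number of isomorphism classes of cubic fields of discriminant exactly `D`. -/
noncomputable def cubicCountDisc (D : ℤ) : ℕ :=
  countFields (fun K => Module.finrank ℚ K = 3 ∧ subDisc K = D)


set_option linter.all false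

@[ext] structure Form where
  a : ℤ
  b : ℤ
  c : ℤ
  d : ℤ

namespace Form
abbrev Mat := Matrix (Fin 2) (Fin 2) ℤ
abbrev SL := Matrix.SpecialLinearGroup (Fin 2) ℤ

def disc (f : Form) : ℤ := f.b^2*f.c^2 - 4*f.a*f.c^3 - 4*f.b^3*f.d - 27*f.a^2*f.d^2 + 18*f.a*f.b*f.c*f.d
def ev (f : Form) (x y : ℤ) : ℤ := f.a*x^3 + f.b*x^2*y + f.c*x*y^2 + f.d*y^3
def P (f : Form) : ℤ := f.b^2 - 3*f.a*f.c
def Q (f : Form) : ℤ := f.b*f.c - 9*f.a*f.d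
def R (f : Form) : ℤ := f.c^2 - 3*f.b*f.d
/-- substitution f(pX+qY, rX+sY) for M = [[p,q],[r,s]] -/
def sub (f : Form) (M : Mat) : Form where
  a := f.a*M 0 0^3 + f.b*M 0 0^2*M 1 0 + f.c*M 0 0*M 1 0^2 + f.d*M 1 0^3
  b := 3*f.a*M 0 0^2*M 0 1 + f.b*(M 0 0^2*M 1 1 + 2*M 0 0*M 0 1*M 1 0)
     + f.c*(2*M 0 0*M 1 0*M 1 1 + M 0 1*M 1 0^2) + 3*f.d*M 1 0^2*M 1 1
  c := 3*f.a*M 0 0*M 0 1^2 + f.b*(M 0 1^2*M 1 0 + 2*M 0 0*M 0 1*M 1 1)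
     + f.c*(2*M 0 1*M 1 0*M 1 1 + M 0 0*M 1 1^2) + 3*f.d*M 1 0*M 1 1^2
  d := f.a*M 0 1^3 + f.b*M 0 1^2*M 1 1 + f.c*M 0 1*M 1 1^2 + f.d*M 1 1^3
def smul (k : ℤ) (f : Form) : Form := ⟨k*f.a, k*f.b, k*f.c, k*f.d⟩
def Irr (f : Form) : Prop := ∀ x y : ℤ, f.ev x y = 0 → x = 0 ∧ y = 0

theorem ev_sub (f : Form) (M : Mat) (x y : ℤ) :
    (f.sub M).ev x y = f.ev (M 0 0*x + M 0 1*y) (M 1 0*x + M 1 1*y) := by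
  simp only [ev, sub]; ring

theorem sub_sub (f : Form) (M N : Mat) : (f.sub M).sub N = f.sub (M*N) := by
  ext <;> simp only [sub, Matrix.mul_apply, Fin.sum_univ_two] <;> ring

theorem disc_sub (f : Form) (M : Mat) : (f.sub M).disc = M.det^6 * f.disc := by
  simp only [disc, sub, Matrix.det_fin_two]; ring

theorem sub_one (f : Form) : f.sub 1 = f := by
  ext <;> simp [sub]

theorem smul_sub (k : ℤ) (f : Form) (M : Mat) : (smul k f).sub M = smul k (f.sub M) := by
  ext <;> simp only [sub, smul] <;> ring

theorem disc_smul (k : ℤ) (f : Form) : (smul k f).disc = k^4 * f.disc := by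
  simp only [disc, smul]; ring

theorem ev_smul (k : ℤ) (f : Form) (x y : ℤ) : (smul k f).ev x y = k * f.ev x y := by
  simp only [ev, smul]; ring

theorem smul_smul' (k l : ℤ) (f : Form) : smul k (smul l f) = smul (k*l) f := by
  ext <;> simp only [smul] <;> ring

theorem smul_inj {k : ℤ} (hk : k ≠ 0) {f g : Form} (h : smul k f = smul k g) : f = g := by
  have := Form.ext_iff.1 h
  simp only [smul] at this
  obtain ⟨h1, h2, h3, h4⟩ := this
  ext
  exacts [mul_left_cancel₀ hk h1, mul_left_cancel₀ hk h2, mul_left_cancel₀ hk h3, mul_left_cancel₀ hk h4]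

theorem sub_smul_one (f : Form) (k : ℤ) : f.sub (k • (1 : Mat)) = smul (k^3) f := by
  ext <;> simp [sub, smul] <;> ring

theorem sub_neg (f : Form) (M : Mat) : f.sub (-M) = smul (-1) (f.sub M) := by
  ext <;> simp only [sub, smul, Matrix.neg_apply] <;> ring

theorem Irr.a_ne {f : Form} (h : f.Irr) : f.a ≠ 0 := by
  intro h0
  have := h 1 0 (by simp [ev, h0])
  simp at this

theorem Irr.d_ne {f : Form} (h : f.Irr) : f.d ≠ 0 := by
  intro h0
  have := h 0 1 (by simp [ev, h0])
  simp at this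

theorem Irr.smul {f : Form} (h : f.Irr) {k : ℤ} (hk : k ≠ 0) : (Form.smul k f).Irr := by
  intro x y hxy
  rw [ev_smul] at hxy
  exact h x y ((mul_eq_zero.1 hxy).resolve_left hk)

theorem Irr.of_smul {f : Form} {k : ℤ} (h : (Form.smul k f).Irr) : f.Irr := by
  intro x y hxy
  exact h x y (by rw [ev_smul, hxy, mul_zero])

theorem Irr.sub {f : Form} (h : f.Irr) {M : Mat} (hM : M.det ≠ 0) : (f.sub M).Irr := by
  intro x y hxy
  rw [ev_sub] at hxy
  obtain ⟨h1, h2⟩ := h _ _ hxy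
  rw [Matrix.det_fin_two] at hM
  constructor
  · have : (M 0 0 * M 1 1 - M 0 1 * M 1 0) * x = 0 := by linear_combination M 1 1 * h1 - M 0 1 * h2
    exact (mul_eq_zero.1 this).resolve_left hM
  · have : (M 0 0 * M 1 1 - M 0 1 * M 1 0) * y = 0 := by linear_combination -M 1 0 * h1 + M 0 0 * h2
    exact (mul_eq_zero.1 this).resolve_left hM

theorem sub_adj (f : Form) (M : Mat) : (f.sub M).sub M.adjugate = smul (M.det^3) f := by
  rw [sub_sub, Matrix.mul_adjugate, sub_smul_one]

theorem Irr.of_sub {f : Form} {M : Mat} (hM : M.det ≠ 0) (h : (f.sub M).Irr) : f.Irr := by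
  have := h.sub (M := M.adjugate) (by
    rw [Matrix.det_adjugate]; simpa using hM)
  rw [sub_adj] at this
  exact this.of_smul

theorem syz (f : Form) : f.Q^2 - 4*f.P*f.R = -3*f.disc := by
  simp only [P, Q, R, disc]; ring

end Form

set_option linter.all false
namespace Form

def NM (p : ℕ) (f : Form) : Prop :=
  ((p:ℤ) ∣ f.a ∧ (p:ℤ) ∣ f.b ∧ (p:ℤ) ∣ f.c ∧ (p:ℤ) ∣ f.d) ∨ ((p:ℤ)^2 ∣ f.a ∧ (p:ℤ) ∣ f.b) ∨
  ∃ r : ℤ, (p:ℤ)^2 ∣ f.ev r 1 ∧ (p:ℤ) ∣ 3*f.a*r^2 + 2*f.b*r + f.c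

def NM' (p : ℕ) (f : Form) : Prop :=
  ((p:ℤ) ∣ f.a ∧ (p:ℤ) ∣ f.b ∧ (p:ℤ) ∣ f.c ∧ (p:ℤ) ∣ f.d) ∨
  ∃ u v : ℤ, ¬ ((p:ℤ) ∣ u ∧ (p:ℤ) ∣ v) ∧ (p:ℤ) ∣ 3*f.a*u^2+2*f.b*u*v+f.c*v^2 ∧
    (p:ℤ) ∣ f.b*u^2+2*f.c*u*v+3*f.d*v^2 ∧ (p:ℤ)^2 ∣ f.ev u v

theorem exists_inv_mod {p : ℕ} (hp : p.Prime) (n : ℕ) {v : ℤ} (hv : ¬ (p:ℤ) ∣ v) :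
    ∃ w : ℤ, (p:ℤ)^n ∣ v * w - 1 := by
  have h : IsCoprime v ((p:ℤ)^n) := by
    apply IsCoprime.pow_right
    exact ((Nat.prime_iff_prime_int.1 hp).coprime_iff_not_dvd.2 hv).symm
  obtain ⟨s, t, hst⟩ := h
  exact ⟨s, ⟨-t, by linear_combination hst⟩⟩

theorem nm_iff {p : ℕ} (hp : p.Prime) (f : Form) : NM p f ↔ NM' p f := by
  have hpi := Nat.prime_iff_prime_int.1 hp
  constructor
  · rintro (h | ⟨h1, h2⟩ | ⟨r, h1, h2⟩)
    · exact Or.inl h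
    · refine Or.inr ⟨1, 0, ?_, ?_, ?_, ?_⟩
      · rintro ⟨h, -⟩; exact hpi.not_unit (isUnit_of_dvd_one h)
      · have : (p:ℤ) ∣ f.a := (dvd_pow_self _ two_ne_zero).trans h1
        simpa using this.mul_left 3
      · simpa using h2
      · simpa [ev] using h1
    · refine Or.inr ⟨r, 1, ?_, ?_, ?_, h1⟩
      · rintro ⟨-, h⟩; exact hpi.not_unit (isUnit_of_dvd_one h)
      · simpa using h2
      · have h3 : (p:ℤ) ∣ f.ev r 1 := (dvd_pow_self _ two_ne_zero).trans h1
        have : f.b*r^2+2*f.c*r*1+3*f.d*1^2 = 3*f.ev r 1 - r*(3*f.a*r^2 + 2*f.b*r + f.c) := by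
          simp only [ev]; ring
        rw [this]
        exact dvd_sub (h3.mul_left _) (h2.mul_left _)
  · rintro (h | ⟨u, v, h0, h1, h2, h3⟩)
    · exact Or.inl h
    by_cases hv : (p:ℤ) ∣ v
    · have hu : ¬ (p:ℤ) ∣ u := fun h => h0 ⟨h, hv⟩
      obtain ⟨w, rfl⟩ := hv
      have hb : (p:ℤ) ∣ f.b := by
        have : (p:ℤ) ∣ f.b*u^2 := by
          have e : f.b*u^2 = (f.b*u^2+2*f.c*u*(p*w)+3*f.d*(p*w)^2) - p*(2*f.c*u*w+3*f.d*p*w^2) := by ring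
          rw [e]; exact dvd_sub h2 (dvd_mul_right _ _)
        exact (hpi.dvd_or_dvd this).resolve_right (fun h => hu (hpi.dvd_of_dvd_pow h))
      refine Or.inr (Or.inl ⟨?_, hb⟩)
      obtain ⟨b', hb'⟩ := hb
      have : (p:ℤ)^2 ∣ f.a*u^3 := by
        have e : f.a*u^3 = f.ev u (p*w) - p^2*(b'*u^2*w+f.c*u*w^2+f.d*p*w^3) := by
          simp only [ev]; rw [hb']; ring
        rw [e]; exact dvd_sub h3 (dvd_mul_right _ _)
      have hc : IsCoprime ((p:ℤ)^2) (u^3) := ((hpi.coprime_iff_not_dvd.2 hu).pow_left).pow_right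
      exact hc.dvd_of_dvd_mul_right this
    · obtain ⟨w, hw⟩ := exists_inv_mod hp 2 hv
      obtain ⟨k, hk⟩ := hw
      refine Or.inr (Or.inr ⟨u*w, ?_, ?_⟩)
      · have hc : IsCoprime ((p:ℤ)^2) (v^3) := ((hpi.coprime_iff_not_dvd.2 hv).pow_left).pow_right
        apply hc.dvd_of_dvd_mul_right
        have hvw : v*w = 1 + p^2*k := by linear_combination hk
        have e : f.ev (u*w) 1 * v^3 = f.a*u^3*(v*w)^3+f.b*u^2*v*(v*w)^2+f.c*u*v^2*(v*w)+f.d*v^3 := by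
          simp only [ev]; ring
        rw [e, hvw]
        have e2 : f.a*u^3*(1 + p^2*k)^3+f.b*u^2*v*(1 + p^2*k)^2+f.c*u*v^2*(1 + p^2*k)+f.d*v^3
          = f.ev u v + p^2*(f.a*u^3*(3*k+3*k^2*p^2+k^3*p^4) + f.b*u^2*v*(2*k+k^2*p^2)+f.c*u*v^2*k) := by
          simp only [ev]; ring
        rw [e2]; exact dvd_add h3 (dvd_mul_right _ _)
      · have hc : IsCoprime ((p:ℤ)) (v^2) := ((hpi.coprime_iff_not_dvd.2 hv)).pow_right
        apply hc.dvd_of_dvd_mul_right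
        have hvw : v*w = 1 + p^2*k := by linear_combination hk
        have e : (3*f.a*(u*w)^2 + 2*f.b*(u*w) + f.c) * v^2 = 3*f.a*u^2*(v*w)^2+2*f.b*u*v*(v*w)+f.c*v^2 := by
          ring
        rw [e, hvw]
        have e2 : 3*f.a*u^2*(1 + p^2*k)^2+2*f.b*u*v*(1 + p^2*k)+f.c*v^2 =
          (3*f.a*u^2+2*f.b*u*v+f.c*v^2) + p*(3*f.a*u^2*(2*p*k+p^3*k^2)+2*f.b*u*v*p*k) := by ring
        rw [e2]; exact dvd_add h1 (dvd_mul_right _ _)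

theorem NM'.of_sub {p : ℕ} (hp : p.Prime) {f : Form} {M : Mat} (hM : ¬ (p:ℤ) ∣ M.det)
    (h : NM' p (f.sub M)) : NM' p f := by
  have hpi := Nat.prime_iff_prime_int.1 hp
  rw [Matrix.det_fin_two] at hM
  rcases h with h | ⟨u, v, h0, h1, h2, h3⟩
  · left
    have key : ∀ x : ℤ, (p:ℤ) ∣ ((M 0 0 * M 1 1 - M 0 1 * M 1 0)^3) * x → (p:ℤ) ∣ x := by
      intro x hx
      exact (hpi.dvd_or_dvd hx).resolve_left (fun h => hM (hpi.dvd_of_dvd_pow h))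
    have e := sub_adj f M
    have e' := Form.ext_iff.1 e
    simp only [Form.smul, Matrix.det_fin_two] at e'
    obtain ⟨h1, h2, h3, h4⟩ := h
    have : ∀ N : Mat, (p:ℤ) ∣ ((f.sub M).sub N).a ∧ (p:ℤ) ∣ ((f.sub M).sub N).b ∧ (p:ℤ) ∣ ((f.sub M).sub N).c
        ∧ (p:ℤ) ∣ ((f.sub M).sub N).d := by
      intro N
      generalize f.sub M = g at *
      obtain ⟨a, ha⟩ := h1
      obtain ⟨b, hb⟩ := h2
      obtain ⟨c, hc⟩ := h3
      obtain ⟨d, hd⟩ := h4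
      have : g = Form.smul p ⟨a, b, c, d⟩ := by ext <;> simp [Form.smul, *]
      rw [this, smul_sub]
      exact ⟨dvd_mul_right _ _, dvd_mul_right _ _, dvd_mul_right _ _, dvd_mul_right _ _⟩
    obtain ⟨t1, t2, t3, t4⟩ := this M.adjugate
    rw [e'.1] at t1
    rw [e'.2.1] at t2
    rw [e'.2.2.1] at t3
    rw [e'.2.2.2] at t4
    exact ⟨key _ t1, key _ t2, key _ t3, key _ t4⟩
  · right
    refine ⟨M 0 0*u + M 0 1*v, M 1 0*u + M 1 1*v, ?_, ?_, ?_, ?_⟩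
    · rintro ⟨k1, k2⟩
      apply h0
      constructor
      · have : (p:ℤ) ∣ (M 0 0 * M 1 1 - M 0 1 * M 1 0) * u := by
          have e : (M 0 0 * M 1 1 - M 0 1 * M 1 0) * u = M 1 1 * (M 0 0*u + M 0 1*v) - M 0 1 * (M 1 0*u + M 1 1*v) := by ring
          rw [e]; exact dvd_sub (k1.mul_left _) (k2.mul_left _)
        exact (hpi.dvd_or_dvd this).resolve_left hM
      · have : (p:ℤ) ∣ (M 0 0 * M 1 1 - M 0 1 * M 1 0) * v := by
          have e : (M 0 0 * M 1 1 - M 0 1 * M 1 0) * v = M 0 0 * (M 1 0*u + M 1 1*v) - M 1 0 * (M 0 0*u + M 0 1*v) := by ring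
          rw [e]; exact dvd_sub (k2.mul_left _) (k1.mul_left _)
        exact (hpi.dvd_or_dvd this).resolve_left hM
    · refine (hpi.dvd_or_dvd (b := 3*f.a*(M 0 0*u + M 0 1*v)^2+2*f.b*(M 0 0*u + M 0 1*v)*(M 1 0*u + M 1 1*v)+f.c*(M 1 0*u + M 1 1*v)^2) ?_).resolve_left hM
      have e : (M 0 0 * M 1 1 - M 0 1 * M 1 0) * (3*f.a*(M 0 0*u + M 0 1*v)^2+2*f.b*(M 0 0*u + M 0 1*v)*(M 1 0*u + M 1 1*v)+f.c*(M 1 0*u + M 1 1*v)^2)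
        = M 1 1 * (3*(f.sub M).a*u^2+2*(f.sub M).b*u*v+(f.sub M).c*v^2) - M 1 0 * ((f.sub M).b*u^2+2*(f.sub M).c*u*v+3*(f.sub M).d*v^2) := by
        simp only [sub]; ring
      rw [e]; exact dvd_sub (h1.mul_left _) (h2.mul_left _)
    · refine (hpi.dvd_or_dvd (b := f.b*(M 0 0*u + M 0 1*v)^2+2*f.c*(M 0 0*u + M 0 1*v)*(M 1 0*u + M 1 1*v)+3*f.d*(M 1 0*u + M 1 1*v)^2) ?_).resolve_left hM
      have e : (M 0 0 * M 1 1 - M 0 1 * M 1 0) * (f.b*(M 0 0*u + M 0 1*v)^2+2*f.c*(M 0 0*u + M 0 1*v)*(M 1 0*u + M 1 1*v)+3*f.d*(M 1 0*u + M 1 1*v)^2)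
        = M 0 0 * ((f.sub M).b*u^2+2*(f.sub M).c*u*v+3*(f.sub M).d*v^2) - M 0 1 * (3*(f.sub M).a*u^2+2*(f.sub M).b*u*v+(f.sub M).c*v^2) := by
        simp only [sub]; ring
      rw [e]; exact dvd_sub (h2.mul_left _) (h1.mul_left _)
    · rw [← ev_sub]; exact h3

/-- arithmetic core: integrality of (x+ω)/p forces non-maximality -/
theorem nm_of_integral {p : ℕ} (hp : p.Prime) (f : Form) (x : ℤ) (h1 : (p:ℤ) ∣ 3*x+f.b)
    (h2 : (p:ℤ)^2 ∣ 3*x^2+2*f.b*x+f.a*f.c) (h3 : (p:ℤ)^3 ∣ x^3+f.b*x^2+f.a*f.c*x+f.a^2*f.d) : NM p f := by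
  have hpi := Nat.prime_iff_prime_int.1 hp
  have hp0 : (p:ℤ) ≠ 0 := hpi.ne_zero
  by_cases hx : (p:ℤ) ∣ x
  · obtain ⟨y, rfl⟩ := hx
    have hb : (p:ℤ) ∣ f.b := by
      have : f.b = (3*(p*y)+f.b) - p*(3*y) := by ring
      rw [this]; exact dvd_sub h1 (dvd_mul_right _ _)
    obtain ⟨b, hb'⟩ := id hb
    have hac : (p:ℤ)^2 ∣ f.a*f.c := by
      have : f.a*f.c = (3*(p*y)^2+2*f.b*(p*y)+f.a*f.c) - p^2*(3*y^2+2*b*y) := by rw [hb']; ring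
      rw [this]; exact dvd_sub h2 (dvd_mul_right _ _)
    obtain ⟨e, he⟩ := id hac
    have had : (p:ℤ)^3 ∣ f.a^2*f.d := by
      have : f.a^2*f.d = ((p*y)^3+f.b*(p*y)^2+f.a*f.c*(p*y)+f.a^2*f.d) - p^3*(y^3+b*y^2+e*y) := by rw [he, hb']; ring
      rw [this]; exact dvd_sub h3 (dvd_mul_right _ _)
    by_cases ha : (p:ℤ) ∣ f.a
    · obtain ⟨a, ha'⟩ := id ha
      by_cases ha2 : (p:ℤ) ∣ a
      · obtain ⟨a2, rfl⟩ := ha2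
        exact Or.inr (Or.inl ⟨⟨a2, by rw [ha']; ring⟩, hb⟩)
      · refine Or.inl ⟨ha, hb, ?_, ?_⟩
        · rw [ha', pow_two, mul_assoc] at hac
          exact (hpi.dvd_or_dvd ((mul_dvd_mul_iff_left hp0).1 hac)).resolve_left ha2
        · have : (p:ℤ)^2 * p ∣ p^2*(a^2*f.d) := by
            rw [ha'] at had; convert had using 1 <;> ring
          have := (mul_dvd_mul_iff_left (pow_ne_zero 2 hp0)).1 this
          exact (hpi.dvd_or_dvd this).resolve_left (fun h => ha2 (hpi.dvd_of_dvd_pow h))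
    · refine Or.inr (Or.inr ⟨0, ?_, ?_⟩)
      · have hc : IsCoprime ((p:ℤ)^3) (f.a^2) := ((hpi.coprime_iff_not_dvd.2 ha).pow_left).pow_right
        have := hc.dvd_of_dvd_mul_left had
        simpa [ev] using (pow_dvd_pow (p:ℤ) (by norm_num : 2 ≤ 3)).trans this
      · have hc : IsCoprime ((p:ℤ)^2) (f.a) := ((hpi.coprime_iff_not_dvd.2 ha).pow_left)
        have := hc.dvd_of_dvd_mul_left hac
        simpa using (dvd_pow_self _ two_ne_zero).trans this
  · have ha : ¬ (p:ℤ) ∣ f.a := by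
      intro ha
      have h3' : (p:ℤ) ∣ x^3+f.b*x^2+f.a*f.c*x+f.a^2*f.d := (dvd_pow_self _ three_ne_zero).trans h3
      have h2' : (p:ℤ) ∣ 3*x^2+2*f.b*x+f.a*f.c := (dvd_pow_self _ two_ne_zero).trans h2
      have k3 : (p:ℤ) ∣ x^2*(x+f.b) := by
        have : x^2*(x+f.b) = (x^3+f.b*x^2+f.a*f.c*x+f.a^2*f.d) - f.a*(f.c*x+f.a*f.d) := by ring
        rw [this]; exact dvd_sub h3' (ha.mul_right _)
      have k3' : (p:ℤ) ∣ x+f.b := (hpi.dvd_or_dvd k3).resolve_left (fun h => hx (hpi.dvd_of_dvd_pow h))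
      have k2 : (p:ℤ) ∣ x*(3*x+2*f.b) := by
        have : x*(3*x+2*f.b) = (3*x^2+2*f.b*x+f.a*f.c) - f.a*f.c := by ring
        rw [this]; exact dvd_sub h2' (ha.mul_right _)
      have k2' := (hpi.dvd_or_dvd k2).resolve_left hx
      apply hx
      have : x = (3*x+2*f.b) - 2*(x+f.b) := by ring
      rw [this]; exact dvd_sub k2' (k3'.mul_left _)
    obtain ⟨w, k, hk⟩ := exists_inv_mod hp 3 ha
    have haw : f.a*w = 1+p^3*k := by linear_combination hk
    refine Or.inr (Or.inr ⟨x*w, ?_, ?_⟩)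
    · have hc : IsCoprime ((p:ℤ)^2) (f.a^2) := ((hpi.coprime_iff_not_dvd.2 ha).pow_left).pow_right
      apply hc.dvd_of_dvd_mul_right
      have e : f.ev (x*w) 1 * f.a^2 = x^3*(f.a*w)^3+f.b*x^2*(f.a*w)^2+f.a*f.c*x*(f.a*w)+f.a^2*f.d := by
        simp only [ev]; ring
      have e2 : x^3*(1+p^3*k)^3+f.b*x^2*(1+p^3*k)^2+f.a*f.c*x*(1+p^3*k)+f.a^2*f.d =
        (x^3+f.b*x^2+f.a*f.c*x+f.a^2*f.d) + p^2*(x^3*(3*k*p+3*k^2*p^4+k^3*p^7) + f.b*x^2*(2*k*p+k^2*p^4)+f.a*f.c*x*(p*k)) := by ring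
      rw [e, haw, e2]
      exact dvd_add ((pow_dvd_pow (p:ℤ) (by norm_num : 2 ≤ 3)).trans h3) (dvd_mul_right _ _)
    · have hc : IsCoprime ((p:ℤ)) (f.a) := ((hpi.coprime_iff_not_dvd.2 ha))
      apply hc.dvd_of_dvd_mul_right
      have e : (3*f.a*(x*w)^2 + 2*f.b*(x*w) + f.c) * f.a = 3*x^2*(f.a*w)^2+2*f.b*x*(f.a*w)+f.a*f.c := by ring
      have e2 : 3*x^2*(1+p^3*k)^2+2*f.b*x*(1+p^3*k)+f.a*f.c = (3*x^2+2*f.b*x+f.a*f.c) +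
        p*(3*x^2*(2*p^2*k+p^5*k^2)+2*f.b*x*p^2*k) := by ring
      rw [e, haw, e2]
      exact dvd_add ((dvd_pow_self _ two_ne_zero).trans h2) (dvd_mul_right _ _)

/-- NM gives an over-form -/
theorem NM.over {p : ℕ} (hp : p.Prime) {f : Form} (h : NM p f) :
    ∃ (g : Form) (M : Mat) (k : ℤ), k ≠ 0 ∧ M.det ≠ 0 ∧ f.sub M = smul k g ∧
      ∃ i : ℕ, 0 < i ∧ f.disc = p^i * g.disc := by
  have hpi := Nat.prime_iff_prime_int.1 hp
  have hp0 : (p:ℤ) ≠ 0 := hpi.ne_zero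
  rcases h with ⟨⟨a, ha⟩, ⟨b, hb⟩, ⟨c, hc⟩, ⟨d, hd⟩⟩ | ⟨⟨a, ha⟩, ⟨b, hb⟩⟩ | ⟨r, ⟨d, hd⟩, ⟨c, hc⟩⟩
  · refine ⟨⟨a, b, c, d⟩, 1, p, hp0, by simp, ?_, 4, by norm_num, ?_⟩
    · rw [sub_one]; ext <;> simp [smul, *]
    · simp only [disc, ha, hb, hc, hd]; ring
  · refine ⟨⟨a, b, f.c, p*f.d⟩, !![1, 0; 0, (p:ℤ)], p^2, pow_ne_zero _ hp0, by simp [Matrix.det_fin_two, hp.ne_zero], ?_, 2, by norm_num, ?_⟩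
    · ext <;> simp [smul, sub, *] <;> ring
    · simp only [disc, ha, hb]; ring
  · have hd' : f.d = p^2*d - (f.a*r^3+f.b*r^2+f.c*r) := by simp only [ev] at hd; linear_combination hd
    have hc' : f.c = p*c - (3*f.a*r^2+2*f.b*r) := by linear_combination hc
    refine ⟨⟨p*f.a, f.b+3*f.a*r, c, d⟩, !![(p:ℤ), r; 0, 1], p^2, pow_ne_zero _ hp0, by simp [Matrix.det_fin_two, hp.ne_zero], ?_, 2, by norm_num, ?_⟩
    · ext <;> simp [smul, sub]
      · ring
      · ring
      · rw [hc']; ring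
      · rw [hd']; ring
    · simp only [disc]; rw [hd', hc']; ring

end Form

set_option linter.all false
namespace Form
open NumberField Module

section
variable {K : Type*} [Field K]

def evK (f : Form) (x y : K) : K := (f.a:K)*x^3 + f.b*x^2*y + f.c*x*y^2 + f.d*y^3

def HasRoot (f : Form) (K : Type*) [Field K] : Prop := ∃ x y : K, ¬ (x = 0 ∧ y = 0) ∧ f.evK x y = 0

theorem evK_sub (f : Form) (M : Mat) (x y : K) :
    (f.sub M).evK x y = f.evK (M 0 0*x + M 0 1*y) (M 1 0*x + M 1 1*y) := by
  simp only [evK, sub]; push_cast; ring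

theorem HasRoot.of_sub {f : Form} {M : Mat} [CharZero K] (hM : M.det ≠ 0) (h : (f.sub M).HasRoot K) : f.HasRoot K := by
  obtain ⟨x, y, h0, h⟩ := h
  rw [evK_sub] at h
  refine ⟨_, _, ?_, h⟩
  rintro ⟨h1, h2⟩
  apply h0
  rw [Matrix.det_fin_two] at hM
  have hM' : ((M 0 0 : K) * M 1 1 - M 0 1 * M 1 0) ≠ 0 := by exact_mod_cast hM
  constructor
  · have : ((M 0 0 : K) * M 1 1 - M 0 1 * M 1 0) * x = 0 := by linear_combination (M 1 1:K) * h1 - M 0 1 * h2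
    exact (mul_eq_zero.1 this).resolve_left hM'
  · have : ((M 0 0 : K) * M 1 1 - M 0 1 * M 1 0) * y = 0 := by linear_combination -(M 1 0 :K) * h1 + M 0 0 * h2
    exact (mul_eq_zero.1 this).resolve_left hM'

theorem HasRoot.smul {f : Form} (k : ℤ) (h : f.HasRoot K) : (Form.smul k f).HasRoot K := by
  obtain ⟨x, y, h0, h⟩ := h
  refine ⟨x, y, h0, ?_⟩
  have : (Form.smul k f).evK x y = k * f.evK x y := by simp only [evK, Form.smul]; push_cast; ring
  rw [this, h, mul_zero]

theorem HasRoot.of_smul {f : Form} [CharZero K] {k : ℤ} (hk : k ≠ 0) (h : (Form.smul k f).HasRoot K) : f.HasRoot K := by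
  obtain ⟨x, y, h0, h⟩ := h
  refine ⟨x, y, h0, ?_⟩
  have : (Form.smul k f).evK x y = k * f.evK x y := by simp only [evK, Form.smul]; push_cast; ring
  rw [this] at h
  exact (mul_eq_zero.1 h).resolve_left (by exact_mod_cast hk)

theorem HasRoot.sub {f : Form} {M : Mat} [CharZero K] (hM : M.det ≠ 0) (h : f.HasRoot K) : (f.sub M).HasRoot K := by
  apply HasRoot.of_sub (M := M.adjugate)
  · rw [Matrix.det_adjugate]; simpa using hM
  · rw [sub_adj]; exact h.smul _

/-- root in affine form -/
theorem HasRoot.exists_root {f : Form} [CharZero K] (hf : f.Irr) (h : f.HasRoot K) :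
    ∃ ρ : K, (f.a:K)*ρ^3+f.b*ρ^2+f.c*ρ+f.d = 0 := by
  obtain ⟨x, y, h0, h⟩ := h
  by_cases hy : y = 0
  · subst hy
    simp [evK] at h
    rcases h with h | h
    · exact absurd h hf.a_ne
    · exact absurd ⟨h, rfl⟩ h0
  · refine ⟨x/y, ?_⟩
    simp only [evK] at h
    field_simp
    linear_combination h

theorem hasRoot_of_root {f : Form} {ρ : K} (h : (f.a:K)*ρ^3+f.b*ρ^2+f.c*ρ+f.d = 0) : f.HasRoot K :=
  ⟨ρ, 1, by simp, by simp only [evK]; linear_combination h⟩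

theorem root_irrational {f : Form} [CharZero K] (hf : f.Irr) {ρ : K} (h : (f.a:K)*ρ^3+f.b*ρ^2+f.c*ρ+f.d = 0)
    (q : ℚ) : ρ ≠ q := by
  rintro rfl
  have h' : (f.a:ℚ)*q^3+f.b*q^2+f.c*q+f.d = 0 := by exact_mod_cast h
  have h2 : f.ev q.num q.den = 0 := by
    have hq : (q.den:ℚ) ≠ 0 := by exact_mod_cast q.den_nz
    have : ((f.ev q.num q.den : ℤ):ℚ) = 0 := by
      simp only [ev]; push_cast
      have e : (q.num:ℚ) = q * q.den := by rw [Rat.mul_den_eq_num]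
      rw [e]
      linear_combination (q.den:ℚ)^3 * h'
    exact_mod_cast this
  have := (hf _ _ h2).2
  exact q.den_nz (by exact_mod_cast this)
end

section
variable {K : Type*} [Field K] [NumberField K]

/-- degree of irrational elements in cubic fields -/
theorem natDegree_minpoly_eq (hK : finrank ℚ K = 3) {x : K} (hx : ∀ q : ℚ, x ≠ q) : (minpoly ℚ x).natDegree = 3 := by
  have hd : (minpoly ℚ x).natDegree ∣ 3 := hK ▸ minpoly.degree_dvd (Algebra.IsIntegral.isIntegral x)
  rcases (Nat.dvd_prime Nat.prime_three).1 hd with h | h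
  · exfalso
    rw [minpoly.natDegree_eq_one_iff] at h
    obtain ⟨q, hq⟩ := h
    exact hx q (by rw [← hq]; simp)
  · exact h

theorem lin_indep_sq (hK : finrank ℚ K = 3) {x : K} (hx : ∀ q : ℚ, x ≠ q) (u v w : ℚ)
    (h : (u:K) + v*x + w*x^2 = 0) : u = 0 ∧ v = 0 ∧ w = 0 := by
  by_contra hne
  open Polynomial in
  have hp : (C u + C v * X + C w * X^2 : ℚ[X]) ≠ 0 := by
    intro h0
    apply hne
    have h1 := congrArg (fun p => p.coeff 0) h0
    have h2 := congrArg (fun p => p.coeff 1) h0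
    have h3 := congrArg (fun p => p.coeff 2) h0
    simp [coeff_X, coeff_one, coeff_X_pow, coeff_C] at h1 h2 h3
    exact ⟨h1, h2, h3⟩
  open Polynomial in
  have hd : (C u + C v * X + C w * X^2 : ℚ[X]).natDegree ≤ 2 := by compute_degree
  have := Polynomial.natDegree_le_natDegree (minpoly.degree_le_of_ne_zero ℚ x hp (by simpa using h))
  rw [natDegree_minpoly_eq hK hx] at this
  omega

end
end Form

set_option linter.all false
namespace Form
open NumberField Module

section
variable {K : Type*} [Field K] [NumberField K]

def om (f : Form) (ρ : K) : K := -(f.a*ρ)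
def th (f : Form) (ρ : K) : K := -(f.a*ρ^2+f.b*ρ+f.c)

abbrev Rt (f : Form) (ρ : K) : Prop := (f.a:K)*ρ^3+f.b*ρ^2+f.c*ρ+f.d = 0

theorem om_th {f : Form} {ρ : K} (h : Rt f ρ) : om f ρ * th f ρ = -(f.a*f.d) := by
  simp only [om, th]; linear_combination (f.a:K)*h
theorem om_om {f : Form} {ρ : K} (h : Rt f ρ) : om f ρ * om f ρ = -(f.a*f.c) + f.b*om f ρ - f.a*th f ρ := by
  simp only [om, th]; ring
theorem th_th {f : Form} {ρ : K} (h : Rt f ρ) : th f ρ * th f ρ = -(f.b*f.d) + f.d*om f ρ - f.c*th f ρ := by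
  simp only [om, th]; linear_combination (f.a*ρ+f.b)*h

theorem om_irr {f : Form} (hf : f.Irr) {ρ : K} (h : Rt f ρ) (q : ℚ) : om f ρ ≠ q := by
  intro e
  have ha : (f.a:K) ≠ 0 := by exact_mod_cast hf.a_ne
  apply root_irrational hf h (-(q/f.a))
  simp only [om] at e
  push_cast
  rw [← e]; field_simp

theorem om_cube {f : Form} {ρ : K} (h : Rt f ρ) : (om f ρ)^3 - f.b*(om f ρ)^2 + f.a*f.c*om f ρ - f.a^2*f.d = 0 := by
  simp only [om]; linear_combination -(f.a:K)^2*h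
theorem th_cube {f : Form} {ρ : K} (h : Rt f ρ) : (th f ρ)^3 + f.c*(th f ρ)^2 + f.b*f.d*th f ρ + f.a*f.d^2 = 0 := by
  have h1 := th_th h
  have h2 := om_th h
  linear_combination (th f ρ) * h1 + (f.d:K)*h2

theorem isIntegral_of_cubic {x : K} (u v w : ℤ) (h : x^3 + u*x^2+v*x+w = 0) : IsIntegral ℤ x := by
  open Polynomial in
  refine ⟨X^3 + C u * X^2 + C v * X + C w, ?_, ?_⟩
  · monicity!
  · simp only [eval₂_add, eval₂_mul, eval₂_pow, eval₂_X, eval₂_C]; simpa using h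

theorem om_int {f : Form} {ρ : K} (h : Rt f ρ) : IsIntegral ℤ (om f ρ) :=
  isIntegral_of_cubic (-f.b) (f.a*f.c) (-(f.a^2*f.d)) (by push_cast; linear_combination om_cube h)
theorem th_int {f : Form} {ρ : K} (h : Rt f ρ) : IsIntegral ℤ (th f ρ) :=
  isIntegral_of_cubic (f.c) (f.b*f.d) ((f.a*f.d^2)) (by push_cast; linear_combination th_cube h)

def vec (f : Form) (ρ : K) : Fin 3 → K := ![1, om f ρ, th f ρ]

theorem comb_zero (hK : finrank ℚ K = 3) {f : Form} (hf : f.Irr) {ρ : K} (h : Rt f ρ) (u v w : ℚ)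
    (e : (u:K) + v*om f ρ + w*th f ρ = 0) : u = 0 ∧ v = 0 ∧ w = 0 := by
  have ha : (f.a:ℚ) ≠ 0 := by exact_mod_cast hf.a_ne
  have := lin_indep_sq hK (root_irrational hf h) (u - w*f.c) (-(v*f.a)-w*f.b) (-(w*f.a)) (by
    push_cast; simp only [om, th] at e; linear_combination e)
  obtain ⟨h1, h2, h3⟩ := this
  have hw : w = 0 := by
    have : w * f.a = 0 := by linarith
    exact (mul_eq_zero.1 this).resolve_right ha
  subst hw
  have hv : v = 0 := by
    have : v * f.a = 0 := by linarith
    exact (mul_eq_zero.1 this).resolve_right ha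
  subst hv
  exact ⟨by linarith, rfl, rfl⟩

theorem vec_li (hK : finrank ℚ K = 3) {f : Form} (hf : f.Irr) {ρ : K} (h : Rt f ρ) : LinearIndependent ℚ (vec f ρ) := by
  rw [Fintype.linearIndependent_iff]
  intro g hg
  simp [vec, Fin.sum_univ_three, Algebra.smul_def] at hg
  have := comb_zero hK hf h (g 0) (g 1) (g 2) hg
  intro i; fin_cases i <;> simp [this]

noncomputable def bas (hK : finrank ℚ K = 3) {f : Form} (hf : f.Irr) {ρ : K} (h : Rt f ρ) : Basis (Fin 3) ℚ K :=
  basisOfLinearIndependentOfCardEqFinrank (vec_li hK hf h) (by simp [hK])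

theorem bas_coe (hK : finrank ℚ K = 3) {f : Form} (hf : f.Irr) {ρ : K} (h : Rt f ρ) : ⇑(bas hK hf h) = vec f ρ := by
  simp [bas]

theorem bas_repr (hK : finrank ℚ K = 3) {f : Form} (hf : f.Irr) {ρ : K} (h : Rt f ρ) (u v w : ℚ) :
    ⇑((bas hK hf h).repr (u + v*om f ρ + w * th f ρ)) = ![u, v, w] := by
  have : (u + v*om f ρ + w * th f ρ : K) = ∑ i, (![u,v,w] i) • bas hK hf h i := by
    rw [bas_coe]; simp [vec, Fin.sum_univ_three, Algebra.smul_def]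
  rw [this, Basis.repr_sum_self]

theorem tr_comb (hK : finrank ℚ K = 3) {f : Form} (hf : f.Irr) {ρ : K} (h : Rt f ρ) (u v w : ℚ) :
    Algebra.trace ℚ K (u + v*om f ρ + w * th f ρ) = 3*u + v*f.b - w*f.c := by
  rw [Algebra.trace_eq_matrix_trace (bas hK hf h), Matrix.trace, Fin.sum_univ_three]
  simp only [Matrix.diag_apply, Algebra.leftMulMatrix_eq_repr_mul, bas_coe]
  have e0 : (u + v*om f ρ + w * th f ρ) * vec f ρ 0 = u + v*om f ρ + w * th f ρ := by simp [vec]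
  have e1 : (u + v*om f ρ + w * th f ρ) * vec f ρ 1 = ((-(v*f.a*f.c)-w*f.a*f.d : ℚ):K) + ((u+v*f.b:ℚ):K) * om f ρ + ((-(v*f.a):ℚ):K)*th f ρ := by
    simp [vec]; linear_combination v * om_om h + w * om_th h
  have e2 : (u + v*om f ρ + w * th f ρ) * vec f ρ 2 = ((-(w*f.b*f.d)-v*f.a*f.d : ℚ):K) + ((w*f.d:ℚ):K) * om f ρ + ((u-(w*f.c):ℚ):K)*th f ρ := by
    simp [vec]; linear_combination w * th_th h + v * om_th h
  rw [e0, e1, e2, bas_repr, bas_repr, bas_repr]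
  simp; ring

theorem discr_vec (hK : finrank ℚ K = 3) {f : Form} (hf : f.Irr) {ρ : K} (h : Rt f ρ) :
    Algebra.discr ℚ (vec f ρ) = f.disc := by
  have t00 := tr_comb hK hf h 1 0 0
  have t01 := tr_comb hK hf h 0 1 0
  have t02 := tr_comb hK hf h 0 0 1
  have t11 := tr_comb hK hf h (-(f.a*f.c)) f.b (-f.a)
  have t12 := tr_comb hK hf h (-(f.a*f.d)) 0 0
  have t22 := tr_comb hK hf h (-(f.b*f.d)) f.d (-f.c)
  have e11 : om f ρ * om f ρ = ((-(f.a*f.c):ℚ):K) + ((f.b:ℚ):K)*om f ρ + ((-f.a:ℚ):K)*th f ρ := by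
    push_cast; linear_combination om_om h
  have e12 : om f ρ * th f ρ = ((-(f.a*f.d):ℚ):K) + ((0:ℚ):K)*om f ρ + ((0:ℚ):K)*th f ρ := by
    push_cast; linear_combination om_th h
  have e22 : th f ρ * th f ρ = ((-(f.b*f.d):ℚ):K) + ((f.d:ℚ):K)*om f ρ + ((-f.c:ℚ):K)*th f ρ := by
    push_cast; linear_combination th_th h
  rw [← e11] at t11
  rw [← e12] at t12
  rw [← e22] at t22
  have t21 := t12
  rw [mul_comm] at t21
  simp only [Rat.cast_one, Rat.cast_zero, zero_mul, one_mul, add_zero, zero_add] at t00 t01 t02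
  rw [Algebra.discr_def, Matrix.det_fin_three]
  simp only [Algebra.traceMatrix_apply, Algebra.traceForm_apply, vec, Matrix.cons_val, one_mul, mul_one]
  rw [t00, t01, t02, t11, t12, t21, t22]
  simp only [disc]; push_cast; ring

/-- integral basis indexed by Fin 3 -/
theorem exists_ib (hK : finrank ℚ K = 3) : ∃ B : Basis (Fin 3) ℚ K,
    (∀ x : K, IsIntegral ℤ x ↔ ∃ c : Fin 3 → ℤ, x = ∑ i, (c i : K) * B i) ∧ Algebra.discr ℚ B = NumberField.discr K := by
  have hc : Fintype.card (Free.ChooseBasisIndex ℤ (𝓞 K)) = 3 := by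
    rw [← hK, finrank_eq_card_basis (integralBasis K)]
  let e := Fintype.equivFinOfCardEq hc
  refine ⟨(integralBasis K).reindex e, ?_, ?_⟩
  · intro x
    constructor
    · intro hx
      have : x ∈ Submodule.span ℤ (Set.range (integralBasis K)) := by
        rw [mem_span_integralBasis]; exact ⟨⟨x, hx⟩, rfl⟩
      rw [Submodule.mem_span_range_iff_exists_fun] at this
      obtain ⟨c, hc⟩ := this
      refine ⟨c ∘ e.symm, ?_⟩
      rw [← hc, ← e.sum_comp]
      simp
    · rintro ⟨c, rfl⟩
      apply IsIntegral.sum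
      intro i _
      apply IsIntegral.mul
      · exact isIntegral_algebraMap (R := ℤ) (A := K)
      · simp only [Basis.coe_reindex, Function.comp, integralBasis_apply]
        exact RingOfIntegers.isIntegral_coe _
  · rw [coe_discr]
    rw [← Algebra.discr_reindex ℚ (integralBasis K) e]
    simp

end
end Form

set_option linter.all false
namespace Form
open NumberField Module Matrix

section
variable {K : Type*} [Field K] [NumberField K]

def Spans (f : Form) (ρ : K) : Prop := ∀ x : K, IsIntegral ℤ x → ∃ u v w : ℤ, x = u + v*om f ρ + w*th f ρ

theorem vec_int {f : Form} {ρ : K} (h : Rt f ρ) (i : Fin 3) : IsIntegral ℤ (vec f ρ i) := by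
  fin_cases i
  · exact isIntegral_one
  · exact om_int h
  · exact th_int h

theorem exists_idx (hK : finrank ℚ K = 3) {f : Form} (hf : f.Irr) {ρ : K} (h : Rt f ρ) :
    ∃ (B : Basis (Fin 3) ℚ K) (N : Matrix (Fin 3) (Fin 3) ℤ),
      (∀ x : K, IsIntegral ℤ x ↔ ∃ c : Fin 3 → ℤ, x = ∑ i, (c i : K) * B i) ∧
      (∀ i, vec f ρ i = ∑ j, (N i j : K) * B j) ∧ f.disc = N.det^2 * NumberField.discr K := by
  obtain ⟨B, hB, hd⟩ := exists_ib hK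
  choose N hN using fun i => (hB _).1 (vec_int h i)
  refine ⟨B, Matrix.of N, hB, fun i => by simpa using hN i, ?_⟩
  have e : vec f ρ = ((Matrix.of N).map (Int.cast : ℤ → ℚ)).map (algebraMap ℚ K) *ᵥ ⇑B := by
    ext i; rw [hN i]; simp [Matrix.mulVec, dotProduct]
  have h1 := discr_vec hK hf h
  rw [e, Algebra.discr_of_matrix_mulVec, hd] at h1
  have : ((Matrix.of N).map (Int.cast : ℤ → ℚ)).det = ((Matrix.of N).det : ℚ) := by
    have := (Int.castRingHom ℚ).map_det (Matrix.of N)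
    simp only [RingHom.mapMatrix_apply, Int.coe_castRingHom] at this
    exact this.symm
  rw [this] at h1
  exact_mod_cast h1.symm

theorem comb_int {f : Form} {ρ : K} (h : Rt f ρ) (u v w : ℤ) : IsIntegral ℤ ((u:K) + v*om f ρ + w*th f ρ) :=
  ((isIntegral_algebraMap (R := ℤ) (A := K) (x := u)).add ((isIntegral_algebraMap (R := ℤ) (A := K) (x := v)).mul (om_int h))).add
    ((isIntegral_algebraMap (R := ℤ) (A := K) (x := w)).mul (th_int h))

theorem spans_of_unit {f : Form} {ρ : K} {B : Basis (Fin 3) ℚ K} {N : Matrix (Fin 3) (Fin 3) ℤ}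
    (hB : ∀ x : K, IsIntegral ℤ x ↔ ∃ c : Fin 3 → ℤ, x = ∑ i, (c i : K) * B i)
    (hN : ∀ i, vec f ρ i = ∑ j, (N i j : K) * B j) (hu : IsUnit N.det) : Spans f ρ := by
  intro x hx
  obtain ⟨c, rfl⟩ := (hB x).1 hx
  let y : Fin 3 → ℤ := Matrix.vecMul c N⁻¹
  have hy : Matrix.vecMul y N = c := by
    simp only [y, Matrix.vecMul_vecMul, Matrix.nonsing_inv_mul _ hu, Matrix.vecMul_one]
  refine ⟨y 0, y 1, y 2, ?_⟩
  have e : ((y 0:K) + y 1*om f ρ + y 2*th f ρ) = ∑ i, (y i : K) * vec f ρ i := by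
    simp [Fin.sum_univ_three, vec]
  rw [e]
  simp_rw [hN, Finset.mul_sum]
  rw [Finset.sum_comm]
  refine Finset.sum_congr rfl fun j _ => ?_
  rw [← congrFun hy j]
  simp only [Matrix.vecMul, dotProduct]
  push_cast
  rw [Finset.sum_mul]
  exact Finset.sum_congr rfl fun i _ => by ring

theorem disc_sq (hK : finrank ℚ K = 3) {f : Form} (hf : f.Irr) (h : f.HasRoot K) :
    ∃ n : ℤ, f.disc = n^2 * NumberField.discr K := by
  obtain ⟨ρ, h⟩ := h.exists_root hf
  obtain ⟨B, N, -, -, h3⟩ := exists_idx hK hf h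
  exact ⟨_, h3⟩

theorem spans_of_disc (hK : finrank ℚ K = 3) {f : Form} (hf : f.Irr) {ρ : K} (h : Rt f ρ)
    (hd : f.disc = NumberField.discr K) : Spans f ρ := by
  obtain ⟨B, N, h1, h2, h3⟩ := exists_idx hK hf h
  apply spans_of_unit h1 h2
  rw [hd] at h3
  have h4 : N.det^2 = 1 := by
    have := discr_ne_zero K
    have h5 : (N.det^2 - 1) * NumberField.discr K = 0 := by linear_combination -h3
    linarith [(mul_eq_zero.1 h5).resolve_right this]
  exact IsUnit.of_mul_eq_one N.det (by linear_combination h4)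

/-- core integrality: from α with pα = x + ω integral deduce NM -/
theorem nm_of_alpha (hK : finrank ℚ K = 3) {f : Form} (hf : f.Irr) {ρ : K} (h : Rt f ρ) {p : ℕ} (hp : p.Prime)
    {α : K} (hα : IsIntegral ℤ α) {x : ℤ} (e : (p:K)*α = x + om f ρ) : NM p f := by
  have hp0 : (p:K) ≠ 0 := by exact_mod_cast hp.ne_zero
  have hpq : (p:ℚ) ≠ 0 := by exact_mod_cast hp.ne_zero
  have hirr : ∀ q : ℚ, α ≠ q := by
    rintro q rfl
    apply om_irr hf h (p*q-x)
    push_cast; linear_combination -e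
  have hom : om f ρ = p*α - x := by linear_combination -e
  open Polynomial in
  let H : ℚ[X] := X^3 + C (-(3*x+f.b:ℚ)/p) * X^2 + C ((3*x^2+2*f.b*x+f.a*f.c:ℚ)/p^2) * X + C (-(x^3+f.b*x^2+f.a*f.c*x+f.a^2*f.d:ℚ)/p^3)
  have hHm : H.Monic := by unfold H; monicity!
  open Polynomial in
  have hHd : H.natDegree = 3 := by unfold H; compute_degree!
  have hHr : Polynomial.aeval α H = 0 := by
    simp only [H, map_add, map_mul, map_pow, Polynomial.aeval_X, Polynomial.aeval_C]
    have := om_cube h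
    rw [hom] at this
    simp only [eq_ratCast]; push_cast
    field_simp
    linear_combination this
  have hmp : minpoly ℚ α = H := by
    have hdvd := minpoly.dvd ℚ α hHr
    symm; apply Polynomial.eq_of_monic_of_dvd_of_natDegree_le (minpoly.monic (Algebra.IsIntegral.isIntegral α)) hHm hdvd
    rw [hHd, natDegree_minpoly_eq hK hirr]
  have hz := minpoly.isIntegrallyClosed_eq_field_fractions' ℚ hα
  rw [hmp] at hz
  have c2 := congrArg (fun q => q.coeff 2) hz
  have c1 := congrArg (fun q => q.coeff 1) hz
  have c0 := congrArg (fun q => q.coeff 0) hz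
  simp only [H, Polynomial.coeff_add, Polynomial.coeff_C_mul, Polynomial.coeff_X_pow, Polynomial.coeff_X, Polynomial.coeff_C, Polynomial.coeff_map] at c2 c1 c0
  norm_num at c2 c1 c0
  apply nm_of_integral hp f x
  · refine ⟨-(minpoly ℤ α).coeff 2, ?_⟩
    have : (3*x+f.b:ℚ) = p * (-(minpoly ℤ α).coeff 2) := by rw [← c2]; field_simp; ring
    exact_mod_cast this
  · refine ⟨(minpoly ℤ α).coeff 1, ?_⟩
    have : (3*x^2+2*f.b*x+f.a*f.c:ℚ) = p^2 * ((minpoly ℤ α).coeff 1) := by rw [← c1]; field_simp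
    exact_mod_cast this
  · refine ⟨-(minpoly ℤ α).coeff 0, ?_⟩
    have : (x^3+f.b*x^2+f.a*f.c*x+f.a^2*f.d:ℚ) = p^3 * (-(minpoly ℤ α).coeff 0) := by rw [← c0]; field_simp; ring
    exact_mod_cast this

theorem root_ne_zero {f : Form} (hf : f.Irr) {ρ : K} (h : Rt f ρ) : ρ ≠ 0 := by
  have := root_irrational hf h 0
  simpa using this

theorem unit_of_not_nm (hK : finrank ℚ K = 3) {f : Form} (hf : f.Irr) {ρ : K} (h : Rt f ρ)
    (hmax : ∀ p : ℕ, p.Prime → ¬ NM p f) : Spans f ρ ∧ f.disc = NumberField.discr K := by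
  obtain ⟨B, N, h1, h2, h3⟩ := exists_idx hK hf h
  suffices hu : IsUnit N.det by
    refine ⟨spans_of_unit h1 h2 hu, ?_⟩
    rw [h3]
    have : N.det^2 = 1 := by
      rcases Int.isUnit_iff.1 hu with h | h <;> rw [h] <;> norm_num
    rw [this, one_mul]
  by_contra hu
  rw [Int.isUnit_iff_natAbs_eq] at hu
  obtain ⟨p, hp, hpd⟩ := Nat.exists_prime_and_dvd hu
  have hpd' : (p:ℤ) ∣ N.det := Int.natCast_dvd.2 hpd
  haveI := Fact.mk hp
  apply hmax p hp
  have hdet : (N.map (Int.castRingHom (ZMod p))).det = 0 := by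
    have := (Int.castRingHom (ZMod p)).map_det N
    rw [RingHom.mapMatrix_apply] at this
    rw [← this]
    simpa using (ZMod.intCast_zmod_eq_zero_iff_dvd _ p).2 hpd'
  obtain ⟨v, hv0, hv⟩ := Matrix.exists_vecMul_eq_zero_iff.2 hdet
  have hp0 : (p:K) ≠ 0 := by exact_mod_cast hp.ne_zero
  -- main claim for integer vectors
  have key : ∀ w : Fin 3 → ℤ, (∀ j, ∑ i, ((w i : ℤ) : ZMod p) * (N i j : ZMod p) = 0) →
      ∃ α : K, IsIntegral ℤ α ∧ (p:K)*α = w 0 + w 1 * om f ρ + w 2 * th f ρ := by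
    intro w hw
    have : ∀ j, (p:ℤ) ∣ ∑ i, w i * N i j := by
      intro j
      rw [← ZMod.intCast_zmod_eq_zero_iff_dvd]; push_cast; exact hw j
    choose c hc using this
    refine ⟨∑ j, (c j : K) * B j, (h1 _).2 ⟨c, rfl⟩, ?_⟩
    have e : ((w 0:K) + w 1*om f ρ + w 2*th f ρ) = ∑ i, (w i : K) * vec f ρ i := by
      simp [Fin.sum_univ_three, vec]
    rw [e]
    simp_rw [h2, Finset.mul_sum]
    rw [Finset.sum_comm]
    refine Finset.sum_congr rfl fun j _ => ?_
    have := hc j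
    have h' : ((∑ i, w i * N i j : ℤ):K) = p * c j := by rw [this]; push_cast; rfl
    rw [← mul_assoc, ← h']; push_cast
    rw [Finset.sum_mul]
    exact Finset.sum_congr rfl fun i _ => by ring
  have hvj : ∀ j, ∑ i, v i * (N i j : ZMod p) = 0 := by
    intro j
    have := congrFun hv j
    simpa [Matrix.vecMul, dotProduct] using this
  -- scaling
  have key2 : ∀ t : ZMod p, ∃ α : K, IsIntegral ℤ α ∧ (p:K)*α = ((t * v 0).val : ℤ) + ((t * v 1).val:ℤ) * om f ρ + ((t * v 2).val:ℤ) * th f ρ := by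
    intro t
    apply key (fun i => ((t * v i).val : ℤ))
    intro j
    simp only [Int.cast_natCast, ZMod.natCast_val, ZMod.cast_id', id]
    have e2 : ∑ i, t * v i * (N i j : ZMod p) = t * ∑ i, v i * (N i j : ZMod p) := by
      rw [Finset.mul_sum]; exact Finset.sum_congr rfl fun i _ => by ring
    simpa [hvj] using e2
  by_cases hv1 : v 1 = 0
  · by_cases hv2 : v 2 = 0
    · -- v 0 ≠ 0
      have hv00 : v 0 ≠ 0 := by
        intro h0; apply hv0; ext i; fin_cases i <;> simp [h0, hv1, hv2]
      obtain ⟨α, hα, e⟩ := key2 (v 0)⁻¹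
      rw [inv_mul_cancel₀ hv00, hv1, hv2] at e
      simp only [mul_zero, ZMod.val_zero, ZMod.val_one] at e
      exfalso
      have ea : α = ((1/p:ℚ):K) := by push_cast; field_simp; push_cast at e; linear_combination e
      rw [ea] at hα
      have : IsIntegral ℤ (1/p:ℚ) := (isIntegral_algebraMap_iff (B := K) (algebraMap ℚ K).injective).1 (by simpa using hα)
      obtain ⟨z, hz⟩ := IsIntegrallyClosed.isIntegral_iff.1 this
      simp at hz
      have hpq : (p:ℚ) ≠ 0 := by exact_mod_cast hp.ne_zero
      have : (z:ℚ)*p = 1 := by rw [hz]; field_simp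
      have : z * p = 1 := by exact_mod_cast this
      have := Int.isUnit_iff_natAbs_eq.1 (IsUnit.of_mul_eq_one_right _ this)
      simp at this
      exact hp.one_lt.ne' this
    · obtain ⟨α, hα, e⟩ := key2 (v 2)⁻¹
      rw [inv_mul_cancel₀ hv2, hv1] at e
      simp only [mul_zero, ZMod.val_zero, ZMod.val_one] at e
      have hρ := root_ne_zero hf h
      let M : Mat := !![0,1;1,0]
      have hMd : M.det ≠ 0 := by simp [M, Matrix.det_fin_two]
      have hr : Rt (f.sub M) (ρ⁻¹) := by
        simp [Rt, sub, M]
        field_simp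
        linear_combination h
      have : NM p (f.sub M) := by
        refine nm_of_alpha hK (hf.sub hMd) hr hp (α := -α) hα.neg (x := -((((v 2)⁻¹ * v 0).val:ℕ):ℤ)) ?_
        have : om (f.sub M) ρ⁻¹ = - th f ρ := by
          simp [om, th, sub, M]; field_simp; linear_combination -h
        rw [this]; push_cast at e ⊢; linear_combination -e
      rw [nm_iff hp] at this ⊢
      exact NM'.of_sub hp (M := M) (by intro hh; apply (Nat.prime_iff_prime_int.1 hp).not_unit; apply isUnit_of_dvd_one; simpa [M, Matrix.det_fin_two] using hh) this
  · obtain ⟨α, hα, e⟩ := key2 (v 1)⁻¹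
    rw [inv_mul_cancel₀ hv1] at e
    simp only [ZMod.val_one] at e
    set z : ℤ := ((((v 1)⁻¹ * v 2).val:ℕ):ℤ) with hz
    let M : Mat := !![1,0;z,1]
    have hMd : M.det ≠ 0 := by simp [M, Matrix.det_fin_two]
    have hne : (1 - z*ρ : K) ≠ 0 := by
      intro h0
      by_cases hz0 : (z:K) = 0
      · rw [hz0] at h0; simp at h0
      · apply root_irrational hf h (1/z); push_cast; field_simp; linear_combination -h0
    have hr : Rt (f.sub M) (ρ/(1-z*ρ)) := by
      simp [Rt, sub, M]
      field_simp
      linear_combination h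
    have : NM p (f.sub M) := by
      refine nm_of_alpha hK (hf.sub hMd) hr hp (α := α) hα (x := ((((v 1)⁻¹ * v 0).val:ℕ):ℤ) - (f.c*z+f.d*z^2)) ?_
      have : om (f.sub M) (ρ/(1-z*ρ)) = om f ρ + z*th f ρ + (f.c*z+f.d*z^2) := by
        simp [om, th, sub, M]; field_simp; linear_combination -(z:K)^2*h
      rw [this]; push_cast at e ⊢; linear_combination e
    rw [nm_iff hp] at this ⊢
    exact NM'.of_sub hp (M := M) (by intro hh; apply (Nat.prime_iff_prime_int.1 hp).not_unit; apply isUnit_of_dvd_one; simpa [M, Matrix.det_fin_two] using hh) this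
end
end Form

set_option linter.all false
namespace Form
open NumberField Module Matrix

theorem ext_ev {f g : Form} (h : ∀ x y, f.ev x y = g.ev x y) : f = g := by
  have h1 := h 1 0
  have h2 := h 0 1
  have h3 := h 1 1
  have h4 := h 1 (-1)
  simp only [ev] at h1 h2 h3 h4
  ext <;> linarith

section
variable {K : Type*} [Field K] [NumberField K]

theorem comb_zero_int (hK : finrank ℚ K = 3) {f : Form} (hf : f.Irr) {ρ : K} (h : Rt f ρ) {u v w u' v' w' : ℤ}
    (e : (u:K) + v*om f ρ + w*th f ρ = u' + v' * om f ρ + w' * th f ρ) : u = u' ∧ v = v' ∧ w = w' := by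
  have := comb_zero hK hf h (u-u') (v-v') (w-w') (by push_cast; linear_combination e)
  obtain ⟨h1, h2, h3⟩ := this
  refine ⟨?_, ?_, ?_⟩
  · exact_mod_cast sub_eq_zero.1 h1
  · exact_mod_cast sub_eq_zero.1 h2
  · exact_mod_cast sub_eq_zero.1 h3

theorem equiv_of_spans (hK : finrank ℚ K = 3) {f g : Form} (hf : f.Irr) (hg : g.Irr) {ρ σ : K}
    (h : Rt f ρ) (h' : Rt g σ) (hs : Spans f ρ) (hs' : Spans g σ) :
    ∃ M : Mat, (M.det = 1 ∨ M.det = -1) ∧ smul M.det g = f.sub M := by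
  obtain ⟨s1, p, q, hW⟩ := hs _ (om_int h')
  obtain ⟨t1, r, s, hT⟩ := hs _ (th_int h')
  obtain ⟨s1', p', q', hw⟩ := hs' _ (om_int h)
  obtain ⟨t1', r', s', ht⟩ := hs' _ (th_int h)
  set ω := om f ρ with hω
  set θ := th f ρ with hθ
  set W := om g σ
  set T := th g σ
  have k1 := comb_zero_int hK hf h (u := 0) (v := 1) (w := 0) (u' := s1'+p'*s1+q'*t1) (v' := p'*p+q'*r) (w' := p'*q+q'*s) (by
    push_cast; rw [← hω, ← hθ]; rw [hW, hT] at hw; linear_combination hw)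
  have k2 := comb_zero_int hK hf h (u := 0) (v := 0) (w := 1) (u' := t1'+r'*s1+s'*t1) (v' := r'*p+s'*r) (w' := r'*q+s'*s) (by
    push_cast; rw [← hω, ← hθ]; rw [hW, hT] at ht; linear_combination ht)
  obtain ⟨-, k11, k12⟩ := k1
  obtain ⟨-, k21, k22⟩ := k2
  have hu : (p*s-r*q) * (p'*s'-q'*r') = 1 := by
    have : (p*s-r*q) * (p'*s'-q'*r') = (p'*p+q'*r)*(r'*q+s'*s) - (p'*q+q'*s)*(r'*p+s'*r) := by ring
    rw [this, ← k11, ← k12, ← k21, ← k22]; ring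
  refine ⟨!![p, r; q, s], ?_, ?_⟩
  · rw [Matrix.det_fin_two]; simpa using Int.isUnit_iff.1 (IsUnit.of_mul_eq_one _ hu)
  · apply ext_ev
    intro x y
    rw [ev_smul, ev_sub, Matrix.det_fin_two]
    simp only [Matrix.of_apply, Matrix.cons_val', Matrix.cons_val_zero, Matrix.cons_val_one, Matrix.cons_val_fin_one]
    -- α = xW + yT
    have oo := om_om h; have ot := om_th h; have tt := th_th h
    have OO := om_om h'; have OT := om_th h'; have TT := th_th h'
    set X := p*x+r*y with hX
    set Y := q*x+s*y with hY
    set u := s1*x+t1*y with hu'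
    set A := x^2*g.b + y^2*g.d with hA
    set B := -x^2*g.a - y^2*g.c with hB
    have e1 : ((x:K)*W+y*T) = u + X*ω+Y*θ := by
      rw [hW, hT, hX, hY, hu']; push_cast; ring
    have e2 : ((x:K)*W+y*T)^2 = ((-x^2*g.a*g.c - y^2*g.b*g.d - 2*x*y*g.a*g.d : ℤ):K) + A*W + B*T := by
      rw [hA, hB]; push_cast
      linear_combination (x:K)^2*OO + 2*x*y*OT + (y:K)^2*TT
    have e3 : (u + X*ω+Y*θ : K)^2 = ((u^2 - X^2*f.a*f.c - Y^2*f.b*f.d - 2*X*Y*f.a*f.d : ℤ):K)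
        + ((2*u*X+X^2*f.b+Y^2*f.d : ℤ):K) * ω + ((2*u*Y-X^2*f.a-Y^2*f.c : ℤ):K) * θ := by
      push_cast
      linear_combination (X:K)^2*oo + 2*X*Y*ot + (Y:K)^2*tt
    rw [e1, e3, hW, hT] at e2
    obtain ⟨-, c1, c2⟩ := comb_zero_int hK hf h (u' := (-x^2*g.a*g.c - y^2*g.b*g.d - 2*x*y*g.a*g.d) + A*s1 + B*t1)
      (v' := A*p+B*r) (w' := A*q+B*s) (e2.trans (by push_cast; rw [← hω, ← hθ]; ring))
    simp only [ev]
    rw [hA, hB] at c1 c2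
    rw [hX, hY] at *
    linear_combination ((p*x+r*y)) * c2 - (q*x+s*y) * c1

theorem disc_ne (hK : finrank ℚ K = 3) {f : Form} (hf : f.Irr) (h : f.HasRoot K) : f.disc ≠ 0 := by
  obtain ⟨ρ, h⟩ := h.exists_root hf
  have h1 := discr_vec hK hf h
  have h2 := Algebra.discr_not_zero_of_basis ℚ (bas hK hf h)
  rw [bas_coe, h1] at h2
  exact_mod_cast h2
end

open Polynomial in
theorem minpoly_of_root {K : Type*} [Field K] [NumberField K] (hK : finrank ℚ K = 3) {f : Form} (hf : f.Irr) {ρ : K} (h : Rt f ρ) :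
    minpoly ℚ ρ = X^3 + C (f.b/f.a:ℚ) * X^2 + C (f.c/f.a:ℚ) * X + C (f.d/f.a:ℚ) := by
  have ha : (f.a:K) ≠ 0 := by exact_mod_cast hf.a_ne
  symm
  apply Polynomial.eq_of_monic_of_dvd_of_natDegree_le (minpoly.monic (Algebra.IsIntegral.isIntegral ρ))
  · monicity!
  · apply minpoly.dvd
    simp only [map_add, map_mul, map_pow, aeval_X, aeval_C]
    simp only [eq_ratCast]; push_cast
    field_simp
    linear_combination h
  · rw [natDegree_minpoly_eq hK (root_irrational hf h)]
    have : natDegree (X^3 + C (f.b/f.a:ℚ) * X^2 + C (f.c/f.a:ℚ) * X + C (f.d/f.a:ℚ)) = 3 := by compute_degree!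
    exact this.le

theorem adj_equiv {K : Type*} [Field K] [NumberField K] (hK : finrank ℚ K = 3) (P : Polynomial ℚ) (hP : Irreducible P)
    (hd : P.natDegree = 3) {ρ : K} (h : Polynomial.aeval ρ P = 0) : Nonempty (AdjoinRoot P ≃ₐ[ℚ] K) := by
  haveI := Fact.mk hP
  let φ : AdjoinRoot P →ₐ[ℚ] K := AdjoinRoot.liftAlgHom P (Algebra.ofId ℚ K) ρ (by simpa [Polynomial.aeval_def] using h)
  have hfin : FiniteDimensional ℚ (AdjoinRoot P) := (AdjoinRoot.powerBasis hP.ne_zero).finite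
  have hr : finrank ℚ (AdjoinRoot P) = 3 := by
    rw [(AdjoinRoot.powerBasis hP.ne_zero).finrank, AdjoinRoot.powerBasis_dim, hd]
  have inj : Function.Injective φ := φ.toRingHom.injective
  have := (LinearMap.injective_iff_surjective_of_finrank_eq_finrank (f := φ.toLinearMap) (by rw [hr, hK])).1 inj
  exact ⟨AlgEquiv.ofBijective φ ⟨inj, this⟩⟩

theorem iso_of_hasRoot {K L : Type*} [Field K] [NumberField K] [Field L] [NumberField L] (hK : finrank ℚ K = 3)
    (hL : finrank ℚ L = 3) {f : Form} (hf : f.Irr) (h : f.HasRoot K) (h' : f.HasRoot L) : Nonempty (K ≃+* L) := by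
  obtain ⟨ρ, h⟩ := h.exists_root hf
  obtain ⟨σ, h'⟩ := h'.exists_root hf
  have hP := minpoly.irreducible (Algebra.IsIntegral.isIntegral (R := ℚ) ρ)
  have hd := natDegree_minpoly_eq hK (root_irrational hf h)
  obtain ⟨e1⟩ := adj_equiv hK _ hP hd (minpoly.aeval ℚ ρ)
  obtain ⟨e2⟩ := adj_equiv hL _ hP hd (ρ := σ) (by
    rw [minpoly_of_root hK hf h, ← minpoly_of_root hL hf h']; exact minpoly.aeval ℚ σ)
  exact ⟨(e1.symm.trans e2).toRingEquiv⟩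

theorem HasRoot.map {K L : Type*} [Field K] [Field L] (e : K →+* L) {f : Form} (h : f.HasRoot K) : f.HasRoot L := by
  obtain ⟨x, y, h0, h⟩ := h
  refine ⟨e x, e y, by simpa using h0, ?_⟩
  have := congrArg e h
  simpa [evK] using this

theorem exists_form {K : Type*} [Field K] [NumberField K] (hK : finrank ℚ K = 3) : ∃ f : Form, f.Irr ∧ f.HasRoot K := by
  have : ∃ x : K, ∀ q : ℚ, x ≠ q := by
    by_contra hc
    push Not at hc
    have : Function.Surjective (algebraMap ℚ K) := fun x => by obtain ⟨q, hq⟩ := hc x; exact ⟨q, by rw [hq]; simp⟩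
    have h2 : finrank ℚ K ≤ 1 := finrank_le_one (1:K) (fun x => by obtain ⟨q, hq⟩ := hc x; exact ⟨q, by rw [hq]; simp [Algebra.smul_def]⟩)
    omega
  obtain ⟨x, hx⟩ := this
  have hd := natDegree_minpoly_eq hK hx
  have hirr := minpoly.irreducible (Algebra.IsIntegral.isIntegral (R := ℚ) x)
  have hm := minpoly.monic (Algebra.IsIntegral.isIntegral (R := ℚ) x)
  have hz := minpoly.aeval ℚ x
  have c3 : (minpoly ℚ x).coeff 3 = 1 := by rw [← hd]; exact hm
  have hev : ∀ t : ℚ, (minpoly ℚ x).eval t = (minpoly ℚ x).coeff 0 + (minpoly ℚ x).coeff 1 * t + (minpoly ℚ x).coeff 2 * t^2 + t^3 := by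
    intro t
    rw [Polynomial.eval_eq_sum_range, hd]
    simp [Finset.sum_range_succ, c3]
  rw [Polynomial.aeval_eq_sum_range, hd] at hz
  simp [Finset.sum_range_succ, c3, Algebra.smul_def] at hz
  set q0 := (minpoly ℚ x).coeff 0
  set q1 := (minpoly ℚ x).coeff 1
  set q2 := (minpoly ℚ x).coeff 2
  have d0 := q0.den_nz; have d1 := q1.den_nz; have d2 := q2.den_nz
  let f : Form := ⟨q0.den*q1.den*q2.den, q2.num*q0.den*q1.den, q1.num*q0.den*q2.den, q0.num*q1.den*q2.den⟩
  have ha : f.a ≠ 0 := by simp [f]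
  have e0 : (q0.num:ℚ) = q0 * q0.den := (Rat.mul_den_eq_num q0).symm
  have e1 : (q1.num:ℚ) = q1 * q1.den := (Rat.mul_den_eq_num q1).symm
  have e2 : (q2.num:ℚ) = q2 * q2.den := (Rat.mul_den_eq_num q2).symm
  have hb : (f.b:ℚ) = f.a * q2 := by simp only [f]; push_cast; rw [e2]; ring
  have hc : (f.c:ℚ) = f.a * q1 := by simp only [f]; push_cast; rw [e1]; ring
  have hdd : (f.d:ℚ) = f.a * q0 := by simp only [f]; push_cast; rw [e0]; ring
  refine ⟨f, ?_, hasRoot_of_root (ρ := x) ?_⟩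
  · intro u v huv
    by_cases hv : v = 0
    · subst hv
      refine ⟨?_, rfl⟩
      simp [ev] at huv
      exact huv.resolve_left ha
    · exfalso
      have hv' : (v:ℚ) ≠ 0 := by exact_mod_cast hv
      have h1 : (f.a:ℚ)*u^3+f.b*u^2*v+f.c*u*v^2+f.d*v^3 = 0 := by exact_mod_cast huv
      have haq : (f.a:ℚ) ≠ 0 := by exact_mod_cast ha
      have : (minpoly ℚ x).IsRoot ((u:ℚ)/v) := by
        rw [Polynomial.IsRoot, hev]
        rw [hb, hc, hdd] at h1
        have h2 : (f.a:ℚ) * (u^3+q2*u^2*v+q1*u*v^2+q0*v^3) = 0 := by linear_combination h1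
        have h3 := (mul_eq_zero.1 h2).resolve_left haq
        field_simp
        linear_combination h3
      have := Polynomial.degree_eq_one_of_irreducible_of_root hirr this
      rw [Polynomial.degree_eq_natDegree hirr.ne_zero, hd] at this
      norm_num at this
  · have hb' : (f.b:K) = f.a * (q2:K) := by exact_mod_cast congrArg (Rat.cast : ℚ → K) hb
    have hc' : (f.c:K) = f.a * (q1:K) := by exact_mod_cast congrArg (Rat.cast : ℚ → K) hc
    have hd' : (f.d:K) = f.a * (q0:K) := by exact_mod_cast congrArg (Rat.cast : ℚ → K) hdd
    rw [hb', hc', hd']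
    linear_combination (f.a:K) * hz

theorem exists_max {K : Type*} [Field K] [NumberField K] (hK : finrank ℚ K = 3) : ∃ f : Form, f.Irr ∧ f.HasRoot K ∧ ∀ p : ℕ, p.Prime → ¬ NM p f := by
  classical
  obtain ⟨f0, hf0⟩ := exists_form hK
  have hne : ∃ n, ∃ f : Form, f.Irr ∧ f.HasRoot K ∧ f.disc.natAbs = n := ⟨_, f0, hf0.1, hf0.2, rfl⟩
  obtain ⟨f, hf, hr, hd⟩ := Nat.find_spec hne
  refine ⟨f, hf, hr, fun p hp hnm => ?_⟩
  obtain ⟨g, M, k, hk, hM, e, i, hi, hdd⟩ := NM.over hp hnm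
  have h1 : (f.sub M).Irr := hf.sub hM
  have h2 : (f.sub M).HasRoot K := hr.sub hM
  rw [e] at h1 h2
  have h3 := Nat.find_min' hne ⟨g, h1.of_smul, h2.of_smul hk, rfl⟩
  rw [← hd, hdd, Int.natAbs_mul, Int.natAbs_pow, Int.natAbs_natCast] at h3
  have h4 : g.disc.natAbs ≠ 0 := by simpa using disc_ne hK h1.of_smul (h2.of_smul hk)
  have h5 : 1 < p^i := Nat.one_lt_pow (by omega) hp.one_lt
  nlinarith [Nat.pos_of_ne_zero h4]

theorem not_nm_of_disc {K : Type*} [Field K] [NumberField K] (hK : finrank ℚ K = 3) {f : Form} (hf : f.Irr) (hr : f.HasRoot K)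
   (hd : f.disc = NumberField.discr K) (p : ℕ) (hp : p.Prime) : ¬ NM p f := by
  intro hnm
  obtain ⟨g, M, k, hk, hM, e, i, hi, hdd⟩ := NM.over hp hnm
  have h1 : (f.sub M).Irr := hf.sub hM
  have h2 : (f.sub M).HasRoot K := hr.sub hM
  rw [e] at h1 h2
  obtain ⟨n, hn⟩ := disc_sq hK h1.of_smul (h2.of_smul hk)
  have h0 := discr_ne_zero K
  rw [hn, hd] at hdd
  have : (1 - p^i*n^2 : ℤ) * NumberField.discr K = 0 := by linear_combination hdd
  have := (mul_eq_zero.1 this).resolve_right h0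
  have h6 : (p:ℤ) ∣ 1 := ⟨p^(i-1)*n^2, by rw [← mul_assoc, ← pow_succ', Nat.sub_add_cancel hi]; linarith⟩
  exact (Nat.prime_iff_prime_int.1 hp).not_unit (isUnit_of_dvd_one h6)
end Form

set_option linter.all false
namespace Form
open NumberField Module Matrix

/-- a field for every irreducible form -/
theorem exists_field {f : Form} (hf : f.Irr) : ∃ K : Subfield ℂ, finrank ℚ K = 3 ∧ f.HasRoot K := by
  open Polynomial in
  let P : ℚ[X] := C (f.a:ℚ) * X^3 + C (f.b:ℚ) * X^2 + C (f.c:ℚ) * X + C (f.d:ℚ)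
  have ha : (f.a:ℚ) ≠ 0 := by exact_mod_cast hf.a_ne
  open Polynomial in
  have hPd : P.natDegree = 3 := by unfold P; compute_degree!; exact hf.a_ne
  have hP0 : P ≠ 0 := by intro h; rw [h] at hPd; simp at hPd
  have hirr : Irreducible P := by
    rw [Polynomial.irreducible_iff_roots_eq_zero_of_degree_le_three (by omega) (by omega)]
    rw [Multiset.eq_zero_iff_forall_notMem]
    intro q hq
    rw [Polynomial.mem_roots hP0, Polynomial.IsRoot] at hq
    simp [P] at hq
    exact root_irrational (K := ℚ) hf (ρ := q) hq q (by simp)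
  obtain ⟨ρ, hρ⟩ := IsAlgClosed.exists_aeval_eq_zero ℂ P (by rw [Polynomial.degree_eq_natDegree hP0, hPd]; norm_num)
  have hIntg : IsIntegral ℚ ρ := IsAlgebraic.isIntegral ⟨P, hP0, hρ⟩
  have hmd : (minpoly ℚ ρ).natDegree = 3 := by
    rw [← minpoly.eq_of_irreducible hirr hρ, Polynomial.natDegree_mul_C (by simpa using hP0), hPd]
  refine ⟨(IntermediateField.adjoin ℚ {ρ}).toSubfield, ?_, ?_⟩
  · have := IntermediateField.adjoin.finrank hIntg
    rw [hmd] at this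
    exact this
  · refine hasRoot_of_root (ρ := (⟨ρ, IntermediateField.mem_adjoin_simple_self ℚ ρ⟩ : (IntermediateField.adjoin ℚ {ρ}).toSubfield)) ?_
    apply Subtype.ext
    simp [P] at hρ
    push_cast
    exact hρ

theorem nf_of_finrank {K : Subfield ℂ} (h : finrank ℚ K = 3) : NumberField K :=
  haveI : FiniteDimensional ℚ K := FiniteDimensional.of_finrank_pos (by omega)
  ⟨⟩

theorem disc_ne' {f : Form} (hf : f.Irr) : f.disc ≠ 0 := by
  obtain ⟨K, hK, hr⟩ := exists_field hf
  haveI := nf_of_finrank hK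
  exact disc_ne hK hf hr

theorem subDisc_eq {K : Subfield ℂ} [NumberField K] : subDisc K = NumberField.discr K := by
  have h : FiniteDimensional ℚ K := inferInstance
  unfold subDisc
  rw [dif_pos h]

/-- maximal irreducible forms -/
def Mx (D : ℤ) : Set Form := {f | f.Irr ∧ (∀ p : ℕ, p.Prime → ¬ NM p f) ∧ f.disc = D}

def J : Mat := !![-1, 0; 0, 1]
theorem J_det : J.det = -1 := by simp [J, Matrix.det_fin_two]
theorem J_sq : J * J = 1 := by
  ext i j; fin_cases i <;> fin_cases j <;> simp [J, Matrix.mul_apply, Fin.sum_univ_two]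

theorem P_sub (f : Form) (M : Mat) : (f.sub M).P = M.det^2*(f.P*M 0 0^2 + f.Q*M 0 0*M 1 0 + f.R*M 1 0^2) := by
  simp only [P, Q, R, sub, Matrix.det_fin_two]; ring
theorem Q_sub (f : Form) (M : Mat) : (f.sub M).Q = M.det^2*(2*f.P*M 0 0*M 0 1 + f.Q*(M 0 0*M 1 1+M 0 1*M 1 0) + 2*f.R*M 1 0*M 1 1) := by
  simp only [P, Q, R, sub, Matrix.det_fin_two]; ring
theorem R_sub (f : Form) (M : Mat) : (f.sub M).R = M.det^2*(f.P*M 0 1^2 + f.Q*M 0 1*M 1 1 + f.R*M 1 1^2) := by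
  simp only [P, Q, R, sub, Matrix.det_fin_two]; ring

theorem no_orient_rev {f : Form} (hf : f.Irr) (N : Mat) (hN : N.det = -1) : f.sub N ≠ f := by
  intro e
  have h1 := P_sub f N
  have h2 := Q_sub f N
  have h3 := R_sub f N
  rw [e, hN] at h1 h2 h3
  rw [Matrix.det_fin_two] at hN
  set p := N 0 0 with hp
  set r := N 0 1 with hr
  set q := N 1 0 with hq
  set s := N 1 1 with hs
  have t1 : (p+s) * f.P = 0 := by
    have : 2*((p+s) * f.P) = 0 := by
      linear_combination 2*s*h1 - q*h2 + (2*f.P*p+f.Q*q) * hN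
    linarith
  have t3 : (p+s) * f.R = 0 := by
    have : 2*((p+s) * f.R) = 0 := by
      linear_combination -r*h2 + 2*p*h3 + (f.Q*r+2*f.R*s) * hN
    linarith
  have t2 : (p+s) * f.Q = 0 := by
    have : 2*((p+s) * f.Q) = 0 := by
      linear_combination (-2*r*h1+p*h2) + (s*h2 - 2*q*h3) + (2*f.P*r+f.Q*s+f.Q*p+2*f.R*q) * hN
    linarith
  have ht : p + s = 0 := by
    by_contra ht
    have P0 := (mul_eq_zero.1 t1).resolve_left ht
    have Q0 := (mul_eq_zero.1 t2).resolve_left ht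
    have := syz f
    rw [P0, Q0] at this
    apply disc_ne' hf
    linarith
  have key : ∀ x y : ℤ, p*x+r*y = -x → q*x+s*y = -y → x = 0 ∧ y = 0 := by
    intro x y h1 h2
    apply hf
    have h3 : (f.sub N).ev x y = f.ev x y := by rw [e]
    rw [ev_sub, ← hp, ← hr, ← hq, ← hs, h1, h2] at h3
    have : f.ev (-x) (-y) = - f.ev x y := by simp only [ev]; ring
    linarith
  have hs' : s = -p := by linarith
  rw [hs'] at hN key
  have k1 := key r (-(1+p)) (by ring) (by linear_combination -hN)
  have k2 := key (p-1) q (by linear_combination -hN) (by ring)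
  omega

theorem sub_J_mx {D : ℤ} {f : Form} (h : f ∈ Mx D) (M : Mat) (hM : M.det = 1 ∨ M.det = -1) : f.sub M ∈ Mx D := by
  obtain ⟨h1, h2, h3⟩ := h
  refine ⟨h1.sub (by rcases hM with h | h <;> rw [h] <;> norm_num), fun p hp hn => h2 p hp ?_, ?_⟩
  · rw [nm_iff hp] at hn ⊢
    exact NM'.of_sub hp (by
      intro hd; apply (Nat.prime_iff_prime_int.1 hp).not_unit
      apply isUnit_of_dvd_unit hd; rw [Int.isUnit_iff]; exact hM) hn
  · rw [disc_sub, h3]; rcases hM with h | h <;> rw [h] <;> norm_num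

theorem mx_equiv {K : Type*} [Field K] [NumberField K] (hK : finrank ℚ K = 3) {D : ℤ} {f g : Form} (hf : f ∈ Mx D) (hg : g ∈ Mx D)
    (h : f.HasRoot K) (h' : g.HasRoot K) : ∃ M : Mat, (M.det = 1 ∨ M.det = -1) ∧ g = f.sub M := by
  obtain ⟨ρ, h⟩ := h.exists_root hf.1
  obtain ⟨σ, h'⟩ := h'.exists_root hg.1
  obtain ⟨M, hM, e⟩ := equiv_of_spans hK hf.1 hg.1 h h' (unit_of_not_nm hK hf.1 h hf.2.1).1 (unit_of_not_nm hK hg.1 h' hg.2.1).1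
  rcases hM with h | h
  · exact ⟨M, Or.inl h, by rw [← e, h]; ext <;> simp [smul]⟩
  · refine ⟨-M, Or.inr (by rw [Matrix.det_neg]; simp [h]), ?_⟩
    rw [sub_neg, ← e, h, smul_smul']; ext <;> simp [smul]

abbrev Cls (D : ℤ) := Quot (fun K L : {K : Subfield ℂ // finrank ℚ K = 3 ∧ subDisc K = D} => Nonempty (K.1 ≃+* L.1))

theorem cls_form {D : ℤ} (κ : Cls D) : ∃ f ∈ Mx D, ∃ K : {K : Subfield ℂ // finrank ℚ K = 3 ∧ subDisc K = D}, Quot.mk _ K = κ ∧ f.HasRoot K.1 := by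
  obtain ⟨K, rfl⟩ := Quot.exists_rep κ
  haveI := nf_of_finrank K.2.1
  obtain ⟨f, h1, h2, h3⟩ := exists_max K.2.1
  refine ⟨f, ⟨h1, h3, ?_⟩, K, rfl, h2⟩
  obtain ⟨ρ, hρ⟩ := h2.exists_root h1
  rw [(unit_of_not_nm K.2.1 h1 hρ h3).2, ← subDisc_eq, K.2.2]

theorem form_cls {D : ℤ} {f : Form} (hf : f ∈ Mx D) : ∃ K : {K : Subfield ℂ // finrank ℚ K = 3 ∧ subDisc K = D}, f.HasRoot K.1 := by
  obtain ⟨K, hK, h2⟩ := exists_field hf.1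
  haveI := nf_of_finrank hK
  obtain ⟨ρ, hρ⟩ := h2.exists_root hf.1
  refine ⟨⟨K, hK, ?_⟩, h2⟩
  rw [subDisc_eq, ← (unit_of_not_nm hK hf.1 hρ hf.2.1).2, hf.2.2]

theorem exact_iso {D : ℤ} {K L : {K : Subfield ℂ // finrank ℚ K = 3 ∧ subDisc K = D}}
    (h : Quot.mk (fun K L : {K : Subfield ℂ // finrank ℚ K = 3 ∧ subDisc K = D} => Nonempty (K.1 ≃+* L.1)) K = Quot.mk _ L) : Nonempty (K.1 ≃+* L.1) := by
  have h2 := Quot.eqvGen_exact h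
  clear h
  induction h2 with
  | rel _ _ h => exact h
  | refl _ => exact ⟨RingEquiv.refl _⟩
  | symm _ _ _ ih => obtain ⟨e⟩ := ih; exact ⟨e.symm⟩
  | trans x y z h1 h2 ih1 ih2 =>
    obtain ⟨e⟩ := ih1; obtain ⟨e'⟩ := ih2; exact ⟨e.trans e'⟩

theorem count_bound (D : ℤ) (G B : Set Form)
    (hG : ∀ f : Form, f.Irr → f ∈ G → ∀ γ : Mat, γ.det = 1 → f.sub γ ∈ G → f.sub γ = f)
    (hcov : ∀ f : Form, f.Irr → ∃ γ : Mat, γ.det = 1 ∧ f.sub γ ∈ G ∪ B)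
    (hfin : (G ∩ Mx D).Finite) (hfinB : (B ∩ Mx D).Finite) :
    (G ∩ Mx D).ncard ≤ 2 * cubicCountDisc D ∧ 2 * cubicCountDisc D ≤ (G ∩ Mx D).ncard + (B ∩ Mx D).ncard := by
  classical
  choose φ hφ Kφ hKφ hrφ using fun κ : Cls D => cls_form κ
  -- orbits index
  let ψ : Cls D × Bool → Form := fun i => if i.2 then (φ i.1).sub J else φ i.1
  have hψ : ∀ i, ψ i ∈ Mx D := by
    rintro ⟨κ, b⟩
    cases b
    · exact hφ κ
    · exact sub_J_mx (hφ κ) J (Or.inr J_det)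
  have hψr : ∀ i, (ψ i).HasRoot (Kφ i.1).1 := by
    rintro ⟨κ, b⟩
    cases b
    · exact hrφ κ
    · exact (hrφ κ).sub (by rw [J_det]; norm_num)
  have surj : ∀ g ∈ Mx D, ∃ i, ∃ γ : Mat, γ.det = 1 ∧ g = (ψ i).sub γ := by
    intro g hg
    obtain ⟨K, hK⟩ := form_cls hg
    let κ : Cls D := Quot.mk _ K
    obtain ⟨e⟩ := exact_iso (hKφ κ)
    haveI := nf_of_finrank K.2.1
    have h2 : (φ κ).HasRoot K.1 := (hrφ κ).map e.toRingHom
    obtain ⟨M, hM, eM⟩ := mx_equiv K.2.1 (hφ κ) hg h2 hK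
    rcases hM with h | h
    · exact ⟨(κ, false), M, h, eM⟩
    · refine ⟨(κ, true), J * M, by rw [Matrix.det_mul, J_det, h]; norm_num, ?_⟩
      simp only [ψ, if_true]
      rw [sub_sub, ← mul_assoc, J_sq, one_mul, eM]
  have inj : ∀ i i', (∃ γ : Mat, γ.det = 1 ∧ ψ i = (ψ i').sub γ) → i = i' := by
    rintro ⟨κ, b⟩ ⟨κ', b'⟩ ⟨γ, hγ, e⟩
    have hk : κ = κ' := by
      have h1 := hψr (κ, b)
      rw [e] at h1
      have h2 := HasRoot.of_sub (by rw [hγ]; norm_num) h1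
      have h3 := hψr (κ', b')
      haveI := nf_of_finrank (Kφ κ).2.1
      haveI := nf_of_finrank (Kφ κ').2.1
      have h4 := iso_of_hasRoot (Kφ κ).2.1 (Kφ κ').2.1 (hψ (κ', b')).1 h2 h3
      rw [← hKφ κ, ← hKφ κ']
      exact Quot.sound h4
    subst hk
    have hi := (hφ κ).1
    cases b <;> cases b'
    · rfl
    · exfalso; simp only [ψ, if_true] at e; simp at e
      rw [sub_sub] at e
      exact no_orient_rev hi _ (by rw [Matrix.det_mul, hγ, J_det]; norm_num) e.symm
    · exfalso; simp only [ψ, if_true] at e; simp at e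
      have e2 := congrArg (fun g => g.sub J) e
      simp only [sub_sub, J_sq, sub_one] at e2
      exact no_orient_rev hi (γ * J) (by rw [Matrix.det_mul, hγ, J_det]; norm_num) e2.symm
    · rfl
  have hcard : 2 * cubicCountDisc D = Nat.card (Cls D × Bool) := by
    rw [Nat.card_prod]; simp [cubicCountDisc, countFields, Cls, mul_comm]
  choose ix γx hγx hix using fun g : Mx D => surj g.1 g.2
  haveI : Finite ↥(G ∩ Mx D) := hfin
  haveI : Finite ↥(B ∩ Mx D) := hfinB
  have adj1 : ∀ γ : Mat, γ.det = 1 → γ * γ.adjugate = 1 ∧ γ.adjugate.det = 1 := by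
    intro γ h
    refine ⟨by rw [Matrix.mul_adjugate, h, one_smul], by rw [Matrix.det_adjugate, h]; simp⟩
  -- every index is reached
  have hreach : ∀ i, ∃ g : ↥((G ∩ Mx D) ∪ (B ∩ Mx D)), ix ⟨g.1, g.2.elim (fun h => h.2) (fun h => h.2)⟩ = i := by
    intro i
    obtain ⟨γ, hγ, hm⟩ := hcov _ (hψ i).1
    have hmx := sub_J_mx (hψ i) γ (Or.inl hγ)
    refine ⟨⟨(ψ i).sub γ, ?_⟩, ?_⟩
    · rcases hm with h | h
      · exact Or.inl ⟨h, hmx⟩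
      · exact Or.inr ⟨h, hmx⟩
    · symm; apply inj
      refine ⟨γx ⟨(ψ i).sub γ, hmx⟩ * γ.adjugate, ?_, ?_⟩
      · rw [Matrix.det_mul, hγx, (adj1 γ hγ).2, mul_one]
      · rw [← sub_sub, ← hix ⟨(ψ i).sub γ, hmx⟩, sub_sub, (adj1 γ hγ).1, sub_one]
  have hU : ((G ∩ Mx D) ∪ (B ∩ Mx D)).Finite := hfin.union hfinB
  haveI : Finite ↥((G ∩ Mx D) ∪ (B ∩ Mx D)) := hU
  have hsurj : Function.Surjective (fun g : ↥((G ∩ Mx D) ∪ (B ∩ Mx D)) => ix ⟨g.1, g.2.elim (fun h => h.2) (fun h => h.2)⟩) := hreach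
  haveI : Finite (Cls D × Bool) := Finite.of_surjective _ hsurj
  rw [hcard]
  constructor
  · have : Function.Injective (fun g : ↥(G ∩ Mx D) => ix ⟨g.1, g.2.2⟩) := by
      rintro ⟨g, hg, hgm⟩ ⟨g', hg', hgm'⟩ h
      simp only at h
      have e1 := hix ⟨g, hgm⟩
      have e2 := hix ⟨g', hgm'⟩
      rw [← h] at e2
      have e3 : g' = g.sub ((γx ⟨g, hgm⟩).adjugate * γx ⟨g', hgm'⟩) := by
        simp only at e1 e2
        have e4 := congrArg (fun t => t.sub ((γx ⟨g, hgm⟩).adjugate * γx ⟨g', hgm'⟩)) e1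
        simp only [sub_sub] at e4
        rw [e4, ← mul_assoc, (adj1 _ (hγx ⟨g, hgm⟩)).1, one_mul]; exact e2
      apply Subtype.ext
      have := hG g hgm.1 hg ((γx ⟨g, hgm⟩).adjugate * γx ⟨g', hgm'⟩) (by rw [Matrix.det_mul, (adj1 _ (hγx ⟨g, hgm⟩)).2]; simpa using hγx ⟨g', hgm'⟩) (by rw [← e3]; exact hg')
      rw [← e3] at this
      exact this.symm
    exact Nat.card_le_card_of_injective _ this
  · refine (Nat.card_le_card_of_surjective _ hsurj).trans ?_
    exact Set.ncard_union_le _ _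
end Form

set_option linter.all false

namespace Form
open UpperHalfPlane

/-- the covariant point of a form -/
def Z (f : Form) (z : ℍ) : Prop :=
  (0 < f.disc ∧ (f.P : ℂ)*(z:ℂ)^2 + f.Q*(z:ℂ) + f.R = 0) ∨
  (f.disc < 0 ∧ (f.a : ℂ)*(z:ℂ)^3 + f.b*(z:ℂ)^2 + f.c*(z:ℂ) + f.d = 0)

theorem key2 (p q r N E : ℂ) (hE : E ≠ 0) (h : p*N^2+q*N*E+r*E^2 = 0) : p*(N/E)^2+q*(N/E)+r = 0 := by
  field_simp; linear_combination h
theorem key3 (p q r t N E : ℂ) (hE : E ≠ 0) (h : p*N^3+q*N^2*E+r*N*E^2+t*E^3 = 0) : p*(N/E)^3+q*(N/E)^2+r*(N/E)+t = 0 := by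
  field_simp; linear_combination h

theorem Z_sub {f : Form} (γ : SL) (w : ℍ) (h : Z (f.sub γ.1) w) : Z f (γ • w) := by
  have hden : denom γ (w:ℍ) ≠ 0 := UpperHalfPlane.denom_ne_zero _ _
  have hdet : γ.1.det = 1 := γ.2
  have hd : (f.sub γ.1).disc = f.disc := by rw [disc_sub, hdet]; ring
  have hco : ((γ • w : ℍ) : ℂ) = ((γ.1 0 0 : ℂ) * w + γ.1 0 1) / ((γ.1 1 0 : ℂ) * w + γ.1 1 1) := by
    rw [UpperHalfPlane.coe_specialLinearGroup_apply]; simp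
  have hden' : ((γ.1 1 0 : ℂ) * w + γ.1 1 1) ≠ 0 := by
    have := hden
    simpa [UpperHalfPlane.denom] using this
  have hP := P_sub f γ.1
  have hQ := Q_sub f γ.1
  have hR := R_sub f γ.1
  rw [hdet] at hP hQ hR
  unfold Z at h ⊢
  rw [hd] at h
  rcases h with ⟨h1, h2⟩ | ⟨h1, h2⟩
  · left
    refine ⟨h1, ?_⟩
    rw [hP, hQ, hR] at h2
    rw [hco]
    push_cast at h2
    apply key2 _ _ _ _ _ hden'
    linear_combination h2
  · right
    refine ⟨h1, ?_⟩
    simp only [sub] at h2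
    rw [hco]
    push_cast at h2
    apply key3 _ _ _ _ _ _ hden'
    linear_combination h2

theorem Z_sub' {f : Form} (γ : SL) (z : ℍ) (h : Z f z) : Z (f.sub γ.1) (γ⁻¹ • z) := by
  apply Z_sub (f := f.sub γ.1) γ⁻¹ z
  rw [sub_sub]
  have : γ.1 * (γ⁻¹).1 = 1 := by
    have := congrArg Subtype.val (mul_inv_cancel γ)
    rwa [Matrix.SpecialLinearGroup.coe_mul, Matrix.SpecialLinearGroup.coe_one] at this
  rw [this, sub_one]; exact h

def U (f : Form) : ℤ := 2*f.b^3 - 9*f.a*f.b*f.c + 27*f.a^2*f.d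
theorem U_syz (f : Form) : f.U^2 + 27*f.a^2*f.disc = 4*f.P^3 := by
  simp only [U, P, disc]; ring

theorem P_pos {f : Form} (hf : f.a ≠ 0) (h : 0 < f.disc) : 0 < f.P := by
  have h1 := U_syz f
  have h2 : 0 < f.a^2 := by positivity
  have : 0 < 4 * f.P^3 := by nlinarith [sq_nonneg f.U, mul_pos h2 h]
  by_contra hP
  push Not at hP
  have : f.P^3 ≤ 0 := by
    have : f.P^3 = f.P * f.P^2 := by ring
    rw [this]; exact mul_nonpos_of_nonpos_of_nonneg hP (sq_nonneg _)
  linarith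

/-- explicit parametrisation, positive discriminant -/
theorem Z_pos {f : Form} (hf : f.a ≠ 0) (h : 0 < f.disc) {z : ℍ} (hz : Z f z) :
    (f.Q : ℝ) = -2*f.P*z.re ∧ (f.R : ℝ) = f.P*(z.re^2+z.im^2) := by
  rcases hz with ⟨_, h2⟩ | ⟨h1, _⟩
  swap
  · omega
  have hy := z.im_pos
  have him := congrArg Complex.im h2
  have hre := congrArg Complex.re h2
  simp [pow_two] at him hre
  have hQ : (f.Q : ℝ) = -2*f.P*z.re := by
    have : z.im * (f.Q + 2*f.P*z.re) = 0 := by linear_combination him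
    have := (mul_eq_zero.1 this).resolve_left hy.ne'
    linarith
  refine ⟨hQ, ?_⟩
  rw [hQ] at hre
  linear_combination hre

theorem Z_neg {f : Form} (hf : f.a ≠ 0) (h : f.disc < 0) {z : ℍ} (hz : Z f z) :
    ∃ e : ℝ, (f.b : ℝ) = -f.a*(e + 3*z.re) ∧ (f.c : ℝ) = f.a*(2*z.re*e+3*z.re^2+z.im^2)
      ∧ (f.d:ℝ) = -f.a*(e+z.re)*(z.re^2+z.im^2) ∧ -(f.disc:ℝ) = 4*f.a^4*z.im^2*(e^2+z.im^2)^2 := by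
  rcases hz with ⟨h1, _⟩ | ⟨_, h2⟩
  · omega
  have hy := z.im_pos
  have him := congrArg Complex.im h2
  have hre := congrArg Complex.re h2
  simp [pow_succ] at him hre
  have ha : (f.a : ℝ) ≠ 0 := by exact_mod_cast hf
  have hb : (f.b : ℝ) = -f.a*((-f.b/f.a-3*z.re) + 3*z.re) := by field_simp; ring
  set e : ℝ := -f.b/f.a-3*z.re with he
  have hc : (f.c : ℝ) = f.a*(2*z.re*e+3*z.re^2+z.im^2) := by
    have : z.im * (f.c - f.a*(2*z.re*e+3*z.re^2+z.im^2)) = 0 := by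
      rw [hb] at him
      linear_combination him
    have := (mul_eq_zero.1 this).resolve_left hy.ne'
    linarith
  have hd : (f.d:ℝ) = -f.a*(e+z.re)*(z.re^2+z.im^2) := by
    rw [hb, hc] at hre
    linear_combination hre
  refine ⟨e, hb, hc, hd, ?_⟩
  simp only [disc]; push_cast
  rw [hb, hc, hd]; ring

theorem Z_exists {f : Form} (hf : f.a ≠ 0) (h : f.disc ≠ 0) : ∃ z : ℍ, Z f z := by
  have ha : (f.a : ℝ) ≠ 0 := by exact_mod_cast hf
  have haC : (f.a : ℂ) ≠ 0 := by exact_mod_cast hf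
  rcases lt_or_gt_of_ne h with h | h
  · -- negative
    have hroot : ∃ w : ℂ, (f.a : ℂ)*w^3 + f.b*w^2 + f.c*w + f.d = 0 := by
      have hdeg : ((Polynomial.C (f.a:ℂ)) * Polynomial.X^3 + Polynomial.C (f.b:ℂ) * Polynomial.X^2 + Polynomial.C (f.c:ℂ) * Polynomial.X + Polynomial.C (f.d:ℂ)).degree = 3 :=
        Polynomial.degree_cubic haC
      obtain ⟨w, hw⟩ := IsAlgClosed.exists_root _ (by rw [hdeg]; norm_num)
      exact ⟨w, by simpa [Polynomial.IsRoot] using hw⟩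
    obtain ⟨w, hw⟩ := hroot
    rcases lt_trichotomy w.im 0 with hi | hi | hi
    · refine ⟨⟨(starRingEnd ℂ) w, by simpa using hi⟩, Or.inr ⟨h, ?_⟩⟩
      have := congrArg (starRingEnd ℂ) hw
      simpa using this
    · have hwr : w = (w.re : ℂ) := Complex.ext (by simp) (by simp [hi])
      set α := w.re
      have hα : (f.a : ℝ)*α^3 + f.b*α^2 + f.c*α + f.d = 0 := by
        rw [hwr] at hw; exact_mod_cast hw
      set B : ℝ := f.b + f.a*α with hB
      set Cc : ℝ := f.c + f.b*α + f.a*α^2 with hC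
      have hE : (f.disc : ℝ) = (B^2 - 4*f.a*Cc) * (3*f.a*α^2+2*f.b*α+f.c)^2 := by
        have hd : (f.d : ℝ) = -(f.a*α^3+f.b*α^2+f.c*α) := by linarith
        simp only [disc]; push_cast; rw [hd, hB, hC]; ring
      have hEn : B^2 - 4*f.a*Cc < 0 := by
        by_contra hcon
        push Not at hcon
        have : (f.disc : ℝ) < 0 := by exact_mod_cast h
        rw [hE] at this
        have := mul_nonneg hcon (sq_nonneg (3*f.a*α^2+2*f.b*α+f.c))
        linarith
      set y : ℝ := Real.sqrt (4*f.a*Cc - B^2) / (2*|(f.a:ℝ)|) with hy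
      have hypos : 0 < y := by
        apply div_pos (Real.sqrt_pos.2 (by linarith))
        have := abs_pos.2 ha
        linarith
      have hy2 : y^2 * (4*f.a^2) = 4*f.a*Cc - B^2 := by
        rw [hy, div_pow, Real.sq_sqrt (by linarith), mul_pow, sq_abs]; field_simp; ring
      refine ⟨⟨⟨-B/(2*f.a), y⟩, hypos⟩, Or.inr ⟨h, ?_⟩⟩
      set z : ℂ := ⟨-B/(2*f.a), y⟩ with hz
      have hq : (f.a:ℂ)*z^2 + B*z + Cc = 0 := by
        have h4 : (4*(f.a:ℝ)) ≠ 0 := by positivity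
        apply Complex.ext
        · simp [hz, pow_two]
          apply mul_left_cancel₀ h4
          field_simp
          linear_combination -hy2
        · simp [hz, pow_two]
          field_simp
          ring
      have hd : (f.d : ℂ) = -α*Cc := by
        have : (f.d:ℝ) = -α*Cc := by rw [hC]; linarith
        exact_mod_cast congrArg (fun x : ℝ => (x:ℂ)) this
      have hBc : (B : ℂ) = f.b + f.a*α := by rw [hB]; push_cast; ring
      have hCc : (Cc : ℂ) = f.c + f.b*α+f.a*α^2 := by rw [hC]; push_cast; ring
      show (f.a : ℂ)*z^3 + f.b*z^2 + f.c*z + f.d = 0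
      rw [hd]
      rw [hBc] at hq
      linear_combination (z-α)*hq - z * hCc
    · exact ⟨⟨w, hi⟩, Or.inr ⟨h, hw⟩⟩
  · have hP := P_pos hf h
    have hPr : (0:ℝ) < f.P := by exact_mod_cast hP
    have hD : (0:ℝ) < f.disc := by exact_mod_cast h
    set y : ℝ := Real.sqrt (3*f.disc)/(2*f.P) with hy
    have hypos : 0 < y := div_pos (Real.sqrt_pos.2 (by linarith)) (by linarith)
    have hs : (f.Q:ℝ)^2 - 4*f.P*f.R = -3*f.disc := by exact_mod_cast syz f
    have hy2 : y^2*(4*f.P^2) = 3*f.disc := by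
      rw [hy, div_pow, Real.sq_sqrt (by linarith)]; field_simp; norm_num
    refine ⟨⟨⟨-f.Q/(2*f.P), y⟩, hypos⟩, Or.inl ⟨h, ?_⟩⟩
    show (f.P:ℂ)*(⟨-f.Q/(2*f.P), y⟩:ℂ)^2 + f.Q*(⟨-f.Q/(2*f.P), y⟩:ℂ) + f.R = 0
    have h4 : (4*(f.P:ℝ)) ≠ 0 := by positivity
    apply Complex.ext
    · simp [pow_two]
      apply mul_left_cancel₀ h4
      field_simp
      linear_combination -hy2 - hs
    · simp [pow_two]
      field_simp
      ring

end Form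

set_option linter.all false

namespace Form
open UpperHalfPlane
open scoped Modular MatrixGroups

def rD (a b c d : ℝ) : ℝ := b^2*c^2 - 4*a*c^3 - 4*b^3*d - 27*a^2*d^2 + 18*a*b*c*d
def rP (a b c d : ℝ) : ℝ := b^2 - 3*a*c
def rQ (a b c d : ℝ) : ℝ := b*c - 9*a*d
def rR (a b c d : ℝ) : ℝ := c^2 - 3*b*d
def rHi (a b c d : ℝ) : Prop := (0 < rD a b c d ∧ 4*rP a b c d^2 < 3*rD a b c d) ∨
  (rD a b c d < 0 ∧ (rP a b c d + 4*a^2 < 0 ∨ 4*(rP a b c d + 4*a^2)^2 < -rD a b c d))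
def rFd (a b c d : ℝ) : Prop := (0 < rD a b c d ∧ rP a b c d ≤ rR a b c d ∧ -rQ a b c d ≤ rP a b c d ∧ rQ a b c d ≤ rP a b c d) ∨
  (rD a b c d < 0 ∧ 0 ≤ d^2-b*d+a*c-a^2 ∧ 0 ≤ (a+b)^2+a*c+b*c-a*d ∧ 0 ≤ (a-b)^2+a*c-b*c+a*d)
def rFdo (a b c d : ℝ) : Prop := (0 < rD a b c d ∧ rP a b c d < rR a b c d ∧ -rQ a b c d < rP a b c d ∧ rQ a b c d < rP a b c d) ∨
  (rD a b c d < 0 ∧ 0 < d^2-b*d+a*c-a^2 ∧ 0 < (a+b)^2+a*c+b*c-a*d ∧ 0 < (a-b)^2+a*c-b*c+a*d)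
def Hi (f : Form) : Prop := rHi f.a f.b f.c f.d
def Fd (f : Form) : Prop := rFd f.a f.b f.c f.d
def Fdo (f : Form) : Prop := rFdo f.a f.b f.c f.d

theorem rD_eq (f : Form) : rD f.a f.b f.c f.d = f.disc := by simp only [rD, disc]; push_cast; ring
theorem rP_eq (f : Form) : rP f.a f.b f.c f.d = f.P := by simp only [rP, P]; push_cast; ring
theorem rQ_eq (f : Form) : rQ f.a f.b f.c f.d = f.Q := by simp only [rQ, Q]; push_cast; ring
theorem rR_eq (f : Form) : rR f.a f.b f.c f.d = f.R := by simp only [rR, R]; push_cast; ring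

theorem hi_iff {f : Form} (hf : f.a ≠ 0) {z : ℍ} (hz : Z f z) : f.Hi ↔ 1 < z.im := by
  unfold Hi rHi
  rw [rD_eq, rP_eq]
  have hy := z.im_pos
  have ha : (f.a : ℝ) ≠ 0 := by exact_mod_cast hf
  rcases hz.elim (fun h => Or.inl h.1) (fun h => Or.inr h.1) with h | h
  · obtain ⟨h1, h2⟩ := Z_pos hf h hz
    have hP : (0:ℝ) < f.P := by exact_mod_cast P_pos hf h
    have hD : (0:ℝ) < f.disc := by exact_mod_cast h
    have hs : (f.Q:ℝ)^2 - 4*f.P*f.R = -3*f.disc := by exact_mod_cast syz f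
    have h3 : 3*(f.disc:ℝ) = 4*f.P^2*z.im^2 := by rw [h1, h2] at hs; linarith
    constructor
    · rintro (⟨_, h4⟩ | ⟨h4, _⟩)
      · rw [h3] at h4
        have : (1:ℝ) < z.im^2 := by
          by_contra hcon
          push Not at hcon
          nlinarith [mul_le_mul_of_nonneg_left hcon (by positivity : (0:ℝ) ≤ 4*(f.P:ℝ)^2)]
        nlinarith
      · linarith
    · intro h4
      left
      refine ⟨hD, ?_⟩
      rw [h3]
      have : (0:ℝ) < 4*(f.P:ℝ)^2 := by positivity
      nlinarith [mul_lt_mul_of_pos_left (show (1:ℝ) < z.im^2 by nlinarith) this]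
  · obtain ⟨e, hb, hc, hd, hD⟩ := Z_neg hf h hz
    have hDn : (f.disc:ℝ) < 0 := by exact_mod_cast h
    have hP : (f.P:ℝ) = f.a^2*(e^2-3*z.im^2) := by
      rw [← rP_eq]; unfold rP; rw [hb, hc]; ring
    have ha2 : (0:ℝ) < f.a^2 := by positivity
    have ha4 : (0:ℝ) < f.a^4 := by positivity
    have e1 : (f.P:ℝ) + 4*f.a^2 = f.a^2*(e^2-3*z.im^2+4) := by rw [hP]; ring
    have e2 : 4*((f.P:ℝ) + 4*f.a^2)^2 = f.a^4*(4*(e^2-3*z.im^2+4)^2) := by rw [e1]; ring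
    have e3 : -(f.disc:ℝ) = f.a^4*(4*(z.im*(e^2+z.im^2))^2) := by rw [hD]; ring
    rw [e2, e3, e1]
    set y := z.im
    constructor
    · rintro (⟨h4, _⟩ | ⟨_, h4 | h4⟩)
      · linarith
      · have : e^2-3*y^2+4 < 0 := by
          by_contra hcon; push Not at hcon
          have := mul_nonneg ha2.le hcon; linarith
        nlinarith [sq_nonneg e]
      · have h5 := lt_of_mul_lt_mul_left h4 ha4.le
        by_contra hcon
        push Not at hcon
        have h6 : y*(e^2+y^2) ≤ e^2-3*y^2+4 := by
          have : y^2 ≤ 1 := by nlinarith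
          have : y*(e^2+y^2) ≤ 1*(e^2+y^2) := mul_le_mul_of_nonneg_right hcon (by positivity)
          nlinarith
        have h7 : 0 ≤ y*(e^2+y^2) := by positivity
        nlinarith
    · intro h4
      right
      refine ⟨hDn, ?_⟩
      by_cases h5 : e^2-3*y^2+4 < 0
      · left; exact mul_neg_of_pos_of_neg ha2 h5
      · right
        push Not at h5
        apply mul_lt_mul_of_pos_left _ ha4
        have h6 : e^2-3*y^2+4 < y*(e^2+y^2) := by
          have h8 : 1 < y^2 := by nlinarith
          have : 1*(e^2+y^2) ≤ y*(e^2+y^2) := mul_le_mul_of_nonneg_right h4.le (by positivity)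
          nlinarith
        nlinarith

theorem fd_aux {f : Form} (hf : f.a ≠ 0) {z : ℍ} (hz : Z f z) :
    (f.Fd ↔ 1 ≤ z.re^2+z.im^2 ∧ z.re ≤ 1/2 ∧ -(1/2) ≤ z.re) ∧
    (f.Fdo ↔ 1 < z.re^2+z.im^2 ∧ z.re < 1/2 ∧ -(1/2) < z.re) := by
  unfold Fd rFd Fdo rFdo
  rw [rD_eq, rP_eq, rQ_eq, rR_eq]
  have hy := z.im_pos
  have ha : (f.a : ℝ) ≠ 0 := by exact_mod_cast hf
  rcases hz.elim (fun h => Or.inl h.1) (fun h => Or.inr h.1) with h | h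
  · obtain ⟨h1, h2⟩ := Z_pos hf h hz
    have hP : (0:ℝ) < f.P := by exact_mod_cast P_pos hf h
    have hD : (0:ℝ) < f.disc := by exact_mod_cast h
    have hD' : ¬ ((f.disc:ℝ) < 0) := by linarith
    simp only [hD, hD', true_and, false_and, or_false]
    rw [h1, h2]
    refine ⟨and_congr ?_ (and_congr ?_ ?_), and_congr ?_ (and_congr ?_ ?_)⟩
    · exact le_mul_iff_one_le_right hP
    · constructor
      · intro h; by_contra hc; push Not at hc; nlinarith
      · intro h; nlinarith
    · constructor
      · intro h; by_contra hc; push Not at hc; nlinarith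
      · intro h; nlinarith
    · exact lt_mul_iff_one_lt_right hP
    · constructor
      · intro h; by_contra hc; push Not at hc; nlinarith
      · intro h; nlinarith
    · constructor
      · intro h; by_contra hc; push Not at hc; nlinarith
      · intro h; nlinarith
  · obtain ⟨e, hb, hc, hd, hD⟩ := Z_neg hf h hz
    have hDn : (f.disc:ℝ) < 0 := by exact_mod_cast h
    have hD' : ¬ (0 < (f.disc:ℝ)) := by linarith
    simp only [hDn, hD', true_and, false_and, false_or]
    set x := z.re
    set y := z.im
    have ha2 : (0:ℝ) < f.a^2 := by positivity
    have e1 : (f.d:ℝ)^2-f.b*f.d+f.a*f.c-f.a^2 = (f.a^2*(((e+x)*x-1)^2+(e+x)^2*y^2))*(x^2+y^2-1) := by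
      rw [hb, hc, hd]; ring
    have e2 : ((f.a:ℝ)+f.b)^2+f.a*f.c+f.b*f.c-f.a*f.d = (f.a^2*((1-e-2*x)^2+y^2))*(1-2*x) := by
      rw [hb, hc, hd]; ring
    have e3 : ((f.a:ℝ)-f.b)^2+f.a*f.c-f.b*f.c+f.a*f.d = (f.a^2*((1+e+2*x)^2+y^2))*(1+2*x) := by
      rw [hb, hc, hd]; ring
    have p1 : 0 < (f.a:ℝ)^2*(((e+x)*x-1)^2+(e+x)^2*y^2) := by
      apply mul_pos ha2
      by_cases h0 : e + x = 0
      · rw [h0]; norm_num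
      · have : 0 < (e+x)^2 * y^2 := by positivity
        nlinarith [sq_nonneg ((e+x)*x-1)]
    have p2 : 0 < (f.a:ℝ)^2*((1-e-2*x)^2+y^2) := by positivity
    have p3 : 0 < (f.a:ℝ)^2*((1+e+2*x)^2+y^2) := by positivity
    rw [e1, e2, e3, mul_nonneg_iff_of_pos_left p1, mul_nonneg_iff_of_pos_left p2, mul_nonneg_iff_of_pos_left p3,
      mul_pos_iff_of_pos_left p1, mul_pos_iff_of_pos_left p2, mul_pos_iff_of_pos_left p3]
    refine ⟨and_congr ?_ (and_congr ?_ ?_), and_congr ?_ (and_congr ?_ ?_)⟩ <;> constructor <;> intro h <;> linarith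

theorem mem_fd_iff (z : ℍ) : z ∈ 𝒟 ↔ 1 ≤ z.re^2+z.im^2 ∧ z.re ≤ 1/2 ∧ -(1/2) ≤ z.re := by
  have : Complex.normSq (z:ℂ) = z.re^2+z.im^2 := by
    rw [Complex.normSq_apply]; simp; ring
  simp only [ModularGroup.fd, Set.mem_setOf_eq, this, abs_le]
  tauto

theorem mem_fdo_iff (z : ℍ) : z ∈ 𝒟ᵒ ↔ 1 < z.re^2+z.im^2 ∧ z.re < 1/2 ∧ -(1/2) < z.re := by
  have : Complex.normSq (z:ℂ) = z.re^2+z.im^2 := by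
    rw [Complex.normSq_apply]; simp; ring
  simp only [ModularGroup.fdo, Set.mem_setOf_eq, this, abs_lt]
  tauto

theorem fd_iff {f : Form} (hf : f.a ≠ 0) {z : ℍ} (hz : Z f z) : f.Fd ↔ z ∈ 𝒟 := by
  rw [mem_fd_iff, (fd_aux hf hz).1]
theorem fdo_iff {f : Form} (hf : f.a ≠ 0) {z : ℍ} (hz : Z f z) : f.Fdo ↔ z ∈ 𝒟ᵒ := by
  rw [mem_fdo_iff, (fd_aux hf hz).2]

def Up : Set Form := {f | 0 < f.a ∧ 0 ≤ f.b ∧ f.b < 3*f.a ∧ f.Hi}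
def Low : Set Form := {f | 0 < f.a ∧ ¬ f.Hi ∧ f.Fd}
def LowI : Set Form := {f | 0 < f.a ∧ ¬ f.Hi ∧ f.Fdo}
def Bd : Set Form := Low \ LowI
def Gd : Set Form := Up ∪ LowI
def Dom : Set Form := Up ∪ Low

theorem lowI_low {f : Form} (hf : f.Irr) (h : f ∈ LowI) : f ∈ Low := by
  obtain ⟨z, hz⟩ := Z_exists hf.a_ne (disc_ne' hf)
  refine ⟨h.1, h.2.1, (fd_iff hf.a_ne hz).2 ?_⟩
  have := (fdo_iff hf.a_ne hz).1 h.2.2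
  rw [mem_fdo_iff] at this
  rw [mem_fd_iff]
  exact ⟨this.1.le, this.2.1.le, this.2.2.le⟩

theorem sub_T (f : Form) (n : ℤ) : (f.sub (ModularGroup.T^n : SL(2,ℤ)).1).a = f.a ∧ (f.sub (ModularGroup.T^n : SL(2,ℤ)).1).b = f.b + 3*f.a*n := by
  rw [ModularGroup.coe_T_zpow]
  constructor <;> simp [sub] <;> ring

theorem sub_neg_a (f : Form) (γ : SL) : (f.sub (-γ).1).a = - (f.sub γ.1).a := by
  have : (-γ).1 = - γ.1 := by simp
  rw [this, sub_neg]; simp [smul]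

/-- covering -/
theorem L1 {f : Form} (hf : f.Irr) : ∃ γ : SL, f.sub γ.1 ∈ Dom := by
  obtain ⟨z, hz⟩ := Z_exists hf.a_ne (disc_ne' hf)
  obtain ⟨g, hg⟩ := ModularGroup.exists_smul_mem_fd z
  -- fix the sign
  have hsign : ∃ γ : SL, 0 < (f.sub γ.1).a ∧ γ⁻¹ • z = g • z := by
    have hne : (f.sub (g⁻¹).1).a ≠ 0 := (hf.sub (M := (g⁻¹).1) (by rw [(g⁻¹).2]; norm_num)).a_ne
    rcases lt_or_gt_of_ne hne with h | h
    · refine ⟨-g⁻¹, by rw [sub_neg_a]; linarith, ?_⟩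
      rw [inv_neg, inv_inv, ModularGroup.SL_neg_smul]
    · exact ⟨g⁻¹, h, by rw [inv_inv]⟩
  obtain ⟨γ, hγ, hγz⟩ := hsign
  have hZ := Z_sub' γ z hz
  rw [hγz] at hZ
  by_cases hhi : 1 < (g • z).im
  · set h := f.sub γ.1 with hh
    -- translate
    set n : ℤ := -(h.b / (3*h.a)) with hn
    refine ⟨γ * ModularGroup.T^n, Or.inl ?_⟩
    have e : f.sub (γ * ModularGroup.T^n : SL).1 = h.sub (ModularGroup.T^n : SL).1 := by
      rw [hh, sub_sub]; rfl
    rw [e]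
    obtain ⟨ea, eb⟩ := sub_T h n
    have hZ2 := Z_sub' (ModularGroup.T^n) _ hZ
    have hm : 0 < 3*h.a := by linarith
    have m1 := Int.emod_nonneg h.b hm.ne'
    have m2 := Int.emod_lt_of_pos h.b hm
    have m3 := Int.emod_add_mul_ediv h.b (3*h.a)
    refine ⟨by rw [ea]; exact hγ, ?_, ?_, ?_⟩
    · rw [eb, hn]; linarith
    · rw [eb, ea, hn]; linarith
    · rw [hi_iff (by rw [ea]; exact hγ.ne') hZ2, ← zpow_neg, ModularGroup.im_T_zpow_smul]
      exact hhi
  · exact ⟨γ, Or.inr ⟨hγ, by rw [hi_iff hγ.ne' hZ]; exact hhi, (fd_iff hγ.ne' hZ).2 hg⟩⟩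

theorem normSq_denom_ge {w : ℍ} (hw : w ∈ 𝒟) (g : SL) : 1 ≤ Complex.normSq (denom g w) := by
  rw [mem_fd_iff] at hw
  obtain ⟨h1, h2, h3⟩ := hw
  have e : Complex.normSq (denom g w) = (g.1 1 0:ℝ)^2*(w.re^2+w.im^2) + 2*(g.1 1 0)*(g.1 1 1)*w.re+(g.1 1 1:ℝ)^2 := by
    rw [Complex.normSq_apply]; simp [denom]; ring
  rw [e]
  have hcd : (1:ℤ) ≤ (g.1 1 0)^2 - |g.1 1 0 * g.1 1 1| + (g.1 1 1)^2 := by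
    have hdet := g.2
    rw [Matrix.det_fin_two] at hdet
    set c := g.1 1 0
    set d := g.1 1 1
    by_contra hcon
    have h4 : c^2 + d^2 ≤ |c*d| := by linarith
    have h5 : 2*|c*d| ≤ c^2+d^2 := by
      rw [abs_mul]; nlinarith [sq_nonneg (|c|-|d|), sq_abs c, sq_abs d]
    have hc : c = 0 := by nlinarith [sq_nonneg c, sq_nonneg d, abs_nonneg (c*d)]
    have hd : d = 0 := by nlinarith [sq_nonneg c, sq_nonneg d, abs_nonneg (c*d)]
    rw [hc, hd] at hdet; simp at hdet
  have hcd' : (1:ℝ) ≤ (g.1 1 0:ℝ)^2 - |(g.1 1 0:ℝ) * g.1 1 1| + (g.1 1 1:ℝ)^2 := by exact_mod_cast hcd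
  have h6 : -|(g.1 1 0:ℝ) * g.1 1 1| ≤ 2*((g.1 1 0:ℝ)*(g.1 1 1)*w.re) := by
    have : |2*((g.1 1 0:ℝ)*(g.1 1 1)*w.re)| ≤ |(g.1 1 0:ℝ) * g.1 1 1| := by
      rw [abs_mul, abs_mul _ w.re]
      have : |w.re| ≤ 1/2 := abs_le.2 ⟨h3, h2⟩
      have h7 := abs_nonneg ((g.1 1 0:ℝ) * g.1 1 1)
      rw [abs_of_pos (by norm_num : (0:ℝ) < 2)]
      nlinarith
    linarith [neg_abs_le (2*((g.1 1 0:ℝ)*(g.1 1 1)*w.re))]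
  nlinarith [mul_le_mul_of_nonneg_left h1 (sq_nonneg (g.1 1 0:ℝ))]

theorem im_le_of_fd {w : ℍ} (hw : w ∈ 𝒟) (g : SL) : (g • w).im ≤ w.im := by
  rw [ModularGroup.im_smul_eq_div_normSq]
  exact div_le_self w.im_pos.le (normSq_denom_ge hw g)

theorem c_zero {w : ℍ} (hw : 1 < w.im) (g : SL) (hg : 1 < (g • w).im) : g.1 1 0 = 0 := by
  by_contra hc
  rw [ModularGroup.im_smul_eq_div_normSq] at hg
  have e : Complex.normSq (denom g w) = ((g.1 1 0:ℝ)*w.re+g.1 1 1)^2 + (g.1 1 0:ℝ)^2*w.im^2 := by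
    rw [Complex.normSq_apply]; simp [denom]; ring
  have h1 : (1:ℝ) ≤ (g.1 1 0:ℝ)^2 := by
    have : (1:ℤ) ≤ (g.1 1 0)^2 := by have : 0 < (g.1 1 0)^2 := by positivity
                                     omega
    exact_mod_cast this
  rw [e, lt_div_iff₀ (by positivity)] at hg
  nlinarith [sq_nonneg ((g.1 1 0:ℝ)*w.re+g.1 1 1), mul_le_mul_of_nonneg_right h1 (sq_nonneg w.im)]

theorem L2 {f : Form} (hf : f.Irr) (hG : f ∈ Gd) (γ : SL) (hγ : f.sub γ.1 ∈ Dom) : γ = 1 := by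
  obtain ⟨z, hz⟩ := Z_exists hf.a_ne (disc_ne' hf)
  have hZ := Z_sub' γ z hz
  have hf' : (f.sub γ.1).Irr := hf.sub (by rw [γ.2]; norm_num)
  have ha : 0 < f.a := by rcases hG with h | h <;> exact h.1
  have ha' : 0 < (f.sub γ.1).a := by rcases hγ with h | h <;> exact h.1
  have hpm : γ⁻¹ = 1 ∨ γ⁻¹ = -1 → γ = 1 := by
    rintro (h | h)
    · exact inv_eq_one.1 h
    · exfalso
      have : γ = -1 := by rw [← inv_inv γ, h, inv_neg, inv_one]
      rw [this, sub_neg_a] at ha'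
      have : f.sub (1:SL).1 = f := sub_one f
      rw [this] at ha'
      linarith
  have hback : γ • (γ⁻¹ • z) = z := smul_inv_smul γ z
  rcases hG with hu | hl
  · have h1 := (hi_iff ha.ne' hz).1 hu.2.2.2
    rcases hγ with hu' | hl'
    · have h2 := (hi_iff ha'.ne' hZ).1 hu'.2.2.2
      have hc := c_zero h2 γ (by rw [hback]; exact h1)
      obtain ⟨n, hn⟩ := ModularGroup.exists_eq_T_zpow_of_c_eq_zero hc
      have hdet := γ.2
      rw [Matrix.det_fin_two, hc, mul_zero, sub_zero] at hdet
      have e1 : (f.sub γ.1).a = f.a*γ.1 0 0^3 := by simp [sub, hc]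
      have e2 : (f.sub γ.1).b = 3*f.a*γ.1 0 0^2*γ.1 0 1 + f.b*(γ.1 0 0^2*γ.1 1 1) := by simp [sub, hc]
      have hpos : γ.1 0 0 = 1 ∧ γ.1 1 1 = 1 := by
        rcases Int.mul_eq_one_iff_eq_one_or_neg_one.1 hdet with h | h
        · exact h
        · rw [e1, h.1] at ha'; linarith
      rw [hpos.1, hpos.2] at e2
      rw [hpos.1] at e1
      have b1 := hu.2.1
      have b2 := hu.2.2.1
      have b3 := hu'.2.1
      have b4 := hu'.2.2.1
      rw [e2] at b3 b4
      rw [e1] at b4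
      have h01 : γ.1 0 1 = 0 := by
        by_contra hne
        rcases lt_or_gt_of_ne hne with h | h
        · nlinarith
        · nlinarith
      ext i j
      fin_cases i <;> fin_cases j <;> simp [hpos, hc, h01]
    · exfalso
      have h2 := (fd_iff ha'.ne' hZ).1 hl'.2.2
      have h3 := hl'.2.1
      rw [hi_iff ha'.ne' hZ] at h3
      have := im_le_of_fd h2 γ
      rw [hback] at this
      linarith
  · have h1 := (fdo_iff ha.ne' hz).1 hl.2.2
    have h0 := hl.2.1
    rw [hi_iff ha.ne' hz] at h0
    have h1' : z ∈ 𝒟 := (fd_iff ha.ne' hz).1 (lowI_low hf hl).2.2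
    rcases hγ with hu' | hl'
    · exfalso
      have h2 := (hi_iff ha'.ne' hZ).1 hu'.2.2.2
      have := im_le_of_fd h1' γ⁻¹
      linarith
    · have h2 := (fd_iff ha'.ne' hZ).1 hl'.2.2
      exact hpm (ModularGroup.eq_one_or_neg_one_of_mem_fdo_mem_fd h1 h2)

open ModularGroup in
def repL : List SL := [1,-1,T,-T,T⁻¹,-T⁻¹,S,-S,T*S,-(T*S),T⁻¹*S*T⁻¹,-(T⁻¹*S*T⁻¹),S*T⁻¹,-(S*T⁻¹),S*T,-(S*T),T*S*T,-(T*S*T),T⁻¹*S,-(T⁻¹*S)]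

theorem fd_fin {z : ℍ} (hz1 : z ∈ 𝒟) : {g : SL | g • z ∈ 𝒟}.Finite := by
  refine (List.finite_toSet repL).subset ?_
  intro g hg
  have := ModularGroup.cases_of_mem_fd_smul_mem_fd hz1 hg
  show g ∈ repL
  unfold repL
  rcases this with (h|h)|⟨h|h,_⟩|⟨h|h,_⟩|⟨h|h,_⟩|⟨h|h,_⟩|⟨h|h,_⟩|⟨h|h,_⟩|⟨h|h,_⟩|⟨h|h,_⟩|⟨h|h,_⟩ <;>
    rw [h] <;> simp only [List.mem_cons, true_or, or_true]

theorem L3 {f : Form} (hf : f.Irr) (hG : f ∈ Dom) : {γ : SL | f.sub γ.1 ∈ Dom}.Finite := by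
  by_cases hu : f ∈ Gd
  · apply (Set.finite_singleton (1:SL)).subset
    intro γ hγ
    exact L2 hf hu γ hγ
  have hl : f ∈ Low := by
    rcases hG with h | h
    · exact absurd (Or.inl h) hu
    · exact h
  obtain ⟨z, hz⟩ := Z_exists hf.a_ne (disc_ne' hf)
  have hz1 := (fd_iff hf.a_ne hz).1 hl.2.2
  have h0 := hl.2.1
  rw [hi_iff hf.a_ne hz] at h0
  have key : ∀ γ : SL, f.sub γ.1 ∈ Dom → γ⁻¹ • z ∈ 𝒟 := by
    intro γ hγ
    have hZ := Z_sub' γ z hz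
    have ha' : 0 < (f.sub γ.1).a := by rcases hγ with h | h <;> exact h.1
    rcases hγ with hu' | hl'
    · exfalso
      have h2 := (hi_iff ha'.ne' hZ).1 hu'.2.2.2
      have := im_le_of_fd hz1 γ⁻¹
      linarith
    · exact (fd_iff ha'.ne' hZ).1 hl'.2.2
  have hfin : {g : SL | g • z ∈ 𝒟}.Finite := fd_fin hz1
  have : {γ : SL | f.sub γ.1 ∈ Dom} ⊆ (fun g : SL => g⁻¹) '' {g : SL | g • z ∈ 𝒟} := by
    intro γ hγ
    exact ⟨γ⁻¹, key γ hγ, inv_inv γ⟩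
  exact (hfin.image _).subset this

end Form

set_option linter.all false

namespace Form
open UpperHalfPlane
open scoped Modular MatrixGroups

theorem prm {f : Form} (hf : f.a ≠ 0) {z : ℍ} (hz : Z f z) {l : ℝ} (hl : 0 ≤ l) (hD : |(f.disc:ℝ)| ≤ l^4) :
    ∃ b' c' d' : ℝ, (f.b:ℝ) = b' - 3*f.a*z.re ∧ (f.c:ℝ) = c' - 2*b'*z.re+3*f.a*z.re^2 ∧
      (f.d:ℝ) = d' - c'*z.re + b'*z.re^2 - f.a*z.re^3 ∧ |c'| ≤ 3*|(f.a:ℝ)| * z.im^2 ∧ |d'| ≤ |b'| * z.im^2 ∧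
      (f.a:ℝ)^2*z.im^3 ≤ l^2 ∧ b'^2*z.im ≤ l^2 := by
  have hy := z.im_pos
  have ha : (f.a : ℝ) ≠ 0 := by exact_mod_cast hf
  rcases hz.elim (fun h => Or.inl h.1) (fun h => Or.inr h.1) with h | h
  · obtain ⟨h1, h2⟩ := Z_pos hf h hz
    have hP : (0:ℝ) < f.P := by exact_mod_cast P_pos hf h
    have hDp : (0:ℝ) < f.disc := by exact_mod_cast h
    have hs : (f.Q:ℝ)^2 - 4*f.P*f.R = -3*f.disc := by exact_mod_cast syz f
    have h3 : 3*(f.disc:ℝ) = 4*f.P^2*z.im^2 := by rw [h1, h2] at hs; linarith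
    rw [abs_of_pos hDp] at hD
    set x := z.re
    set y := z.im
    obtain ⟨b', hb'⟩ : ∃ b', b' = (f.b:ℝ) + 3*f.a*x := ⟨_, rfl⟩
    obtain ⟨c', hc'⟩ : ∃ c', c' = (f.c:ℝ) + 2*f.b*x + 3*f.a*x^2 := ⟨_, rfl⟩
    obtain ⟨d', hd'⟩ : ∃ d', d' = (f.d:ℝ) + f.c*x + f.b*x^2+f.a*x^3 := ⟨_, rfl⟩
    have hPe : (f.P:ℝ) = b'^2 - 3*f.a*c' := by rw [← rP_eq, hb', hc']; unfold rP; ring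
    have hQe : b'*c' - 9*f.a*d' = 0 := by
      have : b'*c' - 9*f.a*d' = f.Q + 2*f.P*x := by rw [← rP_eq, ← rQ_eq, hb', hc', hd']; unfold rP rQ; ring
      rw [this, h1]; ring
    have hRe : c'^2 - 3*b'*d' = f.P*y^2 := by
      have : c'^2 - 3*b'*d' = f.R + f.Q*x + f.P*x^2 := by
        rw [← rP_eq, ← rQ_eq, ← rR_eq, hb', hc', hd']; unfold rP rQ rR; ring
      rw [this, h1, h2]; ring
    have hc3 : c' = -3*f.a*y^2 := by
      have : (f.P:ℝ) * (c' + 3*f.a*y^2) = 0 := by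
        linear_combination (-3*f.a)*hRe  + c' * hPe + b' * hQe
      have := (mul_eq_zero.1 this).resolve_left hP.ne'
      linarith
    have hd3 : d' = -b'*y^2/3 := by
      rw [hc3] at hQe
      have : (f.a:ℝ) * (9*d'+3*b'*y^2) = 0 := by linear_combination -hQe
      have := (mul_eq_zero.1 this).resolve_left ha
      linarith
    have hPe' : (f.P:ℝ) = b'^2 + 9*f.a^2*y^2 := by rw [hPe, hc3]; ring
    have hPy : (f.P:ℝ)*y ≤ l^2 := by
      apply le_of_sq_le_sq _ (by positivity)
      nlinarith
    rw [hPe'] at hPy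
    refine ⟨b', c', d', by rw [hb']; ring, by rw [hb', hc']; ring, by rw [hb', hc', hd']; ring, ?_, ?_, ?_, ?_⟩
    · rw [hc3, abs_mul, abs_mul, abs_of_nonneg (sq_nonneg y)]; norm_num
    · rw [hd3, abs_div, abs_mul, abs_of_nonneg (sq_nonneg y), abs_neg]
      have := mul_nonneg (abs_nonneg b') (sq_nonneg y)
      rw [abs_of_pos (by norm_num : (0:ℝ) < 3)]; linarith
    · have : 0 ≤ (f.a:ℝ)^2*y^3 := by positivity
      have : 0 ≤ b'^2*y := by positivity
      nlinarith
    · have : 0 ≤ (f.a:ℝ)^2*y^3 := by positivity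
      nlinarith
  · obtain ⟨e, hb, hc, hd, hDe⟩ := Z_neg hf h hz
    have hDn : (f.disc:ℝ) < 0 := by exact_mod_cast h
    rw [abs_of_neg hDn, hDe] at hD
    set x := z.re
    set y := z.im
    have hk : 2*f.a^2*y*(e^2+y^2) ≤ l^2 := by
      apply le_of_sq_le_sq _ (by positivity)
      nlinarith
    refine ⟨-f.a*e, f.a*y^2, -f.a*e*y^2, by rw [hb]; ring, by rw [hc]; ring, by rw [hd]; ring, ?_, ?_, ?_, ?_⟩
    · rw [abs_mul, abs_of_nonneg (sq_nonneg y)]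
      have := mul_nonneg (abs_nonneg (f.a:ℝ)) (sq_nonneg y)
      linarith
    · rw [abs_mul (-(f.a:ℝ)*e), abs_of_nonneg (sq_nonneg y)]
    · have : 0 ≤ (f.a:ℝ)^2*y^3 := by positivity
      have : 0 ≤ (f.a:ℝ)^2*e^2*y := by positivity
      nlinarith
    · have : 0 ≤ (f.a:ℝ)^2*y^3 := by positivity
      have : 0 ≤ (f.a:ℝ)^2*e^2*y := by positivity
      nlinarith

/-- sizes in the upper region -/
theorem up_size {f : Form} (hD0 : f.disc ≠ 0) (h : f ∈ Up) {l : ℝ} (hl : 0 ≤ l) (hD : |(f.disc:ℝ)| ≤ l^4) :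
    (f.a:ℝ) ≤ l ∧ |(f.P:ℝ)| ≤ 10*l^2 ∧ |(f.U:ℝ)| ≤ 64*l^3 := by
  have ha := h.1
  have haR : (0:ℝ) < f.a := by exact_mod_cast ha
  obtain ⟨z, hz⟩ := Z_exists ha.ne' hD0
  have hy := (hi_iff ha.ne' hz).1 h.2.2.2
  obtain ⟨b', c', d', hb, hc, hd, h1, h2, h3, h4⟩ := prm ha.ne' hz hl hD
  set x := z.re
  set y := z.im
  have hPe : (f.P:ℝ) = b'^2 - 3*f.a*c' := by rw [← rP_eq, hb, hc]; unfold rP; ring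
  have ha1 : (f.a:ℝ)^2 ≤ l^2 := by
    have : (1:ℝ) ≤ y^3 := one_le_pow₀ hy.le
    nlinarith [sq_nonneg (f.a:ℝ)]
  have ha2 : (f.a:ℝ)^2*y^2 ≤ l^2 := by
    have : y^2 ≤ y^3 := by nlinarith [sq_nonneg y]
    nlinarith [sq_nonneg (f.a:ℝ)]
  have hb2 : b'^2 ≤ l^2 := by nlinarith [sq_nonneg b']
  have hal : (f.a:ℝ) ≤ l := le_of_sq_le_sq ha1 hl
  have hPl : |(f.P:ℝ)| ≤ 10*l^2 := by
    rw [hPe]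
    have : |(f.a:ℝ)*c'| ≤ 3*l^2 := by
      rw [abs_mul, abs_of_pos haR]
      rw [abs_of_pos haR] at h1
      nlinarith
    have := abs_le.1 this
    rw [abs_le]; constructor <;> nlinarith [sq_nonneg b']
  refine ⟨hal, hPl, ?_⟩
  have hU : (f.U:ℝ)^2 + 27*f.a^2*f.disc = 4*f.P^3 := by exact_mod_cast U_syz f
  have hP3 : (f.P:ℝ)^3 ≤ (10*l^2)^3 := by
    calc (f.P:ℝ)^3 ≤ |(f.P:ℝ)^3| := le_abs_self _
      _ = |(f.P:ℝ)|^3 := abs_pow _ _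
      _ ≤ _ := pow_le_pow_left₀ (abs_nonneg _) hPl 3
  have hDa : -(f.a^2*f.disc:ℝ) ≤ l^2*l^4 := by
    calc -(f.a^2*f.disc:ℝ) = f.a^2 * (-f.disc) := by ring
      _ ≤ f.a^2 * l^4 := by
        apply mul_le_mul_of_nonneg_left _ (sq_nonneg _)
        linarith [neg_abs_le (f.disc:ℝ)]
      _ ≤ _ := mul_le_mul_of_nonneg_right ha1 (by positivity)
  apply abs_le_of_sq_le_sq _ (by positivity)
  have : 0 ≤ l^6 := by positivity
  nlinarith

set_option maxHeartbeats 2000000 in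
theorem low_size {f : Form} (hD0 : f.disc ≠ 0) (h : f ∈ Low) {l : ℝ} (hl : 0 ≤ l) (hD : |(f.disc:ℝ)| ≤ l^4) :
    (f.a:ℝ) ≤ 8*l ∧ |(f.b:ℝ)| ≤ 8*l ∧ |(f.c:ℝ)| ≤ 8*l ∧ |(f.d:ℝ)| ≤ 8*l := by
  have ha := h.1
  have haR : (0:ℝ) < f.a := by exact_mod_cast ha
  obtain ⟨z, hz⟩ := Z_exists ha.ne' hD0
  have hy := h.2.1
  rw [hi_iff ha.ne' hz] at hy
  push Not at hy
  have hfd := (fd_iff ha.ne' hz).1 h.2.2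
  rw [mem_fd_iff] at hfd
  obtain ⟨b', c', d', hb, hc, hd, h1, h2, h3, h4⟩ := prm ha.ne' hz hl hD
  have hy0 := z.im_pos
  set x := z.re
  set y := z.im
  obtain ⟨f1, f2, f3⟩ := hfd
  have hx : |x| ≤ 1/2 := abs_le.2 ⟨f3, f2⟩
  have hx2 : x^2 ≤ 1/4 := by nlinarith
  have hy2 : 3/4 ≤ y^2 := by linarith
  have hy1 : 4/5 ≤ y := by nlinarith
  have hy3 : 3/5 ≤ y^3 := by nlinarith
  have hyy : y^2 ≤ 1 := by nlinarith
  have haa : (f.a:ℝ) ≤ 13/10*l := by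
    apply le_of_sq_le_sq _ (by positivity)
    nlinarith [sq_nonneg (f.a:ℝ)]
  have hbb : |b'| ≤ 12/10*l := by
    apply abs_le_of_sq_le_sq _ (by positivity)
    nlinarith [sq_nonneg b']
  have hcc : |c'| ≤ 39/10*l := by
    rw [abs_of_pos haR] at h1; nlinarith
  have hdd : |d'| ≤ 12/10*l := by nlinarith [abs_nonneg b']
  have hx3 : |x^2| ≤ 1/4 := by rw [abs_of_nonneg (sq_nonneg x)]; exact hx2
  have m : ∀ u v p q : ℝ, |u| ≤ p → |v| ≤ q → |u*v| ≤ p*q := fun u v p q hu hv => by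
    rw [abs_mul]; exact mul_le_mul hu hv (abs_nonneg _) ((abs_nonneg _).trans hu)
  have haa' : |(f.a:ℝ)| ≤ 13/10*l := by rw [abs_of_pos haR]; exact haa
  have t1 := abs_le.1 (m _ _ _ _ haa' hx)
  have t2 := abs_le.1 (m _ _ _ _ hbb hx)
  have t3 := abs_le.1 (m _ _ _ _ haa' hx3)
  have t4 := abs_le.1 (m _ _ _ _ hcc hx)
  have t5 := abs_le.1 (m _ _ _ _ hbb hx3)
  have t6 := abs_le.1 (m _ _ _ _ (m _ _ _ _ haa' hx3) hx)
  have hbb' := abs_le.1 hbb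
  have hcc' := abs_le.1 hcc
  have hdd' := abs_le.1 hdd
  refine ⟨by linarith, ?_, ?_, ?_⟩
  · rw [hb, abs_le]; constructor <;> linarith
  · rw [hc, abs_le]; constructor <;> linarith
  · have : f.a*x^3 = f.a*x^2*x := by ring
    rw [hd, abs_le, this]; constructor <;> linarith

def Red : Set Form := {f | 0 < f.a ∧ f.Fd}

theorem red_ineq (A β y K : ℝ) (hA : 1 ≤ A) (hβ : 0 ≤ β) (hy : 3/4 ≤ y^2) (hy0 : 0 < y) (hK : 1 ≤ K)
    (h1 : A^2*y^3 ≤ K) (h2 : β^2*y ≤ K) :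
    A*(2*A*y^2+4/3*β*y^2) ≤ 30*K ∧ (β+3/2*A)*(4*A*y^2+β) ≤ 30*K ∧ β+3/2*A ≤ 30*K ∧ 4*A*y^2+β ≤ 30*K := by
  have hy1 : 4/5 ≤ y := by nlinarith
  have k1 : A^2*y^2 ≤ 5/4*K := by
    have : 4/5*(A^2*y^2) ≤ y*(A^2*y^2) := mul_le_mul_of_nonneg_right hy1 (by positivity)
    nlinarith
  have k2 : A*β*y^2 ≤ K := by
    have : 0 ≤ y*(A*y-β)^2 := by positivity
    nlinarith
  have k3 : β^2 ≤ 5/4*K := by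
    have : 4/5*(β^2) ≤ y*(β^2) := mul_le_mul_of_nonneg_right hy1 (by positivity)
    nlinarith
  have k4 : A*β ≤ 4/3*K := by
    have : 3/4*(A*β) ≤ y^2*(A*β) := mul_le_mul_of_nonneg_right hy (by positivity)
    nlinarith
  have k5 : A*y^2 ≤ A^2*y^2 := by
    have : A ≤ A^2 := by nlinarith
    exact mul_le_mul_of_nonneg_right this (sq_nonneg _)
  have k6 : β ≤ 3*K := by nlinarith [sq_nonneg (β-1)]
  have k7 : A ≤ 2*K := by
    have : 3/4*A ≤ y^2*A := mul_le_mul_of_nonneg_right hy (by linarith)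
    nlinarith
  refine ⟨?_, ?_, ?_, ?_⟩ <;> nlinarith

set_option maxHeartbeats 2000000 in
theorem red_size {f : Form} (hD0 : f.disc ≠ 0) (h : f ∈ Red) {l : ℝ} (hl : 1 ≤ l) (hD : |(f.disc:ℝ)| ≤ l^4) :
    |(f.a:ℝ)*f.d| ≤ 30*l^2 ∧ |(f.b:ℝ)*f.c| ≤ 30*l^2 ∧ |(f.b:ℝ)| ≤ 30*l^2 ∧ |(f.c:ℝ)| ≤ 30*l^2 ∧ (f.a:ℝ) ≤ 30*l^2 := by
  have ha := h.1
  have haR : (0:ℝ) < f.a := by exact_mod_cast ha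
  have haR1 : (1:ℝ) ≤ f.a := by exact_mod_cast ha
  obtain ⟨z, hz⟩ := Z_exists ha.ne' hD0
  have hfd := (fd_iff ha.ne' hz).1 h.2
  rw [mem_fd_iff] at hfd
  obtain ⟨b', c', d', hb, hc, hd, h1, h2, h3, h4⟩ := prm ha.ne' hz (by linarith) hD
  have hy0 := z.im_pos
  set x := z.re
  set y := z.im
  obtain ⟨f1, f2, f3⟩ := hfd
  have hx : |x| ≤ 1/2 := abs_le.2 ⟨f3, f2⟩
  have hx2 : x^2 ≤ 1/4 := by nlinarith
  have hy2 : 3/4 ≤ y^2 := by linarith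
  have hx3 : |x^2| ≤ 1/4 := by rw [abs_of_nonneg (sq_nonneg x)]; exact hx2
  have m : ∀ u v p q : ℝ, |u| ≤ p → |v| ≤ q → |u*v| ≤ p*q := fun u v p q hu hv => by
    rw [abs_mul]; exact mul_le_mul hu hv (abs_nonneg _) ((abs_nonneg _).trans hu)
  have haa : |(f.a:ℝ)| ≤ f.a := by rw [abs_of_pos haR]
  rw [abs_of_pos haR] at h1
  obtain ⟨r1, r2, r3, r4⟩ := red_ineq f.a |b'| y (l^2) haR1 (abs_nonneg _) hy2 hy0 (by nlinarith) h3 (by rw [sq_abs]; exact h4)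
  have t1 := abs_le.1 (m _ _ _ _ haa hx)
  have t2 := abs_le.1 (m _ _ _ _ (le_refl |b'|) hx)
  have t3 := abs_le.1 (m _ _ _ _ haa hx3)
  have t4 := abs_le.1 (m _ _ _ _ h1 hx)
  have t5 := abs_le.1 (m _ _ _ _ (le_refl |b'|) hx3)
  have t6 := abs_le.1 (m _ _ _ _ (m _ _ _ _ haa hx3) hx)
  have hbb := abs_le.1 (le_refl |b'|)
  have hcc := abs_le.1 h1
  have hdd := abs_le.1 h2
  have q1 : 3/4*(f.a:ℝ) ≤ f.a*y^2 := by nlinarith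
  have q2 : 3/4*|b'| ≤ |b'| * y^2 := by nlinarith [abs_nonneg b']
  have B1 : |(f.b:ℝ)| ≤ |b'|+3/2*f.a := by rw [hb, abs_le]; constructor <;> linarith
  have C1 : |(f.c:ℝ)| ≤ 4*f.a*y^2+|b'| := by rw [hc, abs_le]; constructor <;> linarith
  have D1 : |(f.d:ℝ)| ≤ 2*f.a*y^2+4/3*|b'| * y^2 := by
    have : f.a*x^3 = f.a*x^2*x := by ring
    rw [hd, abs_le, this]; constructor <;> linarith
  refine ⟨?_, ?_, B1.trans r3, C1.trans r4, ?_⟩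
  · exact (m _ _ _ _ haa D1).trans r1
  · exact (m _ _ _ _ B1 C1).trans r2
  · linarith [abs_nonneg b']

theorem L1R {f : Form} (hf : f.Irr) : ∃ γ : SL, f.sub γ.1 ∈ Red := by
  obtain ⟨z, hz⟩ := Z_exists hf.a_ne (disc_ne' hf)
  obtain ⟨g, hg⟩ := ModularGroup.exists_smul_mem_fd z
  have hne : (f.sub (g⁻¹).1).a ≠ 0 := (hf.sub (M := (g⁻¹).1) (by rw [(g⁻¹).2]; norm_num)).a_ne
  have hsign : ∃ γ : SL, 0 < (f.sub γ.1).a ∧ γ⁻¹ • z = g • z := by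
    rcases lt_or_gt_of_ne hne with h | h
    · refine ⟨-g⁻¹, by rw [sub_neg_a]; linarith, ?_⟩
      rw [inv_neg, inv_inv, ModularGroup.SL_neg_smul]
    · exact ⟨g⁻¹, h, by rw [inv_inv]⟩
  obtain ⟨γ, hγ, hγz⟩ := hsign
  have hZ := Z_sub' γ z hz
  rw [hγz] at hZ
  exact ⟨γ, hγ, (fd_iff hγ.ne' hZ).2 hg⟩

end Form

set_option linter.all false

open scoped Classical
noncomputable section
namespace Form
open scoped ENNReal

def ind (s : Set Form) (f : Form) : ℝ≥0∞ := if f ∈ s then 1 else 0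

def Nw (f : Form) : ℝ≥0∞ := ∑' γ : SL, ind Dom (f.sub γ.1)
def Fw (f : Form) : ℝ≥0∞ := ind Dom f / Nw f

theorem sub_mulSL (f : Form) (g h : SL) : (f.sub g.1).sub h.1 = f.sub (g*h).1 := by
  rw [sub_sub]; rfl

theorem irr_SL {f : Form} (γ : SL) : (f.sub γ.1).Irr ↔ f.Irr := by
  constructor
  · intro h
    have := h.sub (M := (γ⁻¹).1) (by rw [(γ⁻¹).2]; norm_num)
    rw [sub_mulSL, mul_inv_cancel] at this
    simpa [sub_one] using this
  · intro h; exact h.sub (by rw [γ.2]; norm_num)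

theorem disc_SL (f : Form) (γ : SL) : (f.sub γ.1).disc = f.disc := by
  rw [disc_sub, γ.2]; ring

theorem Nw_sub (f : Form) (g : SL) : Nw (f.sub g.1) = Nw f := by
  unfold Nw
  simp_rw [sub_mulSL]
  exact (Equiv.mulLeft g).tsum_eq (fun γ : SL => ind Dom (f.sub γ.1))

theorem Nw_fin {f : Form} (hf : f.Irr) : Nw f ≠ ⊤ := by
  obtain ⟨g, hg⟩ := L1 hf
  rw [← Nw_sub f g]
  have hfin := L3 ((irr_SL g).2 hf) hg
  unfold Nw
  rw [tsum_eq_sum (s := hfin.toFinset)]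
  · apply ENNReal.sum_ne_top.2
    intro γ _
    unfold ind
    split_ifs <;> simp
  · intro γ hγ
    unfold ind
    rw [if_neg]
    simpa using hγ

theorem Nw_one_le {f : Form} (hf : f.Irr) : 1 ≤ Nw f := by
  obtain ⟨g, hg⟩ := L1 hf
  calc (1:ℝ≥0∞) = ind Dom (f.sub g.1) := by unfold ind; rw [if_pos hg]
    _ ≤ _ := ENNReal.le_tsum g

theorem Fw_sum {f : Form} (hf : f.Irr) : ∑' γ : SL, Fw (f.sub γ.1) = 1 := by
  unfold Fw
  simp_rw [Nw_sub, div_eq_mul_inv]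
  rw [ENNReal.tsum_mul_right]
  exact ENNReal.mul_inv_cancel (by have := Nw_one_le hf; intro h; rw [Nw, h] at this; simp at this) (Nw_fin hf)

theorem Fw_le (f : Form) (hf : f.Irr) : Fw f ≤ ind Dom f := by
  unfold Fw
  exact ENNReal.div_le_of_le_mul (le_mul_of_one_le_right (by simp) (Nw_one_le hf))

theorem Fw_gd {f : Form} (hf : f.Irr) (h : f ∈ Gd) : Fw f = 1 := by
  have hd : f ∈ Dom := by
    rcases h with h | h
    · exact Or.inl h
    · exact Or.inr (lowI_low hf h)
  have : Nw f = 1 := by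
    unfold Nw
    rw [tsum_eq_single (1:SL)]
    · unfold ind
      rw [if_pos]
      simpa [sub_one] using hd
    · intro γ hγ
      unfold ind
      rw [if_neg]
      intro hh
      exact hγ (L2 hf h γ hh)
  unfold Fw ind
  rw [this, if_pos hd]; simp

def wt (D : ℤ) (f : Form) : ℝ≥0∞ := if f.Irr ∧ f.disc = D then Fw f else 0

theorem wt_sum (D : ℤ) (f : Form) : ∑' γ : SL, wt D (f.sub γ.1) = if f.Irr ∧ f.disc = D then 1 else 0 := by
  unfold wt
  simp_rw [irr_SL, disc_SL]
  split_ifs with h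
  · exact Fw_sum h.1
  · simp

def S (D : ℤ) (φ : Form → ℝ≥0∞) : ℝ≥0∞ := ∑' f, wt D f * φ f

/-- coset representatives for determinant p -/
def Hr (p : ℕ) : Option (Fin p) → Mat
  | none => !![1, 0; 0, (p:ℤ)]
  | some r => !![(p:ℤ), ((r:ℕ):ℤ); 0, 1]

theorem Hr_det (p : ℕ) (i) : (Hr p i).det = p := by
  cases i <;> simp [Hr, Matrix.det_fin_two]

abbrev DM (p : ℕ) := {M : Mat // M.det = (p:ℤ)}

def cosMap (p : ℕ) : Option (Fin p) × SL → DM p := fun x => ⟨Hr p x.1 * x.2.1, by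
  rw [Matrix.det_mul, Hr_det, x.2.2, mul_one]⟩

theorem cos_inj {p : ℕ} (hp : p.Prime) : Function.Injective (cosMap p) := by
  have hpi := Nat.prime_iff_prime_int.1 hp
  have hp0 : (p:ℤ) ≠ 0 := by exact_mod_cast hp.ne_zero
  have key : ∀ (r : Fin p) (γ γ' : SL), (Hr p none * γ.1 ≠ Hr p (some r) * γ'.1) := by
    intro r γ γ' h
    have h1 := congrFun (congrFun h 1) 0
    have h2 := congrFun (congrFun h 1) 1
    simp [Hr, Matrix.mul_apply, Fin.sum_univ_two] at h1 h2
    have hd := γ'.2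
    rw [Matrix.det_fin_two, ← h1, ← h2] at hd
    exact hpi.not_unit (isUnit_of_dvd_one ⟨γ'.1 0 0 * γ.1 1 1 - γ'.1 0 1 * γ.1 1 0, by linear_combination -hd⟩)
  rintro ⟨i, γ⟩ ⟨i', γ'⟩ h
  have h : Hr p i * γ.1 = Hr p i' * γ'.1 := congrArg Subtype.val h
  rcases i with _ | r <;> rcases i' with _ | r'
  · have h1 := congrFun (congrFun h 1) 0
    have h2 := congrFun (congrFun h 1) 1
    have h3 := congrFun (congrFun h 0) 0
    have h4 := congrFun (congrFun h 0) 1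
    simp [Hr, Matrix.mul_apply, Fin.sum_univ_two] at h1 h2 h3 h4
    have e1 := h1.resolve_right hp.ne_zero
    have e2 := h2.resolve_right hp.ne_zero
    congr 1
    ext a b
    fin_cases a <;> fin_cases b <;> simp [*]
  · exact (key _ _ _ h).elim
  · exact (key _ _ _ h.symm).elim
  · have h1 := congrFun (congrFun h 1) 0
    have h2 := congrFun (congrFun h 1) 1
    have h3 := congrFun (congrFun h 0) 0
    have h4 := congrFun (congrFun h 0) 1
    simp [Hr, Matrix.mul_apply, Fin.sum_univ_two] at h1 h2 h3 h4
    have hd := γ'.2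
    rw [Matrix.det_fin_two] at hd
    rw [h1] at h3
    rw [h2] at h4
    have hdv : (p:ℤ) ∣ ((r:ℕ):ℤ) - ((r':ℕ):ℤ) := by
      refine ⟨(γ'.1 0 0 - γ.1 0 0) * -γ'.1 0 1 * 0 + ((γ'.1 0 1 - γ.1 0 1) * γ'.1 0 0 - (γ'.1 0 0 - γ.1 0 0) * γ'.1 0 1), ?_⟩
      linear_combination (γ'.1 0 0) * h4 - (γ'.1 0 1) * h3 - (((r:ℕ):ℤ) - ((r':ℕ):ℤ)) * hd
    have hr : r = r' := by
      have := Int.eq_zero_of_abs_lt_dvd hdv (by rw [abs_lt]; have := r.2; have := r'.2; omega)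
      ext; omega
    subst hr
    have h3' := mul_left_cancel₀ hp0 (add_right_cancel h3)
    have h4' := mul_left_cancel₀ hp0 (add_right_cancel h4)
    congr 1
    ext a b
    fin_cases a <;> fin_cases b <;> simp [*]

theorem cos_surj {p : ℕ} (hp : p.Prime) : Function.Surjective (cosMap p) := by
  have hp0 : (p:ℤ) ≠ 0 := by exact_mod_cast hp.ne_zero
  rintro ⟨M, hM⟩
  have hd := hM
  rw [Matrix.det_fin_two] at hd
  by_cases h : (p:ℤ) ∣ M 1 0 ∧ (p:ℤ) ∣ M 1 1
  · obtain ⟨⟨z, hz⟩, ⟨w, hw⟩⟩ := h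
    refine ⟨⟨none, ⟨!![M 0 0, M 0 1; z, w], ?_⟩⟩, ?_⟩
    · rw [Matrix.det_fin_two]
      simp
      rw [hz, hw] at hd
      exact mul_left_cancel₀ hp0 (by linear_combination hd)
    · apply Subtype.ext
      ext a b
      fin_cases a <;> fin_cases b <;> simp [cosMap, Hr, Matrix.mul_apply, Fin.sum_univ_two, *]
  · have : ∃ r : ℤ, (p:ℤ) ∣ M 0 0 - r * M 1 0 ∧ (p:ℤ) ∣ M 0 1 - r * M 1 1 := by
      by_cases hz : (p:ℤ) ∣ M 1 0
      · have hw : ¬ (p:ℤ) ∣ M 1 1 := fun h' => h ⟨hz, h'⟩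
        obtain ⟨w, hw⟩ := exists_inv_mod hp 1 hw
        rw [pow_one] at hw
        obtain ⟨k, hk⟩ := hw
        refine ⟨M 0 1 * w, ⟨-M 0 0 * k + w, ?_⟩, ⟨-M 0 1 * k, by linear_combination -M 0 1 * hk⟩⟩
        linear_combination -M 0 0 * hk + w * hd
      · obtain ⟨w, hw⟩ := exists_inv_mod hp 1 hz
        rw [pow_one] at hw
        obtain ⟨k, hk⟩ := hw
        refine ⟨M 0 0 * w, ⟨-M 0 0 * k, by linear_combination -M 0 0 * hk⟩, ⟨-M 0 1 * k - w, ?_⟩⟩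
        linear_combination -M 0 1 * hk - w * hd
    obtain ⟨r, hr⟩ := this
    have hpp : (0:ℤ) < p := by exact_mod_cast hp.pos
    have hm := Int.emod_add_mul_ediv r p
    obtain ⟨⟨x, hx⟩, ⟨y, hy⟩⟩ := hr
    refine ⟨⟨some ⟨(r % p).toNat, ?_⟩, ⟨!![x + (r/p) * M 1 0, y + (r/p) * M 1 1; M 1 0, M 1 1], ?_⟩⟩, ?_⟩
    · have := Int.emod_nonneg r hp0; have := Int.emod_lt_of_pos r hpp; omega
    · rw [Matrix.det_fin_two]
      simp
      exact mul_left_cancel₀ hp0 (by linear_combination hd - M 1 1 * hx + M 1 0 * hy)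
    · have e : (((r % p).toNat : ℕ) : ℤ) = r % p := Int.toNat_of_nonneg (Int.emod_nonneg r hp0)
      apply Subtype.ext
      ext a b
      fin_cases a <;> fin_cases b <;> simp [cosMap, Hr, Matrix.mul_apply, Fin.sum_univ_two, max_eq_left (Int.emod_nonneg r hp0)]
      · linear_combination -hx + M 1 0 * hm
      · linear_combination -hy + M 1 1 * hm

def cosEquiv {p : ℕ} (hp : p.Prime) : Option (Fin p) × SL ≃ DM p := Equiv.ofBijective _ ⟨cos_inj hp, cos_surj hp⟩

end Form
end

set_option linter.all false
open scoped Classical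
noncomputable section
namespace Form
open scoped ENNReal

def omg (p : ℕ) (f : Form) : ℕ := ∑ i : Option (Fin p), if ∃ g, f.sub (Hr p i) = smul p g then 1 else 0
def ob (p : ℕ) (f : Form) : ℕ := ∑ i : Option (Fin p), if ∃ g, f.sub (Hr p i) = smul ((p:ℤ)^2) g then 1 else 0

theorem fiber {p : ℕ} (hp : p.Prime) {n : ℤ} (hn : n ≠ 0) (E : ℤ) (f : Form)
    (h : ∀ g (M : Mat), M.det = p → f.sub M = smul n g → g.Irr ∧ g.disc = E) :
    ∑' M : DM p, ∑' g, (if f.sub M.1 = smul n g then wt E g else 0) =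
      ∑ i, if ∃ g, f.sub (Hr p i) = smul n g then 1 else 0 := by
  rw [← (cosEquiv hp).tsum_eq, ENNReal.summable.tsum_prod' (fun _ => ENNReal.summable), tsum_fintype]
  apply Finset.sum_congr rfl
  intro i _
  have e : ∀ γ : SL, ((cosEquiv hp) (i, γ)).1 = Hr p i * γ.1 := fun γ => rfl
  simp_rw [e, ← sub_sub]
  split_ifs with hg
  · obtain ⟨g, hg⟩ := hg
    have h1 := h g _ (Hr_det p i) hg
    have := wt_sum E g
    rw [if_pos h1] at this
    rw [← this]
    apply tsum_congr
    intro γ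
    rw [hg, smul_sub, tsum_eq_single (g.sub γ.1)]
    · rw [if_pos rfl]
    · intro g' hg'
      rw [if_neg]
      intro h2
      exact hg' (smul_inj hn h2).symm
  · rw [ENNReal.tsum_eq_zero]
    intro γ
    rw [ENNReal.tsum_eq_zero]
    intro g
    rw [if_neg]
    intro h2
    apply hg
    refine ⟨g.sub (γ⁻¹).1, ?_⟩
    rw [← smul_sub, ← h2, sub_mulSL, mul_inv_cancel]
    simp [sub_one]

def adjE (p : ℕ) : DM p ≃ DM p where
  toFun M := ⟨M.1.adjugate, by rw [Matrix.det_adjugate, M.2]; simp⟩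
  invFun M := ⟨M.1.adjugate, by rw [Matrix.det_adjugate, M.2]; simp⟩
  left_inv M := by
    apply Subtype.ext
    simp only [Matrix.adjugate_fin_two]
    ext i j; fin_cases i <;> fin_cases j <;> simp
  right_inv M := by
    apply Subtype.ext
    simp only [Matrix.adjugate_fin_two]
    ext i j; fin_cases i <;> fin_cases j <;> simp

theorem rel_iff {p : ℕ} (hp : p.Prime) (f g : Form) (M : DM p) :
    f.sub M.1 = smul ((p:ℤ)^2) g ↔ g.sub (adjE p M).1 = smul p f := by
  have hp0 : (p:ℤ) ≠ 0 := by exact_mod_cast hp.ne_zero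
  have e : (adjE p M).1 = M.1.adjugate := rfl
  have h1 := sub_adj f M.1
  have h2 := sub_adj g M.1.adjugate
  have e2 : M.1.adjugate.adjugate = M.1 := congrArg Subtype.val ((adjE p).left_inv M)
  have e3 : M.1.adjugate.det = p := (adjE p M).2
  rw [M.2] at h1
  rw [e2, e3] at h2
  rw [e]
  constructor
  · intro h
    rw [h, smul_sub] at h1
    apply smul_inj (pow_ne_zero 2 hp0)
    rw [h1, smul_smul']; congr 1
  · intro h
    rw [h, smul_sub] at h2
    apply smul_inj hp0
    rw [h2, smul_smul']; congr 1; ring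

theorem unfold {p : ℕ} (hp : p.Prime) (E : ℤ) (Φ : Form → ℝ≥0∞)
    (hΦ : ∀ f g (M : Mat), M.det = p → f.sub M = smul ((p:ℤ)^2) g → Φ f = Φ g) :
    S ((p:ℤ)^2*E) (fun f => ob p f * Φ f) = S E (fun g => omg p g * Φ g) := by
  have hp0 : (p:ℤ) ≠ 0 := by exact_mod_cast hp.ne_zero
  have hL : S ((p:ℤ)^2*E) (fun f => ob p f * Φ f) =
      ∑' f, ∑' g, ∑' M : DM p, if f.sub M.1 = smul ((p:ℤ)^2) g then wt ((p:ℤ)^2*E) f * wt E g * Φ f else 0 := by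
    unfold S
    apply tsum_congr
    intro f
    by_cases hf : f.Irr ∧ f.disc = (p:ℤ)^2*E
    · rw [ENNReal.tsum_comm]
      have := fiber hp (pow_ne_zero 2 hp0) E f (by
        intro g M hM h
        constructor
        · apply Irr.of_smul (k := (p:ℤ)^2)
          rw [← h]
          exact hf.1.sub (by rw [hM]; exact hp0)
        · have := congrArg disc h
          rw [disc_sub, disc_smul, hM, hf.2] at this
          exact (mul_left_cancel₀ (pow_ne_zero 8 hp0) (by linear_combination this)).symm)
      have e : ((ob p f : ℕ) : ℝ≥0∞) = ∑' M : DM p, ∑' g, (if f.sub M.1 = smul ((p:ℤ)^2) g then wt E g else 0) := by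
        rw [this]; unfold ob; push_cast; rfl
      simp only []; rw [e, ← ENNReal.tsum_mul_right, ← ENNReal.tsum_mul_left]
      apply tsum_congr; intro M
      rw [← ENNReal.tsum_mul_right, ← ENNReal.tsum_mul_left]
      apply tsum_congr; intro g
      split_ifs
      · ring
      · simp
    · have : wt ((p:ℤ)^2*E) f = 0 := by unfold wt; rw [if_neg hf]
      simp [this]
  have hR : S E (fun g => omg p g * Φ g) =
      ∑' g, ∑' f, ∑' M : DM p, if g.sub M.1 = smul p f then wt ((p:ℤ)^2*E) f * wt E g * Φ g else 0 := by
    unfold S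
    apply tsum_congr
    intro g
    by_cases hf : g.Irr ∧ g.disc = E
    · rw [ENNReal.tsum_comm]
      have := fiber hp hp0 ((p:ℤ)^2*E) g (by
        intro f M hM h
        constructor
        · apply Irr.of_smul (k := (p:ℤ))
          rw [← h]
          exact hf.1.sub (by rw [hM]; exact hp0)
        · have := congrArg disc h
          rw [disc_sub, disc_smul, hM, hf.2] at this
          exact (mul_left_cancel₀ (pow_ne_zero 4 hp0) (by linear_combination this)).symm)
      have e : ((omg p g : ℕ) : ℝ≥0∞) = ∑' M : DM p, ∑' f, (if g.sub M.1 = smul p f then wt ((p:ℤ)^2*E) f else 0) := by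
        rw [this]; unfold omg; push_cast; rfl
      simp only []; rw [e, ← ENNReal.tsum_mul_right, ← ENNReal.tsum_mul_left]
      apply tsum_congr; intro M
      rw [← ENNReal.tsum_mul_right, ← ENNReal.tsum_mul_left]
      apply tsum_congr; intro f
      split_ifs
      · ring
      · simp
    · have : wt E g = 0 := by unfold wt; rw [if_neg hf]
      simp [this]
  rw [hL, hR, ENNReal.tsum_comm]
  apply tsum_congr; intro g
  apply tsum_congr; intro f
  rw [← (adjE p).tsum_eq (fun M : DM p => if g.sub M.1 = smul p f then wt ((p:ℤ)^2*E) f * wt E g * Φ g else 0)]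
  apply tsum_congr; intro M
  by_cases h : f.sub M.1 = smul ((p:ℤ)^2) g
  · rw [if_pos h, if_pos ((rel_iff hp f g M).1 h), hΦ f g M.1 M.2 h]
  · rw [if_neg h, if_neg (fun h' => h ((rel_iff hp f g M).2 h'))]

theorem r_smul (k a b c d : ℝ) : rD (k*a) (k*b) (k*c) (k*d) = k^4*rD a b c d ∧ rP (k*a) (k*b) (k*c) (k*d) = k^2*rP a b c d
   ∧ rQ (k*a) (k*b) (k*c) (k*d) = k^2*rQ a b c d ∧ rR (k*a) (k*b) (k*c) (k*d) = k^2*rR a b c d := by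
  refine ⟨?_, ?_, ?_, ?_⟩ <;> simp only [rD, rP, rQ, rR] <;> ring

theorem pos_sc {k : ℝ} (hk : 0 < k) (n : ℕ) (x y z : ℝ) (h1 : y = k^n*x) (h2 : z = 0 ∨ z = k^n*0) : 0 < y ↔ 0 < x := by
  rw [h1]; exact mul_pos_iff_of_pos_left (by positivity)

theorem lt_sc {k : ℝ} (hk : 0 < k) (n : ℕ) {x y x' y' : ℝ} (h : y' - x' = k^n*(y-x)) : x' < y' ↔ x < y := by
  rw [← sub_pos, h, mul_pos_iff_of_pos_left (by positivity), sub_pos]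
theorem le_sc {k : ℝ} (hk : 0 < k) (n : ℕ) {x y x' y' : ℝ} (h : y' - x' = k^n*(y-x)) : x' ≤ y' ↔ x ≤ y := by
  rw [← sub_nonneg, h, mul_nonneg_iff_of_pos_left (by positivity), sub_nonneg]

theorem rHi_sc {k : ℝ} (hk : 0 < k) (a b c d : ℝ) : rHi (k*a) (k*b) (k*c) (k*d) ↔ rHi a b c d := by
  unfold rHi
  obtain ⟨h1, h2, -, -⟩ := r_smul k a b c d
  rw [h1, h2]
  apply or_congr (and_congr (lt_sc hk 4 (by ring)) (lt_sc hk 4 (by ring))) (and_congr (lt_sc hk 4 (by ring)) (or_congr (lt_sc hk 2 (by ring)) (lt_sc hk 4 (by ring))))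

theorem rFd_sc {k : ℝ} (hk : 0 < k) (a b c d : ℝ) : rFd (k*a) (k*b) (k*c) (k*d) ↔ rFd a b c d := by
  unfold rFd
  obtain ⟨h1, h2, h3, h4⟩ := r_smul k a b c d
  rw [h1, h2, h3, h4]
  apply or_congr (and_congr (lt_sc hk 4 (by ring)) (and_congr (le_sc hk 2 (by ring)) (and_congr (le_sc hk 2 (by ring)) (le_sc hk 2 (by ring)))))
   (and_congr (lt_sc hk 4 (by ring)) (and_congr (le_sc hk 2 (by ring)) (and_congr (le_sc hk 2 (by ring)) (le_sc hk 2 (by ring)))))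

theorem rFdo_sc {k : ℝ} (hk : 0 < k) (a b c d : ℝ) : rFdo (k*a) (k*b) (k*c) (k*d) ↔ rFdo a b c d := by
  unfold rFdo
  obtain ⟨h1, h2, h3, h4⟩ := r_smul k a b c d
  rw [h1, h2, h3, h4]
  apply or_congr (and_congr (lt_sc hk 4 (by ring)) (and_congr (lt_sc hk 2 (by ring)) (and_congr (lt_sc hk 2 (by ring)) (lt_sc hk 2 (by ring)))))
   (and_congr (lt_sc hk 4 (by ring)) (and_congr (lt_sc hk 2 (by ring)) (and_congr (lt_sc hk 2 (by ring)) (lt_sc hk 2 (by ring)))))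

theorem Hi_smul {k : ℤ} (hk : 0 < k) (f : Form) : (smul k f).Hi ↔ f.Hi := by
  unfold Hi smul; push_cast; exact rHi_sc (by exact_mod_cast hk) _ _ _ _
theorem Fd_smul {k : ℤ} (hk : 0 < k) (f : Form) : (smul k f).Fd ↔ f.Fd := by
  unfold Fd smul; push_cast; exact rFd_sc (by exact_mod_cast hk) _ _ _ _
theorem Fdo_smul {k : ℤ} (hk : 0 < k) (f : Form) : (smul k f).Fdo ↔ f.Fdo := by
  unfold Fdo smul; push_cast; exact rFdo_sc (by exact_mod_cast hk) _ _ _ _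

theorem a_smul {k : ℤ} (hk : 0 < k) (f : Form) : 0 < (smul k f).a ↔ 0 < f.a := mul_pos_iff_of_pos_left hk

theorem Up_smul {k : ℤ} (hk : 0 < k) (f : Form) : smul k f ∈ Up ↔ f ∈ Up := by
  have e : (smul k f).b < 3*(smul k f).a ↔ f.b < 3*f.a := by
    simp only [smul]
    constructor
    · intro h; by_contra h'; nlinarith
    · intro h; nlinarith
  exact and_congr (a_smul hk f) (and_congr (mul_nonneg_iff_of_pos_left hk) (and_congr e (Hi_smul hk f)))
theorem Low_smul {k : ℤ} (hk : 0 < k) (f : Form) : smul k f ∈ Low ↔ f ∈ Low :=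
  and_congr (a_smul hk f) (and_congr (not_congr (Hi_smul hk f)) (Fd_smul hk f))
theorem LowI_smul {k : ℤ} (hk : 0 < k) (f : Form) : smul k f ∈ LowI ↔ f ∈ LowI :=
  and_congr (a_smul hk f) (and_congr (not_congr (Hi_smul hk f)) (Fdo_smul hk f))
theorem Dom_smul {k : ℤ} (hk : 0 < k) (f : Form) : smul k f ∈ Dom ↔ f ∈ Dom := or_congr (Up_smul hk f) (Low_smul hk f)
theorem Bd_smul {k : ℤ} (hk : 0 < k) (f : Form) : smul k f ∈ Bd ↔ f ∈ Bd := and_congr (Low_smul hk f) (not_congr (LowI_smul hk f))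
theorem Red_smul {k : ℤ} (hk : 0 < k) (f : Form) : smul k f ∈ Red ↔ f ∈ Red := and_congr (a_smul hk f) (Fd_smul hk f)

theorem Irr_smul {k : ℤ} (hk : 0 < k) (f : Form) : (smul k f).Irr ↔ f.Irr :=
  ⟨Irr.of_smul, fun h => h.smul hk.ne'⟩

theorem wt_smul {k : ℤ} (hk : 0 < k) (E : ℤ) (f : Form) : wt (k^4*E) (smul k f) = wt E f := by
  unfold wt
  rw [Irr_smul hk, disc_smul]
  have : (k^4*f.disc = k^4*E) ↔ f.disc = E := mul_right_inj' (pow_ne_zero 4 hk.ne')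
  have e : (smul k f).Fw = f.Fw := by
    unfold Fw Nw ind
    simp_rw [smul_sub, Dom_smul hk]
  simp only [this, e]

theorem scale {k : ℤ} (hk : 0 < k) (E : ℤ) (Ψ : Form → ℝ≥0∞) :
    S (k^4*E) (fun f => if ∃ g, f = smul k g then Ψ f else 0) = S E (fun g => Ψ (smul k g)) := by
  unfold S
  rw [← Function.Injective.tsum_eq (g := smul k) (fun f g h => smul_inj hk.ne' h)]
  · apply tsum_congr
    intro g
    rw [wt_smul hk]
    simp only []
    rw [if_pos ⟨g, rfl⟩]
  · intro f hf
    by_contra hc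
    apply hf
    simp only
    rw [if_neg, mul_zero]
    rintro ⟨g, rfl⟩
    exact hc ⟨g, rfl⟩

end Form
end

set_option linter.all false
open scoped Classical
noncomputable section
namespace Form
open scoped ENNReal

theorem exists_smul_iff (n : ℤ) (f : Form) : (∃ g, f = smul n g) ↔ n ∣ f.a ∧ n ∣ f.b ∧ n ∣ f.c ∧ n ∣ f.d := by
  constructor
  · rintro ⟨g, rfl⟩
    exact ⟨⟨_, rfl⟩, ⟨_, rfl⟩, ⟨_, rfl⟩, ⟨_, rfl⟩⟩
  · rintro ⟨⟨a, ha⟩, ⟨b, hb⟩, ⟨c, hc⟩, ⟨d, hd⟩⟩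
    exact ⟨⟨a, b, c, d⟩, by ext <;> simp [smul, *]⟩

theorem omg_none (p : ℕ) (f : Form) : (∃ g, f.sub (Hr p none) = smul p g) ↔ (p:ℤ) ∣ f.a := by
  rw [exists_smul_iff]
  constructor
  · intro h; simpa [sub, Hr] using h.1
  · intro h
    refine ⟨by simpa [sub, Hr] using h, ?_, ?_, ?_⟩
    · exact ⟨f.b, by simp [sub, Hr]; ring⟩
    · exact ⟨f.c*p, by simp [sub, Hr]; ring⟩
    · exact ⟨f.d*p^2, by simp [sub, Hr]; ring⟩

theorem omg_some (p : ℕ) (f : Form) (r : Fin p) : (∃ g, f.sub (Hr p (some r)) = smul p g) ↔ (p:ℤ) ∣ f.ev (r:ℕ) 1 := by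
  rw [exists_smul_iff]
  have e : (f.sub (Hr p (some r))).d = f.ev (r:ℕ) 1 := by simp [sub, Hr, ev]
  rw [e]
  constructor
  · intro h; exact h.2.2.2
  · intro h
    refine ⟨?_, ?_, ?_, h⟩
    · exact ⟨f.a*p^2, by simp [sub, Hr]; ring⟩
    · exact ⟨3*f.a*p*(r:ℕ)+f.b*p, by simp [sub, Hr]; ring⟩
    · exact ⟨3*f.a*(r:ℕ)^2+2*f.b*(r:ℕ)+f.c, by simp [sub, Hr]; ring⟩

theorem ob_none {p : ℕ} (hp : p.Prime) (f : Form) : (∃ g, f.sub (Hr p none) = smul ((p:ℤ)^2) g) ↔ (p:ℤ)^2 ∣ f.a ∧ (p:ℤ) ∣ f.b := by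
  have hp0 : (p:ℤ) ≠ 0 := by exact_mod_cast hp.ne_zero
  rw [exists_smul_iff]
  have eb : (f.sub (Hr p none)).b = p*f.b := by simp [sub, Hr]; ring
  have ea : (f.sub (Hr p none)).a = f.a := by simp [sub, Hr]
  rw [ea, eb]
  constructor
  · rintro ⟨h1, h2, -⟩
    refine ⟨h1, ?_⟩
    rw [pow_two] at h2
    exact (mul_dvd_mul_iff_left hp0).1 h2
  · rintro ⟨h1, h2⟩
    refine ⟨h1, by rw [pow_two]; exact mul_dvd_mul_left _ h2, ?_, ?_⟩
    · exact ⟨f.c, by simp [sub, Hr]; ring⟩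
    · exact ⟨f.d*p, by simp [sub, Hr]; ring⟩

theorem ob_some {p : ℕ} (hp : p.Prime) (f : Form) (r : Fin p) : (∃ g, f.sub (Hr p (some r)) = smul ((p:ℤ)^2) g) ↔
    (p:ℤ)^2 ∣ f.ev (r:ℕ) 1 ∧ (p:ℤ) ∣ 3*f.a*(r:ℕ)^2 + 2*f.b*(r:ℕ) + f.c := by
  have hp0 : (p:ℤ) ≠ 0 := by exact_mod_cast hp.ne_zero
  rw [exists_smul_iff]
  have e : (f.sub (Hr p (some r))).d = f.ev (r:ℕ) 1 := by simp [sub, Hr, ev]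
  have ec : (f.sub (Hr p (some r))).c = p*(3*f.a*(r:ℕ)^2 + 2*f.b*(r:ℕ) + f.c) := by simp [sub, Hr]; ring
  rw [e, ec]
  constructor
  · rintro ⟨-, -, h2, h1⟩
    refine ⟨h1, ?_⟩
    rw [pow_two] at h2
    exact (mul_dvd_mul_iff_left hp0).1 h2
  · rintro ⟨h1, h2⟩
    refine ⟨?_, ?_, by rw [pow_two]; exact mul_dvd_mul_left _ h2, h1⟩
    · exact ⟨f.a*p, by simp [sub, Hr]; ring⟩
    · exact ⟨3*f.a*(r:ℕ)+f.b, by simp [sub, Hr]; ring⟩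

theorem omg_eq (p : ℕ) (f : Form) : omg p f = (if (p:ℤ) ∣ f.a then 1 else 0) + ∑ r : Fin p, if (p:ℤ) ∣ f.ev (r:ℕ) 1 then 1 else 0 := by
  unfold omg
  rw [Fintype.sum_option]
  simp only [omg_none, omg_some]

def nm (p : ℕ) (f : Form) : ℕ := if NM p f then 1 else 0
def lw (p : ℕ) (f : Form) : ℕ := if h : ∃ g, f = smul p g then omg p h.choose else 0
def lf (p : ℕ) (f : Form) : ℕ := if ∃ g, f = smul p g then 1 else 0

theorem ob_smul {p : ℕ} (hp : p.Prime) (g : Form) : ob p (smul p g) = omg p g := by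
  have hp0 : (p:ℤ) ≠ 0 := by exact_mod_cast hp.ne_zero
  unfold ob omg
  apply Finset.sum_congr rfl
  intro i _
  have : (∃ g_1, (smul (p:ℤ) g).sub (Hr p i) = smul ((p:ℤ)^2) g_1) ↔ (∃ g_1, g.sub (Hr p i) = smul (p:ℤ) g_1) := by
    constructor
    · rintro ⟨h, hh⟩
      rw [smul_sub, pow_two, ← smul_smul'] at hh
      exact ⟨h, smul_inj hp0 hh⟩
    · rintro ⟨h, hh⟩
      exact ⟨h, by rw [smul_sub, hh, smul_smul', pow_two]⟩
  simp only [this]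

theorem nm_prim {p : ℕ} (hp : p.Prime) (f : Form) (h : ¬ ∃ g, f = smul p g) : ob p f = nm p f := by
  have hpi := Nat.prime_iff_prime_int.1 hp
  have hp0 : (p:ℤ) ≠ 0 := by exact_mod_cast hp.ne_zero
  rw [exists_smul_iff] at h
  have sd : ∀ {x : ℤ}, (p:ℤ)^2 ∣ x → (p:ℤ) ∣ x := fun h => (dvd_pow_self _ two_ne_zero).trans h
  have key : ∀ i i', (∃ g, f.sub (Hr p i) = smul ((p:ℤ)^2) g) → (∃ g, f.sub (Hr p i') = smul ((p:ℤ)^2) g) → i = i' := by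
    have k1 : ∀ r : Fin p, (∃ g, f.sub (Hr p none) = smul ((p:ℤ)^2) g) → (∃ g, f.sub (Hr p (some r)) = smul ((p:ℤ)^2) g) → False := by
      intro r h1 h2
      rw [ob_none hp] at h1
      rw [ob_some hp] at h2
      apply h
      have ha := sd h1.1
      have hb := h1.2
      have hc : (p:ℤ) ∣ f.c := by
        have := h2.2
        rwa [dvd_add_right] at this
        exact dvd_add ((ha.mul_left 3).mul_right _) ((hb.mul_left 2).mul_right _)
      refine ⟨ha, hb, hc, ?_⟩
      have := sd h2.1
      unfold ev at this
      rw [dvd_add_right] at this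
      · simpa using this
      · exact dvd_add (dvd_add (ha.mul_right _) ((hb.mul_right _).mul_right _)) ((hc.mul_right _).mul_right _)
    rintro (_ | r) (_ | r') h1 h2
    · rfl
    · exact (k1 _ h1 h2).elim
    · exact (k1 _ h2 h1).elim
    · by_contra hne
      rw [ob_some hp] at h1 h2
      apply h
      have hr : ¬ (p:ℤ) ∣ ((r':ℕ):ℤ) - ((r:ℕ):ℤ) := by
        intro hd
        have := Int.eq_zero_of_abs_lt_dvd hd (by rw [abs_lt]; have := r.2; have := r'.2; omega)
        apply hne
        congr 1
        ext; omega
      obtain ⟨h1, h3⟩ := h1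
      obtain ⟨h2, h4⟩ := h2
      replace h1 := sd h1
      replace h2 := sd h2
      unfold ev at h1 h2
      generalize ((r':ℕ):ℤ) = y at *
      generalize ((r:ℕ):ℤ) = x at *
      have ha : (p:ℤ) ∣ f.a := by
        have : (p:ℤ) ∣ (y-x)^3*f.a := by
          have e : (y-x)^3*f.a = (y-x)*((3*f.a*x^2 + 2*f.b*x + f.c) + (3*f.a*y^2 + 2*f.b*y + f.c)) - 2*((f.a * y ^ 3 + f.b * y ^ 2 * 1 + f.c * y * 1 ^ 2 + f.d * 1 ^ 3) - (f.a * x ^ 3 + f.b * x ^ 2 * 1 + f.c * x * 1 ^ 2 + f.d * 1 ^ 3)) := by ring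
          rw [e]
          exact dvd_sub ((dvd_add h3 h4).mul_left _) ((dvd_sub h2 h1).mul_left _)
        exact (hpi.dvd_or_dvd this).resolve_left (fun h' => hr (hpi.dvd_of_dvd_pow h'))
      have hb : (p:ℤ) ∣ f.b := by
        have : (p:ℤ) ∣ (y-x)^2*f.b := by
          have e : (y-x)^2*f.b = ((f.a * y ^ 3 + f.b * y ^ 2 * 1 + f.c * y * 1 ^ 2 + f.d * 1 ^ 3) - (f.a * x ^ 3 + f.b * x ^ 2 * 1 + f.c * x * 1 ^ 2 + f.d * 1 ^ 3)) - (y-x)*(3*f.a*x^2 + 2*f.b*x + f.c) - f.a*((y-x)^2*(y+2*x)) := by ring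
          rw [e]
          exact dvd_sub (dvd_sub (dvd_sub h2 h1) (h3.mul_left _)) (ha.mul_right _)
        exact (hpi.dvd_or_dvd this).resolve_left (fun h' => hr (hpi.dvd_of_dvd_pow h'))
      have hc : (p:ℤ) ∣ f.c := by
        rwa [dvd_add_right] at h3
        exact dvd_add ((ha.mul_left 3).mul_right _) ((hb.mul_left 2).mul_right _)
      refine ⟨ha, hb, hc, ?_⟩
      rw [dvd_add_right] at h1
      · simpa using h1
      · exact dvd_add (dvd_add (ha.mul_right _) ((hb.mul_right _).mul_right _)) ((hc.mul_right _).mul_right _)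
  have ex : NM p f ↔ ∃ i, (∃ g, f.sub (Hr p i) = smul ((p:ℤ)^2) g) := by
    constructor
    · rintro (h1 | h1 | ⟨r, h1, h2⟩)
      · exact (h h1).elim
      · exact ⟨none, (ob_none hp f).2 h1⟩
      · have hpp : (0:ℤ) < p := by exact_mod_cast hp.pos
        have hm := Int.emod_add_mul_ediv r p
        have e : (((r % p).toNat : ℕ) : ℤ) = r % p := Int.toNat_of_nonneg (Int.emod_nonneg r hp0)
        refine ⟨some ⟨(r % p).toNat, ?_⟩, (ob_some hp f _).2 ?_⟩
        · have := Int.emod_nonneg r hp0; have := Int.emod_lt_of_pos r hpp; omega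
        · simp only [e]
          have e2 : r % p = r - p*(r/p) := by linarith
          rw [e2]
          set k := r/(p:ℤ)
          obtain ⟨u, hu⟩ := h1
          obtain ⟨v, hv⟩ := h2
          unfold ev at *
          constructor
          · refine ⟨u - k*v + 3*f.a*r*k^2 + f.b*k^2 - f.a*p*k^3, ?_⟩
            linear_combination hu - p*k*hv
          · refine ⟨v - 6*f.a*r*k + 3*f.a*p*k^2 - 2*f.b*k, ?_⟩
            linear_combination hv
    · rintro ⟨_ | r, hi⟩
      · exact Or.inr (Or.inl ((ob_none hp f).1 hi))
      · exact Or.inr (Or.inr ⟨_, (ob_some hp f r).1 hi⟩)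
  unfold ob nm
  split_ifs with hN
  · obtain ⟨i, hi⟩ := ex.1 hN
    rw [Finset.sum_eq_single i]
    · rw [if_pos hi]
    · intro b _ hb
      rw [if_neg]
      intro h'
      exact hb (key _ _ h' hi)
    · simp
  · apply Finset.sum_eq_zero
    intro i _
    rw [if_neg]
    intro h'
    exact hN (ex.2 ⟨i, h'⟩)

theorem nm_id {p : ℕ} (hp : p.Prime) (f : Form) : nm p f + lw p f = ob p f + lf p f := by
  have hp0 : (p:ℤ) ≠ 0 := by exact_mod_cast hp.ne_zero
  by_cases h : ∃ g, f = smul p g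
  · have hs := h.choose_spec
    have e1 : nm p f = 1 := by
      unfold nm; rw [if_pos]
      exact Or.inl ((exists_smul_iff _ _).1 h)
    have e2 : lf p f = 1 := by unfold lf; rw [if_pos h]
    have e3 : lw p f = omg p h.choose := by unfold lw; rw [dif_pos h]
    have e4 : ob p f = omg p h.choose := by
      conv_lhs => rw [hs]
      exact ob_smul hp _
    omega
  · have e2 : lf p f = 0 := by unfold lf; rw [if_neg h]
    have e3 : lw p f = 0 := by unfold lw; rw [dif_neg h]
    rw [nm_prim hp f h, e2, e3]

theorem lw_smul {p : ℕ} (hp : p.Prime) (g : Form) : lw p (smul p g) = omg p g := by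
  have hp0 : (p:ℤ) ≠ 0 := by exact_mod_cast hp.ne_zero
  have h : ∃ g', smul (p:ℤ) g = smul p g' := ⟨g, rfl⟩
  unfold lw
  rw [dif_pos h, ← smul_inj hp0 h.choose_spec]

end Form
end

set_option linter.all false
open scoped Classical
noncomputable section
namespace Form
open scoped ENNReal

def evZ (p : ℕ) (f : Form) (x y : ZMod p) : ZMod p := (f.a:ZMod p)*x^3 + (f.b:ZMod p)*x^2*y + (f.c:ZMod p)*x*y^2 + (f.d:ZMod p)*y^3

theorem finbij (p : ℕ) (hp : 0 < p) : Function.Bijective (fun r : Fin p => ((r:ℕ):ZMod p)) := by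
  haveI : NeZero p := ⟨hp.ne'⟩
  apply (Fintype.bijective_iff_injective_and_card _).2
  constructor
  · intro a b h
    have := congrArg ZMod.val h
    simp only [ZMod.val_natCast_of_lt a.2, ZMod.val_natCast_of_lt b.2] at this
    exact Fin.ext this
  · simp [ZMod.card]

theorem zc {p : ℕ} (hp : p.Prime) (f : Form) [NeZero p] :
    (∑ y : ZMod p, ∑ x : ZMod p, if evZ p f x y = 0 then 1 else 0) = 1 + (p-1) * omg p f := by
  haveI := Fact.mk hp
  have h1 : ∀ y : ZMod p, y ≠ 0 → (∑ x : ZMod p, if evZ p f x y = 0 then 1 else 0) = ∑ r : Fin p, if (p:ℤ) ∣ f.ev (r:ℕ) 1 then 1 else 0 := by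
    intro y hy
    rw [Fintype.sum_bijective _ (finbij p hp.pos) _ (fun r : ZMod p => if evZ p f r 1 = 0 then 1 else 0)]
    · rw [← Fintype.sum_equiv (Equiv.mulRight₀ y hy) (fun r => if evZ p f ((Equiv.mulRight₀ y hy) r) y = 0 then 1 else 0) _ (fun _ => rfl)]
      apply Finset.sum_congr rfl
      intro r _
      have : evZ p f ((Equiv.mulRight₀ y hy) r) y = y^3 * evZ p f r 1 := by
        simp [evZ]; ring
      rw [this]
      simp [hy]
    · intro r
      have : (p:ℤ) ∣ f.ev (r:ℕ) 1 ↔ evZ p f ((r:ℕ):ZMod p) 1 = 0 := by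
        rw [← ZMod.intCast_zmod_eq_zero_iff_dvd]
        simp [ev, evZ]
      simp only [this]
  have h0 : (∑ x : ZMod p, if evZ p f x 0 = 0 then 1 else 0) = 1 + (p-1) * (if (p:ℤ) ∣ f.a then 1 else 0) := by
    have e : ∀ x, evZ p f x 0 = (f.a : ZMod p)*x^3 := fun x => by simp [evZ]
    simp only [e]
    split_ifs with ha
    · rw [← ZMod.intCast_zmod_eq_zero_iff_dvd] at ha
      simp [ha, ZMod.card]
      have := hp.pos; omega
    · rw [← ZMod.intCast_zmod_eq_zero_iff_dvd] at ha
      simp [ha]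
  rw [← Finset.add_sum_erase _ _ (Finset.mem_univ (0:ZMod p)), h0,
    Finset.sum_congr rfl (fun y hy => h1 y (Finset.ne_of_mem_erase hy)), Finset.sum_const, omg_eq]
  simp [ZMod.card]
  split_ifs <;> ring

theorem omg_of_zc {p : ℕ} (hp : p.Prime) [NeZero p] (f g : Form) (h : (∑ y : ZMod p, ∑ x : ZMod p, if evZ p f x y = 0 then 1 else 0) = (∑ y : ZMod p, ∑ x : ZMod p, if evZ p g x y = 0 then 1 else 0)) : omg p f = omg p g := by
  rw [zc hp, zc hp] at h
  have := hp.two_le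
  have h' : (p-1)*omg p f = (p-1)*omg p g := by omega
  exact Nat.eq_of_mul_eq_mul_left (by omega) h'

theorem omg_smul {p : ℕ} (hp : p.Prime) {k : ℤ} (hk : ¬ (p:ℤ) ∣ k) (f : Form) : omg p (smul k f) = omg p f := by
  have hpi := Nat.prime_iff_prime_int.1 hp
  rw [omg_eq, omg_eq]
  simp only [ev_smul]
  have : ∀ x, (p:ℤ) ∣ k*x ↔ (p:ℤ) ∣ x := fun x => ⟨fun h => (hpi.dvd_or_dvd h).resolve_left hk, fun h => h.mul_left k⟩
  simp only [this, smul]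

theorem omg_sub {p : ℕ} (hp : p.Prime) {M : Mat} (hM : ¬ (p:ℤ) ∣ M.det) (f : Form) : omg p (f.sub M) = omg p f := by
  haveI := Fact.mk hp
  haveI : NeZero p := ⟨hp.ne_zero⟩
  apply omg_of_zc hp
  rw [← Fintype.sum_prod_type', ← Fintype.sum_prod_type']
  have hd : ((M.det : ℤ) : ZMod p) ≠ 0 := by rwa [Ne, ZMod.intCast_zmod_eq_zero_iff_dvd]
  rw [Matrix.det_fin_two] at hd
  push_cast at hd
  have hb : Function.Bijective (fun v : ZMod p × ZMod p => ((M 1 0 : ZMod p)*v.2 + (M 1 1 : ZMod p)*v.1, (M 0 0 : ZMod p)*v.2 + (M 0 1 : ZMod p)*v.1)) := by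
    rw [← Finite.injective_iff_bijective]
    rintro ⟨y, x⟩ ⟨y', x'⟩ h
    simp only [Prod.mk.injEq] at h ⊢
    obtain ⟨h1, h2⟩ := h
    constructor
    · apply mul_left_cancel₀ hd
      linear_combination (M 0 0 : ZMod p) * h1 - (M 1 0 : ZMod p)*h2
    · apply mul_left_cancel₀ hd
      linear_combination -(M 0 1 : ZMod p) * h1 + (M 1 1 : ZMod p)*h2
  apply Fintype.sum_bijective _ hb
  rintro ⟨y, x⟩
  have : evZ p (f.sub M) x y = evZ p f ((M 0 0 : ZMod p)*x + (M 0 1 : ZMod p)*y) ((M 1 0 : ZMod p)*x + (M 1 1 : ZMod p)*y) := by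
    simp only [evZ, sub]; push_cast; ring
  simp only [this]

theorem NM'_smul {p : ℕ} (hp : p.Prime) {k : ℤ} (hk : ¬ (p:ℤ) ∣ k) (f : Form) : NM' p (smul k f) ↔ NM' p f := by
  have hpi := Nat.prime_iff_prime_int.1 hp
  have h1 : ∀ x, (p:ℤ) ∣ k*x ↔ (p:ℤ) ∣ x := fun x => ⟨fun h => (hpi.dvd_or_dvd h).resolve_left hk, fun h => h.mul_left k⟩
  have h2 : ∀ x, (p:ℤ)^2 ∣ k*x ↔ (p:ℤ)^2 ∣ x := fun x =>
    ⟨fun h => (IsCoprime.pow_left ((Prime.coprime_iff_not_dvd hpi).2 hk)).dvd_of_dvd_mul_left h, fun h => h.mul_left k⟩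
  unfold NM'
  simp only [ev_smul, h2]
  simp only [smul, h1]
  have e1 : ∀ u v : ℤ, 3*(k*f.a)*u^2+2*(k*f.b)*u*v+k*f.c*v^2 = k*(3*f.a*u^2+2*f.b*u*v+f.c*v^2) := fun u v => by ring
  have e2 : ∀ u v : ℤ, (k*f.b)*u^2+2*(k*f.c)*u*v+3*(k*f.d)*v^2 = k*(f.b*u^2+2*f.c*u*v+3*f.d*v^2) := fun u v => by ring
  simp only [e1, e2, h1]

theorem nm_smul {p : ℕ} (hp : p.Prime) {k : ℤ} (hk : ¬ (p:ℤ) ∣ k) (f : Form) : nm p (smul k f) = nm p f := by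
  unfold nm; simp only [nm_iff hp, NM'_smul hp hk]

theorem nm_sub {p : ℕ} (hp : p.Prime) {M : Mat} (hM : ¬ (p:ℤ) ∣ M.det) (f : Form) : nm p (f.sub M) = nm p f := by
  have hpi := Nat.prime_iff_prime_int.1 hp
  have : NM p (f.sub M) ↔ NM p f := by
    rw [nm_iff hp, nm_iff hp]
    constructor
    · exact NM'.of_sub hp hM
    · intro h
      apply NM'.of_sub (M := M.adjugate) hp
      · rw [Matrix.det_adjugate]; simpa using hM
      · rw [sub_adj, NM'_smul hp]
        · exact h
        · intro h'; exact hM (hpi.dvd_of_dvd_pow h')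
  unfold nm; simp only [this]

/-- weight attached to two disjoint sets of primes -/
def Th (s j : Finset ℕ) (f : Form) : ℝ≥0∞ := ((∏ p ∈ s, nm p f : ℕ) : ℝ≥0∞) * ((∏ p ∈ j, omg p f : ℕ) : ℝ≥0∞)

theorem Th_inv {q : ℕ} (hq : q.Prime) {s j : Finset ℕ} (hs : ∀ p ∈ s, p.Prime) (hj : ∀ p ∈ j, p.Prime) (hqs : q ∉ s) (hqj : q ∉ j)
    (f : Form) : (∀ M : Mat, M.det = q → Th s j (f.sub M) = Th s j f) ∧ (∀ n : ℕ, Th s j (smul ((q:ℤ)^n) f) = Th s j f) := by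
  have h : ∀ p, p.Prime → p ≠ q → ¬ (p:ℤ) ∣ q := by
    intro p hp hne hd
    exact hne ((Nat.prime_dvd_prime_iff_eq hp hq).1 (by exact_mod_cast hd))
  have h' : ∀ p, p.Prime → p ≠ q → ∀ n : ℕ, ¬ (p:ℤ) ∣ (q:ℤ)^n := by
    intro p hp hne n hd
    exact h p hp hne ((Nat.prime_iff_prime_int.1 hp).dvd_of_dvd_pow hd)
  have n1 : ∀ p ∈ s, p ≠ q := fun p hp he => hqs (he ▸ hp)
  have n2 : ∀ p ∈ j, p ≠ q := fun p hp he => hqj (he ▸ hp)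
  constructor
  · intro M hM
    unfold Th
    rw [Finset.prod_congr rfl (fun p hp => nm_sub (hs p hp) (by rw [hM]; exact h p (hs p hp) (n1 p hp)) f),
      Finset.prod_congr rfl (fun p hp => omg_sub (hj p hp) (by rw [hM]; exact h p (hj p hp) (n2 p hp)) f)]
  · intro n
    unfold Th
    rw [Finset.prod_congr rfl (fun p hp => nm_smul (hs p hp) (h' p (hs p hp) (n1 p hp) n) f),
      Finset.prod_congr rfl (fun p hp => omg_smul (hj p hp) (h' p (hj p hp) (n2 p hp) n) f)]

theorem S_add (D : ℤ) (φ ψ : Form → ℝ≥0∞) : S D (fun f => φ f + ψ f) = S D φ + S D ψ := by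
  unfold S
  simp_rw [mul_add]
  exact ENNReal.tsum_add

theorem S_zero {D : ℤ} {φ : Form → ℝ≥0∞} (h : ∀ f, f.disc = D → φ f = 0) : S D φ = 0 := by
  unfold S
  rw [ENNReal.tsum_eq_zero]
  intro f
  unfold wt
  split_ifs with hh
  · rw [h f hh.2, mul_zero]
  · simp

theorem ob_disc {p : ℕ} (hp : p.Prime) {f : Form} (h : ob p f ≠ 0) : (p:ℤ)^2 ∣ f.disc := by
  have hp0 : (p:ℤ) ≠ 0 := by exact_mod_cast hp.ne_zero
  unfold ob at h
  obtain ⟨i, -, hi⟩ := Finset.exists_ne_zero_of_sum_ne_zero h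
  have hi' : ∃ g, f.sub (Hr p i) = smul ((p:ℤ)^2) g := by
    by_contra hc; exact hi (if_neg hc)
  obtain ⟨g, hg⟩ := hi'
  have := congrArg disc hg
  rw [disc_sub, disc_smul, Hr_det] at this
  exact ⟨g.disc, mul_left_cancel₀ (pow_ne_zero 6 hp0) (by linear_combination this)⟩

theorem rec_S {p : ℕ} (hp : p.Prime) {s j : Finset ℕ} (hs : ∀ p ∈ s, p.Prime) (hj : ∀ p ∈ j, p.Prime) (hqs : p ∉ s) (hqj : p ∉ j) (D : ℤ) :
    S D (Th (insert p s) j) + (if (p:ℤ)^4 ∣ D then S (D/(p:ℤ)^4) (Th s (insert p j)) else 0) =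
    (if (p:ℤ)^2 ∣ D then S (D/(p:ℤ)^2) (Th s (insert p j)) else 0) + (if (p:ℤ)^4 ∣ D then S (D/(p:ℤ)^4) (Th s j) else 0) := by
  have hp0 : (p:ℤ) ≠ 0 := by exact_mod_cast hp.ne_zero
  have hpp : (0:ℤ) < p := by exact_mod_cast hp.pos
  have e1 : ∀ f, Th (insert p s) j f = nm p f * Th s j f := by
    intro f; unfold Th; rw [Finset.prod_insert hqs]; push_cast; ring
  have e2 : ∀ f, Th s (insert p j) f = omg p f * Th s j f := by
    intro f; unfold Th; rw [Finset.prod_insert hqj]; push_cast; ring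
  have e3 : S D (fun f => lf p f * Th s j f) = (if (p:ℤ)^4 ∣ D then S (D/(p:ℤ)^4) (Th s j) else 0) := by
    split_ifs with hd
    · obtain ⟨E, rfl⟩ := hd
      rw [Int.mul_ediv_cancel_left _ (pow_ne_zero 4 hp0)]
      have := scale hpp E (Th s j)
      have t : (fun g => Th s j (smul p g)) = Th s j := by
        funext g
        have := (Th_inv hp hs hj hqs hqj g).2 1
        rwa [pow_one] at this
      rw [t] at this
      rw [← this]
      congr 1
      funext f
      unfold lf
      split_ifs <;> simp
    · apply S_zero
      intro f hf
      have : lf p f = 0 := by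
        unfold lf; rw [if_neg]
        rintro ⟨g, rfl⟩
        rw [disc_smul] at hf
        exact hd ⟨_, hf.symm⟩
      rw [this]; simp
  have e4 : S D (fun f => lw p f * Th s j f) = (if (p:ℤ)^4 ∣ D then S (D/(p:ℤ)^4) (Th s (insert p j)) else 0) := by
    split_ifs with hd
    · obtain ⟨E, rfl⟩ := hd
      rw [Int.mul_ediv_cancel_left _ (pow_ne_zero 4 hp0)]
      have := scale hpp E (fun f => lw p f * Th s j f)
      have t : (fun g => (lw p (smul p g) : ℝ≥0∞) * Th s j (smul p g)) = Th s (insert p j) := by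
        funext g
        have := (Th_inv hp hs hj hqs hqj g).2 1
        rw [pow_one] at this
        rw [this, e2, lw_smul hp]
      rw [t] at this
      rw [← this]
      congr 1
      funext f
      split_ifs with h
      · rfl
      · unfold lw; rw [dif_neg h]; simp
    · apply S_zero
      intro f hf
      have : lw p f = 0 := by
        unfold lw; rw [dif_neg]
        rintro ⟨g, rfl⟩
        rw [disc_smul] at hf
        exact hd ⟨_, hf.symm⟩
      rw [this]; simp
  have e5 : S D (fun f => ob p f * Th s j f) = (if (p:ℤ)^2 ∣ D then S (D/(p:ℤ)^2) (Th s (insert p j)) else 0) := by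
    split_ifs with hd
    · obtain ⟨E, rfl⟩ := hd
      rw [Int.mul_ediv_cancel_left _ (pow_ne_zero 2 hp0)]
      rw [unfold hp E (Th s j)]
      · congr 1; funext f; rw [e2]
      · intro f g M hM h
        rw [← (Th_inv hp hs hj hqs hqj f).1 M hM, h, (Th_inv hp hs hj hqs hqj g).2 2]
    · apply S_zero
      intro f hf
      have : ob p f = 0 := by
        by_contra hc
        have := ob_disc hp hc
        rw [hf] at this
        exact hd this
      rw [this]; simp
  rw [← e3, ← e4, ← e5, ← S_add, ← S_add]
  congr 1
  funext f
  rw [e1, ← add_mul, ← add_mul]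
  congr 1
  exact_mod_cast nm_id hp f

end Form
end

set_option linter.all false
open scoped Classical
noncomputable section
namespace Form
open scoped ENNReal

theorem S_le_red (D : ℤ) (φ : Form → ℝ≥0∞) (hφ : ∀ f (γ : SL), φ (f.sub γ.1) = φ f) :
    S D φ ≤ ∑' f, if f ∈ Red ∧ f.Irr ∧ f.disc = D then φ f else 0 := by
  have hinv : ∀ γ : SL, Function.Bijective (fun f : Form => f.sub γ.1) := by
    intro γ
    refine Function.bijective_iff_has_inverse.2 ⟨fun f => f.sub (γ⁻¹).1, ?_, ?_⟩
    · intro f; simp only []; rw [sub_mulSL, mul_inv_cancel]; simp [sub_one]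
    · intro f; simp only []; rw [sub_mulSL, inv_mul_cancel]; simp [sub_one]
  calc S D φ ≤ ∑' f, ∑' γ : SL, wt D f * (if f.sub γ.1 ∈ Red then φ f else 0) := by
        unfold S
        apply ENNReal.tsum_le_tsum
        intro f
        by_cases hf : f.Irr ∧ f.disc = D
        · obtain ⟨γ, hγ⟩ := L1R hf.1
          calc wt D f * φ f = wt D f * (if f.sub γ.1 ∈ Red then φ f else 0) := by rw [if_pos hγ]
            _ ≤ _ := ENNReal.le_tsum (f := fun γ : SL => wt D f * (if f.sub γ.1 ∈ Red then φ f else 0)) γ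
        · have : wt D f = 0 := by unfold wt; rw [if_neg hf]
          simp [this]
    _ = ∑' γ : SL, ∑' f, wt D f * (if f.sub γ.1 ∈ Red then φ f else 0) := ENNReal.tsum_comm
    _ = ∑' γ : SL, ∑' f, wt D (f.sub (γ⁻¹).1) * (if f ∈ Red then φ f else 0) := by
        apply tsum_congr
        intro γ
        rw [← (Equiv.ofBijective _ (hinv γ)).tsum_eq (fun f => wt D (f.sub (γ⁻¹).1) * (if f ∈ Red then φ f else 0))]
        apply tsum_congr
        intro f
        simp only [Equiv.ofBijective_apply]
        rw [sub_mulSL, mul_inv_cancel, hφ]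
        simp [sub_one]
    _ = ∑' f, ∑' γ : SL, wt D (f.sub γ.1) * (if f ∈ Red then φ f else 0) := by
        rw [← (Equiv.inv SL).tsum_eq]
        simp only [Equiv.inv_apply, inv_inv]
        exact ENNReal.tsum_comm
    _ ≤ _ := by
        apply ENNReal.tsum_le_tsum
        intro f
        rw [ENNReal.tsum_mul_right, wt_sum]
        by_cases h1 : f.Irr ∧ f.disc = D <;> by_cases h2 : f ∈ Red <;> simp [h1, h2]

theorem omg_SL {p : ℕ} (hp : p.Prime) (f : Form) (γ : SL) : omg p (f.sub γ.1) = omg p f :=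
  omg_sub hp (by rw [γ.2]; exact (Nat.prime_iff_prime_int.1 hp).not_dvd_one) f

/-- number of roots bound -/
theorem omg_le_three {p : ℕ} (hp : p.Prime) (f : Form) (h : ¬ ∃ g, f = smul p g) : omg p f ≤ 3 := by
  haveI := Fact.mk hp
  haveI : NeZero p := ⟨hp.ne_zero⟩
  rw [exists_smul_iff] at h
  rw [omg_eq]
  open Polynomial in
  have key : ∀ q : (ZMod p)[X], q ≠ 0 → (∀ x, q.eval x = evZ p f x 1) → (∑ r : Fin p, if (p:ℤ) ∣ f.ev (r:ℕ) 1 then 1 else 0) ≤ q.natDegree := by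
    intro q hq he
    rw [Fintype.sum_bijective _ (finbij p hp.pos) _ (fun r : ZMod p => if evZ p f r 1 = 0 then 1 else 0)]
    · rw [Finset.sum_boole]
      have : (Finset.univ.filter (fun r : ZMod p => evZ p f r 1 = 0)) ⊆ q.roots.toFinset := by
        intro r hr
        simp only [Finset.mem_filter] at hr
        simp [hq, he, hr.2]
      calc _ ≤ q.roots.toFinset.card := by simpa using Finset.card_le_card this
        _ ≤ _ := (Multiset.toFinset_card_le _).trans (card_roots' q)
    · intro r
      have : (p:ℤ) ∣ f.ev (r:ℕ) 1 ↔ evZ p f ((r:ℕ):ZMod p) 1 = 0 := by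
        rw [← ZMod.intCast_zmod_eq_zero_iff_dvd]
        simp [ev, evZ]
      simp only [this]
  simp only [← ZMod.intCast_zmod_eq_zero_iff_dvd _ p] at h
  open Polynomial in
  by_cases ha : (p:ℤ) ∣ f.a
  · have ha' := ha
    rw [← ZMod.intCast_zmod_eq_zero_iff_dvd] at ha'
    have := key (C (f.b:ZMod p) * X^2 + C (f.c:ZMod p) * X + C (f.d : ZMod p)) (by
      intro h0
      apply h
      have h2 := congrArg (fun q => q.coeff 2) h0
      have h1 := congrArg (fun q => q.coeff 1) h0
      have h3 := congrArg (fun q => q.coeff 0) h0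
      simp only [coeff_add, coeff_C_mul, coeff_X_pow, coeff_X, coeff_C, coeff_zero] at h1 h2 h3
      norm_num at h1 h2 h3
      exact ⟨ha', h2, h1, h3⟩) (by intro x; simp [evZ, ha'])
    have := this.trans natDegree_quadratic_le
    rw [if_pos ha]; omega
  · have := key (C (f.a:ZMod p) * X^3 + C (f.b:ZMod p) * X^2 + C (f.c:ZMod p) * X + C (f.d : ZMod p)) (by
      intro h0
      apply ha
      have h2 := congrArg (fun q => q.coeff 3) h0
      simp only [coeff_add, coeff_C_mul, coeff_X_pow, coeff_X, coeff_C, coeff_zero] at h2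
      norm_num at h2
      rwa [← ZMod.intCast_zmod_eq_zero_iff_dvd]) (by intro x; simp [evZ])
    have := this.trans natDegree_cubic_le
    rw [if_neg ha]; omega

theorem omg_le {p : ℕ} (hp : p.Prime) (f : Form) : omg p f ≤ 3 * (if ∃ g, f = smul p g then p else 1) := by
  split_ifs with h
  · have : omg p f ≤ p + 1 := by
      unfold omg
      calc _ ≤ ∑ i : Option (Fin p), 1 := Finset.sum_le_sum (fun i _ => by split_ifs <;> simp)
        _ = _ := by simp
    have := hp.two_le
    omega
  · have := omg_le_three hp f h; omega

def thn (j : Finset ℕ) (f : Form) : ℕ := ∏ p ∈ j, omg p f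

theorem thn_SL {j : Finset ℕ} (hj : ∀ p ∈ j, p.Prime) (f : Form) (γ : SL) : thn j (f.sub γ.1) = thn j f :=
  Finset.prod_congr rfl (fun p hp => omg_SL (hj p hp) f γ)

theorem thn_le {j : Finset ℕ} (hj : ∀ p ∈ j, p.Prime) (f : Form) :
    thn j f ≤ 3^j.card * ∑ e ∈ j.powerset, (if ∃ g, f = smul ((∏ p ∈ e, p : ℕ):ℤ) g then ∏ p ∈ e, p else 0) := by
  set e0 := j.filter (fun p : ℕ => ∃ g, f = smul (p:ℤ) g) with he0
  have h1 : thn j f ≤ 3^j.card * ∏ p ∈ e0, p := by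
    unfold thn
    calc _ ≤ ∏ p ∈ j, 3 * (if ∃ g, f = smul (p:ℤ) g then p else 1) := Finset.prod_le_prod' (fun p hp => omg_le (hj p hp) f)
      _ = _ := by rw [Finset.prod_mul_distrib, Finset.prod_const, he0, Finset.prod_filter]
  have h2 : ∃ g, f = smul ((∏ p ∈ e0, p : ℕ):ℤ) g := by
    rw [exists_smul_iff]
    have : ∀ x : ℤ, (∀ p ∈ e0, (p:ℤ) ∣ x) → ((∏ p ∈ e0, p : ℕ):ℤ) ∣ x := by
      intro x hx
      push_cast
      apply Finset.prod_dvd_of_coprime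
      · intro p hp q hq hne
        have hp' := hj p (Finset.mem_filter.1 hp).1
        have hq' := hj q (Finset.mem_filter.1 hq).1
        exact Nat.isCoprime_iff_coprime.2 ((Nat.coprime_primes hp' hq').2 hne)
      · exact hx
    have h3 : ∀ p ∈ e0, (p:ℤ) ∣ f.a ∧ (p:ℤ) ∣ f.b ∧ (p:ℤ) ∣ f.c ∧ (p:ℤ) ∣ f.d := fun p hp => (exists_smul_iff _ _).1 (Finset.mem_filter.1 hp).2
    exact ⟨this _ (fun p hp => (h3 p hp).1), this _ (fun p hp => (h3 p hp).2.1), this _ (fun p hp => (h3 p hp).2.2.1), this _ (fun p hp => (h3 p hp).2.2.2)⟩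
  refine h1.trans (Nat.mul_le_mul_left _ ?_)
  have hm : e0 ∈ j.powerset := Finset.mem_powerset.2 (Finset.filter_subset _ _)
  have := Finset.single_le_sum (f := fun e => (if ∃ g, f = smul ((∏ p ∈ e, p : ℕ):ℤ) g then ∏ p ∈ e, p else 0)) (fun _ _ => Nat.zero_le _) hm
  rwa [if_pos h2] at this

/-- weighted count from plain count, for scale-invariant families -/
theorem weighted {A : Set Form} (hsc : ∀ k : ℤ, 0 < k → ∀ f, smul k f ∈ A → f ∈ A)
    (hfin : ∀ Y : ℝ, {f | f ∈ A ∧ |(f.disc:ℝ)| < Y}.Finite) {C β : ℝ} (hC : 0 ≤ C) (hβ : 1/4 ≤ β)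
    (hcnt : ∀ Y : ℝ, 0 < Y → ({f | f ∈ A ∧ |(f.disc:ℝ)| < Y}.ncard : ℝ) ≤ C * Y^β)
    {j : Finset ℕ} (hj : ∀ p ∈ j, p.Prime) (Y : ℝ) (hY : 0 < Y) :
    ∑ f ∈ (hfin Y).toFinset, (thn j f : ℝ) ≤ 6^j.card * C * Y^β := by
  have h1 : ∀ e ∈ j.powerset, (∑ f ∈ (hfin Y).toFinset, ((if ∃ g, f = smul ((∏ p ∈ e, p : ℕ):ℤ) g then ∏ p ∈ e, p else 0 : ℕ) : ℝ)) ≤ C*Y^β := by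
    intro e he
    set E := ∏ p ∈ e, p with hE
    have hEpos : 0 < E := Finset.prod_pos (fun p hp => (hj p (Finset.mem_powerset.1 he hp)).pos)
    have hEz : (0:ℤ) < E := by exact_mod_cast hEpos
    have hER : (1:ℝ) ≤ E := by exact_mod_cast hEpos
    have : (((hfin Y).toFinset.filter (fun f => ∃ g, f = smul (E:ℤ) g)).card : ℝ) ≤ C*(Y/(E:ℝ)^4)^β := by
      refine le_trans ?_ (hcnt _ (by positivity))
      rw [← Set.ncard_coe_finset]
      have hsub : (↑((hfin Y).toFinset.filter (fun f => ∃ g, f = smul (E:ℤ) g)) : Set Form) ⊆ (smul (E:ℤ)) '' {f | f ∈ A ∧ |(f.disc:ℝ)| < Y/(E:ℝ)^4} := by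
        intro f hf
        simp only [Finset.coe_filter, Set.Finite.mem_toFinset, Set.mem_setOf_eq] at hf
        obtain ⟨⟨hA, hd⟩, g, rfl⟩ := hf
        refine ⟨g, ⟨hsc _ hEz g hA, ?_⟩, rfl⟩
        rw [lt_div_iff₀ (by positivity)]
        rw [disc_smul] at hd
        push_cast at hd
        rw [abs_mul, abs_of_nonneg (by positivity : (0:ℝ) ≤ (E:ℝ)^4)] at hd
        linarith
      exact_mod_cast (Set.ncard_le_ncard hsub ((hfin _).image _)).trans (Set.ncard_image_le (hfin _))
    calc _ = (((hfin Y).toFinset.filter (fun f => ∃ g, f = smul (E:ℤ) g)).card : ℝ) * E := by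
          rw [Finset.card_eq_sum_ones, Finset.sum_filter]
          push_cast
          rw [Finset.sum_mul]
          apply Finset.sum_congr rfl
          intro f _
          split_ifs <;> simp
      _ ≤ C*(Y/(E:ℝ)^4)^β * E := by gcongr
      _ ≤ C*Y^β := by
          rw [Real.div_rpow hY.le (by positivity), mul_assoc]
          apply mul_le_mul_of_nonneg_left _ hC
          rw [div_mul_eq_mul_div, div_le_iff₀ (by positivity)]
          apply mul_le_mul_of_nonneg_left _ (by positivity)
          rw [← Real.rpow_natCast, ← Real.rpow_mul (by positivity)]
          calc (E:ℝ) = (E:ℝ)^(1:ℝ) := by simp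
            _ ≤ _ := Real.rpow_le_rpow_of_exponent_le hER (by push_cast; linarith)
  calc ∑ f ∈ (hfin Y).toFinset, (thn j f : ℝ) ≤ ∑ f ∈ (hfin Y).toFinset, (3:ℝ)^j.card * ∑ e ∈ j.powerset, ((if ∃ g, f = smul ((∏ p ∈ e, p : ℕ):ℤ) g then ∏ p ∈ e, p else 0 : ℕ) : ℝ) := by
        apply Finset.sum_le_sum
        intro f _
        exact_mod_cast thn_le hj f
    _ = (3:ℝ)^j.card * ∑ e ∈ j.powerset, ∑ f ∈ (hfin Y).toFinset, ((if ∃ g, f = smul ((∏ p ∈ e, p : ℕ):ℤ) g then ∏ p ∈ e, p else 0 : ℕ) : ℝ) := by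
        rw [← Finset.mul_sum, Finset.sum_comm]
    _ ≤ (3:ℝ)^j.card * ∑ e ∈ j.powerset, C*Y^β := by
        gcongr with e he
        exact h1 e he
    _ = 6^j.card * C * Y^β := by
        rw [Finset.sum_const, Finset.card_powerset, show (6:ℝ) = 3*2 by norm_num, mul_pow]
        simp; ring

end Form
end

set_option linter.all false
open scoped Classical
noncomputable section
namespace Form

/-- `A ⊆ ℝ` has at most `V` break points. -/
def BP (V : ℕ) (A : Set ℝ) : Prop :=
  ∃ E : Finset ℝ, E.card ≤ V ∧ ∀ p q : ℝ, p ≤ q → (∀ e ∈ E, e ∉ Set.Icc p q) → (p ∈ A ↔ q ∈ A)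

theorem BP.compl {V : ℕ} {A : Set ℝ} (h : BP V A) : BP V {t | ¬ t ∈ A} := by
  obtain ⟨E, h1, h2⟩ := h
  exact ⟨E, h1, fun p q hpq he => not_congr (h2 p q hpq he)⟩

theorem BP.inter {V W : ℕ} {A B : Set ℝ} (h : BP V A) (h' : BP W B) : BP (V+W) {t | t ∈ A ∧ t ∈ B} := by
  obtain ⟨E, h1, h2⟩ := h
  obtain ⟨F, h3, h4⟩ := h'
  refine ⟨E ∪ F, (Finset.card_union_le _ _).trans (by omega), fun p q hpq he => and_congr (h2 p q hpq ?_) (h4 p q hpq ?_)⟩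
  · intro e h; exact he e (Finset.mem_union_left _ h)
  · intro e h; exact he e (Finset.mem_union_right _ h)

theorem BP.poly (q : Polynomial ℝ) {V : ℕ} (h : q.natDegree ≤ V) : BP V {t | 0 < q.eval t} := by
  by_cases hq : q = 0
  · subst hq
    exact ⟨∅, by simp, by simp⟩
  refine ⟨q.roots.toFinset, (Multiset.toFinset_card_le _).trans ((Polynomial.card_roots' q).trans h), ?_⟩
  intro a b hab he
  have hc : ContinuousOn (fun t => q.eval t) (Set.Icc a b) := q.continuous.continuousOn
  have hno : ∀ t ∈ Set.Icc a b, q.eval t ≠ 0 := by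
    intro t ht h0
    exact he t (by simp [hq, h0]) ht
  simp only [Set.mem_setOf_eq]
  constructor
  · intro h0
    by_contra h1
    obtain ⟨t, ht, h2⟩ := intermediate_value_Icc' hab hc ⟨not_lt.1 h1, h0.le⟩
    exact hno t ht h2
  · intro h0
    by_contra h1
    obtain ⟨t, ht, h2⟩ := intermediate_value_Icc hab hc ⟨not_lt.1 h1, h0.le⟩
    exact hno t ht h2

theorem fin_shift {A : Set ℝ} {α β : ℝ} (hA : A ⊆ Set.Icc α β) (x : ℝ) : {n : ℤ | x + n ∈ A}.Finite := by
  apply (Set.finite_Icc ⌊α - x⌋ ⌈β - x⌉).subset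
  intro n hn
  have := hA hn
  constructor
  · have h : (⌊α - x⌋:ℝ) ≤ n := (Int.floor_le _).trans (by linarith [this.1])
    exact_mod_cast h
  · have h : (n:ℝ) ≤ ⌈β - x⌉ := le_trans (by linarith [this.2]) (Int.le_ceil _)
    exact_mod_cast h

theorem cnt1 {V : ℕ} {A : Set ℝ} (h : BP V A) {α β : ℝ} (hA : A ⊆ Set.Icc α β) (x y : ℝ) :
    |({n : ℤ | x + n ∈ A}.ncard : ℝ) - ({n : ℤ | y + n ∈ A}.ncard : ℝ)| ≤ V := by
  obtain ⟨E, hE, h2⟩ := h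
  set y' := y - ⌊y - x⌋ with hy'
  have hy1 : x ≤ y' := by have := Int.floor_le (y-x); linarith
  have hy2 : y' < x + 1 := by have := Int.lt_floor_add_one (y-x); linarith
  have hyy : {n : ℤ | y + n ∈ A}.ncard = {n : ℤ | y' + n ∈ A}.ncard := by
    have : {n : ℤ | y' + n ∈ A} = (fun n => n + ⌊y-x⌋) '' {n : ℤ | y + n ∈ A} := by
      ext n
      simp only [Set.mem_setOf_eq, Set.mem_image]
      constructor
      · intro h
        refine ⟨n - ⌊y-x⌋, ?_, by ring⟩
        push_cast
        convert h using 1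
        rw [hy']; ring
      · rintro ⟨k, hk, rfl⟩
        push_cast
        convert hk using 1
        rw [hy']; ring
    rw [this, Set.ncard_image_of_injective _ (add_left_injective _)]
  rw [hyy]
  have hbad : ∀ n : ℤ, ¬ (x + n ∈ A ↔ y' + n ∈ A) → n ∈ (E.image (fun e => ⌊e - x⌋)) := by
    intro n hn
    by_contra hc
    apply hn
    apply h2 _ _ (by linarith)
    intro e he hI
    apply hc
    refine Finset.mem_image.2 ⟨e, he, ?_⟩
    rw [Int.floor_eq_iff]
    exact ⟨by linarith [hI.1], by linarith [hI.2]⟩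
  have hcard : (E.image (fun e => ⌊e - x⌋)).card ≤ V := Finset.card_image_le.trans hE
  have key : ∀ u v : ℝ, (∀ n : ℤ, ¬ (u + n ∈ A ↔ v + n ∈ A) → n ∈ (E.image (fun e => ⌊e - x⌋))) →
      {n : ℤ | u + n ∈ A}.ncard ≤ {n : ℤ | v + n ∈ A}.ncard + V := by
    intro u v huv
    have : {n : ℤ | u + n ∈ A} ⊆ {n : ℤ | v + n ∈ A} ∪ ↑(E.image (fun e => ⌊e - x⌋)) := by
      intro n hn
      by_cases h : v + n ∈ A
      · exact Or.inl h
      · exact Or.inr (huv n (fun h' => h (h'.1 hn)))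
    calc _ ≤ ({n : ℤ | v + n ∈ A} ∪ ↑(E.image (fun e => ⌊e - x⌋))).ncard :=
          Set.ncard_le_ncard this ((fin_shift hA v).union (Finset.finite_toSet _))
      _ ≤ _ := (Set.ncard_union_le _ _).trans (by rw [Set.ncard_coe_finset]; omega)
  have k1 := key x y' hbad
  have k2 := key y' x (fun n hn => hbad n (fun h => hn h.symm))
  have k1' : (({n : ℤ | x + n ∈ A}.ncard : ℕ) : ℝ) ≤ {n : ℤ | y' + n ∈ A}.ncard + V := by exact_mod_cast k1
  have k2' : (({n : ℤ | y' + n ∈ A}.ncard : ℕ) : ℝ) ≤ {n : ℤ | x + n ∈ A}.ncard + V := by exact_mod_cast k2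
  rw [abs_le]; constructor <;> linarith

/-- family of rows -/
theorem cntRows {ι : Type*} (K : Finset ι) {V : ℕ} (A : ι → Set ℝ) (h : ∀ k, BP V (A k))
    (hA : ∀ k, ∃ α β : ℝ, A k ⊆ Set.Icc α β) (x y : ι → ℝ) :
    |∑ k ∈ K, ({n : ℤ | x k + n ∈ A k}.ncard : ℝ) - ∑ k ∈ K, ({n : ℤ | y k + n ∈ A k}.ncard : ℝ)| ≤ V * K.card := by
  rw [← Finset.sum_sub_distrib]
  refine (Finset.abs_sum_le_sum_abs _ _).trans ?_
  calc _ ≤ ∑ k ∈ K, (V:ℝ) := Finset.sum_le_sum (fun k _ => by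
        obtain ⟨α, β, hh⟩ := hA k
        exact cnt1 (h k) hh _ _)
    _ = _ := by simp [mul_comm]

theorem card_Icc_le (α L : ℝ) (hL : 0 ≤ L) : ((Finset.Icc ⌈α⌉ ⌊α+L⌋).card : ℝ) ≤ L + 1 := by
  rw [Int.card_Icc]
  have h1 : (⌊α+L⌋:ℝ) ≤ α + L := Int.floor_le _
  have h2 : α ≤ (⌈α⌉:ℝ) := Int.le_ceil _
  by_cases h : 0 ≤ ⌊α+L⌋ + 1 - ⌈α⌉
  · have : (((⌊α+L⌋ + 1 - ⌈α⌉).toNat : ℤ) : ℝ) = ((⌊α+L⌋ + 1 - ⌈α⌉ : ℤ):ℝ) := by rw [Int.toNat_of_nonneg h]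
    push_cast at this
    rw [this]; linarith
  · rw [Int.toNat_of_nonpos (by omega)]; simp; linarith

theorem mem_Icc_iff (α L : ℝ) (k : ℤ) : k ∈ Finset.Icc ⌈α⌉ ⌊α+L⌋ ↔ α ≤ k ∧ (k:ℝ) ≤ α + L := by
  rw [Finset.mem_Icc, Int.ceil_le, Int.le_floor]

/-- two-dimensional counting as a sum over rows -/
theorem cnt2_rows {B : Set (ℤ × ℤ)} {K : Finset ℤ} (hK : ∀ z ∈ B, z.2 ∈ K)
    (hf : ∀ k, {n : ℤ | (n,k) ∈ B}.Finite) :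
    B.Finite ∧ (B.ncard : ℝ) = ∑ k ∈ K, ({n : ℤ | (n,k) ∈ B}.ncard : ℝ) := by
  have hB : B = ↑(K.biUnion (fun k => ((hf k).toFinset).image (fun n => (n,k)))) := by
    ext ⟨n,k⟩
    simp only [Finset.coe_biUnion, Set.mem_iUnion, Finset.coe_image, Set.mem_image, Finset.mem_coe, Set.Finite.coe_toFinset]
    constructor
    · intro h; exact ⟨k, hK _ h, n, h, rfl⟩
    · rintro ⟨k', _, n', h, he⟩
      simp only [Prod.mk.injEq] at he
      obtain ⟨rfl, rfl⟩ := he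
      exact h
  constructor
  · rw [hB]; exact Finset.finite_toSet _
  · conv_lhs => rw [hB]
    rw [Set.ncard_coe_finset, Finset.card_biUnion]
    · push_cast
      apply Finset.sum_congr rfl
      intro k _
      rw [Finset.card_image_of_injective _ (fun a b h => by simpa using h), ← Set.ncard_eq_toFinset_card _ (hf k)]
    · intro k _ k' _ hne
      rw [Function.onFun, Finset.disjoint_left]
      intro z hz hz'
      simp only [Finset.mem_image] at hz hz'
      obtain ⟨_, _, rfl⟩ := hz
      obtain ⟨_, _, h⟩ := hz'
      exact hne (by simpa using (congrArg Prod.snd h).symm)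

theorem shift_x {V : ℕ} {A : Set (ℝ × ℝ)} (h1 : ∀ t, BP V {s | (s,t) ∈ A}) {s0 t0 S T : ℝ} (hT : 0 ≤ T)
    (hA : ∀ z ∈ A, z.1 ∈ Set.Icc s0 (s0+S) ∧ z.2 ∈ Set.Icc t0 (t0+T)) (x x' y : ℝ) :
    {z : ℤ × ℤ | (x + z.1, y + z.2) ∈ A}.Finite ∧
    |({z : ℤ × ℤ | (x + z.1, y + z.2) ∈ A}.ncard : ℝ) - ({z : ℤ × ℤ | (x' + z.1, y + z.2) ∈ A}.ncard : ℝ)| ≤ V * (T+1) := by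
  have hs : ∀ t, {s | (s,t) ∈ A} ⊆ Set.Icc s0 (s0+S) := fun t s hs => (hA _ hs).1
  set K := Finset.Icc ⌈t0 - y⌉ ⌊(t0 - y) + T⌋ with hK
  have hm : ∀ x, ∀ z ∈ {z : ℤ × ℤ | ((x:ℝ) + z.1, y + z.2) ∈ A}, z.2 ∈ K := by
    intro x z hz
    rw [hK, mem_Icc_iff]
    have := (hA _ hz).2
    simp only [Set.mem_Icc] at this
    constructor <;> linarith [this.1, this.2]
  have hff : ∀ x k, {n : ℤ | (n,k) ∈ {z : ℤ × ℤ | ((x:ℝ) + z.1, y + z.2) ∈ A}}.Finite :=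
    fun x k => fin_shift (hs (y+k)) x
  obtain ⟨f1, e1⟩ := cnt2_rows (hm x) (hff x)
  obtain ⟨f2, e2⟩ := cnt2_rows (hm x') (hff x')
  refine ⟨f1, ?_⟩
  rw [e1, e2]
  have := cntRows K (fun k : ℤ => {s | (s,y+k) ∈ A}) (fun k => h1 _) (fun k => ⟨_, _, hs _⟩) (fun _ => x) (fun _ => x')
  refine le_trans this ?_
  gcongr
  exact card_Icc_le _ _ hT

theorem cnt2 {V : ℕ} {A : Set (ℝ × ℝ)} (h1 : ∀ t, BP V {s | (s,t) ∈ A}) (h2 : ∀ s, BP V {t | (s,t) ∈ A})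
    {s0 t0 S T : ℝ} (hS : 0 ≤ S) (hT : 0 ≤ T)
    (hA : ∀ z ∈ A, z.1 ∈ Set.Icc s0 (s0+S) ∧ z.2 ∈ Set.Icc t0 (t0+T)) (x x' y y' : ℝ) :
    |({z : ℤ × ℤ | (x + z.1, y + z.2) ∈ A}.ncard : ℝ) - ({z : ℤ × ℤ | (x' + z.1, y' + z.2) ∈ A}.ncard : ℝ)| ≤ V * (S+T+2) := by
  have k1 := (shift_x h1 hT hA x x' y).2
  have k2 := (shift_x (A := Prod.swap ⁻¹' A) (s0 := t0) (t0 := s0) (S := T) (T := S) h2 hS (fun z hz => (hA _ hz).symm) y y' x').2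
  have hsw : ∀ y : ℝ, {z : ℤ × ℤ | (y + z.1, x' + z.2) ∈ Prod.swap ⁻¹' A}.ncard = {z : ℤ × ℤ | (x' + z.1, y + z.2) ∈ A}.ncard := by
    intro y
    have : {z : ℤ × ℤ | (y + z.1, x' + z.2) ∈ Prod.swap ⁻¹' A} = Prod.swap '' {z : ℤ × ℤ | (x' + z.1, y + z.2) ∈ A} := by
      ext ⟨a, b⟩
      simp
    rw [this, Set.ncard_image_of_injective _ Prod.swap_injective]
  rw [hsw, hsw] at k2
  calc _ ≤ _ := abs_sub_le _ _ _
    _ ≤ V * (T+1) + V*(S+1) := add_le_add k1 k2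
    _ = _ := by ring

end Form
end

set_option linter.all false
open scoped Classical
noncomputable section
namespace Form

theorem basis_exists (J : ℕ) (hJ : 0 < J) (r : ℤ) : ∃ u v e f k : ℤ, 1 ≤ u ∧ u ≤ Nat.sqrt J ∧ |v| ≤ Nat.sqrt J ∧ |e| ≤ u ∧
    u * f - v * e = J ∧ (J:ℤ) ∣ u * r + v ∧ (J:ℤ) ∣ e * r + f ∧ u * r - k * J = - v := by
  set n := Nat.sqrt J with hn
  have hn0 : 0 < n := Nat.sqrt_pos.2 hJ
  obtain ⟨q, hq, hd⟩ := Real.exists_rat_abs_sub_le_and_den_le ((r:ℝ)/J) hn0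
  have hJR : (0:ℝ) < J := by exact_mod_cast hJ
  have hdp : (0:ℝ) < q.den := by exact_mod_cast q.den_pos
  have hv : |q.num * J - q.den * r| ≤ n := by
    have h1 : |((q.num * J - q.den * r : ℤ) : ℝ)| * (n+1) ≤ J := by
      have e1 : ((q.num * J - q.den * r : ℤ) : ℝ) = - (((r:ℝ)/J - q) * (q.den * J)) := by
        have : (q:ℝ) = q.num / q.den := by exact_mod_cast (Rat.num_div_den q).symm
        rw [this]
        push_cast
        field_simp
        ring
      rw [e1, abs_neg, abs_mul, abs_of_pos (by positivity : (0:ℝ) < q.den * J)]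
      have h2 : |(r:ℝ)/J - q| * ((n+1) * q.den) ≤ 1 := by
        rwa [le_div_iff₀ (by positivity)] at hq
      nlinarith
    have h2 : |q.num * J - q.den * r| * (n+1) ≤ J := by exact_mod_cast h1
    have h3 : (J:ℤ) < (n+1)*(n+1) := by exact_mod_cast Nat.lt_succ_sqrt J
    by_contra h
    push Not at h
    nlinarith
  have hcop : IsCoprime q.num (q.den:ℤ) := by
    have := q.reduced
    rw [Int.isCoprime_iff_nat_coprime]
    simpa using this
  obtain ⟨a, b, hab⟩ := hcop
  have hdz : (0:ℤ) < q.den := by exact_mod_cast q.den_pos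
  have hmod := Int.emod_add_mul_ediv (-a) (q.den:ℤ)
  set x := (-a) % (q.den:ℤ) with hx
  set s := (-a) / (q.den:ℤ) with hs
  have hx0 : 0 ≤ x := Int.emod_nonneg _ hdz.ne'
  have hx1 : x < q.den := Int.emod_lt_of_pos _ hdz
  refine ⟨q.den, q.num * J - q.den * r, x, (b - q.num * s) * J - x * r, q.num, by omega, by exact_mod_cast hd, hv, ?_, ?_, ?_, ?_, ?_⟩
  · rw [abs_of_nonneg hx0]; exact hx1.le
  · have hxx : x = -a - q.den * s := by linarith
    rw [hxx]
    linear_combination (J:ℤ) * hab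
  · exact ⟨q.num, by ring⟩
  · exact ⟨b - q.num*s, by ring⟩
  · ring

/-- integer points of `A` in given residue classes -/
def NP (A : Set (ℝ × ℝ)) (m J : ℕ) (r : ℤ) (α β : ZMod m) (τ : ZMod J) : Set (ℤ × ℤ) :=
  {z | ((z.1:ℝ), (z.2:ℝ)) ∈ A ∧ (z.1 : ZMod m) = α ∧ (z.2 : ZMod m) = β ∧ ((z.1 * r + z.2 : ℤ) : ZMod J) = τ}

theorem NP_eq {A : Set (ℝ × ℝ)} {m J : ℕ} (hm : 0 < m) (hJ : 0 < J) (hmJ : Nat.Coprime m J) (r : ℤ) (α β : ZMod m) (τ : ZMod J)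
    {u v e f : ℤ} (hdet : u * f - v * e = J) (h1 : (J:ℤ) ∣ u * r + v) (h2 : (J:ℤ) ∣ e * r + f) :
    ∃ x y : ℝ, (NP A m J r α β τ).ncard = {z : ℤ × ℤ | (x + z.1, y + z.2) ∈
      {w : ℝ × ℝ | ((m:ℝ) * (w.1 * u + w.2 * e), (m:ℝ) * (w.1 * v + w.2 * f)) ∈ A}}.ncard := by
  haveI : NeZero m := ⟨hm.ne'⟩
  haveI : NeZero J := ⟨hJ.ne'⟩
  have hmR : (0:ℝ) < m := by exact_mod_cast hm
  have hJR : (0:ℝ) < J := by exact_mod_cast hJ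
  have hdR : (u:ℝ) * f - v * e = J := by exact_mod_cast hdet
  have hJz : (J:ℤ) ≠ 0 := by exact_mod_cast hJ.ne'
  have hmz : (m:ℤ) ≠ 0 := by exact_mod_cast hm.ne'
  obtain ⟨p, q, hpq⟩ := Nat.isCoprime_iff_coprime.2 hmJ
  obtain ⟨a0, rfl⟩ := ZMod.intCast_surjective α
  obtain ⟨b0, rfl⟩ := ZMod.intCast_surjective β
  obtain ⟨t0, rfl⟩ := ZMod.intCast_surjective τ
  -- particular solution
  set w1 := a0 with hw1
  set w2 := b0 + m * (p * (t0 - a0 * r - b0)) with hw2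
  have hw2J : (J:ℤ) ∣ (w1 * r + w2) - t0 := by
    refine ⟨ - q * (t0 - a0 * r - b0), ?_⟩
    rw [hw2, hw1]
    linear_combination (t0 - a0*r-b0) * hpq
  refine ⟨((w1:ℝ) * f - w2 * e)/(J*m), ((u:ℝ) * w2 - v * w1)/(J*m), ?_⟩
  have id1 : ∀ I K : ℝ, (m:ℝ) * ((((w1:ℝ) * f - w2 * e)/(J*m) + I) * u + (((u:ℝ) * w2 - v * w1)/(J*m) + K) * e) = w1 + m * (I * u + K * e) := by
    intro I K
    field_simp
    rw [← hdR]; ring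
  have id2 : ∀ I K : ℝ, (m:ℝ) * ((((w1:ℝ) * f - w2 * e)/(J*m) + I) * v + (((u:ℝ) * w2 - v * w1)/(J*m) + K) * f) = w2 + m * (I * v + K * f) := by
    intro I K
    field_simp
    rw [← hdR]; ring
  symm
  apply Set.ncard_congr (fun z _ => (w1 + m * (z.1 * u + z.2 * e), w2 + m * (z.1 * v + z.2 * f)))
  · rintro ⟨i, k⟩ hz
    simp only [Set.mem_setOf_eq, NP] at hz ⊢
    refine ⟨?_, ?_, ?_, ?_⟩
    · convert hz using 2
      · push_cast
        field_simp
        rw [← hdR]; ring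
      · push_cast
        field_simp
        rw [← hdR]; ring
    · simp
    · simp [hw2]
    · rw [ZMod.intCast_eq_intCast_iff_dvd_sub]
      obtain ⟨c1, hc1⟩ := h1
      obtain ⟨c2, hc2⟩ := h2
      obtain ⟨c3, hc3⟩ := hw2J
      refine ⟨ - c3 - m * (i * c1 + k * c2), ?_⟩
      linear_combination (-1:ℤ) * hc3 - m * i * hc1 - m * k * hc2
  · rintro ⟨i, k⟩ ⟨i', k'⟩ _ _ h
    simp only [Prod.mk.injEq] at h
    obtain ⟨e1, e2⟩ := h
    have e1' : i * u + k * e = i' * u + k' * e := by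
      apply mul_left_cancel₀ hmz; linarith
    have e2' : i * v + k * f = i' * v + k' * f := by
      apply mul_left_cancel₀ hmz; linarith
    have g1 : i = i' := by
      apply mul_left_cancel₀ hJz; linear_combination f * e1' - e * e2' - (i - i') * hdet
    have g2 : k = k' := by
      apply mul_left_cancel₀ hJz; linear_combination u * e2' - v * e1' - (k - k') * hdet
    rw [g1, g2]
  · rintro ⟨c, d⟩ hz
    obtain ⟨hA, hc, hd, ht⟩ := hz
    simp only at hA hc hd ht
    rw [ZMod.intCast_eq_intCast_iff_dvd_sub] at hc hd ht
    obtain ⟨c1, hc⟩ := hc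
    obtain ⟨d1, hd⟩ := hd
    -- c = a0 - m c1, d = b0 - m d1
    set z1 := -c1 with hz1
    set z2 := -d1 - p * (t0 - a0 * r - b0) with hz2
    have hcc : c = w1 + m * z1 := by rw [hz1, hw1]; linarith
    have hdd : d = w2 + m * z2 := by rw [hz2, hw2]; linarith
    have hJz12 : (J:ℤ) ∣ z1 * r + z2 := by
      have : (J:ℤ) ∣ m * (z1 * r + z2) := by
        have h3 := dvd_add ht hw2J
        have h4 : t0 - (c * r + d) + (w1 * r + w2 - t0) = - (m * (z1 * r + z2)) := by rw [hcc, hdd]; ring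
        rw [h4, dvd_neg] at h3
        exact h3
      exact (IsCoprime.dvd_of_dvd_mul_left (Nat.isCoprime_iff_coprime.2 hmJ.symm) this)
    obtain ⟨g, hg⟩ := hJz12
    obtain ⟨g1, hg1⟩ := h1
    obtain ⟨g2, hg2⟩ := h2
    refine ⟨(z1 * g2 - g * e, u * g - z1 * g1), ?_, ?_⟩
    · simp only [Set.mem_setOf_eq]
      have k1 : ((z1 * g2 - g * e) * u + (u * g - z1 * g1) * e) = z1 := by
        apply mul_left_cancel₀ hJz
        linear_combination (-z1 * u) * hg2 + z1 * e * hg1 + z1 * hdet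
      have k2 : ((z1 * g2 - g * e) * v + (u * g - z1 * g1) * f) = z2 := by
        apply mul_left_cancel₀ hJz
        linear_combination (-z1 * v) * hg2 + v * e * hg - f * u * hg + z1 * f * hg1 + z2 * hdet
      have k1R : (((z1 * g2 - g * e : ℤ):ℝ) * u + ((u * g - z1 * g1 : ℤ):ℝ) * e) = z1 := by exact_mod_cast k1
      have k2R : (((z1 * g2 - g * e : ℤ):ℝ) * v + ((u * g - z1 * g1 : ℤ):ℝ) * f) = z2 := by exact_mod_cast k2
      convert hA using 2
      · rw [hcc]
        rw [id1, k1R]; push_cast; ring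
      · rw [hdd]
        rw [id2, k2R]; push_cast; ring
    · simp only [Prod.mk.injEq]
      have k1 : ((z1 * g2 - g * e) * u + (u * g - z1 * g1) * e) = z1 := by
        apply mul_left_cancel₀ hJz
        linear_combination (-z1 * u) * hg2 + z1 * e * hg1 + z1 * hdet
      have k2 : ((z1 * g2 - g * e) * v + (u * g - z1 * g1) * f) = z2 := by
        apply mul_left_cancel₀ hJz
        linear_combination (-z1 * v) * hg2 + v * e * hg - f * u * hg + z1 * f * hg1 + z2 * hdet
      rw [k1, k2, hcc, hdd]
      exact ⟨rfl, rfl⟩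

/-- line-tameness for planar sets -/
def LBP (V : ℕ) (A : Set (ℝ × ℝ)) : Prop := ∀ p1 q1 p2 q2 : ℝ, BP V {t | (p1 + t * q1, p2 + t * q2) ∈ A}

theorem NP_diff {A : Set (ℝ × ℝ)} {V : ℕ} (hV : LBP V A) {γ δ Lc Ld : ℝ} (hLc : 0 ≤ Lc) (hLd : 0 ≤ Ld)
    (hA : ∀ z ∈ A, |z.1 - γ| ≤ Lc ∧ |z.2 - δ| ≤ Ld)
    {m J : ℕ} (hm : 0 < m) (hJ : 0 < J) (hmJ : Nat.Coprime m J) (r : ℤ) 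
    {u v e f : ℤ} (hdet : u * f - v * e = J) (h1 : (J:ℤ) ∣ u * r + v) (h2 : (J:ℤ) ∣ e * r + f)
    (α β α' β' : ZMod m) (τ τ' : ZMod J) :
    |((NP A m J r α β τ).ncard : ℝ) - (NP A m J r α' β' τ').ncard| ≤
      V * (2 * ((Lc * |f| + Ld * |e|)/(J*m)) + 2 * ((Ld * |u| + Lc * |v|)/(J*m)) + 2) := by
  obtain ⟨x, y, hxy⟩ := NP_eq (A := A) hm hJ hmJ r α β τ hdet h1 h2
  obtain ⟨x', y', hxy'⟩ := NP_eq (A := A) hm hJ hmJ r α' β' τ' hdet h1 h2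
  rw [hxy, hxy']
  have hmR : (0:ℝ) < m := by exact_mod_cast hm
  have hJR : (0:ℝ) < J := by exact_mod_cast hJ
  have hdR : (u:ℝ) * f - v * e = J := by exact_mod_cast hdet
  have hJm : (0:ℝ) < J * m := by positivity
  refine cnt2 (s0 := (γ * f - δ * e)/(J*m) - (Lc * |f| + Ld * |e|)/(J*m)) (t0 := (u * δ - v * γ)/(J*m) - (Ld * |u| + Lc * |v|)/(J*m))
    ?_ ?_ (by positivity) (by positivity) ?_ x x' y y'
  · intro t
    have := hV (m * (t * e)) (m * u) (m * (t * f)) (m * v)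
    convert this using 1
    ext s
    simp only [Set.mem_setOf_eq]
    ring_nf
  · intro s
    have := hV (m * (s * u)) (m * e) (m * (s * v)) (m * f)
    convert this using 1
    ext t
    simp only [Set.mem_setOf_eq]
    ring_nf
  · rintro ⟨s, t⟩ hz
    obtain ⟨hc, hd⟩ := hA _ hz
    simp only at hc hd
    have key1 : s - (γ * f - δ * e)/(J*m) = ((m * (s * u + t * e) - γ) * f - (m * (s*v+t*f) - δ) * e) / (J*m) := by
      rw [eq_div_iff hJm.ne', sub_mul, div_mul_cancel₀ _ hJm.ne', ← hdR]; ring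
    have key2 : t - (u * δ - v * γ)/(J*m) = (u * (m * (s*v+t*f) - δ) - v * (m * (s * u + t * e) - γ)) / (J*m) := by
      rw [eq_div_iff hJm.ne', sub_mul, div_mul_cancel₀ _ hJm.ne', ← hdR]; ring
    have b1 : |s - (γ * f - δ * e)/(J*m)| ≤ (Lc * |f| + Ld * |e|)/(J*m) := by
      rw [key1, abs_div, abs_of_pos hJm]
      gcongr
      push_cast
      refine (abs_sub _ _).trans ?_
      rw [abs_mul, abs_mul]
      gcongr
    have b2 : |t - (u * δ - v * γ)/(J*m)| ≤ (Ld * |u| + Lc * |v|)/(J*m) := by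
      rw [key2, abs_div, abs_of_pos hJm]
      gcongr
      push_cast
      refine (abs_sub _ _).trans ?_
      rw [abs_mul, abs_mul, mul_comm |(u:ℝ)|, mul_comm |(v:ℝ)|]
      gcongr
    rw [abs_le] at b1 b2
    constructor
    · exact ⟨by linarith [b1.1], by linarith [b1.2]⟩
    · exact ⟨by linarith [b2.1], by linarith [b2.2]⟩

end Form
end

set_option linter.all false
open scoped Classical
noncomputable section
namespace Form

theorem sum_inv_u (J : ℕ) (hJ : 0 < J) (u k : ℕ → ℤ) (hu1 : ∀ r, 1 ≤ u r) (hu2 : ∀ r, u r ≤ Nat.sqrt J)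
    (hk : ∀ r : ℕ, |u r * r - k r * J| ≤ Nat.sqrt J) :
    ∑ r ∈ Finset.range J, (1:ℝ) / (u r) ≤ 12 * Nat.sqrt J * (1 + Real.log J) := by
  set n := Nat.sqrt J with hn
  have hn0 : 0 < n := Nat.sqrt_pos.2 hJ
  have hnJ : n ≤ J := Nat.sqrt_le_self J
  have hnR : (1:ℝ) ≤ n := by exact_mod_cast hn0
  have hcount : ∀ U ∈ Finset.Icc (1:ℤ) n, (((Finset.range J).filter (fun r => u r = U)).card : ℝ) ≤ 12 * n := by
    intro U hU
    rw [Finset.mem_Icc] at hU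
    have hUR : (1:ℝ) ≤ U := by exact_mod_cast hU.1
    have hUn : (U:ℝ) ≤ n := by exact_mod_cast hU.2
    have hsub : ((Finset.range J).filter (fun r => u r = U)).image (fun r : ℕ => (r:ℤ)) ⊆
        (Finset.Icc (-1) (U+1)).biUnion (fun κ : ℤ => Finset.Icc ⌈((κ:ℝ)*J - n)/U⌉ ⌊((κ:ℝ)*J - n)/U + 2*n/U⌋) := by
      intro x hx
      simp only [Finset.mem_image, Finset.mem_filter, Finset.mem_range] at hx
      obtain ⟨r, ⟨hr, hur⟩, rfl⟩ := hx
      have h1 := hk r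
      rw [hur, abs_le] at h1
      rw [Finset.mem_biUnion]
      refine ⟨k r, ?_, ?_⟩
      · rw [Finset.mem_Icc]
        have hJz : (0:ℤ) < J := by exact_mod_cast hJ
        have hnz : (n:ℤ) ≤ J := by exact_mod_cast hnJ
        have hrz : (r:ℤ) < J := by exact_mod_cast hr
        constructor
        · by_contra hc
          have : k r ≤ -2 := by omega
          have : k r * J ≤ -2 * J := by nlinarith
          have : 0 ≤ U * r := by have := hU.1; positivity
          omega
        · by_contra hc
          have : U + 2 ≤ k r := by omega
          have : (U+2) * J ≤ k r * J := by nlinarith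
          have : U * r ≤ U * J := by nlinarith [hU.1]
          nlinarith
      · rw [mem_Icc_iff]
        have hU0 : (0:ℝ) < U := by linarith
        have h2 : -(n:ℝ) ≤ U * r - k r * J := by exact_mod_cast h1.1
        have h3 : (U:ℝ) * r - k r * J ≤ n := by exact_mod_cast h1.2
        rw [← add_div, div_le_iff₀ hU0, le_div_iff₀ hU0]
        push_cast
        constructor <;> nlinarith
    rw [← Finset.card_image_of_injective _ (fun a b h => by simpa using h : Function.Injective (fun r : ℕ => (r:ℤ)))]
    calc _ ≤ (((Finset.Icc (-1) (U+1)).biUnion (fun κ : ℤ => Finset.Icc ⌈((κ:ℝ)*J - n)/U⌉ ⌊((κ:ℝ)*J - n)/U + 2*n/U⌋)).card : ℝ) := by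
          exact_mod_cast Finset.card_le_card hsub
      _ ≤ ∑ κ ∈ Finset.Icc (-1) (U+1), ((Finset.Icc ⌈((κ:ℝ)*J - n)/U⌉ ⌊((κ:ℝ)*J - n)/U + 2*n/U⌋).card : ℝ) := by
          exact_mod_cast Finset.card_biUnion_le
      _ ≤ ∑ κ ∈ Finset.Icc (-1) (U+1), (2*n/U+1 : ℝ) := Finset.sum_le_sum (fun κ _ => card_Icc_le _ _ (by positivity))
      _ = (U+3) * (2*n/U+1) := by
          rw [Finset.sum_const, Int.card_Icc, nsmul_eq_mul]
          congr 1
          have : (((U + 1 + 1 - -1).toNat : ℤ):ℝ) = ((U+1+1 - -1 : ℤ):ℝ) := by rw [Int.toNat_of_nonneg (by omega)]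
          push_cast at this
          rw [this]; ring
      _ ≤ 12 * n := by
          have e1 : ((U:ℝ)+3) * (2*n/U+1) = 2*n + U + 6 * (n/U) + 3 := by field_simp; ring
          have e2 : (n:ℝ)/U ≤ n := div_le_self (by linarith) hUR
          rw [e1]; nlinarith
  have hmaps : ∀ r ∈ Finset.range J, u r ∈ Finset.Icc (1:ℤ) n := fun r _ => Finset.mem_Icc.2 ⟨hu1 r, hu2 r⟩
  rw [← Finset.sum_fiberwise_of_maps_to hmaps]
  calc _ = ∑ U ∈ Finset.Icc (1:ℤ) n, (((Finset.range J).filter (fun r => u r = U)).card : ℝ) * (1/U) := by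
        apply Finset.sum_congr rfl
        intro U _
        rw [Finset.sum_congr rfl (g := fun _ => (1:ℝ)/U) (fun r hr => by rw [(Finset.mem_filter.1 hr).2])]
        simp
    _ ≤ ∑ U ∈ Finset.Icc (1:ℤ) n, 12 * n * (1/(U:ℝ)) := by
        apply Finset.sum_le_sum
        intro U hU
        have hU' := (Finset.mem_Icc.1 hU).1
        have : (0:ℝ) < U := by exact_mod_cast hU'
        exact mul_le_mul_of_nonneg_right (hcount U hU) (by positivity)
    _ = 12 * n * (harmonic n : ℝ) := by
        rw [← Finset.mul_sum]
        congr 1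
        rw [harmonic_eq_sum_Icc]
        push_cast
        symm
        apply Finset.sum_bij (fun (i:ℕ) _ => (i:ℤ))
        · intro i hi; rw [Finset.mem_Icc] at hi ⊢; omega
        · intro a _ b _ h; exact_mod_cast h
        · intro b hb
          rw [Finset.mem_Icc] at hb
          exact ⟨b.toNat, by rw [Finset.mem_Icc]; omega, by omega⟩
        · intro i hi; simp
    _ ≤ 12 * n * (1 + Real.log n) := by gcongr; exact harmonic_le_one_add_log n
    _ ≤ _ := by gcongr

theorem lat_one {A : Set (ℝ × ℝ)} {F : Finset (ℤ × ℤ)} (hF : ∀ z : ℤ × ℤ, z ∈ F ↔ ((z.1:ℝ),(z.2:ℝ)) ∈ A)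
    {m J : ℕ} [NeZero m] [NeZero J] (r : ℤ) {Eb : ℝ} 
    (hE : ∀ (α β α' β' : ZMod m) (τ τ' : ZMod J), |((NP A m J r α β τ).ncard : ℝ) - (NP A m J r α' β' τ').ncard| ≤ Eb)
    (g : ZMod m → ZMod m → ℂ) (hg : ∀ α β, ‖g α β‖ ≤ 1) (τ : ZMod J) :
    ‖∑ z ∈ F.filter (fun z => ((z.1 * r + z.2 : ℤ) : ZMod J) = τ), g z.1 z.2 - (F.card / J : ℂ) * ((∑ α, ∑ β, g α β) / (m:ℂ)^2)‖ ≤ (m:ℝ)^2 * Eb := by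
  have hmR : (m:ℝ) ≠ 0 := by exact_mod_cast NeZero.ne m
  have hJR : (J:ℝ) ≠ 0 := by exact_mod_cast NeZero.ne J
  have hmC : (m:ℂ) ≠ 0 := by exact_mod_cast NeZero.ne m
  have hJC : (J:ℂ) ≠ 0 := by exact_mod_cast NeZero.ne J
  have hNP : ∀ α β τ, NP A m J r α β τ = ↑(F.filter (fun z : ℤ × ℤ => (((z.1:ZMod m), (z.2:ZMod m)), ((z.1 * r + z.2 : ℤ) : ZMod J)) = ((α, β), τ))) := by
    intro α β τ
    ext z
    simp [NP, hF, and_assoc]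
  have hcard : ∀ α β τ, ((NP A m J r α β τ).ncard) = (F.filter (fun z : ℤ × ℤ => (((z.1:ZMod m), (z.2:ZMod m)), ((z.1 * r + z.2 : ℤ) : ZMod J)) = ((α, β), τ))).card := by
    intro α β τ; rw [hNP, Set.ncard_coe_finset]
  have hsum : (F.card : ℝ) = ∑ w : (ZMod m × ZMod m) × ZMod J, ((NP A m J r w.1.1 w.1.2 w.2).ncard : ℝ) := by
    rw [Finset.card_eq_sum_card_fiberwise (f := fun z : ℤ × ℤ => (((z.1:ZMod m), (z.2:ZMod m)), ((z.1 * r + z.2 : ℤ) : ZMod J))) (t := Finset.univ) (by simp)]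
    rw [Nat.cast_sum]
    exact Finset.sum_congr rfl (fun w _ => by rw [hcard])
  have hcd : (Fintype.card ((ZMod m × ZMod m) × ZMod J) : ℝ) = (m:ℝ)^2 * J := by
    rw [Fintype.card_prod, Fintype.card_prod, ZMod.card, ZMod.card]; push_cast; ring
  have hav : ∀ α β, |((NP A m J r α β τ).ncard : ℝ) - F.card / ((m:ℝ)^2 * J)| ≤ Eb := by
    intro α β
    have e1 : ((NP A m J r α β τ).ncard : ℝ) - F.card / ((m:ℝ)^2 * J) =
        (∑ w : (ZMod m × ZMod m) × ZMod J, (((NP A m J r α β τ).ncard : ℝ) - (NP A m J r w.1.1 w.1.2 w.2).ncard)) / ((m:ℝ)^2 * J) := by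
      rw [Finset.sum_sub_distrib, ← hsum, Finset.sum_const, Finset.card_univ, nsmul_eq_mul, hcd]
      field_simp
    have hpos : (0:ℝ) < (m:ℝ)^2 * J := by positivity
    rw [e1, abs_div, abs_of_pos hpos, div_le_iff₀ hpos]
    refine (Finset.abs_sum_le_sum_abs _ _).trans ?_
    calc _ ≤ ∑ w : (ZMod m × ZMod m) × ZMod J, Eb := Finset.sum_le_sum (fun w _ => hE _ _ _ _ _ _)
      _ = _ := by rw [Finset.sum_const, Finset.card_univ, nsmul_eq_mul, hcd]; ring
  have hL : ∑ z ∈ F.filter (fun z => ((z.1 * r + z.2 : ℤ) : ZMod J) = τ), g z.1 z.2 =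
      ∑ w : ZMod m × ZMod m, ((NP A m J r w.1 w.2 τ).ncard : ℂ) * g w.1 w.2 := by
    rw [← Finset.sum_fiberwise_of_maps_to (t := Finset.univ) (g := fun z : ℤ × ℤ => ((z.1:ZMod m), (z.2:ZMod m))) (by simp)]
    apply Finset.sum_congr rfl
    intro w _
    rw [Finset.sum_congr rfl (g := fun _ => g w.1 w.2) (fun z hz => by
      have := (Finset.mem_filter.1 hz).2
      rw [← this]), Finset.sum_const, hcard, nsmul_eq_mul, Finset.filter_filter]
    congr 4
    ext z
    constructor
    · rintro ⟨h1, h2⟩; rw [h1, h2]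
    · intro h; simp only [Prod.mk.injEq] at h ⊢; exact ⟨h.2, Prod.ext h.1.1 h.1.2⟩
  have hR : (F.card / J : ℂ) * ((∑ α, ∑ β, g α β) / (m:ℂ)^2) = ∑ w : ZMod m × ZMod m, ((F.card / ((m:ℝ)^2 * J) : ℝ) : ℂ) * g w.1 w.2 := by
    rw [← Finset.mul_sum, Fintype.sum_prod_type]
    push_cast
    field_simp
  rw [hL, hR, ← Finset.sum_sub_distrib]
  refine (norm_sum_le _ _).trans ?_
  calc _ ≤ ∑ w : ZMod m × ZMod m, Eb := by
        apply Finset.sum_le_sum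
        intro w _
        rw [← sub_mul, norm_mul]
        have e : (((NP A m J r w.1 w.2 τ).ncard : ℂ) - ((F.card / ((m:ℝ)^2 * J) : ℝ) : ℂ)) = ((((NP A m J r w.1 w.2 τ).ncard : ℝ) - F.card / ((m:ℝ)^2 * J) : ℝ) : ℂ) := by push_cast; ring
        rw [e, Complex.norm_real, Real.norm_eq_abs]
        calc _ ≤ |((NP A m J r w.1 w.2 τ).ncard : ℝ) - F.card / ((m:ℝ)^2 * J)| * 1 := by gcongr; exact hg _ _
          _ ≤ _ := by rw [mul_one]; exact hav _ _
    _ = _ := by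
        rw [Finset.sum_const, Finset.card_univ, nsmul_eq_mul]
        rw [Fintype.card_prod, ZMod.card]; push_cast; ring

theorem lat_main {A : Set (ℝ × ℝ)} {F : Finset (ℤ × ℤ)} (hF : ∀ z : ℤ × ℤ, z ∈ F ↔ ((z.1:ℝ),(z.2:ℝ)) ∈ A)
    {V : ℕ} (hV : LBP V A) {γ δ Lc Ld : ℝ} (hLc : 0 ≤ Lc) (hLd : 0 ≤ Ld)
    (hA : ∀ z ∈ A, |z.1 - γ| ≤ Lc ∧ |z.2 - δ| ≤ Ld)
    {m J : ℕ} [NeZero m] [NeZero J] (hmJ : Nat.Coprime m J) 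
    (g : ZMod m → ZMod m → ℂ) (hg : ∀ α β, ‖g α β‖ ≤ 1) (τ : ℕ → ZMod J) :
    ‖∑ r ∈ Finset.range J, ∑ z ∈ F.filter (fun z => ((z.1 * (r:ℤ) + z.2 : ℤ) : ZMod J) = τ r), g z.1 z.2 - (F.card : ℂ) * ((∑ α, ∑ β, g α β) / (m:ℂ)^2)‖
      ≤ 50 * V * (m * Real.sqrt J * (1 + Real.log J) * (Lc + Ld) + (m:ℝ)^2 * J) := by
  have hm : 0 < m := NeZero.pos m
  have hJ : 0 < J := NeZero.pos J
  have hmR : (0:ℝ) < m := by exact_mod_cast hm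
  have hJR : (1:ℝ) ≤ J := by exact_mod_cast hJ
  have hJC : (J:ℂ) ≠ 0 := by exact_mod_cast hJ.ne'
  choose u v e f k h1 h2 h3 h4 h5 h6 h7 h8 using fun r : ℕ => basis_exists J hJ r
  set n := Nat.sqrt J with hn
  have hn0 : (1:ℝ) ≤ n := by exact_mod_cast Nat.sqrt_pos.2 hJ
  have hnn : (n:ℝ) * n ≤ J := by exact_mod_cast Nat.sqrt_le J
  have hnsq : (n:ℝ) ≤ Real.sqrt J := Real.le_sqrt_of_sq_le (by nlinarith)
  have hsum := sum_inv_u J hJ u k h1 h2 (fun r => by rw [h8, abs_neg]; exact h3 r)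
  set B : ℕ → ℝ := fun r => V * (2 * ((2 * Lc * (1/(u r)) + 2 * Ld * (n / J) + Lc * (n/J))/m) + 2) with hB
  have hone : ∀ r : ℕ, ‖∑ z ∈ F.filter (fun z => ((z.1 * (r:ℤ) + z.2 : ℤ) : ZMod J) = τ r), g z.1 z.2 - (F.card / J : ℂ) * ((∑ α, ∑ β, g α β) / (m:ℂ)^2)‖ ≤ (m:ℝ)^2 * B r := by
    intro r
    apply lat_one hF r _ g hg
    intro α β α' β' τ τ'
    refine (NP_diff hV hLc hLd hA hm hJ hmJ r (h5 r) (h6 r) (h7 r) α β α' β' τ τ').trans ?_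
    have hu1 : (1:ℝ) ≤ u r := by exact_mod_cast h1 r
    have hu2 : (u r:ℝ) ≤ n := by exact_mod_cast h2 r
    have hv : |(v r:ℝ)| ≤ n := by exact_mod_cast h3 r
    have he : |(e r:ℝ)| ≤ u r := by exact_mod_cast h4 r
    have hd : (u r:ℝ) * f r - v r * e r = J := by exact_mod_cast h5 r
    have hf : |(f r:ℝ)| ≤ 2 * J * (1 / u r) := by
      rw [mul_one_div, le_div_iff₀ (by linarith)]
      have : (f r:ℝ) * u r = J + v r * e r := by linarith
      calc |(f r:ℝ)| * u r = |(f r:ℝ) * u r| := by rw [abs_mul, abs_of_pos (by linarith : (0:ℝ) < u r)]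
        _ = |(J:ℝ) + v r * e r| := by rw [this]
        _ ≤ J + |(v r:ℝ)| * |(e r:ℝ)| := by
            refine (abs_add_le _ _).trans ?_
            rw [abs_mul, abs_of_nonneg (by linarith : (0:ℝ) ≤ J)]
        _ ≤ J + n * n := by gcongr; exact he.trans hu2
        _ ≤ _ := by linarith
    rw [hB]
    simp only
    push_cast
    have hau : |(u r:ℝ)| ≤ n := by rw [abs_of_pos (by linarith)]; exact hu2
    have e1 : (Lc * |(f r:ℝ)| + Ld * |(e r:ℝ)|)/(J*m) + (Ld * |(u r:ℝ)| + Lc * |(v r:ℝ)|)/(J*m) ≤ (2 * Lc * (1/(u r)) + 2 * Ld * (n / J) + Lc * (n/J))/m := by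
      calc _ ≤ (Lc * (2 * J * (1 / u r)) + Ld * n)/(J*m) + (Ld * n + Lc * n)/(J*m) := by
            gcongr
            exact he.trans hu2
        _ = _ := by
            have : (J:ℝ) ≠ 0 := by positivity
            field_simp
            ring
    gcongr
    linarith
  have hsplit : ∑ r ∈ Finset.range J, ∑ z ∈ F.filter (fun z => ((z.1 * (r:ℤ) + z.2 : ℤ) : ZMod J) = τ r), g z.1 z.2 - (F.card : ℂ) * ((∑ α, ∑ β, g α β) / (m:ℂ)^2)
      = ∑ r ∈ Finset.range J, (∑ z ∈ F.filter (fun z => ((z.1 * (r:ℤ) + z.2 : ℤ) : ZMod J) = τ r), g z.1 z.2 - (F.card / J : ℂ) * ((∑ α, ∑ β, g α β) / (m:ℂ)^2)) := by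
    rw [Finset.sum_sub_distrib, Finset.sum_const, Finset.card_range, nsmul_eq_mul]
    congr 1
    field_simp
  rw [hsplit]
  refine (norm_sum_le _ _).trans ((Finset.sum_le_sum (fun r _ => hone r)).trans ?_)
  have e2 : ∑ r ∈ Finset.range J, (m:ℝ)^2 * B r = V * (m * (4 * Lc * (∑ r ∈ Finset.range J, (1:ℝ) / (u r)) + 4 * Ld * n + 2 * Lc * n) + 2 * (m:ℝ)^2 * J) := by
    have : ∀ r, (m:ℝ)^2 * B r = V * m * 4 * Lc * (1/(u r)) + (V * m * (4 * Ld * (n/J) + 2 * Lc * (n/J)) + V * 2 * (m:ℝ)^2) := by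
      intro r
      rw [hB]
      simp only
      field_simp
      ring
    rw [Finset.sum_congr rfl (fun r _ => this r), Finset.sum_add_distrib, ← Finset.mul_sum, Finset.sum_const, Finset.card_range, nsmul_eq_mul]
    have : (J:ℝ) ≠ 0 := by positivity
    field_simp
    ring
  rw [e2]
  have hlog : 0 ≤ Real.log J := Real.log_nonneg hJR
  have hV0 : (0:ℝ) ≤ V := by positivity
  set s := Real.sqrt J with hs
  set L := Real.log J with hL
  have hb : 4 * Lc * (∑ r ∈ Finset.range J, (1:ℝ) / (u r)) + 4 * Ld * n + 2 * Lc * n ≤ 50 * (s * (1 + L) * (Lc + Ld)) := by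
    have a1 : 4 * Lc * (∑ r ∈ Finset.range J, (1:ℝ) / (u r)) ≤ 4 * Lc * (12 * s * (1+L)) := by
      gcongr
      exact hsum.trans (by gcongr)
    have a2 : Ld * n ≤ Ld * (s * (1+L)) := by
      gcongr; nlinarith
    have a3 : Lc * n ≤ Lc * (s * (1+L)) := by
      gcongr; nlinarith
    have a4 : 0 ≤ Ld * (s * (1+L)) := by positivity
    nlinarith
  calc _ ≤ V * (m * (50 * (s * (1 + L) * (Lc + Ld))) + 50 * (m:ℝ)^2 * J) := by
        gcongr
        norm_num
    _ = _ := by ring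

end Form
end

set_option linter.all false
open scoped Classical
noncomputable section
namespace Form

def ln (p q : Fin 4 → ℝ) (t : ℝ) : Fin 4 → ℝ := fun k => p k + t * q k

/-- families of functions that are polynomial of bounded degree along lines -/
def PL {ι : Type} (g : ι → (Fin 4 → ℝ) → ℝ) : Prop :=
  ∃ n : ℕ, ∀ i p q, ∃ w : Polynomial ℝ, w.natDegree ≤ n ∧ ∀ t, w.eval t = g i (ln p q t)

/-- families of sets with boundedly many break points along lines -/
def TM {ι : Type} (S : ι → (Fin 4 → ℝ) → Prop) : Prop :=
  ∃ V : ℕ, ∀ i p q, BP V {t | S i (ln p q t)}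

section
variable {ι : Type} {g h : ι → (Fin 4 → ℝ) → ℝ} {S T : ι → (Fin 4 → ℝ) → Prop}

theorem PL.const (k : ι → ℝ) : PL (fun i (_ : Fin 4 → ℝ) => k i) :=
  ⟨0, fun i p q => ⟨Polynomial.C (k i), by simp, by simp⟩⟩
theorem PL.num (k : ℝ) : PL (fun (i:ι) (_ : Fin 4 → ℝ) => k) := PL.const (fun _ => k)
theorem PL.coord (j : Fin 4) : PL (fun (i : ι) (x : Fin 4 → ℝ) => x j) :=
  ⟨1, fun i p q => ⟨Polynomial.C (q j) * Polynomial.X + Polynomial.C (p j), Polynomial.natDegree_linear_le, by simp [ln]; intro t; ring⟩⟩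
theorem PL.add (hg : PL g) (hh : PL h) : PL (fun i x => g i x + h i x) := by
  obtain ⟨n, hn⟩ := hg
  obtain ⟨m, hm⟩ := hh
  refine ⟨max n m, fun i p q => ?_⟩
  obtain ⟨w, h1, h2⟩ := hn i p q
  obtain ⟨w', h1', h2'⟩ := hm i p q
  exact ⟨w + w', (Polynomial.natDegree_add_le _ _).trans (max_le_max h1 h1'), by simp [h2, h2']⟩
theorem PL.mul (hg : PL g) (hh : PL h) : PL (fun i x => g i x * h i x) := by
  obtain ⟨n, hn⟩ := hg
  obtain ⟨m, hm⟩ := hh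
  refine ⟨n + m, fun i p q => ?_⟩
  obtain ⟨w, h1, h2⟩ := hn i p q
  obtain ⟨w', h1', h2'⟩ := hm i p q
  exact ⟨w * w', Polynomial.natDegree_mul_le.trans (add_le_add h1 h1'), by simp [h2, h2']⟩
theorem PL.neg (hg : PL g) : PL (fun i x => - g i x) := by
  have := PL.mul (PL.num (-1)) hg
  simpa using this
theorem PL.sub (hg : PL g) (hh : PL h) : PL (fun i x => g i x - h i x) := by
  simpa [sub_eq_add_neg] using hg.add hh.neg
theorem PL.pow (hg : PL g) (n : ℕ) : PL (fun i x => g i x ^ n) := by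
  induction n with
  | zero => simpa using PL.num 1
  | succ k ih => simpa [pow_succ] using ih.mul hg

theorem TM.and (hS : TM S) (hT : TM T) : TM (fun i x => S i x ∧ T i x) := by
  obtain ⟨V, hV⟩ := hS
  obtain ⟨W, hW⟩ := hT
  exact ⟨V+W, fun i p q => (hV i p q).inter (hW i p q)⟩
theorem TM.not (hS : TM S) : TM (fun i x => ¬ S i x) := by
  obtain ⟨V, hV⟩ := hS
  exact ⟨V, fun i p q => (hV i p q).compl⟩
theorem TM.or (hS : TM S) (hT : TM T) : TM (fun i x => S i x ∨ T i x) := by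
  have := (hS.not.and hT.not).not
  simpa only [not_and_or, not_not] using this
theorem PL.lt (hg : PL g) (hh : PL h) : TM (fun i x => g i x < h i x) := by
  obtain ⟨n, hn⟩ := hh.sub hg
  refine ⟨n, fun i p q => ?_⟩
  obtain ⟨w, h1, h2⟩ := hn i p q
  have := BP.poly w h1
  simpa [h2, sub_pos] using this
theorem PL.le (hg : PL g) (hh : PL h) : TM (fun i x => g i x ≤ h i x) := by
  have := (hh.lt hg).not
  simpa only [not_lt] using this
theorem PL.abs_le (hg : PL g) (hh : PL h) : TM (fun i x => |g i x| ≤ h i x) := by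
  have := (hh.neg.le hg).and (hg.le hh)
  simpa only [← _root_.abs_le] using this
end

def rU (a b c d : ℝ) : ℝ := 2*b^3 - 9*a*b*c + 27*a^2*d

/-- upper region -/
def RU (i : ℝ × ℝ × ℝ) (a b c d : ℝ) : Prop :=
  rHi a b c d ∧ 0 < i.1 * rD a b c d ∧ i.1 * rD a b c d < i.2.1 ∧ |rP a b c d| ≤ 10*i.2.2^2 ∧ |rU a b c d| ≤ 64*i.2.2^3
/-- lower region -/
def RL (i : ℝ × ℝ × ℝ) (a b c d : ℝ) : Prop :=
  ¬ rHi a b c d ∧ rFd a b c d ∧ 0 < i.1 * rD a b c d ∧ i.1 * rD a b c d < i.2.1 ∧ |b| ≤ 8*i.2.2 ∧ |c| ≤ 8*i.2.2 ∧ |d| ≤ 8*i.2.2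

section
variable {ι : Type}
theorem PL.a : PL (fun (i : ι) (x : Fin 4 → ℝ) => x 0) := PL.coord 0
theorem PL.b : PL (fun (i : ι) (x : Fin 4 → ℝ) => x 1) := PL.coord 1
theorem PL.c : PL (fun (i : ι) (x : Fin 4 → ℝ) => x 2) := PL.coord 2
theorem PL.d : PL (fun (i : ι) (x : Fin 4 → ℝ) => x 3) := PL.coord 3
theorem PL_rP : PL (fun (i : ι) (x : Fin 4 → ℝ) => rP (x 0) (x 1) (x 2) (x 3)) :=
  (PL.b.pow 2).sub (((PL.num 3).mul PL.a).mul PL.c)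
theorem PL_rQ : PL (fun (i : ι) (x : Fin 4 → ℝ) => rQ (x 0) (x 1) (x 2) (x 3)) :=
  (PL.b.mul PL.c).sub (((PL.num 9).mul PL.a).mul PL.d)
theorem PL_rR : PL (fun (i : ι) (x : Fin 4 → ℝ) => rR (x 0) (x 1) (x 2) (x 3)) :=
  (PL.c.pow 2).sub (((PL.num 3).mul PL.b).mul PL.d)
theorem PL_rD : PL (fun (i : ι) (x : Fin 4 → ℝ) => rD (x 0) (x 1) (x 2) (x 3)) :=
  (((((PL.b.pow 2).mul (PL.c.pow 2)).sub (((PL.num 4).mul PL.a).mul (PL.c.pow 3))).sub (((PL.num 4).mul (PL.b.pow 3)).mul PL.d)).sub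
    (((PL.num 27).mul (PL.a.pow 2)).mul (PL.d.pow 2))).add (((((PL.num 18).mul PL.a).mul PL.b).mul PL.c).mul PL.d)
theorem PL_rU : PL (fun (i : ι) (x : Fin 4 → ℝ) => rU (x 0) (x 1) (x 2) (x 3)) :=
  (((PL.num 2).mul (PL.b.pow 3)).sub ((((PL.num 9).mul PL.a).mul PL.b).mul PL.c)).add (((PL.num 27).mul (PL.a.pow 2)).mul PL.d)
theorem TM_rHi : TM (fun (i : ι) (x : Fin 4 → ℝ) => rHi (x 0) (x 1) (x 2) (x 3)) := by
  have hP4 : PL (fun (i : ι) (x : Fin 4 → ℝ) => rP (x 0) (x 1) (x 2) (x 3) + 4 * (x 0)^2) := PL_rP.add ((PL.num 4).mul (PL.a.pow 2))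
  exact (((PL.num 0).lt PL_rD).and (((PL.num 4).mul (PL_rP.pow 2)).lt ((PL.num 3).mul PL_rD))).or
    ((PL_rD.lt (PL.num 0)).and ((hP4.lt (PL.num 0)).or (((PL.num 4).mul (hP4.pow 2)).lt PL_rD.neg)))
theorem TM_rFd : TM (fun (i : ι) (x : Fin 4 → ℝ) => rFd (x 0) (x 1) (x 2) (x 3)) := by
  refine (((PL.num 0).lt PL_rD).and ((PL_rP.le PL_rR).and ((PL_rQ.neg.le PL_rP).and (PL_rQ.le PL_rP)))).or
    ((PL_rD.lt (PL.num 0)).and (((PL.num 0).le ?_).and (((PL.num 0).le ?_).and ((PL.num 0).le ?_))))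
  · exact (((PL.d.pow 2).sub (PL.b.mul PL.d)).add (PL.a.mul PL.c)).sub (PL.a.pow 2)
  · exact ((((PL.a.add PL.b).pow 2).add (PL.a.mul PL.c)).add (PL.b.mul PL.c)).sub (PL.a.mul PL.d)
  · exact ((((PL.a.sub PL.b).pow 2).add (PL.a.mul PL.c)).sub (PL.b.mul PL.c)).add (PL.a.mul PL.d)
end

theorem TM_RU : TM (fun (i : ℝ × ℝ × ℝ) (x : Fin 4 → ℝ) => RU i (x 0) (x 1) (x 2) (x 3)) := by
  have h1 : PL (fun (i : ℝ × ℝ × ℝ) (x : Fin 4 → ℝ) => i.1 * rD (x 0) (x 1) (x 2) (x 3)) := (PL.const (fun i : ℝ × ℝ × ℝ => i.1)).mul PL_rD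
  exact TM_rHi.and (((PL.num 0).lt h1).and ((h1.lt (PL.const (fun i : ℝ × ℝ × ℝ => i.2.1))).and
    ((PL_rP.abs_le (PL.const (fun i : ℝ × ℝ × ℝ => 10 * i.2.2^2))).and (PL_rU.abs_le (PL.const (fun i : ℝ × ℝ × ℝ => 64 * i.2.2^3))))))
theorem TM_RL : TM (fun (i : ℝ × ℝ × ℝ) (x : Fin 4 → ℝ) => RL i (x 0) (x 1) (x 2) (x 3)) := by
  have h1 : PL (fun (i : ℝ × ℝ × ℝ) (x : Fin 4 → ℝ) => i.1 * rD (x 0) (x 1) (x 2) (x 3)) := (PL.const (fun i : ℝ × ℝ × ℝ => i.1)).mul PL_rD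
  have h8 : PL (fun (i : ℝ × ℝ × ℝ) (x : Fin 4 → ℝ) => 8 * i.2.2) := PL.const (fun i : ℝ × ℝ × ℝ => 8*i.2.2)
  exact TM_rHi.not.and (TM_rFd.and (((PL.num 0).lt h1).and ((h1.lt (PL.const (fun i : ℝ × ℝ × ℝ => i.2.1))).and
    ((PL.b.abs_le h8).and ((PL.c.abs_le h8).and (PL.d.abs_le h8))))))

/-- a common constant for both regions -/
theorem tame_const : ∃ V : ℕ, ∀ (i : ℝ × ℝ × ℝ) (a b c d a' b' c' d' : ℝ),
    BP V {t | RU i (a + t * a') (b + t * b') (c + t * c') (d + t * d')} ∧ BP V {t | RL i (a + t * a') (b + t * b') (c + t * c') (d + t * d')} := by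
  obtain ⟨V, hV⟩ := TM_RU
  obtain ⟨W, hW⟩ := TM_RL
  refine ⟨max V W, fun i a b c d a' b' c' d' => ?_⟩
  constructor
  · obtain ⟨E, h1, h2⟩ := hV i ![a,b,c,d] ![a',b',c',d']
    refine ⟨E, h1.trans (le_max_left _ _), ?_⟩
    simpa [ln] using h2
  · obtain ⟨E, h1, h2⟩ := hW i ![a,b,c,d] ![a',b',c',d']
    refine ⟨E, h1.trans (le_max_right _ _), ?_⟩
    simpa [ln] using h2

end Form
end

set_option linter.all false
open scoped Classical
noncomputable section
namespace Form

def dZ {m : ℕ} (a b c d : ZMod m) : ZMod m := b^2*c^2 - 4*a*c^3 - 4*b^3*d - 27*a^2*d^2 + 18*a*b*c*d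

theorem dZ_eq (m : ℕ) (f : Form) : ((f.disc : ℤ) : ZMod m) = dZ (f.a : ZMod m) f.b f.c f.d := by
  simp only [disc, dZ]; push_cast; ring

section
variable {m : ℕ} [NeZero m] (χ : DirichletCharacter ℂ m)

def psi (a b : ZMod m) : ℂ := (∑ c, ∑ d, χ (dZ a b c d)) / (m:ℂ)^2

theorem psi_le (a b : ZMod m) : ‖psi χ a b‖ ≤ 1 := by
  have hm : (0:ℝ) < m := by exact_mod_cast NeZero.pos m
  unfold psi
  rw [norm_div, norm_pow, Complex.norm_natCast, div_le_one (by positivity)]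
  refine (norm_sum_le _ _).trans ?_
  calc _ ≤ ∑ c : ZMod m, (m:ℝ) := by
        apply Finset.sum_le_sum
        intro c _
        refine (norm_sum_le _ _).trans ?_
        calc _ ≤ ∑ d : ZMod m, (1:ℝ) := Finset.sum_le_sum (fun d _ => χ.norm_le_one _)
          _ = _ := by simp [ZMod.card]
    _ = _ := by simp [ZMod.card, sq]

theorem psi_shift (a b : ZMod m) : psi χ a (b + 3*a) = psi χ a b := by
  unfold psi
  congr 1
  have h1 : Function.Bijective (fun w : ZMod m × ZMod m => (w.1 + 2*b + 3*a, w.2 + w.1 + b + a)) := by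
    refine Function.bijective_iff_has_inverse.2 ⟨fun w => (w.1 - 2*b - 3*a, w.2 - (w.1 - 2*b-3*a) - b - a), ?_, ?_⟩
    · rintro ⟨c, d⟩; simp only [Prod.mk.injEq]; constructor <;> ring
    · rintro ⟨c, d⟩; simp only [Prod.mk.injEq]; constructor <;> ring
  rw [← Fintype.sum_prod_type' (fun c d => χ (dZ a (b+3*a) c d)), ← Fintype.sum_prod_type' (fun c d => χ (dZ a b c d))]
  symm
  apply Fintype.sum_bijective _ h1
  rintro ⟨c, d⟩
  simp only
  congr 1
  unfold dZ
  ring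

theorem psi_sum (hχ : χ^6 ≠ 1) (a : ZMod m) : ∑ b, psi χ a b = 0 := by
  obtain ⟨t, ht⟩ : ∃ t : (ZMod m)ˣ, χ t ^ 6 ≠ 1 := by
    by_contra hc
    push Not at hc
    apply hχ
    ext t
    rw [MulChar.pow_apply_coe, hc t, MulChar.one_apply_coe]
  unfold psi
  rw [← Finset.sum_div]
  have key : ∑ b, ∑ c, ∑ d, χ (dZ a b c d) = χ t ^ 6 * ∑ b, ∑ c, ∑ d, χ (dZ a b c d) := by
    have hb : ∀ n : ℕ, Function.Bijective (fun x : ZMod m => x * (t:ZMod m)^n) := by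
      intro n
      have := (Units.mulRight (t^n)).bijective
      simpa using this
    rw [Finset.mul_sum]
    rw [← Fintype.sum_bijective _ (hb 1) _ _ (fun x => rfl)]
    apply Finset.sum_congr rfl
    intro b _
    rw [Finset.mul_sum]
    rw [← Fintype.sum_bijective _ (hb 2) _ _ (fun x => rfl)]
    apply Finset.sum_congr rfl
    intro c _
    rw [Finset.mul_sum]
    rw [← Fintype.sum_bijective _ (hb 3) _ _ (fun x => rfl)]
    apply Finset.sum_congr rfl
    intro d _
    rw [← map_pow, ← map_mul]
    congr 1
    unfold dZ
    ring
  have h0 : ∑ b, ∑ c, ∑ d, χ (dZ a b c d) = 0 := by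
    have : (1 - χ t ^ 6) * ∑ b, ∑ c, ∑ d, χ (dZ a b c d) = 0 := by linear_combination key
    rcases mul_eq_zero.1 this with h | h
    · exact absurd (by linear_combination -h : χ t ^ 6 = 1) ht
    · exact h
  rw [h0, zero_div]

theorem sum_period {F : ℕ → ℂ} {p : ℕ} (hF : ∀ n, F (n + p) = F n) (k : ℕ) :
    ∑ n ∈ Finset.range (p * k), F n = k * ∑ n ∈ Finset.range p, F n := by
  have hF' : ∀ k n, F (p * k + n) = F n := by
    intro k
    induction k with
    | zero => simp
    | succ k ih => intro n; rw [← ih n, ← hF (p*k+n)]; congr 1; ring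
  induction k with
  | zero => simp
  | succ k ih =>
    rw [Nat.mul_succ, Finset.sum_range_add, ih, Finset.sum_congr rfl (fun n _ => hF' k n)]
    push_cast; ring

theorem sum_range_zmod (G : ZMod m → ℂ) : ∑ n ∈ Finset.range m, G (n : ZMod m) = ∑ x, G x := by
  rw [Finset.sum_range]
  exact Fintype.sum_bijective _ (finbij m (NeZero.pos m)) _ _ (fun r => rfl)

theorem psi_sum_a (hχ : χ^6 ≠ 1) (a : ℕ) (ha : 0 < a) : ∑ b ∈ Finset.range (3*a), psi χ (a:ZMod m) (b:ZMod m) = 0 := by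
  have h1 := sum_period (F := fun b : ℕ => psi χ (a:ZMod m) (b:ZMod m)) (p := m) (fun n => by simp) (3*a)
  have h2 := sum_period (F := fun b : ℕ => psi χ (a:ZMod m) (b:ZMod m)) (p := 3*a) (fun n => by
    have := psi_shift χ (a:ZMod m) (n:ZMod m)
    push_cast; exact this) m
  rw [mul_comm, h2, sum_range_zmod (fun x => psi χ (a:ZMod m) x), psi_sum χ hχ, mul_zero] at h1
  rcases mul_eq_zero.1 h1 with h | h
  · exact absurd h (by exact_mod_cast NeZero.ne m)
  · exact h

end

/-- one-dimensional cancellation -/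
theorem cancel1 {m : ℕ} [NeZero m] (G : ZMod m → ℂ) (hG : ∀ x, ‖G x‖ ≤ 1) (h0 : ∑ x, G x = 0)
    {V : ℕ} {A : Set ℝ} (hA : ∀ p q : ℝ, BP V {t | p + t * q ∈ A}) {α β : ℝ} (hab : A ⊆ Set.Icc α β)
    (F : Finset ℤ) (hF : ∀ n : ℤ, n ∈ F ↔ (n:ℝ) ∈ A) : ‖∑ n ∈ F, G (n : ZMod m)‖ ≤ m * V := by
  have hm : (0:ℝ) < m := by exact_mod_cast NeZero.pos m
  have hmz : (m:ℤ) ≠ 0 := by exact_mod_cast NeZero.ne m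
  rw [← Finset.sum_fiberwise_of_maps_to (t := Finset.univ) (g := fun n : ℤ => (n : ZMod m)) (by simp)]
  set A' : Set ℝ := {t | 0 + t * m ∈ A} with hA'
  have hA'b : A' ⊆ Set.Icc (α/m) (β/m) := by
    intro t ht
    have := hab ht
    rw [zero_add] at this
    exact ⟨by rw [div_le_iff₀ hm]; exact this.1, by rw [le_div_iff₀ hm]; exact this.2⟩
  have hcard : ∀ x : ZMod m, (F.filter (fun n : ℤ => (n : ZMod m) = x)).card = {n : ℤ | ((x.val:ℝ)/m) + n ∈ A'}.ncard := by
    intro x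
    rw [← Set.ncard_coe_finset]
    symm
    apply Set.ncard_congr (fun n _ => (x.val:ℤ) + m * n)
    · intro n hn
      simp only [Finset.coe_filter, Set.mem_setOf_eq, hF] at hn ⊢
      refine ⟨?_, by simp⟩
      have : (0:ℝ) + ((x.val:ℝ)/m + n) * m = (((x.val:ℤ) + m * n : ℤ) : ℝ) := by push_cast; field_simp; ring
      rw [← this]; exact hn
    · intro n n' _ _ h
      apply mul_left_cancel₀ hmz; linarith
    · intro n hn
      simp only [Finset.coe_filter, Set.mem_setOf_eq, hF] at hn
      have h1 : ((n:ZMod m)) = ((x.val : ℤ) : ZMod m) := by rw [hn.2]; simp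
      rw [ZMod.intCast_eq_intCast_iff_dvd_sub] at h1
      obtain ⟨k, hk⟩ := h1
      refine ⟨-k, ?_, by linarith⟩
      simp only [Set.mem_setOf_eq]
      have : (0:ℝ) + ((x.val:ℝ)/m + ((-k:ℤ):ℝ)) * m = (n : ℝ) := by
        have hk' : ((x.val:ℤ):ℝ) - n = m * k := by exact_mod_cast hk
        push_cast at hk' ⊢
        field_simp
        linarith
      show (0:ℝ) + _ * m ∈ A
      rw [this]; exact hn.1
  have e1 : ∑ x : ZMod m, ∑ n ∈ F.filter (fun n : ℤ => (n : ZMod m) = x), G (n : ZMod m) =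
      ∑ x : ZMod m, (({n : ℤ | ((x.val:ℝ)/m) + n ∈ A'}.ncard : ℂ) - ({n : ℤ | (0:ℝ) + n ∈ A'}.ncard : ℂ)) * G x := by
    simp only [sub_mul]
    rw [Finset.sum_sub_distrib, ← Finset.mul_sum, h0, mul_zero, sub_zero]
    apply Finset.sum_congr rfl
    intro x _
    rw [Finset.sum_congr rfl (g := fun _ => G x) (fun n hn => by rw [(Finset.mem_filter.1 hn).2]), Finset.sum_const, hcard, nsmul_eq_mul]
  rw [e1]
  refine (norm_sum_le _ _).trans ?_
  calc _ ≤ ∑ x : ZMod m, (V:ℝ) := by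
        apply Finset.sum_le_sum
        intro x _
        rw [norm_mul]
        have e : (({n : ℤ | ((x.val:ℝ)/m) + n ∈ A'}.ncard : ℂ) - ({n : ℤ | (0:ℝ) + n ∈ A'}.ncard : ℂ)) = (((({n : ℤ | ((x.val:ℝ)/m) + n ∈ A'}.ncard : ℝ) - ({n : ℤ | (0:ℝ) + n ∈ A'}.ncard : ℝ)) : ℝ) : ℂ) := by push_cast; ring
        rw [e, Complex.norm_real, Real.norm_eq_abs]
        calc _ ≤ (V:ℝ) * 1 := by
              gcongr
              · exact cnt1 (hA 0 m) hA'b _ _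
              · exact hG x
          _ = _ := mul_one _
    _ = _ := by simp [ZMod.card]

end Form
end

set_option linter.all false
open scoped Classical
noncomputable section
namespace Form

def fset (A : Set (ℤ × ℤ)) : Finset (ℤ × ℤ) := if h : A.Finite then h.toFinset else ∅

theorem mem_fset {A : Set (ℤ × ℤ)} (h : A.Finite) (z : ℤ × ℤ) : z ∈ fset A ↔ z ∈ A := by
  simp [fset, h]

theorem card_fset {A : Set (ℤ × ℤ)} (h : A.Finite) : (fset A).card = A.ncard := by
  rw [fset, dif_pos h, Set.ncard_eq_toFinset_card _ h]

theorem RU_tr (i : ℝ × ℝ × ℝ) (a β c d : ℝ) :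
    RU i a (3*a*β) c d ↔ RU i a 0 (c - 3*a*β^2) (d - β*c + 2*a*β^3) := by
  have e1 : rD a (3*a*β) c d = rD a 0 (c - 3*a*β^2) (d - β*c + 2*a*β^3) := by unfold rD; ring
  have e2 : rP a (3*a*β) c d = rP a 0 (c - 3*a*β^2) (d - β*c + 2*a*β^3) := by unfold rP; ring
  have e3 : rU a (3*a*β) c d = rU a 0 (c - 3*a*β^2) (d - β*c + 2*a*β^3) := by unfold rU; ring
  unfold RU rHi
  rw [e1, e2, e3]

theorem RU_bd0 {i : ℝ × ℝ × ℝ} {a c d : ℝ} (ha : 0 < a) (hal : a ≤ i.2.2) (h : RU i a 0 c d) :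
    |c| ≤ 10/3 * i.2.2^3/a^2 ∧ |d| ≤ 3 * i.2.2^3/a^2 := by
  obtain ⟨-, -, -, h1, h2⟩ := h
  set l := i.2.2
  have hl : 0 < l := lt_of_lt_of_le ha hal
  have e1 : rP a 0 c d = -(3*a) * c := by unfold rP; ring
  have e2 : rU a 0 c d = 27*a^2*d := by unfold rU; ring
  rw [e1, abs_mul, abs_neg, abs_of_pos (by positivity : 0 < 3*a)] at h1
  rw [e2, abs_mul, abs_of_pos (by positivity : 0 < 27*a^2)] at h2
  constructor
  · rw [le_div_iff₀ (by positivity)]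
    have : 3*a*|c| * a ≤ 10*l^2 * l := by gcongr
    nlinarith [abs_nonneg c]
  · rw [le_div_iff₀ (by positivity)]
    nlinarith [pow_pos hl 3]

theorem RU_bd {i : ℝ × ℝ × ℝ} {a β c d : ℝ} (ha : 0 < a) (hal : a ≤ i.2.2) (h0 : 0 ≤ β) (h1 : β ≤ 1)
    (h : RU i a (3*a*β) c d) :
    |c - 3*a*β^2| ≤ 7 * i.2.2^3/a^2 ∧ |d - a*β^3| ≤ 7 * i.2.2^3/a^2 := by
  rw [RU_tr] at h
  obtain ⟨h2, h3⟩ := RU_bd0 ha hal h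
  have hl : 0 < i.2.2 := lt_of_lt_of_le ha hal
  set M := i.2.2^3/a^2 with hM
  have hM0 : 0 ≤ M := by positivity
  rw [mul_div_assoc, ← hM] at h2 h3 ⊢
  refine ⟨by linarith, ?_⟩
  have e : d - a*β^3 = (d - β*c + 2*a*β^3) + β * (c - 3*a*β^2) := by ring
  rw [e]
  refine (abs_add_le _ _).trans ?_
  rw [abs_mul, abs_of_nonneg h0]
  have : β * |c - 3*a*β^2| ≤ 1 * (10/3*M) := by gcongr
  linarith

section

theorem LBP_RU {V : ℕ} (hV : ∀ (i : ℝ × ℝ × ℝ) (a b c d a' b' c' d' : ℝ),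
    BP V {t | RU i (a + t * a') (b + t * b') (c + t * c') (d + t * d')} ∧ BP V {t | RL i (a + t * a') (b + t * b') (c + t * c') (d + t * d')})
    (i : ℝ × ℝ × ℝ) (a b : ℝ) : LBP V {w : ℝ × ℝ | RU i a b w.1 w.2} := by
  intro p1 q1 p2 q2
  have := (hV i a b p1 p2 0 0 q1 q2).1
  simpa using this

theorem LBP_RL {V : ℕ} (hV : ∀ (i : ℝ × ℝ × ℝ) (a b c d a' b' c' d' : ℝ),
    BP V {t | RU i (a + t * a') (b + t * b') (c + t * c') (d + t * d')} ∧ BP V {t | RL i (a + t * a') (b + t * b') (c + t * c') (d + t * d')})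
    (i : ℝ × ℝ × ℝ) (a b : ℝ) : LBP V {w : ℝ × ℝ | RL i a b w.1 w.2} := by
  intro p1 q1 p2 q2
  have := (hV i a b p1 p2 0 0 q1 q2).2
  simpa using this

theorem LBP.fst {V : ℕ} (hV : ∀ (i : ℝ × ℝ × ℝ) (a b c d a' b' c' d' : ℝ),
    BP V {t | RU i (a + t * a') (b + t * b') (c + t * c') (d + t * d')} ∧ BP V {t | RL i (a + t * a') (b + t * b') (c + t * c') (d + t * d')})
    {A : Set (ℝ × ℝ)} (h : LBP V A) (t : ℝ) : BP V {s | (s,t) ∈ A} := by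
  simpa using h 0 1 t 0

theorem LBP.snd {V : ℕ} (hV : ∀ (i : ℝ × ℝ × ℝ) (a b c d a' b' c' d' : ℝ),
    BP V {t | RU i (a + t * a') (b + t * b') (c + t * c') (d + t * d')} ∧ BP V {t | RL i (a + t * a') (b + t * b') (c + t * c') (d + t * d')})
    {A : Set (ℝ × ℝ)} (h : LBP V A) (t : ℝ) : BP V {s | (t,s) ∈ A} := by
  simpa using h t 0 0 1

theorem abs_Icc {V : ℕ} (hV : ∀ (i : ℝ × ℝ × ℝ) (a b c d a' b' c' d' : ℝ),
    BP V {t | RU i (a + t * a') (b + t * b') (c + t * c') (d + t * d')} ∧ BP V {t | RL i (a + t * a') (b + t * b') (c + t * c') (d + t * d')})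
    {x γ L : ℝ} (h : |x - γ| ≤ L) : x ∈ Set.Icc (γ - L) ((γ - L) + 2*L) := by
  rw [abs_le] at h; constructor <;> linarith [h.1, h.2]

theorem RU_count {V : ℕ} (hV : ∀ (i : ℝ × ℝ × ℝ) (a b c d a' b' c' d' : ℝ),
    BP V {t | RU i (a + t * a') (b + t * b') (c + t * c') (d + t * d')} ∧ BP V {t | RL i (a + t * a') (b + t * b') (c + t * c') (d + t * d')})
    {i : ℝ × ℝ × ℝ} {a β : ℝ} (ha : 0 < a) (hal : a ≤ i.2.2) (h0 : 0 ≤ β) (h1 : β ≤ 1) :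
    {z : ℤ × ℤ | RU i a (3*a*β) z.1 z.2}.Finite ∧
    |({z : ℤ × ℤ | RU i a (3*a*β) z.1 z.2}.ncard : ℝ) - ({z : ℤ × ℤ | RU i a 0 z.1 z.2}.ncard : ℝ)|
      ≤ V * (2 * (14 * i.2.2^3/a^2 + 1)) := by
  set L := 7 * i.2.2^3/a^2 with hL
  have hl : 0 < i.2.2 := lt_of_lt_of_le ha hal
  have hL0 : 0 ≤ L := by positivity
  set A : Set (ℝ × ℝ) := {w | RU i a 0 w.1 w.2} with hA
  have hAb : ∀ z ∈ A, z.1 ∈ Set.Icc (0-L) ((0-L) + 2*L) ∧ z.2 ∈ Set.Icc (0-L) ((0-L)+2*L) := by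
    intro z hz
    have := RU_bd (β := 0) (c := z.1) (d := z.2) ha hal le_rfl zero_le_one (by rw [mul_zero]; exact hz)
    simp only [ne_eq, OfNat.ofNat_ne_zero, not_false_eq_true, zero_pow, mul_zero] at this
    exact ⟨abs_Icc hV this.1, abs_Icc hV this.2⟩
  have hlbp := LBP_RU hV i a 0
  obtain ⟨s1, s2⟩ := shift_x (fun t => LBP.fst hV hlbp t) (by positivity : 0 ≤ 2*L) hAb (-(3*a*β^2)) 0 0
  -- swapped rows
  set K := Finset.Icc ⌈3*a*β^2 - L⌉ ⌊(3*a*β^2 - L) + 2*L⌋ with hK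
  set Ar : ℤ → Set ℝ := fun k => {s | RU i a 0 (k - 3*a*β^2) s} with hAr
  have hArb : ∀ k, Ar k ⊆ Set.Icc (0-L) ((0-L)+2*L) := fun k s hs => (hAb ((k - 3*a*β^2), s) hs).2
  set B1 : Set (ℤ × ℤ) := {z | RU i a (3*a*β) z.2 z.1} with hB1
  set B2 : Set (ℤ × ℤ) := {z | RU i a 0 (z.2 - 3*a*β^2) z.1} with hB2
  have r1 : ∀ k : ℤ, {n : ℤ | (n,k) ∈ B1} = {n : ℤ | (-(β*k) + 2*a*β^3) + n ∈ Ar k} := by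
    intro k; ext n
    simp only [hB1, hAr, Set.mem_setOf_eq, RU_tr]
    rw [show (n:ℝ) - β * k + 2*a*β^3 = -(β*k) + 2*a*β^3 + n by ring]
  have r2 : ∀ k : ℤ, {n : ℤ | (n,k) ∈ B2} = {n : ℤ | (0:ℝ) + n ∈ Ar k} := by
    intro k; ext n
    simp only [hB2, hAr, Set.mem_setOf_eq, zero_add]
  obtain ⟨f1, c1⟩ := cnt2_rows (B := B1) (K := K) (by
    intro z hz
    rw [hK, mem_Icc_iff]
    have := abs_Icc hV (RU_bd ha hal h0 h1 hz).1
    exact this) (by intro k; rw [r1]; exact fin_shift (hArb k) _)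
  obtain ⟨f2, c2⟩ := cnt2_rows (B := B2) (K := K) (by
    intro z hz
    rw [hK, mem_Icc_iff]
    have := (hAb ((z.2 - 3*a*β^2 : ℝ), (z.1:ℝ)) hz).1
    simp only [Set.mem_Icc] at this
    constructor <;> linarith [this.1, this.2]) (by intro k; rw [r2]; exact fin_shift (hArb k) _)
  have sw : ∀ B : Set (ℤ × ℤ), (Prod.swap ⁻¹' B).ncard = B.ncard := by
    intro B
    apply Set.ncard_preimage_of_injective_subset_range Prod.swap_injective
    intro x _; exact ⟨x.swap, by simp⟩
  have q1 : {z : ℤ × ℤ | RU i a (3*a*β) z.1 z.2} = Prod.swap ⁻¹' B1 := by ext z; simp [hB1]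
  have q2 : {z : ℤ × ℤ | (-(3*a*β^2) + (z.1:ℝ), (0:ℝ) + z.2) ∈ A} = Prod.swap ⁻¹' B2 := by
    ext z
    simp only [hA, hB2, Set.mem_setOf_eq, zero_add, Set.mem_preimage, Prod.swap]
    rw [neg_add_eq_sub]
  have q3 : {z : ℤ × ℤ | ((0:ℝ) + (z.1:ℝ), (0:ℝ) + z.2) ∈ A} = {z : ℤ × ℤ | RU i a 0 z.1 z.2} := by
    ext z; simp [hA]
  rw [q3, q2, sw, c2] at s2
  rw [q1, sw, c1]
  refine ⟨f1.preimage (Prod.swap_injective.injOn), ?_⟩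
  simp only [r1]
  simp only [r2] at s2
  have := cntRows K Ar (fun k => LBP.snd hV hlbp _) (fun k => ⟨_, _, hArb k⟩) (fun k => -(β*k) + 2*a*β^3) (fun _ => 0)
  have hKc := card_Icc_le (3*a*β^2 - L) (2*L) (by positivity)
  rw [← hK] at hKc
  have hV0 : (0:ℝ) ≤ V := Nat.cast_nonneg _
  have h3 := (abs_sub_le _ _ _).trans (add_le_add this s2)
  refine h3.trans ?_
  have : (V:ℝ) * K.card ≤ V * (2*L+1) := by gcongr
  have e : 14 * i.2.2^3/a^2 = 2 * L := by rw [hL]; ring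
  rw [e]; linarith

theorem up_a {V : ℕ} (hV : ∀ (i : ℝ × ℝ × ℝ) (a b c d a' b' c' d' : ℝ),
    BP V {t | RU i (a + t * a') (b + t * b') (c + t * c') (d + t * d')} ∧ BP V {t | RL i (a + t * a') (b + t * b') (c + t * c') (d + t * d')})
    {i : ℝ × ℝ × ℝ} {a : ℕ} (ha : 0 < a) (hal : (a:ℝ) ≤ i.2.2) {m J : ℕ} [NeZero m] [NeZero J]
    (hmJ : Nat.Coprime m J) (χ : DirichletCharacter ℂ m) (hχ : χ^6 ≠ 1) (τ : ℕ → ℕ → ZMod J) :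
    ‖∑ b ∈ Finset.range (3*a), ∑ r ∈ Finset.range J,
      ∑ z ∈ (fset {z : ℤ × ℤ | RU i a b z.1 z.2}).filter (fun z => ((z.1 * (r:ℤ) + z.2 : ℤ) : ZMod J) = τ b r),
        χ (dZ (a:ZMod m) (b:ZMod m) z.1 z.2)‖ ≤
      V * (2400 * (m * Real.sqrt J * (1 + Real.log J) * (i.2.2^3/a)) + 200 * ((m:ℝ)^2 * J * a)) := by
  have ha' : (0:ℝ) < a := by exact_mod_cast ha
  have hl : 0 < i.2.2 := lt_of_lt_of_le ha' hal
  set L := 7 * i.2.2^3/(a:ℝ)^2 with hL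
  have hL0 : 0 ≤ L := by positivity
  have hm1 : (1:ℝ) ≤ m := by exact_mod_cast NeZero.pos m
  have hJ1 : (1:ℝ) ≤ J := by exact_mod_cast NeZero.pos J
  have hlog := Real.log_nonneg hJ1
  have hsq : 1 ≤ Real.sqrt J := Real.one_le_sqrt.2 hJ1
  have hV0 : (0:ℝ) ≤ V := Nat.cast_nonneg _
  have hb : ∀ b ∈ Finset.range (3*a), ∃ β : ℝ, 0 ≤ β ∧ β ≤ 1 ∧ (b:ℝ) = 3*a*β := by
    intro b hb
    have : (b:ℝ) ≤ 3*a := by exact_mod_cast (Finset.mem_range.1 hb).le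
    refine ⟨b/(3*a), by positivity, by rw [div_le_one (by positivity)]; exact this, by field_simp⟩
  have step : ∀ b ∈ Finset.range (3*a), 
     ‖(∑ r ∈ Finset.range J, ∑ z ∈ (fset {z : ℤ × ℤ | RU i a b z.1 z.2}).filter (fun z => ((z.1 * (r:ℤ) + z.2 : ℤ) : ZMod J) = τ b r),
        χ (dZ (a:ZMod m) (b:ZMod m) z.1 z.2)) - ({z : ℤ × ℤ | RU i a 0 z.1 z.2}.ncard : ℂ) * psi χ (a:ZMod m) (b:ZMod m)‖ ≤ 
       50 * V * (m * Real.sqrt J * (1 + Real.log J) * (L + L) + (m:ℝ)^2 * J) + V * (2 * (14 * i.2.2^3/a^2 + 1)) := by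
    intro b hb'
    obtain ⟨β, h0, h1, hβ⟩ := hb b hb'
    obtain ⟨hf, hc⟩ := RU_count hV (i := i) ha' hal h0 h1
    rw [← hβ] at hf hc
    have h2 := lat_main (A := {w : ℝ × ℝ | RU i a b w.1 w.2}) (F := fset {z : ℤ × ℤ | RU i a b z.1 z.2})
      (fun z => by rw [mem_fset hf]; rfl) (LBP_RU hV i a b) (γ := 3*a*β^2) (δ := a*β^3) hL0 hL0
      (by rintro ⟨c, d⟩ hz; rw [hβ] at hz; exact RU_bd ha' hal h0 h1 hz) hmJ (fun c d => χ (dZ (a:ZMod m) (b:ZMod m) c d))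
      (fun _ _ => χ.norm_le_one _) (τ b)
    have e0 : (∑ α, ∑ β, χ (dZ (a:ZMod m) (b:ZMod m) α β)) / (m:ℂ)^2 = psi χ (a:ZMod m) (b:ZMod m) := rfl
    rw [e0, card_fset hf] at h2
    refine (norm_sub_le_norm_sub_add_norm_sub _ _ _).trans (add_le_add h2 ?_)
    rw [← sub_mul, norm_mul]
    have e1 : ‖(({z : ℤ × ℤ | RU i a b z.1 z.2}.ncard : ℂ) - ({z : ℤ × ℤ | RU i a 0 z.1 z.2}.ncard : ℂ))‖ = |({z : ℤ × ℤ | RU i a b z.1 z.2}.ncard : ℝ) - ({z : ℤ × ℤ | RU i a 0 z.1 z.2}.ncard : ℝ)| := by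
      rw [← Real.norm_eq_abs, ← Complex.norm_real]; push_cast; rfl
    rw [e1]
    calc _ ≤ _ * (1:ℝ) := mul_le_mul hc (psi_le χ _ _) (norm_nonneg _) (by positivity)
      _ = _ := mul_one _
  have h3 := norm_sum_le_of_le _ step
  rw [Finset.sum_sub_distrib, ← Finset.mul_sum, psi_sum_a χ hχ a ha, mul_zero, sub_zero] at h3
  refine h3.trans ?_
  rw [Finset.sum_const, Finset.card_range, nsmul_eq_mul]
  push_cast
  set W := (m:ℝ) * Real.sqrt J * (1 + Real.log J) with hW
  have hW1 : 1 ≤ W := by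
    rw [hW]
    have : 1 ≤ (m:ℝ) * Real.sqrt J := one_le_mul_of_one_le_of_one_le hm1 hsq
    exact one_le_mul_of_one_le_of_one_le this (by linarith)
  have hmm : 1 ≤ (m:ℝ)^2 * J := one_le_mul_of_one_le_of_one_le (one_le_pow₀ hm1) hJ1
  have e2 : (a:ℝ) * L = 7 * (i.2.2^3/a) := by rw [hL]; field_simp
  have e3 : (a:ℝ) * (14 * i.2.2^3/a^2) = 14 * (i.2.2^3/a) := by field_simp
  have hq : 0 ≤ i.2.2^3/(a:ℝ) := by positivity
  set q := i.2.2^3/(a:ℝ)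
  have e4 : 3 * (a:ℝ) * (50 * V * (W * (L+L) + (m:ℝ)^2*J) + V * (2 * (14 * i.2.2^3/a^2 + 1))) = 
    V * (300 * W * (a * L) + 150 * ((m:ℝ)^2*J*a) + 6 * (a * (14 * i.2.2^3/a^2)) + 6 * a) := by ring
  rw [e4, e2, e3]
  refine mul_le_mul_of_nonneg_left ?_ hV0
  have h5 : q ≤ W * q := le_mul_of_one_le_left hq hW1
  have h6 : (a:ℝ) ≤ (m:ℝ)^2 * J * a := le_mul_of_one_le_left ha'.le hmm
  nlinarith

end
end Form
end

set_option linter.all false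
open scoped Classical
noncomputable section
namespace Form

def KI (x : ℝ) : Finset ℤ := Finset.Icc ⌈-(8*x)⌉ ⌊-(8*x)+16*x⌋

theorem mem_KI (x : ℝ) (k : ℤ) : k ∈ KI x ↔ |(k:ℝ)| ≤ 8*x := by
  rw [KI, mem_Icc_iff, abs_le]
  constructor <;> rintro ⟨h1, h2⟩ <;> constructor <;> linarith

theorem card_KI (x : ℝ) (hx : 1 ≤ x) : ((KI x).card : ℝ) ≤ 17*x := by
  have := card_Icc_le (-(8*x)) (16*x) (by linarith)
  unfold KI
  linarith

section

theorem RL_finite {V : ℕ} (hV : ∀ (i : ℝ × ℝ × ℝ) (a b c d a' b' c' d' : ℝ),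
    BP V {t | RU i (a + t * a') (b + t * b') (c + t * c') (d + t * d')} ∧ BP V {t | RL i (a + t * a') (b + t * b') (c + t * c') (d + t * d')})
    (i : ℝ × ℝ × ℝ) (a b : ℝ) : {z : ℤ × ℤ | RL i a b z.1 z.2}.Finite := by
  apply Set.Finite.subset ((KI i.2.2 ×ˢ KI i.2.2).finite_toSet)
  rintro ⟨c, d⟩ ⟨-, -, -, -, -, h1, h2⟩
  simp only [Finset.coe_product, Set.mem_prod, Finset.mem_coe, mem_KI]
  exact ⟨h1, h2⟩

theorem low_a {V : ℕ} (hV : ∀ (i : ℝ × ℝ × ℝ) (a b c d a' b' c' d' : ℝ),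
    BP V {t | RU i (a + t * a') (b + t * b') (c + t * c') (d + t * d')} ∧ BP V {t | RL i (a + t * a') (b + t * b') (c + t * c') (d + t * d')})
    {i : ℝ × ℝ × ℝ} (hl : 1 ≤ i.2.2) {a : ℕ} {m J : ℕ} [NeZero m] [NeZero J]
    (hmJ : Nat.Coprime m J) (χ : DirichletCharacter ℂ m) (hχ : χ^6 ≠ 1) (τ : ℤ → ℕ → ZMod J) :
    ‖∑ b ∈ KI i.2.2, ∑ r ∈ Finset.range J,
      ∑ z ∈ (fset {z : ℤ × ℤ | RL i a b z.1 z.2}).filter (fun z => ((z.1 * (r:ℤ) + z.2 : ℤ) : ZMod J) = τ b r),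
        χ (dZ (a:ZMod m) (b:ZMod m) z.1 z.2)‖ ≤
      V * (14000 * (m * Real.sqrt J * (1 + Real.log J) * i.2.2^2) + 900 * ((m:ℝ)^2 * J * i.2.2)) := by
  set l := i.2.2 with hldef
  have hm1 : (1:ℝ) ≤ m := by exact_mod_cast NeZero.pos m
  have hJ1 : (1:ℝ) ≤ J := by exact_mod_cast NeZero.pos J
  have hlog := Real.log_nonneg hJ1
  have hsq : 1 ≤ Real.sqrt J := Real.one_le_sqrt.2 hJ1
  have hV0 : (0:ℝ) ≤ V := Nat.cast_nonneg _
  set E := 50 * V * (m * Real.sqrt J * (1 + Real.log J) * (8*l + 8*l) + (m:ℝ)^2 * J) with hE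
  have hE0 : 0 ≤ E := by positivity
  have step : ∀ b ∈ KI l, 
     ‖(∑ r ∈ Finset.range J, ∑ z ∈ (fset {z : ℤ × ℤ | RL i a b z.1 z.2}).filter (fun z => ((z.1 * (r:ℤ) + z.2 : ℤ) : ZMod J) = τ b r),
        χ (dZ (a:ZMod m) (b:ZMod m) z.1 z.2)) - ((fset {z : ℤ × ℤ | RL i a b z.1 z.2}).card : ℂ) * psi χ (a:ZMod m) (b:ZMod m)‖ ≤ E := by
    intro b hb'
    exact lat_main (A := {w : ℝ × ℝ | RL i a b w.1 w.2}) (F := fset {z : ℤ × ℤ | RL i a b z.1 z.2})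
      (fun z => by rw [mem_fset (RL_finite hV _ _ _)]; rfl) (LBP_RL hV i a b) (γ := 0) (δ := 0) (by linarith) (by linarith)
      (by rintro ⟨c, d⟩ ⟨-, -, -, -, -, h1, h2⟩; simpa using ⟨h1, h2⟩) hmJ (fun c d => χ (dZ (a:ZMod m) (b:ZMod m) c d))
      (fun _ _ => χ.norm_le_one _) (τ b)
  have h3 := norm_sum_le_of_le _ step
  rw [Finset.sum_sub_distrib] at h3
  have h4 : ‖∑ b ∈ KI l, ((fset {z : ℤ × ℤ | RL i a b z.1 z.2}).card : ℂ) * psi χ (a:ZMod m) (b:ZMod m)‖ ≤ (17*l)^2 * (m * V) := by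
    have e : ∀ b ∈ KI l, ((fset {z : ℤ × ℤ | RL i a b z.1 z.2}).card : ℂ) * psi χ (a:ZMod m) (b:ZMod m) = 
       ∑ z ∈ KI l ×ˢ KI l, if RL i a b z.1 z.2 then psi χ (a:ZMod m) (b:ZMod m) else 0 := by
      intro b _
      rw [← Finset.sum_filter, Finset.sum_const, nsmul_eq_mul]
      congr 3
      ext z
      rw [mem_fset (RL_finite hV _ _ _), Finset.mem_filter, Finset.mem_product, mem_KI, mem_KI]
      constructor
      · intro h; exact ⟨⟨h.2.2.2.2.2.1, h.2.2.2.2.2.2⟩, h⟩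
      · intro h; exact h.2
    rw [Finset.sum_congr rfl e, Finset.sum_comm]
    have st : ∀ z ∈ KI l ×ˢ KI l, ‖∑ b ∈ KI l, if RL i a b z.1 z.2 then psi χ (a:ZMod m) (b:ZMod m) else 0‖ ≤ m * V := by
      intro z _
      rw [← Finset.sum_filter]
      refine cancel1 (fun x => psi χ (a:ZMod m) x) (fun x => psi_le χ _ _) (psi_sum χ hχ _) (A := {b : ℝ | RL i a b z.1 z.2}) 
        (fun p q => by simpa using (hV i a p z.1 z.2 0 q 0 0).2) (α := -(8*l)) (β := 8*l) ?_ _ ?_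
      · intro b h; exact abs_le.1 h.2.2.2.2.1
      · intro n
        rw [Finset.mem_filter, mem_KI]
        constructor
        · intro h; exact h.2
        · intro h; exact ⟨h.2.2.2.2.1, h⟩
    refine (norm_sum_le_of_le _ st).trans ?_
    rw [Finset.sum_const, nsmul_eq_mul, Finset.card_product]
    push_cast
    rw [← sq]
    gcongr
    exact card_KI l hl
  have h5 := (norm_le_norm_sub_add _ _).trans (add_le_add h3 h4)
  refine h5.trans ?_
  rw [Finset.sum_const, nsmul_eq_mul]
  have hk := card_KI l hl
  have h6 : ((KI l).card:ℝ) * E ≤ 17*l*E := by gcongr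
  have h7 : (m:ℝ) ≤ m * Real.sqrt J * (1 + Real.log J) := by
    rw [mul_assoc]
    exact le_mul_of_one_le_right (by linarith) (one_le_mul_of_one_le_of_one_le hsq (by linarith))
  have h8 : (17*l)^2 * (m * V) ≤ (17*l)^2 * ((m * Real.sqrt J * (1 + Real.log J)) * V) := by gcongr
  have h9 : 0 ≤ (V:ℝ) * ((m:ℝ)^2*J*l) := by positivity
  have h10 : 0 ≤ (V:ℝ) * ((m * Real.sqrt J * (1 + Real.log J)) * l^2) := by positivity
  rw [hE] at h6
  nlinarith

end
end Form
end

set_option linter.all false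
open scoped Classical
noncomputable section
namespace Form

def rt (J : ℕ) (f : Form) : ℕ := ∑ r ∈ Finset.range J, if (J:ℤ) ∣ f.ev (r:ℕ) 1 then 1 else 0

theorem omg_rt (p : ℕ) (f : Form) : omg p f = (if (p:ℤ) ∣ f.a then 1 else 0) + rt p f := by
  rw [omg_eq, rt, Finset.sum_range]

theorem dvd_evZ (J : ℕ) (f : Form) (r : ℕ) : (J:ℤ) ∣ f.ev (r:ℕ) 1 ↔ evZ J f (r : ZMod J) 1 = 0 := by
  rw [← ZMod.intCast_zmod_eq_zero_iff_dvd]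
  simp [ev, evZ]

theorem rt_eq (J : ℕ) [NeZero J] (f : Form) : rt J f = (Finset.univ.filter (fun x : ZMod J => evZ J f x 1 = 0)).card := by
  rw [Finset.card_filter, rt, Finset.sum_range]
  apply Fintype.sum_bijective _ (finbij J (NeZero.pos J))
  intro r
  simp only [dvd_evZ]

theorem rt_mul {n k : ℕ} [NeZero n] [NeZero k] (h : Nat.Coprime n k) (f : Form) : rt (n*k) f = rt n f * rt k f := by
  haveI : NeZero (n*k) := ⟨mul_ne_zero (NeZero.ne n) (NeZero.ne k)⟩
  rw [rt_eq, rt_eq, rt_eq, ← Finset.card_product]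
  let e := ZMod.chineseRemainder h
  have hh : ∀ x, e (evZ (n*k) f x 1) = (evZ n f (e x).1 1, evZ k f (e x).2 1) := by
    intro x
    simp only [evZ, map_add, map_mul, map_pow, map_one, map_intCast]
    apply Prod.ext <;> simp
  apply Finset.card_bij (fun x _ => e x)
  · intro x hx
    simp only [Finset.mem_filter, Finset.mem_univ, true_and, Finset.mem_product] at hx ⊢
    have := hh x
    rw [hx, map_zero] at this
    exact ⟨(congrArg Prod.fst this).symm, (congrArg Prod.snd this).symm⟩
  · intro x _ y _ hxy; exact e.injective hxy
  · rintro y hy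
    simp only [Finset.mem_filter, Finset.mem_univ, true_and, Finset.mem_product] at hy
    refine ⟨e.symm y, ?_, by simp⟩
    simp only [Finset.mem_filter, Finset.mem_univ, true_and]
    apply e.injective
    rw [hh, map_zero]
    simp [hy.1, hy.2]

theorem rt_one (f : Form) : rt 1 f = 1 := by simp [rt]

theorem rt_prod (u : Finset ℕ) (hu : ∀ p ∈ u, p.Prime) (f : Form) : ∏ p ∈ u, rt p f = rt (∏ p ∈ u, p) f := by
  induction u using Finset.induction_on with
  | empty => simp [rt_one]
  | insert p u hp ih =>
    have hpp := hu p (by simp)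
    have hu' : ∀ q ∈ u, q.Prime := fun q hq => hu q (by simp [hq])
    rw [Finset.prod_insert hp, Finset.prod_insert hp, ih hu']
    haveI : NeZero p := ⟨hpp.ne_zero⟩
    haveI : NeZero (∏ q ∈ u, q) := ⟨Finset.prod_ne_zero_iff.2 (fun q hq => (hu' q hq).ne_zero)⟩
    rw [rt_mul]
    apply Nat.Coprime.prod_right
    intro q hq
    exact (Nat.coprime_primes hpp (hu' q hq)).2 (by rintro rfl; exact hp hq)

theorem prod_dvd_iff (u : Finset ℕ) (hu : ∀ p ∈ u, p.Prime) (a : ℤ) : 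
    (((∏ p ∈ u, p : ℕ) : ℤ) ∣ a) ↔ ∀ p ∈ u, (p:ℤ) ∣ a := by
  constructor
  · intro h p hp
    exact dvd_trans (by exact_mod_cast Finset.dvd_prod_of_mem _ hp) h
  · intro h
    push_cast
    apply Finset.prod_dvd_of_coprime
    · intro p hp q hq hne
      exact Nat.isCoprime_iff_coprime.2 ((Nat.coprime_primes (hu p hp) (hu q hq)).2 hne)
    · exact h

theorem thn_dec (j : Finset ℕ) (hj : ∀ p ∈ j, p.Prime) (f : Form) :
    thn j f = ∑ t ∈ j.powerset, (if ((∏ p ∈ t, p : ℕ) : ℤ) ∣ f.a then 1 else 0) * rt (∏ p ∈ j \ t, p) f := by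
  unfold thn
  simp only [omg_rt]
  rw [Finset.prod_add]
  apply Finset.sum_congr rfl
  intro t ht
  rw [Finset.mem_powerset] at ht
  rw [rt_prod _ (fun p hp => hj p (Finset.mem_sdiff.1 hp).1)]
  congr 1
  rw [if_congr (prod_dvd_iff t (fun p hp => hj p (ht hp)) f.a) rfl rfl]
  split_ifs with h
  · exact Finset.prod_eq_one (fun p hp => by rw [if_pos (h p hp)])
  · push Not at h
    obtain ⟨p, hp, h⟩ := h
    exact Finset.prod_eq_zero hp (by rw [if_neg h])

/-- discriminant window -/
def dd (σ : ℤ) (Y : ℝ) (f : Form) : Prop := 0 < (σ:ℝ) * f.disc ∧ (σ:ℝ) * f.disc < Y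

def sgx (σ : ℤ) : Prop := σ = 1 ∨ σ = -1

theorem dd_iff {σ : ℤ} (hσ : sgx σ) {Y : ℝ} {f : Form} : dd σ Y f → f.disc ≠ 0 ∧ |(f.disc:ℝ)| < Y := by
  rintro ⟨h1, h2⟩
  constructor
  · rintro h; rw [h] at h1; simp at h1
  · rcases hσ with rfl | rfl
    · push_cast at h1 h2
      rw [abs_of_pos (by linarith)]; linarith
    · push_cast at h1 h2
      rw [abs_of_neg (by linarith)]; linarith

def mk4 (x : Σ _ : ℤ, Σ _ : ℤ, ℤ × ℤ) : Form := ⟨x.1, x.2.1, x.2.2.1, x.2.2.2⟩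

theorem mk4_inj : Function.Injective mk4 := by
  rintro ⟨a, b, c, d⟩ ⟨a', b', c', d'⟩ h
  simp only [mk4, Form.mk.injEq] at h
  obtain ⟨rfl, rfl, rfl, rfl⟩ := h
  rfl

def F4 (A : Finset ℤ) (B : ℤ → Finset ℤ) (F : ℤ → ℤ → Finset (ℤ × ℤ)) : Finset Form :=
  (A.sigma (fun a => (B a).sigma (fun b => F a b))).image mk4

theorem mem_F4 {A B F} (f : Form) : f ∈ F4 A B F ↔ f.a ∈ A ∧ f.b ∈ B f.a ∧ (f.c, f.d) ∈ F f.a f.b := by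
  unfold F4
  rw [Finset.mem_image]
  constructor
  · rintro ⟨x, hx, rfl⟩
    simp only [Finset.mem_sigma] at hx
    exact hx
  · intro h
    exact ⟨⟨f.a, f.b, f.c, f.d⟩, by simpa [Finset.mem_sigma] using h, rfl⟩

theorem sum_F4 {A B F} (G : Form → ℂ) : ∑ f ∈ F4 A B F, G f = ∑ a ∈ A, ∑ b ∈ B a, ∑ z ∈ F a b, G ⟨a, b, z.1, z.2⟩ := by
  unfold F4
  rw [Finset.sum_image (fun x _ y _ h => mk4_inj h), Finset.sum_sigma]
  apply Finset.sum_congr rfl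
  intro a _
  rw [Finset.sum_sigma]
  rfl

def UpF (i : ℝ × ℝ × ℝ) : Finset Form :=
  F4 (Finset.Icc 1 ⌊i.2.2⌋) (fun a => (Finset.range (3*a.toNat)).map ⟨fun n : ℕ => (n:ℤ), Nat.cast_injective⟩)
    (fun a b => fset {z : ℤ × ℤ | RU i a b z.1 z.2})

def LowF (i : ℝ × ℝ × ℝ) : Finset Form :=
  F4 (Finset.Icc 1 ⌊8*i.2.2⌋) (fun _ => KI i.2.2) (fun a b => fset {z : ℤ × ℤ | RL i a b z.1 z.2})

section

theorem RU_finite {V : ℕ} (hV : ∀ (i : ℝ × ℝ × ℝ) (a b c d a' b' c' d' : ℝ),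
    BP V {t | RU i (a + t * a') (b + t * b') (c + t * c') (d + t * d')} ∧ BP V {t | RL i (a + t * a') (b + t * b') (c + t * c') (d + t * d')})
    {i : ℝ × ℝ × ℝ} {a : ℤ} {b : ℕ} (ha : 1 ≤ a) (hal : (a:ℝ) ≤ i.2.2) (hb : (b:ℤ) < 3*a) :
    {z : ℤ × ℤ | RU i a b z.1 z.2}.Finite := by
  have ha' : (0:ℝ) < a := by exact_mod_cast ha
  have hb' : (b:ℝ) < 3*a := by exact_mod_cast hb
  have := (RU_count hV (i := i) (β := b/(3*a)) ha' hal (by positivity) (by rw [div_le_one (by positivity)]; exact hb'.le)).1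
  rwa [show 3*(a:ℝ)*(b/(3*a)) = b by field_simp] at this

theorem mem_UpF {V : ℕ} (hV : ∀ (i : ℝ × ℝ × ℝ) (a b c d a' b' c' d' : ℝ),
    BP V {t | RU i (a + t * a') (b + t * b') (c + t * c') (d + t * d')} ∧ BP V {t | RL i (a + t * a') (b + t * b') (c + t * c') (d + t * d')})
    {σ : ℤ} (hσ : sgx σ) {Y l : ℝ} (hl : 0 ≤ l) (hY : Y ≤ l^4) (f : Form) :
    f ∈ UpF ((σ:ℝ),Y,l) ↔ f ∈ Up ∧ dd σ Y f := by
  unfold UpF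
  rw [mem_F4]
  simp only [Finset.mem_Icc, Finset.mem_map, Finset.mem_range, Function.Embedding.coeFn_mk]
  constructor
  · rintro ⟨⟨h1, h2⟩, ⟨b, hb, hbe⟩, h3⟩
    have h2' : (f.a:ℝ) ≤ l := Int.le_floor.1 h2
    have hb' : (b:ℤ) < 3*f.a := by omega
    have hbr : (f.b:ℝ) = (b:ℝ) := by rw [← hbe]; simp
    rw [hbr, mem_fset (RU_finite hV h1 h2' hb')] at h3
    simp only [Set.mem_setOf_eq, ← hbr] at h3
    obtain ⟨h4, h5, h6, -, -⟩ := h3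
    rw [rD_eq] at h5 h6
    exact ⟨⟨by omega, by omega, by omega, h4⟩, h5, h6⟩
  · rintro ⟨h, hd⟩
    obtain ⟨h0, h1⟩ := dd_iff hσ hd
    obtain ⟨u1, u2, u3⟩ := up_size h0 h hl (h1.le.trans hY)
    obtain ⟨b1, b2, b3, b4⟩ := h
    refine ⟨⟨b1, Int.le_floor.2 u1⟩, ⟨f.b.toNat, by omega, by omega⟩, ?_⟩
    have hbr : (f.b:ℝ) = (f.b.toNat:ℝ) := by
      have : ((f.b.toNat:ℤ):ℝ) = (f.b:ℝ) := by rw [Int.toNat_of_nonneg b2]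
      rw [← this, Int.cast_natCast]
    rw [hbr, mem_fset (RU_finite hV b1 u1 (by omega))]
    simp only [Set.mem_setOf_eq, ← hbr]
    refine ⟨b4, ?_, ?_, ?_, ?_⟩
    · rw [rD_eq]; exact hd.1
    · rw [rD_eq]; exact hd.2
    · rw [rP_eq]; exact u2
    · have : rU f.a f.b f.c f.d = f.U := by simp only [rU, U]; push_cast; ring
      rw [this]; exact u3

theorem mem_LowF {V : ℕ} (hV : ∀ (i : ℝ × ℝ × ℝ) (a b c d a' b' c' d' : ℝ),
    BP V {t | RU i (a + t * a') (b + t * b') (c + t * c') (d + t * d')} ∧ BP V {t | RL i (a + t * a') (b + t * b') (c + t * c') (d + t * d')})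
    {σ : ℤ} (hσ : sgx σ) {Y l : ℝ} (hl : 0 ≤ l) (hY : Y ≤ l^4) (f : Form) :
    f ∈ LowF ((σ:ℝ),Y,l) ↔ f ∈ Low ∧ dd σ Y f := by
  unfold LowF
  rw [mem_F4, mem_fset (RL_finite hV _ _ _)]
  simp only [Finset.mem_Icc, mem_KI, Set.mem_setOf_eq]
  constructor
  · rintro ⟨⟨h1, h2⟩, hb, h3⟩
    obtain ⟨h4, h5, h6, h7, -⟩ := h3
    rw [rD_eq] at h6 h7
    exact ⟨⟨by omega, h4, h5⟩, h6, h7⟩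
  · rintro ⟨h, hd⟩
    obtain ⟨h0, h1⟩ := dd_iff hσ hd
    obtain ⟨u1, u2, u3, u4⟩ := low_size h0 h hl (h1.le.trans hY)
    obtain ⟨b1, b2, b3⟩ := h
    refine ⟨⟨b1, Int.le_floor.2 u1⟩, u2, b2, b3, ?_, ?_, u2, u3, u4⟩
    · rw [rD_eq]; exact hd.1
    · rw [rD_eq]; exact hd.2

end
end Form
end

set_option linter.all false
open scoped Classical
noncomputable section
namespace Form

theorem sum_inv_Icc (l : ℝ) (hl : 1 ≤ l) : ∑ a ∈ Finset.Icc (1:ℤ) ⌊l⌋, (1:ℝ)/a ≤ 1 + Real.log l := by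
  have h := harmonic_floor_le_one_add_log l hl
  rw [harmonic_eq_sum_Icc] at h
  push_cast at h
  refine le_trans (le_of_eq ?_) h
  have hfl : (⌊l⌋₊ : ℤ) = ⌊l⌋ := by rw [Int.natCast_floor_eq_floor (by linarith)]
  symm
  apply Finset.sum_bij (fun (n:ℕ) _ => (n:ℤ))
  · intro n hn
    rw [Finset.mem_Icc] at hn ⊢
    rw [← hfl]
    exact_mod_cast hn
  · intro n _ k _ h; exact_mod_cast h
  · intro a ha
    rw [Finset.mem_Icc, ← hfl] at ha
    refine ⟨a.toNat, ?_, by omega⟩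
    rw [Finset.mem_Icc]; omega
  · intro n _; simp

theorem inner_eq {m J J1 : ℕ} (χ : DirichletCharacter ℂ m) (a b : ℤ) (F : Finset (ℤ × ℤ)) :
    ∑ z ∈ F, (((if (J1:ℤ) ∣ (⟨a,b,z.1,z.2⟩ : Form).a then 1 else 0) * rt J ⟨a,b,z.1,z.2⟩ : ℕ) : ℂ) * χ (((⟨a,b,z.1,z.2⟩ : Form).disc : ℤ) : ZMod m) =
    (if (J1:ℤ) ∣ a then 1 else 0) * ∑ r ∈ Finset.range J, ∑ z ∈ F.filter (fun z => ((z.1 * (r:ℤ) + z.2 : ℤ) : ZMod J) = -((a:ZMod J)*r^3+(b:ZMod J)*r^2)), χ (dZ (a:ZMod m) (b:ZMod m) z.1 z.2) := by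
  simp only [Finset.sum_filter]
  rw [Finset.sum_comm, Finset.mul_sum]
  apply Finset.sum_congr rfl
  intro z _
  rw [dZ_eq]
  push_cast
  rw [mul_assoc]
  congr 1
  rw [rt]
  push_cast
  rw [Finset.sum_mul]
  apply Finset.sum_congr rfl
  intro r _
  have : ((J:ℤ) ∣ (⟨a,b,z.1,z.2⟩ : Form).ev (r:ℕ) 1) ↔ ((z.1:ZMod J) * (r:ZMod J) + (z.2:ZMod J)) = -((a:ZMod J)*r^3+(b:ZMod J)*r^2) := by
    rw [dvd_evZ, evZ]
    simp only [one_pow, mul_one]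
    constructor
    · intro h; linear_combination h
    · intro h; linear_combination h
  simp only [this]
  split_ifs <;> simp

section

theorem up_sum {V : ℕ} (hV : ∀ (i : ℝ × ℝ × ℝ) (a b c d a' b' c' d' : ℝ),
    BP V {t | RU i (a + t * a') (b + t * b') (c + t * c') (d + t * d')} ∧ BP V {t | RL i (a + t * a') (b + t * b') (c + t * c') (d + t * d')})
    {i : ℝ × ℝ × ℝ} (hl : 1 ≤ i.2.2) {m J : ℕ} [NeZero m] [NeZero J] (J1 : ℕ)
    (hmJ : Nat.Coprime m J) (χ : DirichletCharacter ℂ m) (hχ : χ^6 ≠ 1) :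
    ‖∑ f ∈ UpF i, (((if (J1:ℤ) ∣ f.a then 1 else 0) * rt J f : ℕ) : ℂ) * χ ((f.disc : ℤ) : ZMod m)‖ ≤
      V * (2400 * (m * Real.sqrt J * (1 + Real.log J) * (i.2.2^3 * (1 + Real.log i.2.2))) + 200 * ((m:ℝ)^2 * J * i.2.2^2)) := by
  unfold UpF
  rw [sum_F4]
  have hm1 : (1:ℝ) ≤ m := by exact_mod_cast NeZero.pos m
  have hJ1 : (1:ℝ) ≤ J := by exact_mod_cast NeZero.pos J
  have hlog := Real.log_nonneg hJ1
  have hV0 : (0:ℝ) ≤ V := Nat.cast_nonneg _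
  set W := m * Real.sqrt J * (1 + Real.log J) with hW
  have hW0 : 0 ≤ W := by positivity
  have step : ∀ a ∈ Finset.Icc (1:ℤ) ⌊i.2.2⌋, 
    ‖∑ b ∈ (Finset.range (3*a.toNat)).map ⟨fun n : ℕ => (n:ℤ), Nat.cast_injective⟩, ∑ z ∈ fset {z : ℤ × ℤ | RU i a b z.1 z.2}, 
    (((if (J1:ℤ) ∣ (⟨a,b,z.1,z.2⟩ : Form).a then 1 else 0) * rt J ⟨a,b,z.1,z.2⟩ : ℕ) : ℂ) * χ (((⟨a,b,z.1,z.2⟩ : Form).disc : ℤ) : ZMod m)‖ ≤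
     V * (2400 * (W * (i.2.2^3 * (1/a))) + 200 * ((m:ℝ)^2 * J * i.2.2)) := by
    intro a ha
    rw [Finset.mem_Icc] at ha
    have hal : (a:ℝ) ≤ i.2.2 := Int.le_floor.1 ha.2
    obtain ⟨n, rfl⟩ : ∃ n : ℕ, a = n := ⟨a.toNat, by omega⟩
    simp only [inner_eq]
    rw [← Finset.mul_sum, norm_mul]
    have h1 : ‖(if (J1:ℤ) ∣ (n:ℤ) then 1 else 0 : ℂ)‖ ≤ 1 := by split_ifs <;> simp
    refine (mul_le_mul h1 ?_ (norm_nonneg _) zero_le_one).trans (one_mul _).le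
    rw [Finset.sum_map]
    simp only [Function.Embedding.coeFn_mk, Int.toNat_natCast]
    have hn : 0 < n := by omega
    have h2 := up_a hV (i := i) (a := n) hn (by exact_mod_cast hal) hmJ χ hχ (fun b r => -(((n:ℤ):ZMod J)*r^3+((b:ℤ):ZMod J)*r^2))
    simp only [Int.cast_natCast] at h2 ⊢
    refine h2.trans ?_
    have hn' : (n:ℝ) ≤ i.2.2 := by exact_mod_cast hal
    rw [mul_one_div]
    gcongr
  refine (norm_sum_le_of_le _ step).trans ?_
  rw [← Finset.mul_sum, Finset.sum_add_distrib, ← Finset.mul_sum, ← Finset.mul_sum, ← Finset.mul_sum, Finset.sum_const, nsmul_eq_mul]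
  have hc : ((Finset.Icc (1:ℤ) ⌊i.2.2⌋).card : ℝ) ≤ i.2.2 := by
    rw [Int.card_Icc]
    have h1 := Int.floor_le i.2.2
    have h2 : (1:ℤ) ≤ ⌊i.2.2⌋ := Int.le_floor.2 (by simpa using hl)
    have : (((⌊i.2.2⌋ + 1 - 1).toNat : ℤ):ℝ) = (⌊i.2.2⌋:ℝ) := by rw [Int.toNat_of_nonneg (by omega)]; simp
    rw [Int.cast_natCast] at this
    rw [this]; exact h1
  have hs := sum_inv_Icc i.2.2 hl
  have h3 : 0 ≤ i.2.2 := by linarith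
  refine mul_le_mul_of_nonneg_left (add_le_add (by gcongr) ?_) hV0
  have : ((Finset.Icc (1:ℤ) ⌊i.2.2⌋).card : ℝ) * (200 * ((m:ℝ)^2 * J * i.2.2)) ≤ i.2.2 * (200 * ((m:ℝ)^2 * J * i.2.2)) := by gcongr
  nlinarith

theorem low_sum {V : ℕ} (hV : ∀ (i : ℝ × ℝ × ℝ) (a b c d a' b' c' d' : ℝ),
    BP V {t | RU i (a + t * a') (b + t * b') (c + t * c') (d + t * d')} ∧ BP V {t | RL i (a + t * a') (b + t * b') (c + t * c') (d + t * d')})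
    {i : ℝ × ℝ × ℝ} (hl : 1 ≤ i.2.2) {m J : ℕ} [NeZero m] [NeZero J] (J1 : ℕ)
    (hmJ : Nat.Coprime m J) (χ : DirichletCharacter ℂ m) (hχ : χ^6 ≠ 1) :
    ‖∑ f ∈ LowF i, (((if (J1:ℤ) ∣ f.a then 1 else 0) * rt J f : ℕ) : ℂ) * χ ((f.disc : ℤ) : ZMod m)‖ ≤
      V * (112000 * (m * Real.sqrt J * (1 + Real.log J) * i.2.2^3) + 7200 * ((m:ℝ)^2 * J * i.2.2^2)) := by
  unfold LowF
  rw [sum_F4]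
  have hJ1 : (1:ℝ) ≤ J := by exact_mod_cast NeZero.pos J
  have hlog := Real.log_nonneg hJ1
  have hV0 : (0:ℝ) ≤ V := Nat.cast_nonneg _
  set W := m * Real.sqrt J * (1 + Real.log J) with hW
  have hW0 : 0 ≤ W := by positivity
  set E := V * (14000 * (W * i.2.2^2) + 900 * ((m:ℝ)^2 * J * i.2.2)) with hE
  have h3 : 0 ≤ i.2.2 := by linarith
  have hE0 : 0 ≤ E := by positivity
  have step : ∀ a ∈ Finset.Icc (1:ℤ) ⌊8*i.2.2⌋, 
    ‖∑ b ∈ KI i.2.2, ∑ z ∈ fset {z : ℤ × ℤ | RL i a b z.1 z.2}, 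
    (((if (J1:ℤ) ∣ (⟨a,b,z.1,z.2⟩ : Form).a then 1 else 0) * rt J ⟨a,b,z.1,z.2⟩ : ℕ) : ℂ) * χ (((⟨a,b,z.1,z.2⟩ : Form).disc : ℤ) : ZMod m)‖ ≤ E := by
    intro a ha
    rw [Finset.mem_Icc] at ha
    obtain ⟨n, rfl⟩ : ∃ n : ℕ, a = n := ⟨a.toNat, by omega⟩
    simp only [inner_eq]
    rw [← Finset.mul_sum, norm_mul]
    have h1 : ‖(if (J1:ℤ) ∣ (n:ℤ) then 1 else 0 : ℂ)‖ ≤ 1 := by split_ifs <;> simp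
    refine (mul_le_mul h1 ?_ (norm_nonneg _) zero_le_one).trans (one_mul _).le
    have h2 := low_a hV (i := i) hl (a := n) hmJ χ hχ (fun b r => -(((n:ℤ):ZMod J)*r^3+((b:ℤ):ZMod J)*r^2))
    simp only [Int.cast_natCast] at h2 ⊢
    exact h2
  refine (norm_sum_le_of_le _ step).trans ?_
  rw [Finset.sum_const, nsmul_eq_mul]
  have hc : ((Finset.Icc (1:ℤ) ⌊8*i.2.2⌋).card : ℝ) ≤ 8*i.2.2 := by
    rw [Int.card_Icc]
    have h1 := Int.floor_le (8*i.2.2)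
    have h2 : (1:ℤ) ≤ ⌊8*i.2.2⌋ := Int.le_floor.2 (by push_cast; linarith)
    have : (((⌊8*i.2.2⌋ + 1 - 1).toNat : ℤ):ℝ) = (⌊8*i.2.2⌋:ℝ) := by rw [Int.toNat_of_nonneg (by omega)]; simp
    rw [Int.cast_natCast] at this
    rw [this]; exact h1
  refine (mul_le_mul_of_nonneg_right hc hE0).trans (le_of_eq ?_)
  rw [hE]; ring

/-- The domain finset. -/
def DomF (i : ℝ × ℝ × ℝ) : Finset Form := UpF i ∪ LowF i

theorem mem_DomF {V : ℕ} (hV : ∀ (i : ℝ × ℝ × ℝ) (a b c d a' b' c' d' : ℝ),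
    BP V {t | RU i (a + t * a') (b + t * b') (c + t * c') (d + t * d')} ∧ BP V {t | RL i (a + t * a') (b + t * b') (c + t * c') (d + t * d')}) {σ : ℤ} (hσ : sgx σ) {Y l : ℝ} (hl : 0 ≤ l) (hY : Y ≤ l^4) (f : Form) :
    f ∈ DomF ((σ:ℝ),Y,l) ↔ f ∈ Dom ∧ dd σ Y f := by
  unfold DomF
  rw [Finset.mem_union, mem_UpF hV hσ hl hY, mem_LowF hV hσ hl hY, Dom, Set.mem_union]
  tauto

theorem dom_sum_J {V : ℕ} (hV : ∀ (i : ℝ × ℝ × ℝ) (a b c d a' b' c' d' : ℝ),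
    BP V {t | RU i (a + t * a') (b + t * b') (c + t * c') (d + t * d')} ∧ BP V {t | RL i (a + t * a') (b + t * b') (c + t * c') (d + t * d')})
    {σ : ℤ} (hσ : sgx σ) {Y l : ℝ} (hl : 1 ≤ l) (hY : Y ≤ l^4) {m J : ℕ} [NeZero m] [NeZero J] (J1 : ℕ)
    (hmJ : Nat.Coprime m J) (χ : DirichletCharacter ℂ m) (hχ : χ^6 ≠ 1) :
    ‖∑ f ∈ DomF ((σ:ℝ),Y,l), (((if (J1:ℤ) ∣ f.a then 1 else 0) * rt J f : ℕ) : ℂ) * χ ((f.disc : ℤ) : ZMod m)‖ ≤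
      V * (115000 * (m * Real.sqrt J * (1 + Real.log J) * (l^3 * (1 + Real.log l))) + 7400 * ((m:ℝ)^2 * J * l^2)) := by
  have hd : Disjoint (UpF ((σ:ℝ),Y,l)) (LowF ((σ:ℝ),Y,l)) := by
    rw [Finset.disjoint_left]
    intro f h1 h2
    rw [mem_UpF hV hσ (by linarith) hY] at h1
    rw [mem_LowF hV hσ (by linarith) hY] at h2
    exact h2.1.2.1 h1.1.2.2.2
  unfold DomF
  rw [Finset.sum_union hd]
  refine (norm_add_le _ _).trans ?_
  have h1 := up_sum hV (i := ((σ:ℝ),Y,l)) hl J1 hmJ χ hχ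
  have h2 := low_sum hV (i := ((σ:ℝ),Y,l)) hl J1 hmJ χ hχ
  simp only at h1 h2
  have hJ1 : (1:ℝ) ≤ J := by exact_mod_cast NeZero.pos J
  have hlog := Real.log_nonneg hJ1
  have hlog' := Real.log_nonneg hl
  set W := m * Real.sqrt J * (1 + Real.log J) with hW
  have hW0 : 0 ≤ W := by positivity
  have hV0 : (0:ℝ) ≤ V := Nat.cast_nonneg _
  have h3 : V * (W * l^3) ≤ V * (W * (l^3 * (1 + Real.log l))) := by
    gcongr
    exact le_mul_of_one_le_right (by positivity) (by linarith)
  have h4 : 0 ≤ V * (W * l^3) := by positivity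
  have h5 : 0 ≤ (V:ℝ) * ((m:ℝ)^2 * J * l^2) := by positivity
  nlinarith

theorem dom_sum_thn {V : ℕ} (hV : ∀ (i : ℝ × ℝ × ℝ) (a b c d a' b' c' d' : ℝ),
    BP V {t | RU i (a + t * a') (b + t * b') (c + t * c') (d + t * d')} ∧ BP V {t | RL i (a + t * a') (b + t * b') (c + t * c') (d + t * d')})
    {σ : ℤ} (hσ : sgx σ) {Y l : ℝ} (hl : 1 ≤ l) (hY : Y ≤ l^4) {m : ℕ} [NeZero m] {j : Finset ℕ}
    (hj : ∀ p ∈ j, p.Prime) (hjm : ∀ p ∈ j, Nat.Coprime m p) (χ : DirichletCharacter ℂ m) (hχ : χ^6 ≠ 1) :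
    ‖∑ f ∈ DomF ((σ:ℝ),Y,l), (thn j f : ℂ) * χ ((f.disc : ℤ) : ZMod m)‖ ≤
      2^j.card * (V * (115000 * (m * Real.sqrt (∏ p ∈ j, p : ℕ) * (1 + Real.log (∏ p ∈ j, p : ℕ)) * (l^3 * (1 + Real.log l))) + 7400 * ((m:ℝ)^2 * (∏ p ∈ j, p : ℕ) * l^2))) := by
  have e : ∀ f, (thn j f : ℂ) * χ ((f.disc : ℤ) : ZMod m) = ∑ t ∈ j.powerset, 
      (((if ((∏ p ∈ t, p : ℕ) : ℤ) ∣ f.a then 1 else 0) * rt (∏ p ∈ j \ t, p) f : ℕ) : ℂ) * χ ((f.disc : ℤ) : ZMod m) := by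
    intro f
    rw [thn_dec j hj, ← Finset.sum_mul]
    push_cast; rfl
  simp only [e]
  rw [Finset.sum_comm]
  have step : ∀ t ∈ j.powerset, ‖∑ f ∈ DomF ((σ:ℝ),Y,l), (((if ((∏ p ∈ t, p : ℕ) : ℤ) ∣ f.a then 1 else 0) * rt (∏ p ∈ j \ t, p) f : ℕ) : ℂ) * χ ((f.disc : ℤ) : ZMod m)‖ ≤ (V * (115000 * (m * Real.sqrt (∏ p ∈ j, p : ℕ) * (1 + Real.log (∏ p ∈ j, p : ℕ)) * (l^3 * (1 + Real.log l))) + 7400 * ((m:ℝ)^2 * (∏ p ∈ j, p : ℕ) * l^2))) := by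
    intro t ht
    have hpos : 0 < ∏ p ∈ j \ t, p := Finset.prod_pos (fun p hp => (hj p (Finset.mem_sdiff.1 hp).1).pos)
    haveI : NeZero (∏ p ∈ j \ t, p) := ⟨hpos.ne'⟩
    have h1 := dom_sum_J hV hσ hl hY (m := m) (J := ∏ p ∈ j \ t, p) (∏ p ∈ t, p) 
      (Nat.Coprime.prod_right (fun p hp => hjm p (Finset.mem_sdiff.1 hp).1)) χ hχ
    refine h1.trans ?_
    have hle : ((∏ p ∈ j \ t, p : ℕ) : ℝ) ≤ (∏ p ∈ j, p : ℕ) := by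
      exact_mod_cast Finset.prod_le_prod_of_subset_of_one_le' Finset.sdiff_subset (fun p hp _ => (hj p hp).one_le)
    have hp1 : (1:ℝ) ≤ (∏ p ∈ j \ t, p : ℕ) := by exact_mod_cast hpos
    have hlog' := Real.log_nonneg hl
    have hlog2 := Real.log_nonneg hp1
    have hlog3 := Real.log_le_log (by linarith) hle
    have hs := Real.sqrt_le_sqrt hle
    have h0 : 0 ≤ l := by linarith
    gcongr
  refine (norm_sum_le_of_le _ step).trans ?_
  rw [Finset.sum_const, nsmul_eq_mul, Finset.card_powerset]
  push_cast
  rfl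

end
end Form
end

set_option linter.all false
open scoped Classical
noncomputable section
namespace Form

theorem red_ab {f : Form} (hD0 : f.disc ≠ 0) (h : f ∈ Red) {l : ℝ} (hl : 1 ≤ l) (hD : |(f.disc:ℝ)| ≤ l^4) :
    (f.a:ℝ) ≤ 2*l ∧ |(f.b:ℝ)| ≤ 5*l := by
  have ha := h.1
  have haR : (0:ℝ) < f.a := by exact_mod_cast ha
  obtain ⟨z, hz⟩ := Z_exists ha.ne' hD0
  have hfd := (fd_iff ha.ne' hz).1 h.2
  rw [mem_fd_iff] at hfd
  obtain ⟨b', c', d', hb, hc, hd, h1, h2, h3, h4⟩ := prm ha.ne' hz (by linarith) hD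
  have hy0 := z.im_pos
  set x := z.re
  set y := z.im
  obtain ⟨f1, f2, f3⟩ := hfd
  have hy2 : 3/4 ≤ y^2 := by nlinarith
  have hy : 4/5 ≤ y := by nlinarith
  have hy3 : 1/2 ≤ y^3 := by nlinarith
  have e1 : (f.a:ℝ) ≤ 2*l := by
    apply le_of_sq_le_sq _ (by linarith)
    nlinarith [sq_nonneg (f.a:ℝ)]
  have e2 : |b'| ≤ 2*l := by
    apply abs_le_of_sq_le_sq _ (by linarith)
    nlinarith [sq_nonneg b']
  refine ⟨e1, ?_⟩
  have hx : |x| ≤ 1/2 := abs_le.2 ⟨f3, f2⟩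
  rw [hb]
  refine (abs_sub _ _).trans ?_
  rw [abs_mul, abs_of_pos (by linarith : 0 < 3*(f.a:ℝ))]
  nlinarith [abs_nonneg x]

def KN (N : ℝ) : Finset ℤ := KI (N/8)

theorem mem_KN (N : ℝ) (k : ℤ) : k ∈ KN N ↔ |(k:ℝ)| ≤ N := by
  rw [KN, mem_KI]; rw [show 8*(N/8) = N by ring]

theorem card_KN {N : ℝ} (hN : 0 ≤ N) : ((KN N).card : ℝ) ≤ 2*N+1 := by
  have := card_Icc_le (-(8*(N/8))) (16*(N/8)) (by linarith)
  unfold KN KI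
  linarith

theorem card_KN0 {N : ℝ} (hN : 0 ≤ N) : (((KN N).erase 0).card : ℝ) ≤ 2*N := by
  have h := card_KN hN
  have h0 : (0:ℤ) ∈ KN N := by rw [mem_KN]; simpa using hN
  rw [Finset.card_erase_of_mem h0, Nat.cast_sub (Finset.card_pos.2 ⟨0, h0⟩)]
  push_cast; linarith

theorem sum_KN {N : ℝ} (hN : 1 ≤ N) : ∑ x ∈ KN N, 1/|(x:ℝ)| ≤ 2*(1+Real.log N) := by
  have h := sum_inv_Icc N hN
  have e : ∀ x ∈ KN N, 1/|(x:ℝ)| ≤ (if 0 < x then 1/(x:ℝ) else 0) + (if x < 0 then 1/((-x:ℤ):ℝ) else 0) := by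
    intro x _
    rcases lt_trichotomy x 0 with hx | rfl | hx
    · rw [if_neg (by omega), if_pos hx, abs_of_neg (by exact_mod_cast hx)]; simp
    · simp
    · rw [if_pos hx, if_neg (by omega), abs_of_pos (by exact_mod_cast hx)]; simp
  refine (Finset.sum_le_sum e).trans ?_
  rw [Finset.sum_add_distrib, ← Finset.sum_filter, ← Finset.sum_filter, two_mul]
  apply add_le_add
  · refine le_trans (le_of_eq ?_) h
    apply Finset.sum_congr _ (fun _ _ => rfl)
    ext x
    rw [Finset.mem_filter, mem_KN, Finset.mem_Icc, Int.le_floor]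
    constructor
    · rintro ⟨h1, h2⟩; exact ⟨h2, (le_abs_self _).trans h1⟩
    · rintro ⟨h1, h2⟩; exact ⟨by rw [abs_of_nonneg (by exact_mod_cast (by omega : 0 ≤ x))]; exact h2, by omega⟩
  · refine le_trans (le_of_eq ?_) h
    apply Finset.sum_bij (fun x _ => -x)
    · intro x hx
      rw [Finset.mem_filter, mem_KN] at hx
      rw [Finset.mem_Icc, Int.le_floor]
      refine ⟨by omega, ?_⟩
      push_cast; exact (neg_le_abs _).trans hx.1
    · intro x _ y _ h; simpa using h
    · intro x hx
      rw [Finset.mem_Icc, Int.le_floor] at hx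
      refine ⟨-x, ?_, by simp⟩
      rw [Finset.mem_filter, mem_KN]
      refine ⟨?_, by omega⟩
      push_cast
      rw [abs_neg, abs_of_nonneg (by exact_mod_cast (by omega : 0 ≤ x))]; exact hx.2
    · intro x _; rfl

def hyp (N : ℝ) : Finset (ℤ × ℤ) := (KN N ×ˢ KN N).filter (fun z => |(z.1:ℝ)*z.2| ≤ N)

theorem mem_hyp {N : ℝ} {x y : ℤ} : (x,y) ∈ hyp N ↔ |(x:ℝ)| ≤ N ∧ |(y:ℝ)| ≤ N ∧ |(x:ℝ)*y| ≤ N := by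
  rw [hyp, Finset.mem_filter, Finset.mem_product, mem_KN, mem_KN, and_assoc]

theorem card_hyp {N : ℝ} (hN : 1 ≤ N) : ((hyp N).card : ℝ) ≤ 9*N*(1+Real.log N) := by
  have hl := Real.log_nonneg hN
  rw [hyp, Finset.card_filter, Finset.sum_product]
  push_cast
  have e : ∀ x ∈ KN N, (∑ y ∈ KN N, if |(x:ℝ)*y| ≤ N then (1:ℝ) else 0) ≤ (if x = 0 then 2*N else 0) + 2*N*(1/|(x:ℝ)|) + 1 := by
    intro x _
    rw [Finset.sum_boole]
    by_cases hx : x = 0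
    · rw [if_pos hx]
      have : ((Finset.filter (fun y : ℤ => |(x:ℝ)*y| ≤ N) (KN N)).card : ℝ) ≤ (KN N).card := by
        exact_mod_cast Finset.card_filter_le _ _
      have h1 := card_KN (by linarith : 0 ≤ N)
      have : 0 ≤ 2*N*(1/|(x:ℝ)|) := by positivity
      linarith
    · rw [if_neg hx, zero_add]
      have hx' : 0 < |(x:ℝ)| := abs_pos.2 (by exact_mod_cast hx)
      have : ((Finset.filter (fun y : ℤ => |(x:ℝ)*y| ≤ N) (KN N)).card : ℝ) ≤ (KN (N/|(x:ℝ)|)).card := by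
        refine Nat.cast_le.2 (Finset.card_le_card ?_)
        intro y hy
        rw [Finset.mem_filter] at hy
        rw [mem_KN, le_div_iff₀ hx', mul_comm, ← abs_mul]
        exact hy.2
      have h1 := card_KN (by positivity : 0 ≤ N/|(x:ℝ)|)
      have : 2*N*(1/|(x:ℝ)|) = 2*(N/|(x:ℝ)|) := by ring
      linarith
  refine (Finset.sum_le_sum e).trans ?_
  rw [Finset.sum_add_distrib, Finset.sum_add_distrib, ← Finset.mul_sum, Finset.sum_ite_eq']
  have h1 := sum_KN hN
  have h2 := card_KN (by linarith : 0 ≤ N)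
  have h3 : (if (0:ℤ) ∈ KN N then 2*N else 0) ≤ 2*N := by split_ifs <;> linarith
  simp only [Finset.sum_const, nsmul_eq_mul, mul_one]
  have h4 : 2*N*∑ x ∈ KN N, 1/|(x:ℝ)| ≤ 2*N*(2*(1+Real.log N)) := by gcongr
  nlinarith

/-- four nonzero integers of bounded product -/
def quad (N : ℝ) : Finset (ℤ × ℤ × ℤ × ℤ) := (((KN N).erase 0) ×ˢ ((KN N).erase 0) ×ˢ ((KN N).erase 0) ×ˢ ((KN N).erase 0)).filter
  (fun z => |(z.1:ℝ)*z.2.1*z.2.2.1*z.2.2.2| ≤ N)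

theorem card_quad {N : ℝ} (hN : 1 ≤ N) : ((quad N).card : ℝ) ≤ 16*N*(1+Real.log N)^3 := by
  have hl := Real.log_nonneg hN
  rw [quad, Finset.card_filter, Finset.sum_product]
  simp only [Finset.sum_product]
  push_cast
  set K := (KN N).erase 0
  have e : ∀ x ∈ K, ∀ y ∈ K, ∀ z ∈ K, (∑ w ∈ K, if |(x:ℝ)*y*z*w| ≤ N then (1:ℝ) else 0) ≤ 2*N*((1/|(x:ℝ)|)*((1/|(y:ℝ)|)*(1/|(z:ℝ)|))) := by
    intro x hx y hy z hz
    rw [Finset.sum_boole]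
    have nz : ∀ {x : ℤ}, x ∈ K → 0 < |(x:ℝ)| := fun hx => abs_pos.2 (by exact_mod_cast (Finset.mem_erase.1 hx).1)
    have hx' := nz hx
    have hy' := nz hy
    have hz' := nz hz
    have h0 : 0 < |(x:ℝ)*y*z| := by rw [abs_mul, abs_mul]; positivity
    have : ((Finset.filter (fun w : ℤ => |(x:ℝ)*y*z*w| ≤ N) K).card : ℝ) ≤ ((KN (N/|(x:ℝ)*y*z|)).erase 0).card := by
      refine Nat.cast_le.2 (Finset.card_le_card ?_)
      intro w hw
      rw [Finset.mem_filter] at hw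
      rw [Finset.mem_erase, mem_KN, le_div_iff₀ h0, mul_comm, ← abs_mul]
      exact ⟨(Finset.mem_erase.1 hw.1).1, hw.2⟩
    have h1 := card_KN0 (by positivity : 0 ≤ N/|(x:ℝ)*y*z|)
    have : 2*N*((1/|(x:ℝ)|)*((1/|(y:ℝ)|)*(1/|(z:ℝ)|))) = 2*(N/|(x:ℝ)*y*z|) := by rw [abs_mul, abs_mul]; field_simp
    linarith
  refine (Finset.sum_le_sum fun x hx => Finset.sum_le_sum fun y hy => Finset.sum_le_sum fun z hz => e x hx y hy z hz).trans ?_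
  simp only [← Finset.mul_sum, ← Finset.sum_mul]
  have hs : ∑ x ∈ K, 1/|(x:ℝ)| ≤ 2*(1+Real.log N) := 
    (Finset.sum_le_sum_of_subset_of_nonneg (Finset.erase_subset _ _) (fun _ _ _ => by positivity)).trans (sum_KN hN)
  have hs0 : 0 ≤ ∑ x ∈ K, 1/|(x:ℝ)| := Finset.sum_nonneg (fun _ _ => by positivity)
  calc _ ≤ 2*N*((2*(1+Real.log N)) * ((2*(1+Real.log N)) * (2*(1+Real.log N)))) := by gcongr
    _ = _ := by ring

theorem red_disc {f : Form} (h : f.Fd) : f.disc ≠ 0 := by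
  intro h0
  rcases h with h | h <;> rw [rD_eq, h0] at h <;> simp at h

theorem up_disc {f : Form} (h : f.Hi) : f.disc ≠ 0 := by
  intro h0
  rcases h with h | h <;> rw [rD_eq, h0] at h <;> simp at h

theorem log30 {l : ℝ} (hl : 1 ≤ l) : 1 + Real.log (30*l^2) ≤ 30*(1+Real.log l) := by
  have h := Real.log_nonneg hl
  rw [Real.log_mul (by norm_num) (by positivity), Real.log_pow]
  have := Real.log_le_sub_one_of_pos (show (0:ℝ) < 30 by norm_num)
  push_cast; linarith

theorem red_cnt {l : ℝ} (hl : 1 ≤ l) : {f | f ∈ Red ∧ |(f.disc:ℝ)| < l^4}.Finite ∧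
    ({f | f ∈ Red ∧ |(f.disc:ℝ)| < l^4}.ncard : ℝ) ≤ 8100^2 * l^4 * (1+Real.log l)^2 := by
  set N := 30*l^2 with hN
  have hN1 : 1 ≤ N := by rw [hN]; nlinarith
  have hll := Real.log_nonneg hl
  set g : Form → (ℤ × ℤ) × (ℤ × ℤ) := fun f => ((f.a,f.d),(f.b,f.c)) with hg
  have hginj : Function.Injective g := by
    rintro ⟨a,b,c,d⟩ ⟨a',b',c',d'⟩ h
    simp only [hg, Prod.mk.injEq] at h
    obtain ⟨⟨rfl, rfl⟩, rfl, rfl⟩ := h; rfl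
  have hmaps : ∀ f ∈ {f | f ∈ Red ∧ |(f.disc:ℝ)| < l^4}, g f ∈ (↑(hyp N ×ˢ hyp N) : Set _) := by
    rintro f ⟨h1, h2⟩
    obtain ⟨r1, r2, r3, r4, r5⟩ := red_size (red_disc h1.2) h1 hl h2.le
    have ha : (1:ℝ) ≤ f.a := by exact_mod_cast h1.1
    rw [Finset.mem_coe, Finset.mem_product]
    simp only [hg]
    rw [mem_hyp, mem_hyp]
    refine ⟨⟨by rw [abs_of_nonneg (by linarith)]; exact r5, ?_, r1⟩, r3, r4, r2⟩
    refine le_trans ?_ r1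
    rw [abs_mul]
    exact le_mul_of_one_le_left (abs_nonneg _) (ha.trans (le_abs_self _))
  constructor
  · apply Set.Finite.of_finite_image _ hginj.injOn
    exact (Finset.finite_toSet (hyp N ×ˢ hyp N)).subset (by rintro _ ⟨f, hf, rfl⟩; exact hmaps f hf)
  · have h1 := Set.ncard_le_ncard_of_injOn g hmaps hginj.injOn (Finset.finite_toSet _)
    rw [Set.ncard_coe_finset, Finset.card_product] at h1
    have h1' : ({f | f ∈ Red ∧ |(f.disc:ℝ)| < l^4}.ncard : ℝ) ≤ (hyp N).card * (hyp N).card := by exact_mod_cast h1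
    refine h1'.trans ?_
    have h2 : ((hyp N).card : ℝ) ≤ 8100 * l^2 * (1+Real.log l) := by
      refine (card_hyp hN1).trans ?_
      have := log30 hl
      rw [← hN] at this
      calc _ ≤ 9*N*(30*(1+Real.log l)) := by gcongr
        _ = _ := by rw [hN]; ring
    calc _ ≤ (8100 * l^2 * (1+Real.log l)) * (8100 * l^2 * (1+Real.log l)) := by gcongr
      _ = _ := by ring

end Form
end

set_option linter.all false
open scoped Classical
noncomputable section
namespace Form

theorem quadset (x : Form → ℤ) (t : Form → ℤ × ℤ × ℤ) (β γ : ℤ × ℤ × ℤ → ℤ)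
    (hinj : ∀ f g, x f = x g → t f = t g → f = g) (A : Set Form) (K : Finset ℤ)
    (hA : ∀ f ∈ A, t f ∈ K ×ˢ K ×ˢ K ∧ x f^2 + β (t f) * x f + γ (t f) = 0) :
    A.Finite ∧ (A.ncard : ℝ) ≤ 2*(K.card:ℝ)^3 := by
  set g : Form → Bool × (ℤ × ℤ × ℤ) := fun f => (decide (0 ≤ 2*x f + β (t f)), t f) with hg
  have hgi : Set.InjOn g A := by
    intro f hf f' hf' h
    simp only [hg, Prod.mk.injEq, decide_eq_decide] at h
    obtain ⟨h1, h2⟩ := h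
    have e1 := (hA f hf).2
    have e2 := (hA f' hf').2
    rw [← h2] at e2 h1
    refine hinj f f' ?_ h2
    have h3 : (x f - x f') * (x f + x f' + β (t f)) = 0 := by linear_combination e1 - e2
    rcases mul_eq_zero.1 h3 with h3 | h3
    · linarith
    · by_cases h4 : 0 ≤ 2*x f + β (t f)
      · have := h1.1 h4; linarith
      · have h5 : ¬ (0 ≤ 2*x f' + β (t f)) := fun h => h4 (h1.2 h)
        push Not at h5 h4
        linarith
  have hm : ∀ f ∈ A, g f ∈ (↑((Finset.univ : Finset Bool) ×ˢ (K ×ˢ K ×ˢ K)) : Set _) := by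
    intro f hf
    simp only [hg]
    rw [Finset.mem_coe, Finset.mem_product]
    exact ⟨Finset.mem_univ _, (hA f hf).1⟩
  constructor
  · exact Set.Finite.of_finite_image ((Finset.finite_toSet _).subset (by rintro _ ⟨f, hf, rfl⟩; exact hm f hf)) hgi
  · have h1 := Set.ncard_le_ncard_of_injOn g hm hgi (Finset.finite_toSet _)
    rw [Set.ncard_coe_finset, Finset.card_product, Finset.card_product, Finset.card_product, Finset.card_univ, Fintype.card_bool] at h1
    calc (A.ncard:ℝ) ≤ ((2*(K.card*(K.card*K.card)) : ℕ) : ℝ) := by exact_mod_cast h1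
      _ = _ := by push_cast; ring

theorem bd_cnt {l : ℝ} (hl : 1 ≤ l) : {f | f ∈ Bd ∧ |(f.disc:ℝ)| < l^4}.Finite ∧
    ({f | f ∈ Bd ∧ |(f.disc:ℝ)| < l^4}.ncard : ℝ) ≤ 12*(17*l)^3 := by
  set A := {f | f ∈ Bd ∧ |(f.disc:ℝ)| < l^4} with hA
  set K := KI l
  have hK : (K.card:ℝ) ≤ 17*l := card_KI l hl
  have hbox : ∀ f ∈ A, f.a ∈ K ∧ f.b ∈ K ∧ f.c ∈ K ∧ f.d ∈ K := by
    rintro f ⟨h1, h2⟩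
    obtain ⟨r1, r2, r3, r4⟩ := low_size (red_disc h1.1.2.2) h1.1 (by linarith) h2.le
    have ha : (0:ℝ) < f.a := by exact_mod_cast h1.1.1
    simp only [K, mem_KI]
    exact ⟨by rw [abs_of_pos ha]; exact r1, r2, r3, r4⟩
  have hb : ∀ (β γ : ℤ × ℤ × ℤ → ℤ), (A ∩ {f | f.b^2 + β (f.a,f.c,f.d) * f.b + γ (f.a,f.c,f.d) = 0}).Finite ∧
      ((A ∩ {f | f.b^2 + β (f.a,f.c,f.d) * f.b + γ (f.a,f.c,f.d) = 0}).ncard : ℝ) ≤ 2*(K.card:ℝ)^3 := by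
    intro β γ
    refine quadset (fun f => f.b) (fun f => (f.a,f.c,f.d)) β γ ?_ _ K ?_
    · rintro ⟨a,b,c,d⟩ ⟨a',b',c',d'⟩ h1 h2
      simp only [Prod.mk.injEq] at h1 h2
      obtain ⟨rfl, rfl, rfl⟩ := h2; subst h1; rfl
    · rintro f ⟨h1, h2⟩
      obtain ⟨r1, r2, r3, r4⟩ := hbox f h1
      exact ⟨by simp only [Finset.mem_product]; exact ⟨r1, r3, r4⟩, h2⟩
  have hd : ∀ (β γ : ℤ × ℤ × ℤ → ℤ), (A ∩ {f | f.d^2 + β (f.a,f.b,f.c) * f.d + γ (f.a,f.b,f.c) = 0}).Finite ∧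
      ((A ∩ {f | f.d^2 + β (f.a,f.b,f.c) * f.d + γ (f.a,f.b,f.c) = 0}).ncard : ℝ) ≤ 2*(K.card:ℝ)^3 := by
    intro β γ
    refine quadset (fun f => f.d) (fun f => (f.a,f.b,f.c)) β γ ?_ _ K ?_
    · rintro ⟨a,b,c,d⟩ ⟨a',b',c',d'⟩ h1 h2
      simp only [Prod.mk.injEq] at h1 h2
      obtain ⟨rfl, rfl, rfl⟩ := h2; subst h1; rfl
    · rintro f ⟨h1, h2⟩
      obtain ⟨r1, r2, r3, r4⟩ := hbox f h1
      exact ⟨by simp only [Finset.mem_product]; exact ⟨r1, r2, r3⟩, h2⟩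
  obtain ⟨f1, n1⟩ := hb (fun t => 3*t.2.2) (fun t => -3*t.1*t.2.1-t.2.1^2)
  obtain ⟨f2, n2⟩ := hb (fun t => t.2.1) (fun t => -3*t.1*t.2.1-9*t.1*t.2.2)
  obtain ⟨f3, n3⟩ := hb (fun t => -t.2.1) (fun t => -3*t.1*t.2.1+9*t.1*t.2.2)
  obtain ⟨f4, n4⟩ := hb (fun t => 2*t.1+t.2.1) (fun t => t.1^2+t.1*t.2.1-t.1*t.2.2)
  obtain ⟨f5, n5⟩ := hb (fun t => -2*t.1-t.2.1) (fun t => t.1^2+t.1*t.2.1+t.1*t.2.2)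
  obtain ⟨f6, n6⟩ := hd (fun t => -t.2.1) (fun t => t.1*t.2.2-t.1^2)
  set A1 := A ∩ {f | f.b^2 + (fun t : ℤ × ℤ × ℤ => 3*t.2.2) (f.a,f.c,f.d) * f.b + (fun t : ℤ × ℤ × ℤ => -3*t.1*t.2.1-t.2.1^2) (f.a,f.c,f.d) = 0} with hA1
  set A2 := A ∩ {f | f.b^2 + (fun t : ℤ × ℤ × ℤ => t.2.1) (f.a,f.c,f.d) * f.b + (fun t : ℤ × ℤ × ℤ => -3*t.1*t.2.1-9*t.1*t.2.2) (f.a,f.c,f.d) = 0} with hA2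
  set A3 := A ∩ {f | f.b^2 + (fun t : ℤ × ℤ × ℤ => -t.2.1) (f.a,f.c,f.d) * f.b + (fun t : ℤ × ℤ × ℤ => -3*t.1*t.2.1+9*t.1*t.2.2) (f.a,f.c,f.d) = 0} with hA3
  set A4 := A ∩ {f | f.b^2 + (fun t : ℤ × ℤ × ℤ => 2*t.1+t.2.1) (f.a,f.c,f.d) * f.b + (fun t : ℤ × ℤ × ℤ => t.1^2+t.1*t.2.1-t.1*t.2.2) (f.a,f.c,f.d) = 0} with hA4
  set A5 := A ∩ {f | f.b^2 + (fun t : ℤ × ℤ × ℤ => -2*t.1-t.2.1) (f.a,f.c,f.d) * f.b + (fun t : ℤ × ℤ × ℤ => t.1^2+t.1*t.2.1+t.1*t.2.2) (f.a,f.c,f.d) = 0} with hA5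
  set A6 := A ∩ {f | f.d^2 + (fun t : ℤ × ℤ × ℤ => -t.2.1) (f.a,f.b,f.c) * f.d + (fun t : ℤ × ℤ × ℤ => t.1*t.2.2-t.1^2) (f.a,f.b,f.c) = 0} with hA6
  have hcov : ∀ f ∈ A, (0 < f.disc ∧ (f ∈ A1 ∨ f ∈ A2 ∨ f ∈ A3)) ∨ (f.disc < 0 ∧ (f ∈ A4 ∨ f ∈ A5 ∨ f ∈ A6)) := by
    intro f hf
    have hFd := hf.1.1.2.2
    have hn : ¬ f.Fdo := fun h => hf.1.2 ⟨hf.1.1.1, hf.1.1.2.1, h⟩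
    unfold Fdo rFdo at hn
    push Not at hn
    rcases hFd with ⟨h1, h2, h3, h4⟩ | ⟨h1, h2, h3, h4⟩
    · left
      refine ⟨by rw [rD_eq] at h1; exact_mod_cast h1, ?_⟩
      have hn1 := hn.1 h1
      by_contra hcon
      push Not at hcon
      obtain ⟨c1, c2, c3⟩ := hcon
      have i1 : rP f.a f.b f.c f.d < rR f.a f.b f.c f.d := lt_of_le_of_ne h2 (fun h => c1 ⟨hf, by
        simp only [rP, rR, Set.mem_setOf_eq] at h ⊢
        have : f.b^2-3*f.a*f.c = f.c^2-3*f.b*f.d := by exact_mod_cast h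
        linear_combination this⟩)
      have i2 : -rQ f.a f.b f.c f.d < rP f.a f.b f.c f.d := lt_of_le_of_ne h3 (fun h => c2 ⟨hf, by
        simp only [rP, rQ, Set.mem_setOf_eq] at h ⊢
        have : -(f.b*f.c-9*f.a*f.d) = f.b^2-3*f.a*f.c := by exact_mod_cast h
        linear_combination -this⟩)
      have i3 : rQ f.a f.b f.c f.d < rP f.a f.b f.c f.d := lt_of_le_of_ne h4 (fun h => c3 ⟨hf, by
        simp only [rP, rQ, Set.mem_setOf_eq] at h ⊢
        have : (f.b*f.c-9*f.a*f.d) = f.b^2-3*f.a*f.c := by exact_mod_cast h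
        linear_combination -this⟩)
      have := hn1 i1 i2
      linarith
    · right
      refine ⟨by rw [rD_eq] at h1; exact_mod_cast h1, ?_⟩
      have hn1 := hn.2 h1
      by_contra hcon
      push Not at hcon
      obtain ⟨c4, c5, c6⟩ := hcon
      have i1 := lt_of_le_of_ne h2 (fun h => c6 ⟨hf, by
        simp only [Set.mem_setOf_eq] at h ⊢
        have : 0 = f.d^2-f.b*f.d+f.a*f.c-f.a^2 := by exact_mod_cast h
        linear_combination -this⟩)
      have i2 := lt_of_le_of_ne h3 (fun h => c4 ⟨hf, by
        simp only [Set.mem_setOf_eq] at h ⊢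
        have : 0 = (f.a+f.b)^2+f.a*f.c+f.b*f.c-f.a*f.d := by exact_mod_cast h
        linear_combination -this⟩)
      have i3 := lt_of_le_of_ne h4 (fun h => c5 ⟨hf, by
        simp only [Set.mem_setOf_eq] at h ⊢
        have : 0 = (f.a-f.b)^2+f.a*f.c-f.b*f.c+f.a*f.d := by exact_mod_cast h
        linear_combination -this⟩)
      have := hn1 i1 i2
      linarith
  have hsub : A ⊆ (A1 ∪ A2 ∪ A3) ∪ (A4 ∪ A5 ∪ A6) := by
    intro f hf
    have := hcov f hf
    simp only [Set.mem_union]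
    tauto
  have hfin : ((A1 ∪ A2 ∪ A3) ∪ (A4 ∪ A5 ∪ A6)).Finite := ((f1.union f2).union f3).union ((f4.union f5).union f6)
  refine ⟨hfin.subset hsub, ?_⟩
  have t0 := Set.ncard_le_ncard hsub hfin
  have t1 := Set.ncard_union_le (A1 ∪ A2 ∪ A3) (A4 ∪ A5 ∪ A6)
  have t2 := Set.ncard_union_le (A1 ∪ A2) A3
  have t3 := Set.ncard_union_le A1 A2
  have t4 := Set.ncard_union_le (A4 ∪ A5) A6
  have t5 := Set.ncard_union_le A4 A5
  have t6 : A.ncard ≤ A1.ncard + A2.ncard + A3.ncard + A4.ncard + A5.ncard + A6.ncard := by omega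
  have t7 : (A.ncard:ℝ) ≤ A1.ncard + A2.ncard + A3.ncard + A4.ncard + A5.ncard + A6.ncard := by exact_mod_cast t6
  have t8 : (K.card:ℝ)^3 ≤ (17*l)^3 := by gcongr
  nlinarith

end Form
end

set_option linter.all false
open scoped Classical
noncomputable section
namespace Form
open UpperHalfPlane
open scoped Modular MatrixGroups

theorem root_dec {f : Form} (ha : f.a ≠ 0) (hd : f.d ≠ 0) (h : ¬ f.Irr) :
    ∃ t : ℤ × ℤ × ℤ × ℤ, f.a = t.1*t.2.1 ∧ f.d = t.2.2.1*t.2.2.2 ∧ f.ev t.2.2.1 t.1 = 0 := by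
  unfold Irr at h
  push Not at h
  obtain ⟨x, y, hxy, hne⟩ := h
  have hg : 0 < Int.gcd x y := by
    rw [Int.gcd_pos_iff]
    by_contra hc
    push Not at hc
    exact hne hc.1 hc.2
  obtain ⟨p, q, hpq, hx, hy⟩ := Int.exists_gcd_one hg
  set g := (Int.gcd x y : ℤ) with hgd
  have hg0 : g ≠ 0 := by rw [hgd]; exact_mod_cast hg.ne'
  have hev : f.ev p q = 0 := by
    have : g^3 * f.ev p q = 0 := by rw [← hxy, hx, hy]; simp only [ev]; ring
    exact (mul_eq_zero.1 this).resolve_left (pow_ne_zero 3 hg0)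
  have hcop : IsCoprime p q := Int.isCoprime_iff_gcd_eq_one.2 hpq
  have e := hev
  simp only [ev] at e
  have h1 : q ∣ f.a := by
    apply (hcop.symm.pow_right (n := 3)).dvd_of_dvd_mul_right
    exact ⟨-(f.b*p^2+f.c*p*q+f.d*q^2), by linear_combination e⟩
  have h2 : p ∣ f.d := by
    apply (hcop.pow_right (n := 3)).dvd_of_dvd_mul_right
    exact ⟨-(f.a*p^2+f.b*p*q+f.c*q^2), by linear_combination e⟩
  obtain ⟨a', ha'⟩ := h1
  obtain ⟨d', hd'⟩ := h2
  exact ⟨(q,a',p,d'), ha', hd', hev⟩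

theorem le_of_prod {x y N : ℝ} (hy : 1 ≤ |y|) (h : |x*y| ≤ N) : |x| ≤ N := by
  rw [abs_mul] at h
  exact (le_mul_of_one_le_right (abs_nonneg _) hy).trans h

theorem one_le_absZ {x : ℤ} (hx : x ≠ 0) : 1 ≤ |(x:ℝ)| := by
  exact_mod_cast Int.one_le_abs hx

theorem redr_cnt {l : ℝ} (hl : 1 ≤ l) : 
    ({f | (f ∈ Red ∧ ¬ f.Irr) ∧ |(f.disc:ℝ)| < l^4}.ncard : ℝ) ≤ 200000000 * l^3 * (1+Real.log l)^3 := by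
  set A := {f | (f ∈ Red ∧ ¬ f.Irr) ∧ |(f.disc:ℝ)| < l^4} with hA
  set N := 30*l^2 with hN
  have hN1 : 1 ≤ N := by rw [hN]; nlinarith
  have hll := Real.log_nonneg hl
  set A0 := A ∩ {f | f.d = 0}
  set A1 := A ∩ {f | f.d ≠ 0}
  have hsz : ∀ f ∈ A, 0 < f.a ∧ ((f.a:ℝ) ≤ 2*l ∧ |(f.b:ℝ)| ≤ 5*l) ∧ (|(f.a:ℝ)*f.d| ≤ N ∧ |(f.b:ℝ)*f.c| ≤ N ∧ |(f.b:ℝ)| ≤ N ∧ |(f.c:ℝ)| ≤ N ∧ (f.a:ℝ) ≤ N) := by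
    rintro f ⟨⟨h1, _⟩, h2⟩
    exact ⟨h1.1, red_ab (red_disc h1.2) h1 hl h2.le, red_size (red_disc h1.2) h1 hl h2.le⟩
  have c0 : (A0.ncard:ℝ) ≤ 5*l*(8100*l^2*(1+Real.log l)) := by
    set g : Form → ℤ × (ℤ × ℤ) := fun f => (f.a,(f.b,f.c)) with hg
    have hm : ∀ f ∈ A0, g f ∈ (↑(KN (2*l) ×ˢ hyp N) : Set _) := by
      rintro f ⟨hf, -⟩
      obtain ⟨s0, ⟨s1, s2⟩, s3, s4, s5, s6, s7⟩ := hsz f hf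
      rw [Finset.mem_coe, Finset.mem_product]
      simp only [hg]
      rw [mem_KN, mem_hyp, abs_of_pos (by exact_mod_cast s0)]
      exact ⟨s1, s5, s6, s4⟩
    have hi : Set.InjOn g A0 := by
      rintro ⟨a,b,c,d⟩ ⟨_, h1⟩ ⟨a',b',c',d'⟩ ⟨_, h2⟩ h
      simp only [Set.mem_setOf_eq, hg, Prod.mk.injEq] at h h1 h2
      obtain ⟨rfl, rfl, rfl⟩ := h; subst h1; subst h2; rfl
    have h1 := Set.ncard_le_ncard_of_injOn g hm hi (Finset.finite_toSet _)
    rw [Set.ncard_coe_finset, Finset.card_product] at h1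
    have h2 := card_KN (by linarith : 0 ≤ 2*l)
    have h3 := card_hyp hN1
    have h4 := log30 hl
    rw [← hN] at h4
    calc (A0.ncard:ℝ) ≤ (KN (2*l)).card * (hyp N).card := by exact_mod_cast h1
      _ ≤ (5*l) * (9*N*(30*(1+Real.log l))) := by
          apply mul_le_mul (by linarith) _ (by positivity) (by positivity)
          exact h3.trans (by gcongr)
      _ = _ := by rw [hN]; ring
  have c1 : (A1.ncard:ℝ) ≤ 16*N*(30*(1+Real.log l))^3 * (11*l) := by
    have hex : ∀ f : Form, ∃ t : ℤ × ℤ × ℤ × ℤ, f ∈ A1 → f.a = t.1*t.2.1 ∧ f.d = t.2.2.1*t.2.2.2 ∧ f.ev t.2.2.1 t.1 = 0 := by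
      intro f
      by_cases hf : f ∈ A1
      · obtain ⟨t, ht⟩ := root_dec (hsz f hf.1).1.ne' hf.2 hf.1.1.2
        exact ⟨t, fun _ => ht⟩
      · exact ⟨0, fun h => absurd h hf⟩
    choose t ht using hex
    set g : Form → (ℤ × ℤ × ℤ × ℤ) × ℤ := fun f => (t f, f.b) with hg
    have hnz : ∀ f ∈ A1, (t f).1 ≠ 0 ∧ (t f).2.1 ≠ 0 ∧ (t f).2.2.1 ≠ 0 ∧ (t f).2.2.2 ≠ 0 := by
      intro f hf
      obtain ⟨h1, h2, _⟩ := ht f hf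
      have h3 := (hsz f hf.1).1.ne'
      have h4 : f.d ≠ 0 := hf.2
      rw [h1] at h3
      rw [h2] at h4
      exact ⟨left_ne_zero_of_mul h3, right_ne_zero_of_mul h3, left_ne_zero_of_mul h4, right_ne_zero_of_mul h4⟩
    have hm : ∀ f ∈ A1, g f ∈ (↑(quad N ×ˢ KN (5*l)) : Set _) := by
      intro f hf
      obtain ⟨s0, ⟨s1, s2⟩, s3, s4, s5, s6, s7⟩ := hsz f hf.1
      obtain ⟨h1, h2, _⟩ := ht f hf
      obtain ⟨z1, z2, z3, z4⟩ := hnz f hf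
      rw [Finset.mem_coe, Finset.mem_product]
      simp only [hg]
      have hp : |((t f).1:ℝ)*(t f).2.1*(t f).2.2.1*(t f).2.2.2| ≤ N := by
        rw [h1, h2] at s3; push_cast at s3; rw [← mul_assoc] at s3; exact s3
      have y1 := one_le_absZ z1
      have y2 := one_le_absZ z2
      have y3 := one_le_absZ z3
      have y4 := one_le_absZ z4
      have hp3 := le_of_prod y4 hp
      have hp2 := le_of_prod y3 hp3
      refine ⟨?_, by rw [mem_KN]; exact s2⟩
      rw [quad, Finset.mem_filter]
      simp only [Finset.mem_product, Finset.mem_erase, mem_KN]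
      refine ⟨⟨⟨z1, le_of_prod y2 hp2⟩, ⟨z2, ?_⟩, ⟨z3, ?_⟩, ⟨z4, ?_⟩⟩, hp⟩
      · rw [mul_comm] at hp2; exact le_of_prod y1 hp2
      · rw [mul_comm] at hp3; refine le_of_prod (y := ((t f).1:ℝ)*(t f).2.1) ?_ hp3
        rw [abs_mul]; nlinarith
      · rw [mul_comm] at hp; refine le_of_prod (y := ((t f).1:ℝ)*(t f).2.1*(t f).2.2.1) ?_ hp
        rw [abs_mul, abs_mul]
        exact one_le_mul_of_one_le_of_one_le (one_le_mul_of_one_le_of_one_le y1 y2) y3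
    have hi : Set.InjOn g A1 := by
      intro f hf f' hf' h
      simp only [hg, Prod.mk.injEq] at h
      obtain ⟨ht', hb⟩ := h
      obtain ⟨h1, h2, h3⟩ := ht f hf
      obtain ⟨h1', h2', h3'⟩ := ht f' hf'
      obtain ⟨z1, z2, z3, z4⟩ := hnz f hf
      rw [← ht'] at h1' h2' h3'
      have ea : f.a = f'.a := by rw [h1, h1']
      have ed : f.d = f'.d := by rw [h2, h2']
      have ec : f.c = f'.c := by
        simp only [ev] at h3 h3'
        rw [← ea, ← ed, ← hb] at h3'
        have : (f.c - f'.c) * ((t f).2.2.1 * (t f).1^2) = 0 := by linear_combination h3 - h3'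
        have := (mul_eq_zero.1 this).resolve_right (mul_ne_zero z3 (pow_ne_zero 2 z1))
        linarith
      exact Form.ext ea hb ec ed
    have h1 := Set.ncard_le_ncard_of_injOn g hm hi (Finset.finite_toSet _)
    rw [Set.ncard_coe_finset, Finset.card_product] at h1
    have h2 := card_KN (by linarith : 0 ≤ 5*l)
    have h3 := card_quad hN1
    have h4 := log30 hl
    rw [← hN] at h4
    have h5 := Real.log_nonneg hN1
    calc (A1.ncard:ℝ) ≤ (quad N).card * (KN (5*l)).card := by exact_mod_cast h1
      _ ≤ (16*N*(30*(1+Real.log l))^3) * (11*l) := by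
          apply mul_le_mul (h3.trans (by gcongr)) (by linarith) (by positivity) (by positivity)
  have hAu : A = A0 ∪ A1 := by
    ext f; simp only [A0, A1, Set.mem_union, Set.mem_inter_iff, Set.mem_setOf_eq, ne_eq]; tauto
  have h1 : (A.ncard:ℝ) ≤ A0.ncard + A1.ncard := by
    rw [hAu]; exact_mod_cast Set.ncard_union_le A0 A1
  have h2 : 5*l*(8100*l^2*(1+Real.log l)) ≤ 40500*l^3*(1+Real.log l)^3 := by
    have : (1+Real.log l) ≤ (1+Real.log l)^3 := le_self_pow₀ (by linarith) (by norm_num)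
    calc _ = 40500*l^3*(1+Real.log l) := by ring
      _ ≤ _ := by gcongr
  have h3 : 16*N*(30*(1+Real.log l))^3 * (11*l) = 142560000*(l^3*(1+Real.log l)^3) := by rw [hN]; ring
  have h4 : 0 ≤ l^3*(1+Real.log l)^3 := by positivity
  linarith

theorem upr_cnt {l : ℝ} (hl : 1 ≤ l) : {f | (f ∈ Up ∧ ¬ f.Irr) ∧ |(f.disc:ℝ)| < l^4}.ncard ≤ 
    {f | (f ∈ Red ∧ ¬ f.Irr) ∧ |(f.disc:ℝ)| < l^4}.ncard := by
  have hex : ∀ f : Form, ∃ n : ℤ, f ∈ Up → f.sub (ModularGroup.T^n : SL(2,ℤ)).1 ∈ Red := by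
    intro f
    by_cases hf : f ∈ Up
    · obtain ⟨h1, h2, h3, h4⟩ := hf
      obtain ⟨z, hz⟩ := Z_exists h1.ne' (up_disc h4)
      have him := (hi_iff h1.ne' hz).1 h4
      refine ⟨round z.re, fun _ => ?_⟩
      have hZ2 := Z_sub' (ModularGroup.T^(round z.re)) _ hz
      obtain ⟨ea, eb⟩ := sub_T f (round z.re)
      refine ⟨by rw [ea]; exact h1, ?_⟩
      rw [fd_iff (by rw [ea]; exact h1.ne') hZ2, mem_fd_iff, ← zpow_neg, ModularGroup.im_T_zpow_smul, ModularGroup.re_T_zpow_smul]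
      have hr := abs_le.1 (abs_sub_round z.re)
      push_cast
      refine ⟨by nlinarith [sq_nonneg (z.re + -(round z.re:ℝ))], by linarith, by linarith⟩
    · exact ⟨0, fun h => absurd h hf⟩
  choose n hn using hex
  apply Set.ncard_le_ncard_of_injOn (fun f => f.sub (ModularGroup.T^(n f) : SL(2,ℤ)).1) _ _ ?_
  · rintro f ⟨⟨h1, h2⟩, h3⟩
    refine ⟨⟨hn f h1, ?_⟩, ?_⟩
    · rw [irr_SL]; exact h2
    · rw [disc_SL]; exact h3
  · rintro f ⟨⟨h1, h2⟩, h3⟩ f' ⟨⟨h1', h2'⟩, h3'⟩ h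
    simp only at h
    obtain ⟨ea, eb⟩ := sub_T f (n f)
    obtain ⟨ea', eb'⟩ := sub_T f' (n f')
    rw [h] at ea eb
    have hA : f.a = f'.a := by rw [← ea, ← ea']
    rw [eb'] at eb
    have hnn : n f = n f' := by
      obtain ⟨u1, u2, u3, _⟩ := h1
      obtain ⟨v1, v2, v3, _⟩ := h1'
      rw [← hA] at v3 eb
      have e1 : f.b - f'.b = 3*f.a*(n f' - n f) := by linear_combination -eb
      rcases lt_trichotomy (n f) (n f') with q | q | q
      · nlinarith
      · exact q
      · nlinarith
    rw [hnn] at h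
    have := congrArg (fun F : Form => F.sub ((ModularGroup.T^(n f') : SL(2,ℤ))⁻¹ : SL).1) h
    rw [sub_mulSL, sub_mulSL, mul_inv_cancel] at this
    simpa [sub_one] using this
  · exact (red_cnt hl).1.subset (fun f hf => ⟨hf.1.1, hf.2⟩)

theorem pow_form (N : ℝ → ℝ) (K : ℝ) (hK : 0 ≤ K) (k : ℕ) (h0 : ∀ Y ≤ 1, N Y ≤ 0)
    (h : ∀ l, 1 ≤ l → N (l^4) ≤ K*l^k*(1+Real.log l)^3) (ε : ℝ) (hε : 0 < ε) :
    ∃ C, 0 ≤ C ∧ ∀ Y, 0 < Y → N Y ≤ C*Y^((k:ℝ)/4+ε) := by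
  set δ := 4*ε/3 with hδ
  have hδ0 : 0 < δ := by positivity
  refine ⟨K*(1+1/δ)^3, by positivity, fun Y hY => ?_⟩
  by_cases hY1 : Y ≤ 1
  · exact (h0 Y hY1).trans (by positivity)
  push Not at hY1
  set l := Y^((1:ℝ)/4) with hl
  have hl1 : 1 ≤ l := Real.one_le_rpow hY1.le (by norm_num)
  have e4 : l^4 = Y := by rw [hl, ← Real.rpow_natCast, ← Real.rpow_mul hY.le]; norm_num
  have h1 := h l hl1
  rw [e4] at h1
  refine h1.trans ?_
  have h2 := Real.log_le_rpow_div (by linarith : 0 ≤ l) hδ0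
  have h3 : 1 ≤ l^δ := Real.one_le_rpow hl1 hδ0.le
  have h4 : 1 + Real.log l ≤ (1+1/δ)*l^δ := by
    calc _ ≤ l^δ + l^δ/δ := add_le_add h3 h2
      _ = _ := by ring
  have hll := Real.log_nonneg hl1
  calc K*l^k*(1+Real.log l)^3 ≤ K*l^k*((1+1/δ)*l^δ)^3 := by gcongr
    _ = K*(1+1/δ)^3*(l^k*(l^δ)^3) := by ring
    _ = _ := by
      congr 1
      rw [hl, ← Real.rpow_natCast, ← Real.rpow_natCast, ← Real.rpow_mul hY.le, ← Real.rpow_mul hY.le, ← Real.rpow_mul hY.le, ← Real.rpow_add hY]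
      congr 1
      rw [hδ]; push_cast; ring

end Form
end

set_option linter.all false
open scoped Classical ENNReal
noncomputable section
namespace Form

theorem dom_disc {f : Form} (h : f ∈ Dom) : f.disc ≠ 0 := by
  rcases h with h | h
  · exact up_disc h.2.2.2
  · exact red_disc h.2.2

theorem dd_of {f : Form} (h0 : f.disc ≠ 0) {Y : ℝ} (h : |(f.disc:ℝ)| < Y) : dd 1 Y f ∨ dd (-1) Y f := by
  unfold dd
  rcases lt_or_gt_of_ne h0 with h1 | h1
  · right
    have : (f.disc:ℝ) < 0 := by exact_mod_cast h1
    rw [abs_of_neg this] at h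
    push_cast
    constructor <;> linarith
  · left
    have : (0:ℝ) < f.disc := by exact_mod_cast h1
    rw [abs_of_pos this] at h
    push_cast
    constructor <;> linarith

theorem dom_fin (Y : ℝ) : {f | f ∈ Dom ∧ |(f.disc:ℝ)| < Y}.Finite := by
  obtain ⟨V, hV⟩ := tame_const
  set l := max 1 Y
  have hl1 : 1 ≤ l := le_max_left _ _
  have hl : Y ≤ l^4 := (le_max_right 1 Y).trans (le_self_pow₀ hl1 (by norm_num))
  apply ((DomF (((1:ℤ):ℝ),Y,l)).finite_toSet.union (DomF (((-1:ℤ):ℝ),Y,l)).finite_toSet).subset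
  rintro f ⟨h1, h2⟩
  rcases dd_of (dom_disc h1) h2 with h | h
  · left; exact (mem_DomF hV (Or.inl rfl) (by linarith) hl f).2 ⟨h1, h⟩
  · right; exact (mem_DomF hV (Or.inr rfl) (by linarith) hl f).2 ⟨h1, h⟩

def DF (σ : ℤ) (Y : ℝ) : Finset Form := (dom_fin Y).toFinset.filter (fun f => dd σ Y f)

theorem mem_DF {σ : ℤ} (hσ : sgx σ) {Y : ℝ} {f : Form} : f ∈ DF σ Y ↔ f ∈ Dom ∧ dd σ Y f := by
  rw [DF, Finset.mem_filter, Set.Finite.mem_toFinset]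
  constructor
  · rintro ⟨⟨h1, h2⟩, h3⟩; exact ⟨h1, h3⟩
  · rintro ⟨h1, h3⟩; exact ⟨⟨h1, (dd_iff hσ h3).2⟩, h3⟩

def DS (σ : ℤ) (Y : ℝ) : Finset ℤ := (Finset.Icc (-⌈Y⌉) ⌈Y⌉).filter (fun D => 0 < σ * D ∧ |(D:ℝ)| < Y)

theorem mem_DS {σ : ℤ} {Y : ℝ} {D : ℤ} : D ∈ DS σ Y ↔ 0 < σ * D ∧ |(D:ℝ)| < Y := by
  rw [DS, Finset.mem_filter, and_iff_right_iff_imp, Finset.mem_Icc]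
  rintro ⟨_, h⟩
  have h1 := abs_lt.1 h
  have h2 := Int.le_ceil Y
  constructor
  · have : ((-⌈Y⌉:ℤ):ℝ) < D := by push_cast; linarith
    exact_mod_cast this.le
  · have : (D:ℝ) < ⌈Y⌉ := by linarith
    exact_mod_cast this.le

theorem disc_DS {σ : ℤ} (hσ : sgx σ) {Y : ℝ} {f : Form} : f.disc ∈ DS σ Y ↔ dd σ Y f := by
  rw [mem_DS, dd]
  have h0 : 0 < σ * f.disc ↔ 0 < (σ:ℝ)*f.disc := by rw [← Int.cast_mul, Int.cast_pos]
  rw [← h0]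
  apply and_congr_right
  intro h
  have : |(f.disc:ℝ)| = (σ:ℝ)*f.disc := by
    rcases hσ with rfl | rfl
    · rw [abs_of_pos (by exact_mod_cast (by linarith : 0 < f.disc))]; push_cast; ring
    · rw [abs_of_neg (by exact_mod_cast (by linarith : f.disc < 0))]; push_cast; ring
  rw [this]

/-- real weight -/
def w (f : Form) : ℝ := if f.Irr then (Fw f).toReal else 0

theorem w_nonneg (f : Form) : 0 ≤ w f := by unfold w; split_ifs <;> simp

theorem w_le (f : Form) : w f ≤ 1 := by
  unfold w
  split_ifs with h
  · have h1 := Fw_le f h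
    have h2 : ind Dom f ≤ 1 := by unfold ind; split_ifs <;> simp
    exact ENNReal.toReal_le_of_le_ofReal zero_le_one (by simpa using h1.trans h2)
  · norm_num

theorem w_gd {f : Form} (hf : f.Irr) (h : f ∈ Gd) : w f = 1 := by
  unfold w; rw [if_pos hf, Fw_gd hf h]; simp

theorem wt_toReal (D : ℤ) (f : Form) : (wt D f).toReal = if f.disc = D then w f else 0 := by
  unfold wt w
  by_cases h1 : f.Irr <;> by_cases h2 : f.disc = D <;> simp [h1, h2]

theorem wt_ne_top (D : ℤ) (f : Form) : wt D f ≠ ⊤ := by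
  unfold wt
  split_ifs with h
  · have h1 := Fw_le f h.1
    have h2 : ind Dom f ≤ 1 := by unfold ind; split_ifs <;> simp
    exact ((h1.trans h2).trans_lt ENNReal.one_lt_top).ne
  · simp

theorem wt_dom {D : ℤ} {f : Form} (h : wt D f ≠ 0) : f ∈ Dom ∧ f.disc = D := by
  unfold wt at h
  split_ifs at h with h1
  · refine ⟨?_, h1.2⟩
    by_contra hc
    apply h
    have := Fw_le f h1.1
    rw [ind, if_neg hc] at this
    simpa using this
  · exact absurd rfl h

theorem S_eq {σ : ℤ} (hσ : sgx σ) {Y : ℝ} {D : ℤ} (hD : D ∈ DS σ Y) (φ : Form → ℝ≥0∞) :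
    S D φ = ∑ f ∈ DF σ Y, wt D f * φ f := by
  unfold S
  apply tsum_eq_sum
  intro f hf
  by_contra hc
  have := wt_dom (left_ne_zero_of_mul hc)
  apply hf
  rw [mem_DF hσ, ← disc_DS hσ, this.2]
  exact ⟨this.1, hD⟩

def tr (s j : Finset ℕ) (f : Form) : ℝ := ((∏ p ∈ s, nm p f : ℕ):ℝ) * (thn j f : ℝ)

theorem tr_nonneg (s j : Finset ℕ) (f : Form) : 0 ≤ tr s j f := by unfold tr; positivity

theorem Th_toReal (s j : Finset ℕ) (f : Form) : (Th s j f).toReal = tr s j f := by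
  unfold Th tr thn; rw [ENNReal.toReal_mul, ENNReal.toReal_natCast, ENNReal.toReal_natCast]

theorem Th_ne_top (s j : Finset ℕ) (f : Form) : Th s j f ≠ ⊤ := by
  unfold Th; exact ENNReal.mul_ne_top (ENNReal.natCast_ne_top _) (ENNReal.natCast_ne_top _)

def Tr (s j : Finset ℕ) (D : ℤ) : ℝ := (S D (Th s j)).toReal

theorem Tr_nonneg (s j : Finset ℕ) (D : ℤ) : 0 ≤ Tr s j D := ENNReal.toReal_nonneg

theorem S_zero_disc (φ : Form → ℝ≥0∞) : S 0 φ = 0 := by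
  unfold S
  rw [ENNReal.tsum_eq_zero]
  intro f
  by_contra hc
  have := wt_dom (left_ne_zero_of_mul hc)
  exact dom_disc this.1 this.2

theorem sgn_ex {D : ℤ} (hD : D ≠ 0) : ∃ σ, sgx σ ∧ D ∈ DS σ (|(D:ℝ)|+1) := by
  rcases lt_or_gt_of_ne hD with h | h
  · exact ⟨-1, Or.inr rfl, mem_DS.2 ⟨by linarith, by linarith⟩⟩
  · exact ⟨1, Or.inl rfl, mem_DS.2 ⟨by linarith, by linarith⟩⟩

theorem S_ne_top (s j : Finset ℕ) (D : ℤ) : S D (Th s j) ≠ ⊤ := by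
  by_cases hD : D = 0
  · rw [hD, S_zero_disc]; simp
  · obtain ⟨σ, hσ, h⟩ := sgn_ex hD
    rw [S_eq hσ h]
    exact ENNReal.sum_ne_top.2 (fun f _ => ENNReal.mul_ne_top (wt_ne_top D f) (Th_ne_top s j f))

theorem Tr_eq {σ : ℤ} (hσ : sgx σ) {Y : ℝ} {D : ℤ} (hD : D ∈ DS σ Y) (s j : Finset ℕ) :
    Tr s j D = ∑ f ∈ DF σ Y, (if f.disc = D then w f else 0) * tr s j f := by
  unfold Tr
  rw [S_eq hσ hD, ENNReal.toReal_sum (fun f _ => ENNReal.mul_ne_top (wt_ne_top D f) (Th_ne_top s j f))]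
  apply Finset.sum_congr rfl
  intro f _
  rw [ENNReal.toReal_mul, wt_toReal, Th_toReal]

def TT {m : ℕ} (χ : DirichletCharacter ℂ m) (σ : ℤ) (s j : Finset ℕ) (Y : ℝ) : ℂ :=
  ∑ D ∈ DS σ Y, χ (D : ZMod m) * (Tr s j D : ℂ)

theorem TT_eq {m : ℕ} (χ : DirichletCharacter ℂ m) {σ : ℤ} (hσ : sgx σ) (s j : Finset ℕ) (Y : ℝ) :
    TT χ σ s j Y = ∑ f ∈ DF σ Y, χ ((f.disc:ℤ) : ZMod m) * ((w f * tr s j f : ℝ) : ℂ) := by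
  unfold TT
  rw [Finset.sum_congr rfl (fun D hD => by rw [Tr_eq hσ hD s j])]
  push_cast
  simp_rw [Finset.mul_sum]
  rw [Finset.sum_comm]
  apply Finset.sum_congr rfl
  intro f hf
  rw [mem_DF hσ, ← disc_DS hσ] at hf
  rw [Finset.sum_eq_single f.disc]
  · simp
  · intro D _ hD
    rw [if_neg (fun h => hD h.symm)]; simp
  · intro h; exact absurd hf.2 h

theorem rec_T {p : ℕ} (hp : p.Prime) {s j : Finset ℕ} (hs : ∀ p ∈ s, p.Prime) (hj : ∀ p ∈ j, p.Prime) (hqs : p ∉ s) (hqj : p ∉ j) (D : ℤ) :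
    Tr (insert p s) j D + (if (p:ℤ)^4 ∣ D then Tr s (insert p j) (D/(p:ℤ)^4) else 0) =
    (if (p:ℤ)^2 ∣ D then Tr s (insert p j) (D/(p:ℤ)^2) else 0) + (if (p:ℤ)^4 ∣ D then Tr s j (D/(p:ℤ)^4) else 0) := by
  have h := congrArg ENNReal.toReal (rec_S hp hs hj hqs hqj D)
  have ht : ∀ (c : Prop) [Decidable c] s j D, (if c then S D (Th s j) else 0) ≠ ⊤ := by
    intro c _ s j D; split_ifs; exacts [S_ne_top s j D, by simp]
  rw [ENNReal.toReal_add (S_ne_top _ _ _) (ht _ _ _ _), ENNReal.toReal_add (ht _ _ _ _) (ht _ _ _ _)] at h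
  have hi : ∀ (c : Prop) [Decidable c] s j D, (if c then S D (Th s j) else 0).toReal = if c then Tr s j D else 0 := by
    intro c _ s j D; split_ifs <;> simp [Tr]
  simp only [hi] at h
  exact h

theorem DS_div {m : ℕ} (χ : DirichletCharacter ℂ m) (σ : ℤ) (Y : ℝ) (k : ℕ) (hk : 0 < k) (g : ℤ → ℝ) :
    ∑ D ∈ DS σ Y, χ (D : ZMod m) * ((if (k:ℤ) ∣ D then g (D/(k:ℤ)) else 0 : ℝ) : ℂ) =
      χ (k : ZMod m) * ∑ D ∈ DS σ (Y/k), χ (D : ZMod m) * (g D : ℂ) := by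
  have hk0 : (k:ℤ) ≠ 0 := by exact_mod_cast hk.ne'
  have hkR : (0:ℝ) < k := by exact_mod_cast hk
  have hkZ : (0:ℤ) < k := by exact_mod_cast hk
  rw [Finset.mul_sum]
  have e : ∀ D : ℤ, χ (D : ZMod m) * ((if (k:ℤ) ∣ D then g (D/(k:ℤ)) else 0 : ℝ) : ℂ) = 
      if (k:ℤ) ∣ D then χ (D : ZMod m) * (g (D/(k:ℤ)) : ℂ) else 0 := by
    intro D; split_ifs <;> simp
  rw [Finset.sum_congr rfl (fun D _ => e D), ← Finset.sum_filter]
  symm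
  apply Finset.sum_bij (fun D _ => (k:ℤ)*D)
  · intro D hD
    rw [mem_DS] at hD
    rw [Finset.mem_filter, mem_DS]
    refine ⟨⟨?_, ?_⟩, dvd_mul_right _ _⟩
    · have := mul_pos hkZ hD.1; linarith
    · push_cast
      rw [abs_mul, abs_of_pos hkR, mul_comm, ← lt_div_iff₀ hkR]; exact hD.2
  · intro D _ D' _ h; exact mul_left_cancel₀ hk0 h
  · intro D hD
    rw [Finset.mem_filter, mem_DS] at hD
    obtain ⟨⟨h1, h2⟩, D', rfl⟩ := hD
    refine ⟨D', ?_, rfl⟩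
    rw [mem_DS]
    constructor
    · have : 0 < (k:ℤ)*(σ*D') := by linarith
      exact (mul_pos_iff_of_pos_left hkZ).1 this
    · push_cast at h2
      rw [abs_mul, abs_of_pos hkR, mul_comm, ← lt_div_iff₀ hkR] at h2; exact h2
  · intro D hD
    rw [Int.mul_ediv_cancel_left _ hk0]
    push_cast
    rw [map_mul]; ring

theorem rec_TT {m : ℕ} (χ : DirichletCharacter ℂ m) (σ : ℤ) {p : ℕ} (hp : p.Prime) {s j : Finset ℕ} (hs : ∀ p ∈ s, p.Prime) (hj : ∀ p ∈ j, p.Prime) (hqs : p ∉ s) (hqj : p ∉ j) (Y : ℝ) :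
    TT χ σ (insert p s) j Y = χ (p : ZMod m)^2 * TT χ σ s (insert p j) (Y/(p:ℝ)^2) + 
      χ (p : ZMod m)^4 * (TT χ σ s j (Y/(p:ℝ)^4) - TT χ σ s (insert p j) (Y/(p:ℝ)^4)) := by
  have h2 := fun g => DS_div χ σ Y (p^2) (pow_pos hp.pos 2) g
  have h4 := fun g => DS_div χ σ Y (p^4) (pow_pos hp.pos 4) g
  push_cast at h2 h4
  rw [map_pow] at h2 h4
  unfold TT
  rw [mul_sub, ← h2, ← h4, ← h4, ← add_sub_assoc, ← Finset.sum_add_distrib, ← Finset.sum_sub_distrib]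
  apply Finset.sum_congr rfl
  intro D _
  have := rec_T hp hs hj hqs hqj D
  have e : Tr (insert p s) j D = (if (p:ℤ)^2 ∣ D then Tr s (insert p j) (D/(p:ℤ)^2) else 0) + (if (p:ℤ)^4 ∣ D then Tr s j (D/(p:ℤ)^4) else 0) - (if (p:ℤ)^4 ∣ D then Tr s (insert p j) (D/(p:ℤ)^4) else 0) := by linarith
  rw [e]
  push_cast
  ring

end Form
end

set_option linter.all false
open scoped Classical ENNReal
noncomputable section
namespace Form

theorem red_fin (Y : ℝ) : {f | f ∈ Red ∧ |(f.disc:ℝ)| < Y}.Finite := by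
  have hl1 : 1 ≤ max 1 Y := le_max_left _ _
  have hl : Y ≤ (max 1 Y)^4 := (le_max_right 1 Y).trans (le_self_pow₀ hl1 (by norm_num))
  exact (red_cnt hl1).1.subset (fun f hf => ⟨hf.1, hf.2.trans_le hl⟩)

theorem disc_one {f : Form} (h : f.disc ≠ 0) {Y : ℝ} (hY : Y ≤ 1) : ¬ |(f.disc:ℝ)| < Y := by
  have := one_le_absZ h
  linarith

theorem red_Y (ε : ℝ) (hε : 0 < ε) : ∃ C, 0 ≤ C ∧ ∀ j : Finset ℕ, (∀ p ∈ j, p.Prime) → ∀ Y : ℝ, 0 < Y →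
    ∑ f ∈ (red_fin Y).toFinset, (thn j f : ℝ) ≤ 6^j.card * C * Y^(1+ε) := by
  obtain ⟨C, hC, h⟩ := pow_form (fun Y => ({f | f ∈ Red ∧ |(f.disc:ℝ)| < Y}.ncard : ℝ)) (8100^2) (by norm_num) 4 (by
    intro Y hY
    have : {f | f ∈ Red ∧ |(f.disc:ℝ)| < Y} = ∅ := by
      rw [Set.eq_empty_iff_forall_notMem]
      rintro f ⟨h1, h2⟩
      exact disc_one (red_disc h1.2) hY h2
    simp only [this]; simp) (by
    intro l hl
    have hll := Real.log_nonneg hl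
    refine (red_cnt hl).2.trans ?_
    gcongr
    · linarith
    · norm_num) ε hε
  refine ⟨C, hC, fun j hj Y hY => ?_⟩
  have e : ((4:ℕ):ℝ)/4+ε = 1+ε := by norm_num
  rw [e] at h
  exact weighted (fun k hk f hf => (Red_smul hk f).1 hf) red_fin hC (by linarith) h hj Y hY

def Bad : Set Form := {f | f ∈ Dom ∧ (f ∈ Bd ∨ ¬ f.Irr)}

theorem bad_fin (Y : ℝ) : {f | f ∈ Bad ∧ |(f.disc:ℝ)| < Y}.Finite :=
  (dom_fin Y).subset (fun f hf => ⟨hf.1.1, hf.2⟩)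

theorem bad_Y (ε : ℝ) (hε : 0 < ε) : ∃ C, 0 ≤ C ∧ ∀ j : Finset ℕ, (∀ p ∈ j, p.Prime) → ∀ Y : ℝ, 0 < Y →
    ∑ f ∈ (bad_fin Y).toFinset, (thn j f : ℝ) ≤ 6^j.card * C * Y^(3/4+ε) := by
  obtain ⟨C, hC, h⟩ := pow_form (fun Y => ({f | f ∈ Bad ∧ |(f.disc:ℝ)| < Y}.ncard : ℝ)) (500000000) (by norm_num) 3 (by
    intro Y hY
    have : {f | f ∈ Bad ∧ |(f.disc:ℝ)| < Y} = ∅ := by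
      rw [Set.eq_empty_iff_forall_notMem]
      rintro f ⟨h1, h2⟩
      exact disc_one (dom_disc h1.1) hY h2
    simp only [this]; simp) (by
    intro l hl
    have hll := Real.log_nonneg hl
    set A := {f | f ∈ Bad ∧ |(f.disc:ℝ)| < l^4}
    set B1 := {f | f ∈ Bd ∧ |(f.disc:ℝ)| < l^4}
    set B2 := {f | (f ∈ Up ∧ ¬ f.Irr) ∧ |(f.disc:ℝ)| < l^4}
    set B3 := {f | (f ∈ Red ∧ ¬ f.Irr) ∧ |(f.disc:ℝ)| < l^4}
    have hsub : A ⊆ B1 ∪ B2 ∪ B3 := by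
      rintro f ⟨⟨h1, h2⟩, h3⟩
      rcases h2 with h2 | h2
      · exact Or.inl (Or.inl ⟨h2, h3⟩)
      · rcases h1 with h1 | h1
        · exact Or.inl (Or.inr ⟨⟨h1, h2⟩, h3⟩)
        · exact Or.inr ⟨⟨⟨h1.1, h1.2.2⟩, h2⟩, h3⟩
    have hfin : (B1 ∪ B2 ∪ B3).Finite := ((bd_cnt hl).1.union ((dom_fin (l^4)).subset 
      (fun f hf => ⟨Or.inl hf.1.1, hf.2⟩))).union ((red_fin (l^4)).subset (fun f hf => ⟨hf.1.1, hf.2⟩))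
    have t1 := Set.ncard_le_ncard hsub hfin
    have t2 := Set.ncard_union_le (B1 ∪ B2) B3
    have t3 := Set.ncard_union_le B1 B2
    have t4 : B2.ncard ≤ B3.ncard := upr_cnt hl
    have t5 : A.ncard ≤ B1.ncard + 2*B3.ncard := by omega
    have t6 : (A.ncard:ℝ) ≤ B1.ncard + 2*B3.ncard := by exact_mod_cast t5
    have t7 := (bd_cnt hl).2
    have t8 := redr_cnt hl
    have t9 : l^3 ≤ l^3*(1+Real.log l)^3 := le_mul_of_one_le_right (by positivity) (one_le_pow₀ (by linarith))
    show (A.ncard:ℝ) ≤ _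
    nlinarith) ε hε
  refine ⟨C, hC, fun j hj Y hY => ?_⟩
  have e : ((3:ℕ):ℝ)/4+ε = 3/4+ε := by norm_num
  rw [e] at h
  exact weighted (A := Bad) (fun k hk f hf => ⟨(Dom_smul hk f).1 hf.1, hf.2.imp (Bd_smul hk f).1 (fun h1 h2 => h1 ((Irr_smul hk f).2 h2))⟩) bad_fin hC (by linarith) h hj Y hY

theorem tr_empty (j : Finset ℕ) (f : Form) : tr ∅ j f = thn j f := by simp [tr]

theorem base2 (ε : ℝ) (hε : 0 < ε) : ∃ C, 0 ≤ C ∧ ∀ (m : ℕ) (χ : DirichletCharacter ℂ m) (σ : ℤ), sgx σ → ∀ j : Finset ℕ, (∀ p ∈ j, p.Prime) → ∀ Y : ℝ, 0 < Y →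
    ‖TT χ σ ∅ j Y‖ ≤ 6^j.card * (C * Y^(1+ε)) := by
  obtain ⟨C, hC, h⟩ := red_Y ε hε
  refine ⟨C, hC, fun m χ σ hσ j hj Y hY => ?_⟩
  rw [← mul_assoc]
  refine le_trans ?_ (h j hj Y hY)
  have h1 : ∀ D ∈ DS σ Y, Tr ∅ j D ≤ ∑ f ∈ (red_fin Y).toFinset, if f.disc = D then (thn j f : ℝ) else 0 := by
    intro D hD
    have hD' := (mem_DS.1 hD).2
    unfold Tr
    have hle := S_le_red D (Th ∅ j) (by
      intro f γ
      unfold Th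
      have := thn_SL hj f γ
      unfold thn at this
      rw [this]; simp)
    rw [tsum_eq_sum (s := (red_fin Y).toFinset) (by
      intro f hf
      rw [if_neg]
      rintro ⟨h1, h2, h3⟩
      apply hf
      rw [Set.Finite.mem_toFinset]
      exact ⟨h1, by rw [h3]; exact hD'⟩)] at hle
    have ht : ∀ f ∈ (red_fin Y).toFinset, (if f ∈ Red ∧ f.Irr ∧ f.disc = D then Th ∅ j f else 0) ≠ ⊤ := by
      intro f _
      split_ifs
      exacts [Th_ne_top _ _ _, by simp]
    refine (ENNReal.toReal_mono (ENNReal.sum_ne_top.2 ht) hle).trans ?_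
    rw [ENNReal.toReal_sum ht]
    apply Finset.sum_le_sum
    intro f _
    by_cases hd : f.disc = D
    · rw [if_pos hd]
      split_ifs
      · rw [Th_toReal, tr_empty]
      · simp
    · rw [if_neg hd, if_neg (fun h => hd h.2.2)]; simp
  calc ‖TT χ σ ∅ j Y‖ ≤ ∑ D ∈ DS σ Y, Tr ∅ j D := by
        unfold TT
        refine (norm_sum_le _ _).trans (Finset.sum_le_sum fun D _ => ?_)
        rw [norm_mul, Complex.norm_real, Real.norm_of_nonneg (Tr_nonneg _ _ _)]
        exact mul_le_of_le_one_left (Tr_nonneg _ _ _) (DirichletCharacter.norm_le_one χ _)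
    _ ≤ ∑ D ∈ DS σ Y, ∑ f ∈ (red_fin Y).toFinset, (if f.disc = D then (thn j f : ℝ) else 0) := Finset.sum_le_sum h1
    _ ≤ _ := by
        rw [Finset.sum_comm]
        apply Finset.sum_le_sum
        intro f _
        rw [Finset.sum_ite_eq]
        split_ifs
        · exact le_rfl
        · positivity

theorem TT_small {m : ℕ} (χ : DirichletCharacter ℂ m) (σ : ℤ) (s j : Finset ℕ) {Y : ℝ} (hY : Y ≤ 1) : TT χ σ s j Y = 0 := by
  unfold TT
  apply Finset.sum_eq_zero
  intro D hD
  exfalso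
  rw [mem_DS] at hD
  have h0 : D ≠ 0 := by rintro rfl; simp at hD
  have := one_le_absZ h0
  linarith [hD.2]

theorem log_rpow {δ x : ℝ} (hδ : 0 < δ) (hx : 1 ≤ x) : 1 + Real.log x ≤ (1+1/δ)*x^δ := by
  have h2 := Real.log_le_rpow_div (by linarith : 0 ≤ x) hδ
  have h3 : 1 ≤ x^δ := Real.one_le_rpow hx hδ.le
  calc _ ≤ x^δ + x^δ/δ := add_le_add h3 h2
    _ = _ := by ring

theorem base1 (ε : ℝ) (hε : 0 < ε) : ∃ C, 0 ≤ C ∧ ∀ (m : ℕ) [NeZero m] (χ : DirichletCharacter ℂ m), χ^6 ≠ 1 → ∀ (σ : ℤ), sgx σ → ∀ j : Finset ℕ, (∀ p ∈ j, p.Prime) → 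
    (∀ p ∈ j, Nat.Coprime m p) → ∀ Y : ℝ, 0 < Y →
    ‖TT χ σ ∅ j Y‖ ≤ 6^j.card * (C * m * ((∏ p ∈ j, p : ℕ):ℝ)^(1/2+ε) * Y^(3/4+ε) + C * (m:ℝ)^2 * ((∏ p ∈ j, p : ℕ):ℝ)^(1:ℝ) * Y^((1:ℝ)/2)) := by
  obtain ⟨V, hV⟩ := tame_const
  obtain ⟨C, hC, h⟩ := bad_Y ε hε
  set K := 1+1/ε with hK
  set K' := 1+1/(4*ε) with hK'
  have hK0 : 0 < K := by positivity
  have hK0' : 0 < K' := by positivity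
  refine ⟨V*115000*K*K' + V*7400 + C, by positivity, fun m _ χ hχ σ hσ j hj hjm Y hY => ?_⟩
  set J := ((∏ p ∈ j, p : ℕ):ℝ) with hJ
  have hJ1 : 1 ≤ J := by
    rw [hJ]; exact_mod_cast Finset.prod_pos (fun p hp => (hj p hp).pos)
  have hm1 : (1:ℝ) ≤ m := by exact_mod_cast NeZero.one_le
  by_cases hY1 : Y ≤ 1
  · rw [TT_small χ σ ∅ j hY1, norm_zero]; positivity
  push Not at hY1
  set l := Y^((1:ℝ)/4) with hl
  have hl1 : 1 ≤ l := Real.one_le_rpow hY1.le (by norm_num)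
  have e4 : l^4 = Y := by rw [hl, ← Real.rpow_natCast, ← Real.rpow_mul hY.le]; norm_num
  have e3 : l^3 = Y^((3:ℝ)/4) := by rw [hl, ← Real.rpow_natCast, ← Real.rpow_mul hY.le]; norm_num
  have e2 : l^2 = Y^((1:ℝ)/2) := by rw [hl, ← Real.rpow_natCast, ← Real.rpow_mul hY.le]; norm_num
  have e5 : l^(4*ε) = Y^ε := by rw [hl, ← Real.rpow_mul hY.le]; congr 1; ring
  have main := dom_sum_thn hV hσ hl1 e4.ge hj hjm χ hχ
  have hDF : DomF ((σ:ℝ),Y,l) = DF σ Y := by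
    ext f; rw [mem_DF hσ, mem_DomF hV hσ (by linarith) e4.ge]
  rw [hDF, ← hJ] at main
  have hdiff : ‖TT χ σ ∅ j Y - ∑ f ∈ DF σ Y, (thn j f : ℂ) * χ ((f.disc : ℤ) : ZMod m)‖ ≤ 6^j.card * C * Y^(3/4+ε) := by
    refine le_trans ?_ (h j hj Y hY)
    rw [TT_eq χ hσ, ← Finset.sum_sub_distrib]
    refine (norm_sum_le _ _).trans ?_
    have e : ∀ f ∈ DF σ Y, ‖χ ((f.disc:ℤ) : ZMod m) * ((w f * tr ∅ j f : ℝ) : ℂ) - (thn j f : ℂ) * χ ((f.disc : ℤ) : ZMod m)‖ ≤ if f ∈ (bad_fin Y).toFinset then (thn j f : ℝ) else 0 := by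
      intro f hf
      rw [tr_empty]
      have e0 : χ ((f.disc:ℤ) : ZMod m) * ((w f * (thn j f:ℝ) : ℝ) : ℂ) - (thn j f : ℂ) * χ ((f.disc : ℤ) : ZMod m) = χ ((f.disc:ℤ) : ZMod m) * (((w f - 1) * (thn j f:ℝ) : ℝ) : ℂ) := by push_cast; ring
      rw [e0, norm_mul, Complex.norm_real, norm_mul, Real.norm_natCast]
      rw [mem_DF hσ] at hf
      split_ifs with hb
      · have h1 : ‖w f - 1‖ ≤ 1 := by rw [Real.norm_eq_abs, abs_le]; constructor <;> linarith [w_nonneg f, w_le f]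
        calc _ ≤ 1 * (1 * (thn j f : ℝ)) := by
              gcongr; exact DirichletCharacter.norm_le_one χ _
          _ = _ := by ring
      · rw [Set.Finite.mem_toFinset] at hb
        have hn : f ∉ Bad := fun h => hb ⟨h, (dd_iff hσ hf.2).2⟩
        have hI : f.Irr := by by_contra hc; exact hn ⟨hf.1, Or.inr hc⟩
        have hB : f ∉ Bd := fun hc => hn ⟨hf.1, Or.inl hc⟩
        have hG : f ∈ Gd := by
          rcases hf.1 with h1 | h1
          · exact Or.inl h1
          · right; by_contra hc; exact hB ⟨h1, hc⟩
        rw [w_gd hI hG]; simp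
    refine (Finset.sum_le_sum e).trans ?_
    rw [← Finset.sum_filter]
    apply Finset.sum_le_sum_of_subset_of_nonneg
    · intro f hf; exact (Finset.mem_filter.1 hf).2
    · intro f _ _; positivity
  have htri : ‖TT χ σ ∅ j Y‖ ≤ ‖TT χ σ ∅ j Y - ∑ f ∈ DF σ Y, (thn j f : ℂ) * χ ((f.disc : ℤ) : ZMod m)‖ + ‖∑ f ∈ DF σ Y, (thn j f : ℂ) * χ ((f.disc : ℤ) : ZMod m)‖ := norm_le_norm_sub_add _ _
  refine htri.trans ((add_le_add hdiff main).trans ?_)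
  have hlj := log_rpow hε hJ1
  have hll := log_rpow (by positivity : 0 < 4*ε) hl1
  rw [e5] at hll
  have l0 := Real.log_nonneg hl1
  have l1 := Real.log_nonneg hJ1
  have a1 : m * Real.sqrt J * (1 + Real.log J) * (l^3 * (1 + Real.log l)) ≤ K*K'*(m*J^(1/2+ε)*Y^(3/4+ε)) := by
    calc _ ≤ m * Real.sqrt J * (K*J^ε) * (l^3 * (K'*Y^ε)) := by gcongr
      _ = K*K'*(m*(J^((1:ℝ)/2)*J^ε)*(Y^((3:ℝ)/4)*Y^ε)) := by rw [Real.sqrt_eq_rpow, e3]; ring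
      _ = _ := by rw [← Real.rpow_add (by linarith), ← Real.rpow_add hY]
  have a2 : C * Y^(3/4+ε) ≤ C * (m*J^(1/2+ε)*Y^(3/4+ε)) := by
    gcongr
    refine le_mul_of_one_le_left (by positivity) ?_
    exact one_le_mul_of_one_le_of_one_le hm1 (Real.one_le_rpow hJ1 (by positivity))
  set U := m*J^(1/2+ε)*Y^(3/4+ε) with hU
  have hU0 : 0 ≤ U := by positivity
  rw [← e2, Real.rpow_one]
  set W := (m:ℝ)^2*J*l^2 with hW
  have hW0 : 0 ≤ W := by positivity
  have p1 : (2:ℝ)^j.card ≤ 6^j.card := by gcongr; norm_num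
  have hV0 : (0:ℝ) ≤ V := Nat.cast_nonneg _
  calc 6^j.card * C * Y^(3/4+ε) + 2^j.card * (V * (115000 * (m * Real.sqrt J * (1 + Real.log J) * (l^3 * (1 + Real.log l))) + 7400 * W))
      ≤ 6^j.card * (C * U) + 6^j.card * (V * (115000 * (K*K'*U) + 7400 * W)) := by
        rw [mul_assoc]; gcongr
    _ = 6^j.card * ((V*115000*K*K'+C)*U + V*7400*W) := by ring
    _ ≤ 6^j.card * ((V*115000*K*K'+V*7400+C)*U + (V*115000*K*K'+V*7400+C)*W) := by
        gcongr
        · have : (0:ℝ) ≤ V*7400 := by positivity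
          linarith
        · have : (0:ℝ) ≤ V*115000*K*K' := by positivity
          linarith
    _ = _ := by rw [hU, hW]; ring

end Form
end

set_option linter.all false
open scoped Classical ENNReal
noncomputable section
namespace Form

def bb (A α β J Y q : ℝ) : ℝ := A * J^α * Y^β * q^(α-2*β)

theorem bb_nonneg {A α β J Y q : ℝ} (hA : 0 ≤ A) (hJ : 0 < J) (hY : 0 < Y) (hq : 0 < q) : 0 ≤ bb A α β J Y q := by
  unfold bb; positivity

theorem bb_step {A α β J Y q p : ℝ} (hA : 0 ≤ A) (hα : 0 ≤ α) (hβ : 0 ≤ β) (hJ : 0 < J) (hY : 0 < Y) (hq : 0 < q) (hp : 1 ≤ p) :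
    bb A α β (p*J) (Y/p^2) q = bb A α β J Y (p*q) ∧ bb A α β J (Y/p^4) q ≤ bb A α β J Y (p*q) ∧
    bb A α β (p*J) (Y/p^4) q ≤ bb A α β J Y (p*q) := by
  have hp0 : 0 < p := by linarith
  have e2 : (Y/p^2)^β = Y^β * p^(-(2*β)) := by
    rw [Real.div_rpow hY.le (by positivity), div_eq_mul_inv, ← Real.rpow_natCast, ← Real.rpow_mul hp0.le, ← Real.rpow_neg hp0.le]; norm_num
  have e4 : (Y/p^4)^β = Y^β * p^(-(4*β)) := by
    rw [Real.div_rpow hY.le (by positivity), div_eq_mul_inv, ← Real.rpow_natCast, ← Real.rpow_mul hp0.le, ← Real.rpow_neg hp0.le]; norm_num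
  have eJ : (p*J)^α = p^α*J^α := Real.mul_rpow hp0.le hJ.le
  have eq : (p*q)^(α-2*β) = p^(α-2*β)*q^(α-2*β) := Real.mul_rpow hp0.le hq.le
  unfold bb
  rw [e2, e4, eJ, eq]
  refine ⟨?_, ?_, ?_⟩
  · have : p^(α-2*β) = p^α*p^(-(2*β)) := by rw [← Real.rpow_add hp0]; congr 1
    rw [this]; ring
  · have : p^(-(4*β)) ≤ p^(α-2*β) := Real.rpow_le_rpow_of_exponent_le hp (by linarith)
    calc _ = (A*J^α*Y^β*q^(α-2*β))*p^(-(4*β)) := by ring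
      _ ≤ (A*J^α*Y^β*q^(α-2*β))*p^(α-2*β) := by gcongr
      _ = _ := by ring
  · have : p^α*p^(-(4*β)) ≤ p^(α-2*β) := by
      rw [← Real.rpow_add hp0]; exact Real.rpow_le_rpow_of_exponent_le hp (by linarith)
    calc _ = (A*J^α*Y^β*q^(α-2*β))*(p^α*p^(-(4*β))) := by ring
      _ ≤ (A*J^α*Y^β*q^(α-2*β))*p^(α-2*β) := by gcongr
      _ = _ := by ring

theorem ind_TT {m : ℕ} (χ : DirichletCharacter ℂ m) (σ : ℤ) {A1 A2 α1 α2 β1 β2 : ℝ} (hA1 : 0 ≤ A1) (hA2 : 0 ≤ A2)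
    (hα1 : 0 ≤ α1) (hα2 : 0 ≤ α2) (hβ1 : 0 ≤ β1) (hβ2 : 0 ≤ β2)
    (hb : ∀ j : Finset ℕ, (∀ p ∈ j, p.Prime) → (∀ p ∈ j, Nat.Coprime m p) → ∀ Y : ℝ, 0 < Y →
      ‖TT χ σ ∅ j Y‖ ≤ 6^j.card * (bb A1 α1 β1 (∏ p ∈ j, p : ℕ) Y 1 + bb A2 α2 β2 (∏ p ∈ j, p : ℕ) Y 1))
    (s : Finset ℕ) : (∀ p ∈ s, p.Prime) → ∀ j : Finset ℕ, (∀ p ∈ j, p.Prime) → (∀ p ∈ j, Nat.Coprime m p) → Disjoint s j → ∀ Y : ℝ, 0 < Y →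
      ‖TT χ σ s j Y‖ ≤ 18^s.card * (6^j.card * (bb A1 α1 β1 (∏ p ∈ j, p : ℕ) Y (∏ p ∈ s, p : ℕ) + bb A2 α2 β2 (∏ p ∈ j, p : ℕ) Y (∏ p ∈ s, p : ℕ))) := by
  induction s using Finset.induction_on with
  | empty =>
    intro _ j hj hjm _ Y hY
    simpa using hb j hj hjm Y hY
  | insert p s hps ih =>
    intro hs j hj hjm hd Y hY
    have hp : p.Prime := hs p (Finset.mem_insert_self _ _)
    have hs' : ∀ p ∈ s, p.Prime := fun q hq => hs q (Finset.mem_insert_of_mem hq)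
    rw [Finset.disjoint_insert_left] at hd
    obtain ⟨hpj, hd⟩ := hd
    rw [rec_TT χ σ hp hs' hj hps hpj]
    have hJ0 : (0:ℝ) < (∏ p ∈ j, p : ℕ) := by exact_mod_cast Finset.prod_pos (fun p hp => (hj p hp).pos)
    have hq0 : (0:ℝ) < (∏ p ∈ s, p : ℕ) := by exact_mod_cast Finset.prod_pos (fun p hp => (hs' p hp).pos)
    have hp1 : (1:ℝ) ≤ p := by exact_mod_cast hp.one_le
    have hp0 : (0:ℝ) < p := by linarith
    rw [Finset.prod_insert hps, Finset.card_insert_of_notMem hps, Nat.cast_mul]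
    set J := ((∏ p ∈ j, p : ℕ):ℝ) with hJ
    set q := ((∏ p ∈ s, p : ℕ):ℝ) with hq
    have n1 := bb_nonneg (α := α1) (β := β1) hA1 hJ0 hY (mul_pos hp0 hq0)
    have n2 := bb_nonneg (α := α2) (β := β2) hA2 hJ0 hY (mul_pos hp0 hq0)
    by_cases hmp : Nat.Coprime m p
    · have hj' : ∀ q ∈ insert p j, q.Prime := by
        intro q hq; rcases Finset.mem_insert.1 hq with rfl | hq; exacts [hp, hj q hq]
      have hjm' : ∀ q ∈ insert p j, Nat.Coprime m q := by
        intro q hq; rcases Finset.mem_insert.1 hq with rfl | hq; exacts [hmp, hjm q hq]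
      have hd' : Disjoint s (insert p j) := by rw [Finset.disjoint_insert_right]; exact ⟨hps, hd⟩
      have i1 := ih hs' (insert p j) hj' hjm' hd' (Y/(p:ℝ)^2) (by positivity)
      have i2 := ih hs' j hj hjm hd (Y/(p:ℝ)^4) (by positivity)
      have i3 := ih hs' (insert p j) hj' hjm' hd' (Y/(p:ℝ)^4) (by positivity)
      rw [Finset.prod_insert hpj, Finset.card_insert_of_notMem hpj, Nat.cast_mul] at i1 i3
      obtain ⟨a1, a2, a3⟩ := bb_step hA1 hα1 hβ1 hJ0 hY hq0 hp1
      obtain ⟨b1, b2, b3⟩ := bb_step hA2 hα2 hβ2 hJ0 hY hq0 hp1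
      rw [a1, b1] at i1
      set E := bb A1 α1 β1 J Y (p*q) + bb A2 α2 β2 J Y (p*q) with hE
      have hE0 : 0 ≤ E := by linarith
      have i2' : ‖TT χ σ s j (Y/(p:ℝ)^4)‖ ≤ 18^s.card * (6^j.card * E) := i2.trans (by rw [hE]; gcongr)
      have i3' : ‖TT χ σ s (insert p j) (Y/(p:ℝ)^4)‖ ≤ 18^s.card * (6^(j.card+1) * E) := i3.trans (by rw [hE]; gcongr)
      have hχ1 : ‖χ (p : ZMod m)‖ ≤ 1 := DirichletCharacter.norm_le_one χ _
      refine (norm_add_le _ _).trans ?_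
      rw [norm_mul, norm_mul, norm_pow, norm_pow]
      have t1 : ‖χ (p : ZMod m)‖^2 ≤ 1 := pow_le_one₀ (norm_nonneg _) hχ1
      have t2 : ‖χ (p : ZMod m)‖^4 ≤ 1 := pow_le_one₀ (norm_nonneg _) hχ1
      have t3 := norm_sub_le (TT χ σ s j (Y/(p:ℝ)^4)) (TT χ σ s (insert p j) (Y/(p:ℝ)^4))
      have t4 := mul_le_of_le_one_left (norm_nonneg (TT χ σ s (insert p j) (Y/(p:ℝ)^2))) t1
      have t5 := mul_le_of_le_one_left (norm_nonneg (TT χ σ s j (Y/(p:ℝ)^4) - TT χ σ s (insert p j) (Y/(p:ℝ)^4))) t2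
      have z : (0:ℝ) ≤ 18^s.card * (6^j.card * E) := by positivity
      have z1 : (18:ℝ)^s.card * (6^(j.card+1) * E) = 6*(18^s.card * (6^j.card * E)) := by rw [pow_succ]; ring
      have z2 : (18:ℝ)^(s.card+1) * (6^j.card * E) = 18*(18^s.card * (6^j.card * E)) := by rw [pow_succ]; ring
      rw [z1] at i1 i3'
      rw [z2]
      linarith
    · have hz : χ (p : ZMod m) = 0 := by
        apply MulChar.map_nonunit
        rw [ZMod.isUnit_iff_coprime]
        exact fun h => hmp h.symm
      rw [hz]
      simp only [ne_eq, OfNat.ofNat_ne_zero, not_false_eq_true, zero_pow, zero_mul, add_zero, norm_zero]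
      positivity

theorem pow_card_le (c : ℝ) (hc : 1 ≤ c) (ε : ℝ) (hε : 0 < ε) : ∃ C, 0 ≤ C ∧ ∀ s : Finset ℕ, (∀ p ∈ s, p.Prime) → 
    c^s.card ≤ C * ((∏ p ∈ s, p : ℕ):ℝ)^ε := by
  set M := ⌈c^(1/ε)⌉₊ with hM
  refine ⟨c^M, by positivity, fun s hs => ?_⟩
  have h1 : ∀ p ∈ s, c ≤ (if p < M then c else 1) * (p:ℝ)^ε := by
    intro p hp
    have hp1 : (1:ℝ) ≤ p := by exact_mod_cast (hs p hp).one_le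
    split_ifs with h
    · exact le_mul_of_one_le_right (by linarith) (Real.one_le_rpow hp1 hε.le)
    · push Not at h
      have h2 : c^(1/ε) ≤ p := (Nat.le_ceil _).trans (by exact_mod_cast h)
      rw [one_mul]
      calc c = (c^(1/ε))^ε := by rw [← Real.rpow_mul (by linarith)]; rw [one_div_mul_cancel hε.ne', Real.rpow_one]
        _ ≤ _ := by gcongr
  calc c^s.card = ∏ p ∈ s, c := by rw [Finset.prod_const]
    _ ≤ ∏ p ∈ s, ((if p < M then c else 1) * (p:ℝ)^ε) := Finset.prod_le_prod (fun _ _ => by linarith) h1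
    _ = c^(s.filter (· < M)).card * ((∏ p ∈ s, p : ℕ):ℝ)^ε := by
      rw [Finset.prod_mul_distrib, Finset.prod_ite, Finset.prod_const, Finset.prod_const_one, mul_one]
      push_cast
      rw [Real.finset_prod_rpow _ _ (fun p _ => by positivity)]
    _ ≤ _ := by
      gcongr
      · calc (s.filter (· < M)).card ≤ (Finset.range M).card := Finset.card_le_card (fun p hp => by
              rw [Finset.mem_range]; exact (Finset.mem_filter.1 hp).2)
          _ = M := Finset.card_range M

theorem nm_disc {p : ℕ} (hp : p.Prime) {f : Form} (h : nm p f ≠ 0) : (p:ℤ)^2 ∣ f.disc := by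
  have h1 := nm_id hp f
  by_cases ho : ob p f = 0
  · have : lf p f ≠ 0 := by omega
    unfold lf at this
    split_ifs at this with hg
    · obtain ⟨g, rfl⟩ := hg
      rw [disc_smul]
      exact Dvd.dvd.mul_right (pow_dvd_pow _ (by norm_num)) _
    · exact absurd rfl this
  · exact ob_disc hp ho

theorem TT_vanish {m : ℕ} (χ : DirichletCharacter ℂ m) {σ : ℤ} (hσ : sgx σ) {s : Finset ℕ} (hs : ∀ p ∈ s, p.Prime) {X : ℝ}
    (hX : X ≤ ((∏ p ∈ s, p : ℕ):ℝ)^2) : TT χ σ s ∅ X = 0 := by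
  rw [TT_eq χ hσ]
  apply Finset.sum_eq_zero
  intro f hf
  rw [mem_DF hσ] at hf
  have hd := (dd_iff hσ hf.2)
  have : tr s ∅ f = 0 := by
    by_contra hc
    unfold tr at hc
    have h1 := left_ne_zero_of_mul hc
    have h2 : (∏ p ∈ s, nm p f) ≠ 0 := by exact_mod_cast h1
    rw [Finset.prod_ne_zero_iff] at h2
    have h3 : (∏ p ∈ s, (p:ℤ)^2) ∣ f.disc := by
      apply Finset.prod_dvd_of_coprime
      · intro p hp q hq hpq
        exact IsCoprime.pow (Nat.isCoprime_iff_coprime.2 ((Nat.coprime_primes (hs p hp) (hs q hq)).2 hpq))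
      · exact fun p hp => nm_disc (hs p hp) (h2 p hp)
    rw [Finset.prod_pow] at h3
    have h4 := Int.le_of_dvd (abs_pos.2 hd.1) ((dvd_abs _ _).2 h3)
    have h5 : (((∏ p ∈ s, p : ℕ):ℝ))^2 ≤ |(f.disc:ℝ)| := by
      have h6 := (Int.cast_le (R := ℝ)).2 h4
      push_cast at h6 ⊢
      exact h6
    linarith [hd.2]
  rw [this]; simp

end Form
end

set_option linter.all false
open scoped Classical ENNReal
noncomputable section
namespace Form

def mxr (f : Form) : ℝ := if ∀ p : ℕ, p.Prime → ¬ NM p f then 1 else 0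

def PX (X : ℝ) : Finset ℕ := (Finset.range ⌈X⌉₊).filter Nat.Prime

theorem mxr_sieve {f : Form} {X : ℝ} (h0 : f.disc ≠ 0) (hX : |(f.disc:ℝ)| < X) :
    ∑ s ∈ (PX X).powerset, (-1:ℝ)^s.card * tr s ∅ f = mxr f := by
  have e1 : ∑ s ∈ (PX X).powerset, (-1:ℝ)^s.card * tr s ∅ f = ∏ p ∈ PX X, (-(nm p f : ℝ) + 1) := by
    rw [Finset.prod_add]
    apply Finset.sum_congr rfl
    intro s _
    rw [Finset.prod_const_one, mul_one, Finset.prod_neg]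
    simp [tr, thn]
  rw [e1]
  unfold mxr
  split_ifs with h
  · apply Finset.prod_eq_one
    intro p hp
    have := h p (Finset.mem_filter.1 hp).2
    simp [nm, this]
  · push Not at h
    obtain ⟨p, hp, hn⟩ := h
    apply Finset.prod_eq_zero (i := p)
    · rw [PX, Finset.mem_filter, Finset.mem_range]
      refine ⟨?_, hp⟩
      have h1 := nm_disc hp (f := f) (by simp [nm, hn])
      have h4 := Int.le_of_dvd (abs_pos.2 h0) ((dvd_abs _ _).2 h1)
      have h6 := (Int.cast_le (R := ℝ)).2 h4
      push_cast at h6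
      have hp1 : (1:ℝ) ≤ p := by exact_mod_cast hp.one_le
      rw [Nat.lt_ceil]
      nlinarith
    · simp [nm, hn]

def Wd (σ : ℤ) (X : ℝ) (D : ℤ) : ℝ := ∑ f ∈ DF σ X, if f.disc = D then w f * mxr f else 0

theorem sum_TT {m : ℕ} (χ : DirichletCharacter ℂ m) {σ : ℤ} (hσ : sgx σ) (X : ℝ) :
    ∑ D ∈ DS σ X, χ (D : ZMod m) * (Wd σ X D : ℂ) = ∑ s ∈ (PX X).powerset, (-1:ℂ)^s.card * TT χ σ s ∅ X := by
  have e1 : ∑ D ∈ DS σ X, χ (D : ZMod m) * (Wd σ X D : ℂ) = ∑ f ∈ DF σ X, χ (f.disc : ZMod m) * ((w f * mxr f : ℝ) : ℂ) := by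
    unfold Wd
    simp_rw [Complex.ofReal_sum, Finset.mul_sum]
    rw [Finset.sum_comm]
    apply Finset.sum_congr rfl
    intro f hf
    rw [Finset.sum_eq_single f.disc]
    · rw [if_pos rfl]
    · intro D _ hD
      rw [if_neg (Ne.symm hD)]; simp
    · intro h
      exact absurd ((disc_DS hσ).2 ((mem_DF hσ).1 hf).2) h
  rw [e1]
  simp_rw [TT_eq χ hσ, Finset.mul_sum]
  rw [Finset.sum_comm]
  apply Finset.sum_congr rfl
  intro f hf
  have hd := dd_iff hσ ((mem_DF hσ).1 hf).2
  rw [← mxr_sieve hd.1 hd.2]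
  push_cast
  rw [Finset.mul_sum, Finset.mul_sum]
  apply Finset.sum_congr rfl
  intro s _
  ring

theorem Wd_bound {σ : ℤ} (hσ : sgx σ) {X : ℝ} {D : ℤ} (hD : D ∈ DS σ X) :
    |2 * (cubicCountDisc D : ℝ) - Wd σ X D| ≤ ∑ f ∈ (bad_fin X).toFinset, if f.disc = D then (1:ℝ) else 0 := by
  have hGD : ∀ f : Form, f.Irr → f ∈ Gd → f ∈ Dom := by
    rintro f hf (h | h)
    · exact Or.inl h
    · exact Or.inr (lowI_low hf h)
  have hDX : |(D:ℝ)| < X := (mem_DS.1 hD).2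
  have hBD : ∀ f : Form, f ∈ Bd → f ∈ Dom := fun f h => Or.inr h.1
  have memDF : ∀ f : Form, f ∈ Dom → f.disc = D → f ∈ DF σ X := by
    rintro f h rfl
    exact (mem_DF hσ).2 ⟨h, (disc_DS hσ).1 hD⟩
  have hfG : (Gd ∩ Mx D).Finite := by
    apply (dom_fin X).subset
    rintro f ⟨h1, h2⟩
    exact ⟨hGD f h2.1 h1, by rw [h2.2.2]; exact hDX⟩
  have hfB : (Bd ∩ Mx D).Finite := by
    apply (dom_fin X).subset
    rintro f ⟨h1, h2⟩
    exact ⟨hBD f h1, by rw [h2.2.2]; exact hDX⟩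
  obtain ⟨c1, c2⟩ := count_bound D Gd Bd (by
    intro f hf hG γ hγ hs
    have hIr : (f.sub γ).Irr := (irr_SL (f := f) ⟨γ, hγ⟩).2 hf
    have := L2 hf hG ⟨γ, hγ⟩ (hGD _ hIr hs)
    have h2 : γ = 1 := congrArg Subtype.val this
    rw [h2, sub_one]) (by
    intro f hf
    obtain ⟨γ, h⟩ := L1 hf
    refine ⟨γ.1, γ.2, ?_⟩
    by_cases hi : f.sub γ.1 ∈ LowI
    · exact Or.inl (Or.inr hi)
    · rcases h with h | h
      · exact Or.inl (Or.inl h)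
      · exact Or.inr ⟨h, hi⟩) hfG hfB
  have nG : ((Gd ∩ Mx D).ncard : ℝ) = ∑ f ∈ DF σ X, if f ∈ Gd ∩ Mx D then (1:ℝ) else 0 := by
    rw [Finset.sum_boole, Set.ncard_eq_toFinset_card _ hfG]
    congr 2
    ext f
    rw [Set.Finite.mem_toFinset, Finset.mem_filter]
    exact ⟨fun h => ⟨memDF f (hGD f h.2.1 h.1) h.2.2.2, h⟩, fun h => h.2⟩
  have nB : ((Bd ∩ Mx D).ncard : ℝ) = ∑ f ∈ DF σ X, if f ∈ Bd ∩ Mx D then (1:ℝ) else 0 := by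
    rw [Finset.sum_boole, Set.ncard_eq_toFinset_card _ hfB]
    congr 2
    ext f
    rw [Set.Finite.mem_toFinset, Finset.mem_filter]
    exact ⟨fun h => ⟨memDF f (hBD f h.1) h.2.2.2, h⟩, fun h => h.2⟩
  have nB2 : ((Bd ∩ Mx D).ncard : ℝ) ≤ ∑ f ∈ (bad_fin X).toFinset, if f.disc = D then (1:ℝ) else 0 := by
    rw [Finset.sum_boole, Set.ncard_eq_toFinset_card _ hfB]
    norm_cast
    apply Finset.card_le_card
    intro f
    rw [Set.Finite.mem_toFinset, Finset.mem_filter, Set.Finite.mem_toFinset]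
    rintro ⟨h1, h2⟩
    exact ⟨⟨⟨hBD f h1, Or.inl h1⟩, by rw [h2.2.2]; exact_mod_cast hDX⟩, h2.2.2⟩
  have l1 : ((Gd ∩ Mx D).ncard : ℝ) ≤ Wd σ X D := by
    rw [nG]
    apply Finset.sum_le_sum
    intro f hf
    split_ifs with h1 h2 h2
    · rw [w_gd h1.2.1 h1.1, mxr, if_pos h1.2.2.1]; norm_num
    · exact absurd h1.2.2.2 h2
    · have := w_nonneg f
      unfold mxr; split_ifs <;> simp [this]
    · exact le_rfl
  have l2 : Wd σ X D ≤ ((Gd ∩ Mx D).ncard : ℝ) + ((Bd ∩ Mx D).ncard : ℝ) := by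
    rw [nG, nB, ← Finset.sum_add_distrib]
    apply Finset.sum_le_sum
    intro f hf
    have p1 : (0:ℝ) ≤ if f ∈ Gd ∩ Mx D then (1:ℝ) else 0 := by split_ifs <;> norm_num
    have p2 : (0:ℝ) ≤ if f ∈ Bd ∩ Mx D then (1:ℝ) else 0 := by split_ifs <;> norm_num
    by_cases hd : f.disc = D
    · rw [if_pos hd]
      by_cases hI : f.Irr
      · by_cases hm : ∀ p : ℕ, p.Prime → ¬ NM p f
        · have hM : f ∈ Mx D := ⟨hI, hm, hd⟩
          rw [mxr, if_pos hm, mul_one]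
          have hw := w_le f
          have hDm := ((mem_DF hσ).1 hf).1
          by_cases hG : f ∈ Gd
          · rw [if_pos (show f ∈ Gd ∩ Mx D from ⟨hG, hM⟩)]; linarith
          · have hB : f ∈ Bd := by
              rcases hDm with h | h
              · exact absurd (Or.inl h) hG
              · exact ⟨h, fun h' => hG (Or.inr h')⟩
            rw [if_pos (show f ∈ Bd ∩ Mx D from ⟨hB, hM⟩)]; linarith
        · rw [mxr, if_neg hm, mul_zero]; linarith
      · rw [w, if_neg hI, zero_mul]; linarith
    · rw [if_neg hd]; linarith
  have c1' : ((Gd ∩ Mx D).ncard : ℝ) ≤ 2 * (cubicCountDisc D : ℝ) := by exact_mod_cast c1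
  have c2' : 2 * (cubicCountDisc D : ℝ) ≤ ((Gd ∩ Mx D).ncard : ℝ) + ((Bd ∩ Mx D).ncard : ℝ) := by exact_mod_cast c2
  rw [abs_le]
  constructor <;> linarith

theorem main_diff {m : ℕ} (χ : DirichletCharacter ℂ m) {σ : ℤ} (hσ : sgx σ) (X : ℝ) :
    ‖∑ D ∈ DS σ X, (cubicCountDisc D : ℂ) * χ (D : ZMod m)‖ ≤
      ∑ s ∈ (PX X).powerset, ‖TT χ σ s ∅ X‖ + ∑ f ∈ (bad_fin X).toFinset, (thn ∅ f : ℝ) := by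
  have e : (2:ℂ) * ∑ D ∈ DS σ X, (cubicCountDisc D : ℂ) * χ (D : ZMod m) =
      ∑ D ∈ DS σ X, χ (D : ZMod m) * (Wd σ X D : ℂ) + ∑ D ∈ DS σ X, χ (D : ZMod m) * ((2 * (cubicCountDisc D : ℝ) - Wd σ X D : ℝ) : ℂ) := by
    rw [Finset.mul_sum, ← Finset.sum_add_distrib]
    apply Finset.sum_congr rfl
    intro D _
    push_cast; ring
  have h1 : ‖∑ D ∈ DS σ X, χ (D : ZMod m) * (Wd σ X D : ℂ)‖ ≤ ∑ s ∈ (PX X).powerset, ‖TT χ σ s ∅ X‖ := by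
    rw [sum_TT χ hσ]
    refine (norm_sum_le _ _).trans (le_of_eq (Finset.sum_congr rfl fun s _ => ?_))
    rw [norm_mul, norm_pow]; simp
  have h2 : ‖∑ D ∈ DS σ X, χ (D : ZMod m) * ((2 * (cubicCountDisc D : ℝ) - Wd σ X D : ℝ) : ℂ)‖ ≤ ∑ f ∈ (bad_fin X).toFinset, (thn ∅ f : ℝ) := by
    refine (norm_sum_le _ _).trans ?_
    calc _ ≤ ∑ D ∈ DS σ X, ∑ f ∈ (bad_fin X).toFinset, (if f.disc = D then (1:ℝ) else 0) := by
          apply Finset.sum_le_sum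
          intro D hD
          rw [norm_mul, Complex.norm_real, Real.norm_eq_abs]
          exact (mul_le_of_le_one_left (abs_nonneg _) (DirichletCharacter.norm_le_one χ _)).trans (Wd_bound hσ hD)
      _ = ∑ f ∈ (bad_fin X).toFinset, ∑ D ∈ DS σ X, (if f.disc = D then (1:ℝ) else 0) := Finset.sum_comm
      _ ≤ _ := by
          apply Finset.sum_le_sum
          intro f _
          rw [Finset.sum_ite_eq]
          split_ifs <;> simp [thn]
  have h3 := congrArg norm e
  rw [norm_mul] at h3
  have h4 := norm_add_le (∑ D ∈ DS σ X, χ (D : ZMod m) * (Wd σ X D : ℂ)) (∑ D ∈ DS σ X, χ (D : ZMod m) * ((2 * (cubicCountDisc D : ℝ) - Wd σ X D : ℝ) : ℂ))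
  have h5 : ‖(2:ℂ)‖ = 2 := by simp
  rw [h5] at h3
  have h6 := norm_nonneg (∑ D ∈ DS σ X, (cubicCountDisc D : ℂ) * χ (D : ZMod m))
  linarith

end Form
end

set_option linter.all false
open scoped Classical ENNReal
noncomputable section
namespace Form

theorem term_bd {t E A B X q : ℝ} (hE : 0 ≤ E) (hA : 0 < A) (hB : 0 < B) (hX : 0 < X) (hq : 1 ≤ q) (hAB : A^2 = B*X)
    (h1 : t ≤ E*(A/q+B)) (h2 : t ≤ E*(X/q^2)) (ht : 0 ≤ t) : t ≤ 2*E*(A^((8:ℝ)/9)*X^((1:ℝ)/9))*(1/q) := by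
  have hq0 : 0 < q := by linarith
  have u1 : t ≤ 2*E*(A*(1/q)) := by
    by_cases h : q*B ≤ A
    · have : B ≤ A/q := by rw [le_div_iff₀ hq0]; linarith
      calc t ≤ E*(A/q+B) := h1
        _ ≤ E*(A/q+A/q) := by gcongr
        _ = _ := by ring
    · push Not at h
      have : X/q^2 ≤ A/q := by
        rw [div_le_div_iff₀ (by positivity) hq0]
        have : B*(X*q) ≤ B*(A*q^2) := by
          calc B*(X*q) = A*q*A := by rw [← mul_assoc, ← hAB]; ring
            _ ≤ A*q*(q*B) := by gcongr
            _ = _ := by ring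
        exact le_of_mul_le_mul_left this hB
      calc t ≤ E*(X/q^2) := h2
        _ ≤ E*(A/q) := by gcongr
        _ ≤ 2*(E*(A/q)) := by linarith [show 0 ≤ E*(A/q) by positivity]
        _ = _ := by ring
  have u2 : t ≤ 2*E*(X*(1/q)) := by
    have : X/q^2 ≤ X/q := by gcongr; nlinarith
    calc t ≤ E*(X/q^2) := h2
        _ ≤ E*(X/q) := by gcongr
        _ ≤ 2*(E*(X/q)) := by linarith [show 0 ≤ E*(X/q) by positivity]
        _ = _ := by ring
  have hm : min A X ≤ A^((8:ℝ)/9)*X^((1:ℝ)/9) := by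
    have hmp : 0 < min A X := lt_min hA hX
    calc min A X = (min A X)^((8:ℝ)/9) * (min A X)^((1:ℝ)/9) := by
          rw [← Real.rpow_add hmp]; norm_num
      _ ≤ _ := by
          gcongr
          · exact min_le_left _ _
          · exact min_le_right _ _
  have u3 : t ≤ 2*E*(min A X*(1/q)) := by
    rcases min_choice A X with h | h <;> rw [h] <;> assumption
  calc t ≤ 2*E*(min A X*(1/q)) := u3
    _ ≤ 2*E*((A^((8:ℝ)/9)*X^((1:ℝ)/9))*(1/q)) := by gcongr
    _ = _ := by ring

theorem prod_inj {s t : Finset ℕ} (hs : ∀ p ∈ s, p.Prime) (ht : ∀ p ∈ t, p.Prime) (h : ∏ p ∈ s, p = ∏ p ∈ t, p) : s = t := by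
  rw [← Nat.primeFactors_prod hs, ← Nat.primeFactors_prod ht, h]

theorem sum_q {X : ℝ} (hX : 1 ≤ X) (S : Finset (Finset ℕ)) (hS : ∀ s ∈ S, (∀ p ∈ s, p.Prime) ∧ ((∏ p ∈ s, p : ℕ):ℝ) ≤ X) :
    ∑ s ∈ S, 1/((∏ p ∈ s, p : ℕ):ℝ) ≤ 1 + Real.log X := by
  refine le_trans ?_ (sum_inv_Icc X hX)
  have e : ∑ s ∈ S, 1/((∏ p ∈ s, p : ℕ):ℝ) = ∑ a ∈ S.image (fun s => ((∏ p ∈ s, p : ℕ):ℤ)), (1:ℝ)/a := by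
    rw [Finset.sum_image]
    · apply Finset.sum_congr rfl
      intro s _
      rw [Int.cast_natCast]
    · intro s hs t ht h
      have h' : ((∏ p ∈ s, p : ℕ):ℤ) = ((∏ p ∈ t, p : ℕ):ℤ) := h
      exact prod_inj (hS s hs).1 (hS t ht).1 (by exact_mod_cast h')
  rw [e]
  apply Finset.sum_le_sum_of_subset_of_nonneg
  · intro a ha
    obtain ⟨s, hs, rfl⟩ := Finset.mem_image.1 ha
    obtain ⟨h1, h2⟩ := hS s hs
    rw [Finset.mem_Icc]
    refine ⟨?_, ?_⟩
    · have : 0 < ∏ p ∈ s, p := Finset.prod_pos (fun p hp => (h1 p hp).pos)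
      exact_mod_cast this
    · rw [Int.le_floor, Int.cast_natCast]; exact h2
  · intro a ha _
    have : (0:ℝ) < a := by exact_mod_cast (Finset.mem_Icc.1 ha).1
    positivity

theorem sieve_sum (δ : ℝ) (hδ : 0 < δ) : ∃ C, 0 ≤ C ∧ ∀ (m : ℕ) [NeZero m] (χ : DirichletCharacter ℂ m), χ^6 ≠ 1 → ∀ σ : ℤ, sgx σ →
    ∀ X : ℝ, 1 ≤ X → ∑ s ∈ (PX X).powerset, ‖TT χ σ s ∅ X‖ ≤ C * X^((7:ℝ)/9+3*δ) * (m:ℝ)^((8:ℝ)/9) := by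
  obtain ⟨C1, hC1, b1⟩ := base1 δ hδ
  obtain ⟨C2, hC2, b2⟩ := base2 δ hδ
  obtain ⟨K, hK, hKs⟩ := pow_card_le 18 (by norm_num) δ hδ
  refine ⟨2*(K*(C1+C2))*(1+1/δ), by positivity, ?_⟩
  intro m _ χ hχ σ hσ X hX
  have hm0 : (0:ℝ) < m := by exact_mod_cast Nat.pos_of_ne_zero (NeZero.ne m)
  have hX0 : 0 < X := by linarith
  have key : ∀ s ∈ (PX X).powerset, ¬ X ≤ ((∏ p ∈ s, p : ℕ):ℝ)^2 →
      ‖TT χ σ s ∅ X‖ ≤ 2*(K*(C1+C2)*X^(2*δ))*((m*X^((3:ℝ)/4))^((8:ℝ)/9)*X^((1:ℝ)/9))*(1/((∏ p ∈ s, p : ℕ):ℝ)) := by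
    intro s hs hq
    have hsp : ∀ p ∈ s, p.Prime := fun p hp => (Finset.mem_filter.1 (Finset.mem_powerset.1 hs hp)).2
    have i1 := ind_TT χ σ (A1 := C1*m) (A2 := C1*(m:ℝ)^2) (α1 := 1/2+δ) (α2 := 1) (β1 := 3/4+δ) (β2 := 1/2)
      (by positivity) (by positivity) (by positivity) (by positivity) (by positivity) (by positivity) (by
        intro j hj hjm Y hY
        have := b1 m χ hχ σ hσ j hj hjm Y hY
        simp only [bb, Real.one_rpow, mul_one] at this ⊢
        exact this) s hsp ∅ (by simp) (by simp) (by simp) X hX0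
    have i2 := ind_TT χ σ (A1 := C2) (A2 := 0) (α1 := 0) (α2 := 0) (β1 := 1+δ) (β2 := 0)
      hC2 le_rfl le_rfl le_rfl (by positivity) le_rfl (by
        intro j hj hjm Y hY
        have := b2 m χ σ hσ j hj Y hY
        simp only [bb, Real.one_rpow, mul_one, Real.rpow_zero, zero_mul, add_zero] at this ⊢
        exact this) s hsp ∅ (by simp) (by simp) (by simp) X hX0
    have hk := hKs s hsp
    have hq1 : (1:ℝ) ≤ ((∏ p ∈ s, p : ℕ):ℝ) := by
      have : 0 < ∏ p ∈ s, p := Finset.prod_pos (fun p hp => (hsp p hp).pos)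
      exact_mod_cast this
    generalize ((∏ p ∈ s, p : ℕ):ℝ) = q at *
    push Not at hq
    have hq0 : 0 < q := by linarith
    have hqX : q ≤ X := by nlinarith
    have hqδ : q^δ ≤ X^δ := by gcongr
    simp only [bb, Finset.prod_empty, Nat.cast_one, Real.one_rpow, mul_one, Finset.card_empty, pow_zero, one_mul, zero_mul, add_zero] at i1 i2
    have hk2 : (18:ℝ)^s.card ≤ K*X^δ := hk.trans (by gcongr)
    have eX : X^(2*δ) = X^δ*X^δ := by rw [← Real.rpow_add hX0]; ring_nf
    have hXδ : 1 ≤ X^δ := Real.one_le_rpow hX hδ.le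
    refine term_bd (B := (m:ℝ)^2*X^((1:ℝ)/2)) (by positivity) (by positivity) (by positivity) hX0 hq1 ?_ ?_ ?_ (norm_nonneg _)
    · rw [mul_pow, ← Real.rpow_natCast (X^((3:ℝ)/4)), ← Real.rpow_mul hX0.le, mul_assoc, ← Real.rpow_add_one hX0.ne']
      norm_num
    · have v1 : q^(1/2+δ-2*(3/4+δ)) ≤ 1/q := by
        have e9 : 1/q = q^(-1:ℝ) := by rw [Real.rpow_neg_one, one_div]
        rw [e9]
        exact Real.rpow_le_rpow_of_exponent_le hq1 (by linarith)
      have v2 : q^((1:ℝ)-2*(1/2)) = 1 := by norm_num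
      rw [v2] at i1
      have v3 : X^(3/4+δ) = X^((3:ℝ)/4)*X^δ := Real.rpow_add hX0 _ _
      rw [v3] at i1
      calc ‖TT χ σ s ∅ X‖ ≤ _ := i1
        _ ≤ (K*X^δ)*(C1*m*(X^((3:ℝ)/4)*X^δ)*(1/q) + C1*(m:ℝ)^2*X^((1:ℝ)/2)*X^δ) := by
            gcongr
        _ = (K*C1*X^(2*δ))*(m*X^((3:ℝ)/4)/q + (m:ℝ)^2*X^((1:ℝ)/2)) := by rw [eX]; ring
        _ ≤ _ := by
            gcongr
            linarith
    · have v1 : q^((0:ℝ)-2*(1+δ)) ≤ 1/q^2 := by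
        rw [one_div, ← Real.rpow_natCast, ← Real.rpow_neg hq0.le]
        exact Real.rpow_le_rpow_of_exponent_le hq1 (by push_cast; linarith)
      have v3 : X^(1+δ) = X*X^δ := by rw [Real.rpow_add hX0, Real.rpow_one]
      rw [v3] at i2
      calc ‖TT χ σ s ∅ X‖ ≤ _ := i2
        _ ≤ (K*X^δ)*(C2*(X*X^δ)*(1/q^2)) := by gcongr
        _ = (K*C2*X^(2*δ))*(X/q^2) := by rw [eX]; ring
        _ ≤ _ := by
            gcongr
            linarith
  set F := 2*(K*(C1+C2)*X^(2*δ))*((m*X^((3:ℝ)/4))^((8:ℝ)/9)*X^((1:ℝ)/9)) with hF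
  have hF0 : 0 ≤ F := by positivity
  set S := (PX X).powerset.filter (fun s => ¬ X ≤ ((∏ p ∈ s, p : ℕ):ℝ)^2) with hS
  have hsp : ∀ s ∈ (PX X).powerset, ∀ p ∈ s, p.Prime := fun s hs p hp => (Finset.mem_filter.1 (Finset.mem_powerset.1 hs hp)).2
  calc ∑ s ∈ (PX X).powerset, ‖TT χ σ s ∅ X‖ = ∑ s ∈ S, ‖TT χ σ s ∅ X‖ := by
        rw [hS, Finset.sum_filter]
        apply Finset.sum_congr rfl
        intro s hs
        split_ifs with h
        · rw [TT_vanish χ hσ (hsp s hs) h, norm_zero]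
        · rfl
    _ ≤ ∑ s ∈ S, F*(1/((∏ p ∈ s, p : ℕ):ℝ)) := Finset.sum_le_sum (fun s hs => key s (Finset.mem_filter.1 hs).1 (Finset.mem_filter.1 hs).2)
    _ = F * ∑ s ∈ S, 1/((∏ p ∈ s, p : ℕ):ℝ) := by rw [Finset.mul_sum]
    _ ≤ F * (1 + Real.log X) := by
        gcongr
        apply sum_q hX
        intro s hs
        obtain ⟨h1, h2⟩ := Finset.mem_filter.1 hs
        push Not at h2
        refine ⟨hsp s h1, ?_⟩
        have hq1 : (1:ℝ) ≤ ((∏ p ∈ s, p : ℕ):ℝ) := by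
          have : 0 < ∏ p ∈ s, p := Finset.prod_pos (fun p hp => (hsp s h1 p hp).pos)
          exact_mod_cast this
        nlinarith
    _ ≤ F * ((1+1/δ)*X^δ) := by gcongr; exact log_rpow hδ hX
    _ = _ := by
        have e1 : X^((7:ℝ)/9+3*δ) = X^(2*δ)*(X^((2:ℝ)/3)*X^((1:ℝ)/9))*X^δ := by
          rw [← Real.rpow_add hX0, ← Real.rpow_add hX0, ← Real.rpow_add hX0]; congr 1; ring
        rw [hF, Real.mul_rpow hm0.le (by positivity), ← Real.rpow_mul hX0.le, e1]
        norm_num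
        ring

theorem final (ε : ℝ) (hε : 0 < ε) : ∃ C : ℝ,
      ∀ (m : ℕ) (χ : DirichletCharacter ℂ m), χ.IsPrimitive → χ ^ 6 ≠ 1 →
      ∀ X : ℝ, 1 ≤ X → ∀ s : ℤ, (s = 1 ∨ s = -1) →
      ‖∑ D ∈ Finset.Icc (-⌈X⌉) ⌈X⌉,
          if 0 < s * D ∧ (|D| : ℝ) < X
          then (cubicCountDisc D : ℂ) * χ ((D : ZMod m)) else 0‖
        ≤ C * X ^ ((7:ℝ)/9 + ε) * (m : ℝ) ^ ((8:ℝ)/9 + ε) := by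
  obtain ⟨C, hC, h⟩ := sieve_sum (ε/3) (by positivity)
  obtain ⟨C', hC', h'⟩ := bad_Y ε hε
  refine ⟨C+C', ?_⟩
  intro m χ _ hχ X hX σ hσ
  have hm : m ≠ 0 := by
    rintro rfl
    apply hχ
    ext u
    have : (u:ZMod 0)^6 = 1 := by
      have hu : (u : (ZMod 0)ˣ)^2 = 1 := Int.units_sq u
      have : (u : (ZMod 0)ˣ)^6 = 1 := by rw [show 6 = 2*3 by norm_num, pow_mul, hu, one_pow]
      have h6 := congrArg Units.val this
      rwa [Units.val_pow_eq_pow_val] at h6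
    rw [MulChar.pow_apply_coe, ← map_pow, this, map_one, MulChar.one_apply_coe]
  haveI : NeZero m := ⟨hm⟩
  have hm1 : (1:ℝ) ≤ m := by exact_mod_cast Nat.one_le_iff_ne_zero.2 hm
  have hX0 : 0 < X := by linarith
  rw [← Finset.sum_filter]
  refine (main_diff χ hσ X).trans ?_
  have a := h m χ hχ σ hσ X hX
  have b := h' ∅ (by simp) X hX0
  rw [Finset.card_empty, pow_zero, one_mul] at b
  have e : (7:ℝ)/9+3*(ε/3) = 7/9+ε := by ring
  rw [e] at a
  have c1 : (m:ℝ)^((8:ℝ)/9) ≤ (m:ℝ)^((8:ℝ)/9+ε) := Real.rpow_le_rpow_of_exponent_le hm1 (by linarith)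
  have c2 : X^(3/4+ε) ≤ X^((7:ℝ)/9+ε) := Real.rpow_le_rpow_of_exponent_le hX (by linarith)
  have c3 : (1:ℝ) ≤ (m:ℝ)^((8:ℝ)/9+ε) := Real.one_le_rpow hm1 (by linarith)
  have a' : C * X^((7:ℝ)/9+ε) * (m:ℝ)^((8:ℝ)/9) ≤ C * X^((7:ℝ)/9+ε) * (m:ℝ)^((8:ℝ)/9+ε) := by gcongr
  have b' : C' * X^(3/4+ε) ≤ C' * X^((7:ℝ)/9+ε) * (m:ℝ)^((8:ℝ)/9+ε) :=
    calc _ ≤ C' * X^((7:ℝ)/9+ε) := by gcongr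
      _ ≤ _ := le_mul_of_one_le_right (by positivity) c3
  calc _ ≤ C * X^((7:ℝ)/9+ε) * (m:ℝ)^((8:ℝ)/9+ε) + C' * X^((7:ℝ)/9+ε) * (m:ℝ)^((8:ℝ)/9+ε) := by linarith
    _ = _ := by ring

end Form
end

/-- Theorem 6.2, first part: the cubic-field discriminant sum twisted by a primitive
Dirichlet character `χ` of conductor `m` whose order does not divide `6` is
`O(X^{7/9+ε} m^{8/9+ε})`, uniformly in `χ` and `m`. -/
theorem twisted_cubic_count_bound :
    ∀ ε : ℝ, 0 < ε → ∃ C : ℝ,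
      ∀ (m : ℕ) (χ : DirichletCharacter ℂ m), χ.IsPrimitive → χ ^ 6 ≠ 1 →
      ∀ X : ℝ, 1 ≤ X → ∀ s : ℤ, (s = 1 ∨ s = -1) →
      ‖∑ D ∈ Finset.Icc (-⌈X⌉) ⌈X⌉,
          if 0 < s * D ∧ (|D| : ℝ) < X
          then (cubicCountDisc D : ℂ) * χ ((D : ZMod m)) else 0‖
        ≤ C * X ^ ((7:ℝ)/9 + ε) * (m : ℝ) ^ ((8:ℝ)/9 + ε) := by
  exact Form.final
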